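/- Let a ≥ 1 be a fixed integer. Then there exist constants C > 0 and x₀ ≥ 2 (possibly depending on a) such that for all real x ≥ x₀ one has ∑_{p ≤ x, p prime} 1/τ(p+a) ≤ 4·K(a)·x/(ln x)^{3/2} + C·x·ln ln x/(ln x)^{5/2}, where K(a) = K·β(a), K = (1/√π)·∏_{p prime} √(p/(p−1))·(p·ln(p/(p−1)) − 1/(p−1)), and β(a) = ∏_{p | a, p prime} (1 + 1/(p(p−1)·ln(p/(p−1)) − 1)). -/

import Mathlib

open Finset

/-- The constant `K` from the theorem. -/
noncomputable def Kconst : ℝ :=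
  (1 / Real.sqrt Real.pi) *
    ∏' p : Nat.Primes,
      Real.sqrt ((p : ℝ) / ((p : ℝ) - 1)) *
        ((p : ℝ) * Real.log ((p : ℝ) / ((p : ℝ) - 1)) - 1 / ((p : ℝ) - 1))

/-- The constant `β(a)` from the theorem. -/
noncomputable def betaConst (a : ℕ) : ℝ :=
  ∏ p ∈ a.primeFactors,
    (1 + 1 / ((p : ℝ) * ((p : ℝ) - 1) * Real.log ((p : ℝ) / ((p : ℝ) - 1)) - 1))

/-! ### Summation by parts and Dirichlet series with bounded coefficient sums -/

/-- Summation by parts for coefficients with bounded partial sums. -/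
lemma norm_sum_Ico_mul_le_of_partialSums {f g : ℕ → ℂ} {B : ℝ}
    (hB : ∀ n, ‖∑ i ∈ range n, f i‖ ≤ B) {m n : ℕ} (hmn : m ≤ n) :
    ‖∑ i ∈ Ico m n, f i * g i‖ ≤
      B * (‖g m‖ + ‖g n‖ + ∑ i ∈ Ico m n, ‖g (i + 1) - g i‖) := by
  have key : ∑ i ∈ Ico m n, f i * g i = (∑ i ∈ range n, f i) * g n - (∑ i ∈ range m, f i) * g m
      - ∑ i ∈ Ico m n, (∑ l ∈ range (i + 1), f l) * (g (i + 1) - g i) := by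
    induction n, hmn using Nat.le_induction with
    | base => simp
    | succ n hmn ih =>
      rw [sum_Ico_succ_top hmn, sum_Ico_succ_top hmn, ih, sum_range_succ]
      ring
  have hB0 : 0 ≤ B := (norm_nonneg _).trans (hB 0)
  rw [key]
  calc _ ≤ ‖(∑ i ∈ range n, f i) * g n‖ + ‖(∑ i ∈ range m, f i) * g m‖
        + ‖∑ i ∈ Ico m n, (∑ l ∈ range (i + 1), f l) * (g (i + 1) - g i)‖ :=
        (norm_sub_le _ _).trans (add_le_add_left (norm_sub_le _ _) _)
    _ ≤ B * ‖g n‖ + B * ‖g m‖ + ∑ i ∈ Ico m n, B * ‖g (i + 1) - g i‖ := by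
        refine add_le_add (add_le_add ?_ ?_) ((norm_sum_le _ _).trans (sum_le_sum fun i _ => ?_))
        all_goals
          rw [norm_mul]
          exact mul_le_mul_of_nonneg_right (hB _) (norm_nonneg _)
    _ = _ := by rw [← mul_sum]; ring

lemma log_pow_le_mul_sqrt {j i : ℕ} (hij : i ≤ j) {u : ℝ} (hu : 1 ≤ u) :
    Real.log u ^ i ≤ (2 * (j + 1 : ℝ)) ^ j * u ^ (1 / 2 : ℝ) := by
  have hu0 : 0 ≤ u := by linarith
  set δ : ℝ := 1 / (2 * (j + 1)) with hδ
  have hδ0 : 0 < δ := by positivity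
  have h1 : Real.log u ≤ 2 * (j + 1 : ℝ) * u ^ δ := by
    have := Real.log_le_rpow_div hu0 hδ0
    rw [hδ] at this ⊢
    calc _ ≤ _ := this
      _ = _ := by field_simp
  have h2 : (1 : ℝ) ≤ 2 * (j + 1 : ℝ) * u ^ δ := by
    have : 1 ≤ u ^ δ := Real.one_le_rpow hu hδ0.le
    nlinarith [(Nat.cast_nonneg j : (0 : ℝ) ≤ j)]
  calc Real.log u ^ i ≤ (2 * (j + 1 : ℝ) * u ^ δ) ^ i :=
        pow_le_pow_left₀ (Real.log_nonneg hu) h1 i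
    _ ≤ (2 * (j + 1 : ℝ) * u ^ δ) ^ j := pow_le_pow_right₀ h2 hij
    _ = (2 * (j + 1 : ℝ)) ^ j * u ^ (δ * j) := by
        rw [mul_pow, ← Real.rpow_natCast (u ^ δ), ← Real.rpow_mul hu0]
    _ ≤ _ := by
        gcongr
        rw [hδ, div_mul_eq_mul_div, div_le_div_iff₀ (by positivity) (by norm_num)]; linarith

/-- The general term `(log u)^j u^{-s}` as a function of a real variable. -/
noncomputable def logPowCpow (j : ℕ) (s : ℂ) (u : ℝ) : ℂ := (Real.log u : ℂ) ^ j * (u : ℂ) ^ (-s)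

lemma hasDerivAt_logPowCpow (j : ℕ) (s : ℂ) {u : ℝ} (hu : 0 < u) :
    HasDerivAt (logPowCpow j s)
      (j * (Real.log u : ℂ) ^ (j - 1) * (u : ℂ) ^ (-s - 1)
        - s * (Real.log u : ℂ) ^ j * (u : ℂ) ^ (-s - 1)) u := by
  have h1 : HasDerivAt (fun u : ℝ => (Real.log u : ℂ)) ((u⁻¹ : ℝ) : ℂ) u :=
    (Real.hasDerivAt_log hu.ne').ofReal_comp
  have h2 : HasDerivAt (fun u : ℝ => (u : ℂ) ^ (-s)) (-s * (u : ℂ) ^ (-s - 1)) u := by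
    have hu' : (u : ℂ) ∈ Complex.slitPlane := Complex.ofReal_mem_slitPlane.2 hu
    have := ((hasDerivAt_id (u : ℂ)).cpow_const (c := -s) hu').comp_ofReal
    simpa using this
  have h3 := (h1.pow j).mul h2
  refine h3.congr_deriv ?_
  have : (u : ℂ) ^ (-s) = (u : ℂ) ^ (-s - 1) * u := by
    rw [Complex.cpow_sub _ _ (by exact_mod_cast hu.ne'), Complex.cpow_one]
    field_simp [show (u : ℂ) ≠ 0 by exact_mod_cast hu.ne']
  simp only [Pi.pow_apply]
  rw [this]
  have hu0 : (u : ℂ) ≠ 0 := by exact_mod_cast hu.ne'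
  push_cast
  field_simp
  ring

lemma norm_deriv_logPowCpow_le (j : ℕ) {s : ℂ} (hs : 1 ≤ s.re) {u : ℝ} (hu : 1 ≤ u) :
    ‖j * (Real.log u : ℂ) ^ (j - 1) * (u : ℂ) ^ (-s - 1)
        - s * (Real.log u : ℂ) ^ j * (u : ℂ) ^ (-s - 1)‖ ≤
      (2 * (j + 1 : ℝ)) ^ j * (j + ‖s‖) * u ^ (-(3 / 2) : ℝ) := by
  have hu0 : 0 < u := by linarith
  have hn : ‖(u : ℂ) ^ (-s - 1)‖ ≤ u ^ (-2 : ℝ) := by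
    rw [Complex.norm_cpow_eq_rpow_re_of_pos hu0]
    apply Real.rpow_le_rpow_of_exponent_le hu
    simp; linarith
  have hl (i : ℕ) : ‖(Real.log u : ℂ) ^ i‖ = Real.log u ^ i := by
    rw [norm_pow, Complex.norm_real, Real.norm_of_nonneg (Real.log_nonneg hu)]
  have hmul : u ^ (1 / 2 : ℝ) * u ^ (-2 : ℝ) = u ^ (-(3 / 2) : ℝ) := by
    rw [← Real.rpow_add hu0]; norm_num
  calc _ ≤ ‖(j : ℂ) * (Real.log u : ℂ) ^ (j - 1) * (u : ℂ) ^ (-s - 1)‖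
        + ‖s * (Real.log u : ℂ) ^ j * (u : ℂ) ^ (-s - 1)‖ := norm_sub_le _ _
    _ ≤ j * ((2 * (j + 1 : ℝ)) ^ j * u ^ (1 / 2 : ℝ)) * u ^ (-2 : ℝ)
        + ‖s‖ * ((2 * (j + 1 : ℝ)) ^ j * u ^ (1 / 2 : ℝ)) * u ^ (-2 : ℝ) := by
        rw [norm_mul, norm_mul, norm_mul, norm_mul, hl, hl, Complex.norm_natCast]
        have := Real.log_nonneg hu
        gcongr
        · exact log_pow_le_mul_sqrt (Nat.sub_le _ _) hu
        · exact log_pow_le_mul_sqrt le_rfl hu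
    _ = _ := by rw [← hmul]; ring

lemma norm_logPowCpow_sub_le (j : ℕ) {s : ℂ} (hs : 1 ≤ s.re) {u v : ℝ} (hu : 1 ≤ u)
    (huv : u ≤ v) : ‖logPowCpow j s v - logPowCpow j s u‖ ≤
      (2 * (j + 1 : ℝ)) ^ j * (j + ‖s‖) * u ^ (-(3 / 2) : ℝ) * (v - u) := by
  apply norm_image_sub_le_of_norm_deriv_le_segment'
    (f' := fun u : ℝ => j * (Real.log u : ℂ) ^ (j - 1) * (u : ℂ) ^ (-s - 1)
        - s * (Real.log u : ℂ) ^ j * (u : ℂ) ^ (-s - 1)) (f := logPowCpow j s) (a := u) (b := v)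
  · intro x hx
    exact (hasDerivAt_logPowCpow j s (by linarith [hx.1])).hasDerivWithinAt
  · intro x hx
    refine (norm_deriv_logPowCpow_le j hs (hu.trans hx.1)).trans ?_
    have : x ^ (-(3 / 2) : ℝ) ≤ u ^ (-(3 / 2) : ℝ) :=
      Real.rpow_le_rpow_of_nonpos (by linarith) hx.1 (by norm_num)
    gcongr
  · exact Set.right_mem_Icc.2 huv

/-- Tail bound for the sum of `n^{-3/2}`. -/
lemma sum_Ico_rpow_neg_three_halves_le {m n : ℕ} (hm : 1 ≤ m) (hmn : m ≤ n) :
    ∑ i ∈ Ico m n, (i : ℝ) ^ (-(3 / 2) : ℝ) ≤ 4 * (m : ℝ) ^ (-(1 / 2) : ℝ) := by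
  suffices h : ∑ i ∈ Ico m n, (i : ℝ) ^ (-(3 / 2) : ℝ) ≤
      4 * (m : ℝ) ^ (-(1 / 2) : ℝ) - 4 * (n : ℝ) ^ (-(1 / 2) : ℝ) by
    have : 0 ≤ (n : ℝ) ^ (-(1 / 2) : ℝ) := by positivity
    linarith
  induction n, hmn using Nat.le_induction with
  | base => simp
  | succ n hmn ih =>
    rw [sum_Ico_succ_top hmn]
    have hn : (1 : ℝ) ≤ n := by exact_mod_cast hm.trans hmn
    suffices (n : ℝ) ^ (-(3 / 2) : ℝ) ≤
        4 * (n : ℝ) ^ (-(1 / 2) : ℝ) - 4 * ((n + 1 : ℕ) : ℝ) ^ (-(1 / 2) : ℝ) by linarith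
    have h0 : (0 : ℝ) < n := by linarith
    set a := Real.sqrt n with ha
    set b := Real.sqrt ((n + 1 : ℕ) : ℝ) with hb
    have hap : 0 < a := Real.sqrt_pos.2 h0
    have hbp : 0 < b := Real.sqrt_pos.2 (by positivity)
    have haa : a ^ 2 = n := Real.sq_sqrt h0.le
    have hbb : b ^ 2 = n + 1 := by rw [hb, Real.sq_sqrt (by positivity)]; push_cast; ring
    have e1 : (n : ℝ) ^ (-(1 / 2) : ℝ) = 1 / a := by
      rw [Real.rpow_neg h0.le, ← Real.sqrt_eq_rpow, one_div]
    have e2 : ((n + 1 : ℕ) : ℝ) ^ (-(1 / 2) : ℝ) = 1 / b := by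
      rw [Real.rpow_neg (by positivity), ← Real.sqrt_eq_rpow, one_div]
    have e3 : (n : ℝ) ^ (-(3 / 2) : ℝ) = 1 / (a * a ^ 2) := by
      rw [haa, show (-(3 / 2) : ℝ) = -(1 / 2) + -1 by norm_num, Real.rpow_add h0, e1,
        Real.rpow_neg_one]
      field_simp
    have hab : a ≤ b := by
      apply Real.sqrt_le_sqrt; push_cast; linarith
    have hb2 : b ≤ 2 * a := by nlinarith
    rw [e1, e2, e3, show 4 * (1 / a) - 4 * (1 / b) = 4 * (b - a) / (a * b) by field_simp]
    rw [div_le_div_iff₀ (by positivity) (by positivity)]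
    have : (b - a) * (b + a) = 1 := by nlinarith
    have h3 : 1 ≤ (b - a) * (3 * a) := by nlinarith
    have h4 : b ≤ 4 * (b - a) * a ^ 2 := by nlinarith
    nlinarith

lemma LSeries_term_mul_log_pow (f : ℕ → ℂ) (j : ℕ) (s : ℂ) {n : ℕ} (hn : n ≠ 0) :
    LSeries.term (fun n => f n * (Real.log n : ℂ) ^ j) s n = f n * logPowCpow j s n := by
  rw [LSeries.term_of_ne_zero hn, logPowCpow, Complex.cpow_neg, Complex.ofReal_natCast]
  ring

lemma sum_range_log_pow_div_le (j N : ℕ) :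
    ∑ n ∈ range (N + 1), Real.log n ^ j * (n : ℝ)⁻¹ ≤ (1 + Real.log N) ^ (j + 1) := by
  rcases Nat.eq_zero_or_pos N with rfl | hN
  · rcases j with _ | j <;> simp
  have hN1 : (1 : ℝ) ≤ N := by exact_mod_cast hN
  have hlog := Real.log_nonneg hN1
  calc _ = ∑ n ∈ Icc 1 N, Real.log n ^ j * (n : ℝ)⁻¹ := by
        symm
        refine sum_subset (fun n hn => ?_) fun n hn hn' => ?_
        · rw [mem_Icc] at hn; rw [mem_range]; omega
        · rw [mem_range] at hn
          rw [mem_Icc] at hn'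
          obtain rfl : n = 0 := by omega
          simp
    _ ≤ ∑ n ∈ Icc 1 N, Real.log N ^ j * (n : ℝ)⁻¹ := by
        refine sum_le_sum fun n hn => ?_
        rw [mem_Icc] at hn
        have h1 : (1 : ℝ) ≤ n := by exact_mod_cast hn.1
        have h2 : (n : ℝ) ≤ N := by exact_mod_cast hn.2
        have := Real.log_nonneg h1
        gcongr
    _ = Real.log N ^ j * (harmonic N : ℝ) := by
        rw [← mul_sum, harmonic_eq_sum_Icc]; push_cast; rfl
    _ ≤ (1 + Real.log N) ^ j * (1 + Real.log N) := by
        have h0 : (0 : ℝ) ≤ (harmonic N : ℝ) := by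
          rw [harmonic_eq_sum_Icc]; push_cast; positivity
        exact mul_le_mul (pow_le_pow_left₀ hlog (by linarith) j) (harmonic_le_one_add_log N) h0
          (by positivity)
    _ = _ := by ring

/-- A Dirichlet series with bounded coefficients and partial sums at most `q` is
`O((1 + log q)^(j+1) |s|)` to the right of `1`, also after `j` differentiations. -/
lemma norm_LSeries_mul_log_pow_le (j : ℕ) : ∃ C : ℝ, 1 ≤ C ∧ ∀ (f : ℕ → ℂ) (q : ℕ), 1 ≤ q →
    (∀ n, ‖f n‖ ≤ 1) → (∀ n, ‖∑ i ∈ range n, f i‖ ≤ q) → ∀ s : ℂ, 1 < s.re →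
    LSeriesSummable (fun n => f n * (Real.log n : ℂ) ^ j) s →
    ‖LSeries (fun n => f n * (Real.log n : ℂ) ^ j) s‖ ≤
      C * (1 + Real.log q) ^ (j + 1) * (1 + ‖s‖) := by
  set K : ℝ := (2 * (j + 1 : ℝ)) ^ j with hK
  have hK1 : 1 ≤ K := one_le_pow₀ (by nlinarith [(Nat.cast_nonneg j : (0 : ℝ) ≤ j)])
  refine ⟨2 ^ (j + 1) + 8 * K * (j + 1), by
    have : (1 : ℝ) ≤ 2 ^ (j + 1) := one_le_pow₀ (by norm_num)
    nlinarith [(Nat.cast_nonneg j : (0 : ℝ) ≤ j)], ?_⟩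
  intro f q hq hf hfq s hs hsum
  have hq1 : (1 : ℝ) ≤ q := by exact_mod_cast hq
  have hlq := Real.log_nonneg hq1
  set N := q ^ 2 with hN
  have hN1 : 1 ≤ N := Nat.one_le_pow _ _ hq
  have hNr : (N : ℝ) = (q : ℝ) ^ 2 := by simp [hN]
  have hlogN : Real.log N = 2 * Real.log q := by rw [hNr, Real.log_pow]; norm_num
  have htend := hsum.hasSum.tendsto_sum_nat
  refine le_of_tendsto htend.norm ?_
  filter_upwards [Filter.eventually_ge_atTop (N + 1)] with n hn
  rw [← Finset.sum_range_add_sum_Ico _ hn]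
  have hg (i : ℕ) (hi : 1 ≤ i) : ‖logPowCpow j s i‖ ≤ Real.log i ^ j * (i : ℝ)⁻¹ := by
    have hi1 : (1 : ℝ) ≤ i := by exact_mod_cast hi
    rw [logPowCpow, norm_mul, norm_pow, Complex.norm_real,
      Real.norm_of_nonneg (Real.log_nonneg hi1),
      Complex.norm_cpow_eq_rpow_re_of_pos (by linarith), ← Real.rpow_neg_one (i : ℝ)]
    have := Real.log_nonneg hi1
    gcongr
    simp; linarith
  have hg2 (i : ℕ) (hi : N + 1 ≤ i) : ‖logPowCpow j s i‖ ≤ K * (q : ℝ)⁻¹ := by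
    have hi1 : (1 : ℝ) ≤ i := by exact_mod_cast hN1.trans (by omega)
    have hqi : (q : ℝ) ^ 2 ≤ i := by rw [← hNr]; exact_mod_cast (by omega)
    refine (hg i (by omega)).trans ?_
    calc _ ≤ K * (i : ℝ) ^ (1 / 2 : ℝ) * (i : ℝ)⁻¹ := by
          gcongr; exact log_pow_le_mul_sqrt le_rfl hi1
      _ = K * (Real.sqrt i)⁻¹ := by
          rw [← Real.sqrt_eq_rpow, mul_assoc]
          congr 1
          have : (i : ℝ) = Real.sqrt i ^ 2 := (Real.sq_sqrt (by linarith)).symm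
          have h0 : 0 < Real.sqrt i := Real.sqrt_pos.2 (by linarith)
          field_simp
          exact this.symm
      _ ≤ K * (q : ℝ)⁻¹ := by
          gcongr
          exact Real.le_sqrt_of_sq_le hqi
  have h1 : ‖∑ i ∈ range (N + 1), LSeries.term (fun n => f n * (Real.log n : ℂ) ^ j) s i‖ ≤
      (1 + Real.log N) ^ (j + 1) := by
    refine le_trans ?_ (sum_range_log_pow_div_le j N)
    refine (norm_sum_le _ _).trans (sum_le_sum fun i _ => ?_)
    rcases Nat.eq_zero_or_pos i with rfl | hi
    · simp
    · rw [LSeries_term_mul_log_pow _ _ _ hi.ne', norm_mul]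
      calc _ ≤ 1 * ‖logPowCpow j s i‖ := by gcongr; exact hf i
        _ ≤ _ := by rw [one_mul]; exact hg i hi
  have h2 : ‖∑ i ∈ Ico (N + 1) n, LSeries.term (fun n => f n * (Real.log n : ℂ) ^ j) s i‖ ≤
      8 * K * (j + 1) * (1 + ‖s‖) := by
    have e : ∑ i ∈ Ico (N + 1) n, LSeries.term (fun n => f n * (Real.log n : ℂ) ^ j) s i =
        ∑ i ∈ Ico (N + 1) n, f i * (fun i : ℕ => logPowCpow j s i) i :=
      sum_congr rfl fun i hi => by
        rw [mem_Ico] at hi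
        rw [LSeries_term_mul_log_pow _ _ _ (by omega)]
    rw [e]
    refine (norm_sum_Ico_mul_le_of_partialSums hfq hn).trans ?_
    have h3 : ∑ i ∈ Ico (N + 1) n, ‖logPowCpow j s ((i + 1 : ℕ) : ℝ) - logPowCpow j s (i : ℝ)‖ ≤
        K * (j + ‖s‖) * (4 * (q : ℝ)⁻¹) := by
      calc _ ≤ ∑ i ∈ Ico (N + 1) n, K * (j + ‖s‖) * (i : ℝ) ^ (-(3 / 2) : ℝ) := by
            refine sum_le_sum fun i hi => ?_
            rw [mem_Ico] at hi
            have hi1 : (1 : ℝ) ≤ i := by exact_mod_cast (by omega)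
            have := norm_logPowCpow_sub_le j hs.le hi1 (v := ((i + 1 : ℕ) : ℝ)) (by push_cast; linarith)
            refine this.trans (le_of_eq ?_)
            push_cast; ring
        _ ≤ K * (j + ‖s‖) * (4 * ((N + 1 : ℕ) : ℝ) ^ (-(1 / 2) : ℝ)) := by
            rw [← mul_sum]
            gcongr
            exact sum_Ico_rpow_neg_three_halves_le (by omega) hn
        _ ≤ _ := by
            gcongr
            rw [Real.rpow_neg (by positivity), ← Real.sqrt_eq_rpow]
            gcongr
            apply Real.le_sqrt_of_sq_le
            push_cast; linarith
    calc _ ≤ (q : ℝ) * (K * (q : ℝ)⁻¹ + K * (q : ℝ)⁻¹ + K * (j + ‖s‖) * (4 * (q : ℝ)⁻¹)) := by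
          gcongr
          · exact hg2 _ le_rfl
          · exact hg2 _ hn
      _ = 2 * K + 4 * K * (j + ‖s‖) := by field_simp; ring
      _ ≤ _ := by
          have hj : (0 : ℝ) ≤ j := Nat.cast_nonneg j
          have hs0 := norm_nonneg s
          have : 0 ≤ (j : ℝ) * ‖s‖ := by positivity
          nlinarith [mul_nonneg (by linarith : (0 : ℝ) ≤ K) hj,
            mul_nonneg (by linarith : (0 : ℝ) ≤ K) hs0,
            mul_nonneg (by linarith : (0 : ℝ) ≤ K) this]
  have hL : 1 ≤ (1 + Real.log q) ^ (j + 1) := one_le_pow₀ (by linarith)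
  have h4 : (1 + Real.log N) ^ (j + 1) ≤ 2 ^ (j + 1) * (1 + Real.log q) ^ (j + 1) := by
    rw [← mul_pow, hlogN]
    gcongr
    linarith
  calc _ ≤ _ := norm_add_le _ _
    _ ≤ 2 ^ (j + 1) * (1 + Real.log q) ^ (j + 1) + 8 * K * (j + 1) * (1 + ‖s‖) :=
        add_le_add (h1.trans h4) h2
    _ ≤ 2 ^ (j + 1) * (1 + Real.log q) ^ (j + 1) * (1 + ‖s‖)
        + 8 * K * (j + 1) * (1 + ‖s‖) * (1 + Real.log q) ^ (j + 1) := by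
        have hs0 := norm_nonneg s
        exact add_le_add (le_mul_of_one_le_right (by positivity) (by linarith))
          (le_mul_of_one_le_right (by positivity) hL)
    _ = _ := by ring

/-! ### Bounds for Dirichlet `L`-series and their derivatives to the right of the line `Re s = 1` -/

/-- The arithmetic function `f(n) (log n)^j`. -/
noncomputable abbrev mulLogPow (f : ℕ → ℂ) (j : ℕ) : ℕ → ℂ := fun n => f n * (Real.log n : ℂ) ^ j

lemma mulLogPow_zero (f : ℕ → ℂ) : mulLogPow f 0 = f := by
  funext n
  change f n * (Real.log n : ℂ) ^ 0 = f n
  rw [pow_zero, mul_one]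

lemma mulLogPow_eq_iterate_logMul (f : ℕ → ℂ) (j : ℕ) : mulLogPow f j = LSeries.logMul^[j] f := by
  induction j with
  | zero => exact mulLogPow_zero f
  | succ j ih =>
    rw [Function.iterate_succ_apply', ← ih]
    funext n
    simp only [mulLogPow, LSeries.logMul, pow_succ, Complex.ofReal_log (Nat.cast_nonneg n),
      Complex.ofReal_natCast]
    ring

lemma abscissaOfAbsConv_mulLogPow (f : ℕ → ℂ) (j : ℕ) :
    LSeries.abscissaOfAbsConv (mulLogPow f j) = LSeries.abscissaOfAbsConv f := by
  rw [mulLogPow_eq_iterate_logMul, LSeries.absicssaOfAbsConv_logPowMul]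

lemma LSeriesSummable_mulLogPow {f : ℕ → ℂ} (hf : LSeries.abscissaOfAbsConv f ≤ 1) (j : ℕ) {s : ℂ}
    (hs : 1 < s.re) : LSeriesSummable (mulLogPow f j) s := by
  apply LSeriesSummable_of_abscissaOfAbsConv_lt_re
  rw [abscissaOfAbsConv_mulLogPow]
  exact hf.trans_lt (by exact_mod_cast hs)

lemma hasDerivAt_LSeries_mulLogPow {f : ℕ → ℂ} (hf : LSeries.abscissaOfAbsConv f ≤ 1) (j : ℕ)
    {s : ℂ} (hs : 1 < s.re) :
    HasDerivAt (LSeries (mulLogPow f j)) (-LSeries (mulLogPow f (j + 1)) s) s := by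
  have := LSeries_hasDerivAt (f := mulLogPow f j) (s := s)
    (by rw [abscissaOfAbsConv_mulLogPow]; exact hf.trans_lt (by exact_mod_cast hs))
  rw [mulLogPow_eq_iterate_logMul f (j + 1), Function.iterate_succ_apply',
    ← mulLogPow_eq_iterate_logMul]
  exact this

lemma abscissaOfAbsConv_le_one_of_norm_le {f : ℕ → ℂ} (hf : ∀ n, ‖f n‖ ≤ 1) :
    LSeries.abscissaOfAbsConv f ≤ 1 :=
  LSeries.abscissaOfAbsConv_le_one_of_isBigO_one
    (Asymptotics.IsBigO.of_bound 1 (Filter.Eventually.of_forall fun n => by simpa using hf n))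

/-- A periodic function with mean zero, bounded by one, has partial sums bounded by the period. -/
lemma norm_sum_range_le_of_periodic {f : ℕ → ℂ} {q : ℕ} (hq : 0 < q)
    (hper : ∀ n, f (n + q) = f n) (h0 : ∑ i ∈ range q, f i = 0) (hf : ∀ n, ‖f n‖ ≤ 1) (n : ℕ) :
    ‖∑ i ∈ range n, f i‖ ≤ q := by
  induction n using Nat.strong_induction_on with
  | _ n ih =>
    rcases lt_or_ge n q with h | h
    · calc _ ≤ ∑ i ∈ range n, ‖f i‖ := norm_sum_le _ _
        _ ≤ ∑ i ∈ range n, (1 : ℝ) := sum_le_sum fun i _ => hf i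
        _ ≤ q := by simp; exact_mod_cast h.le
    · obtain ⟨m, rfl⟩ := Nat.exists_eq_add_of_le h
      rw [sum_range_add, h0, zero_add]
      have : ∀ i, f (q + i) = f i := fun i => by rw [add_comm, hper]
      simp only [this]
      exact ih m (by omega)

lemma sum_range_natCast_zmod {M : Type*} [AddCommMonoid M] {q : ℕ} [NeZero q] (f : ZMod q → M) :
    ∑ i ∈ range q, f (i : ZMod q) = ∑ a : ZMod q, f a := by
  refine (sum_bij (fun a _ => ZMod.val a) (fun a _ => by simpa using ZMod.val_lt a)
    (fun a _ b _ h => ZMod.val_injective q h)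
    (fun b hb => ⟨(b : ZMod q), mem_univ _, ZMod.val_cast_of_lt (mem_range.1 hb)⟩)
    (fun a _ => by simp)).symm

/-- Bounds for derivatives of `L`-series of nonprincipal characters. -/
lemma norm_LSeries_character_le (j : ℕ) : ∃ C : ℝ, 1 ≤ C ∧ ∀ (q : ℕ), 1 ≤ q →
    ∀ χ : DirichletCharacter ℂ q, χ ≠ 1 → ∀ s : ℂ, 1 < s.re →
    ‖LSeries (mulLogPow (fun n => χ n) j) s‖ ≤ C * (1 + Real.log q) ^ (j + 1) * (1 + ‖s‖) := by
  obtain ⟨C, hC, h⟩ := norm_LSeries_mul_log_pow_le j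
  refine ⟨C, hC, fun q hq χ hχ s hs => h _ q hq (fun n => χ.norm_le_one _) ?_ s hs ?_⟩
  · have : NeZero q := ⟨by omega⟩
    refine norm_sum_range_le_of_periodic hq (fun n => by simp) ?_ (fun n => χ.norm_le_one _)
    rw [sum_range_natCast_zmod (fun a => χ a)]
    exact MulChar.sum_eq_zero_of_ne_one hχ
  · exact LSeriesSummable_mulLogPow (abscissaOfAbsConv_le_one_of_norm_le
      fun n => χ.norm_le_one _) j hs

/-- An antiderivative of `(log u)^j u^{-s}`. -/
noncomputable def logPowCpowInt (s : ℂ) : ℕ → ℝ → ℂ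
  | 0, u => (u : ℂ) ^ (1 - s) / (1 - s)
  | j + 1, u => (Real.log u : ℂ) ^ (j + 1) * (u : ℂ) ^ (1 - s) / (1 - s)
      - (j + 1) / (1 - s) * logPowCpowInt s j u

lemma hasDerivAt_logPowCpowInt {s : ℂ} (hs : s ≠ 1) (j : ℕ) {u : ℝ} (hu : 0 < u) :
    HasDerivAt (logPowCpowInt s j) (logPowCpow j s u) u := by
  have hs' : 1 - s ≠ 0 := sub_ne_zero.2 hs.symm
  have hu0 : (u : ℂ) ≠ 0 := by exact_mod_cast hu.ne'
  have h2 : HasDerivAt (fun u : ℝ => (u : ℂ) ^ (1 - s)) ((1 - s) * (u : ℂ) ^ (-s)) u := by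
    have hu' : (u : ℂ) ∈ Complex.slitPlane := Complex.ofReal_mem_slitPlane.2 hu
    have := ((hasDerivAt_id (u : ℂ)).cpow_const (c := 1 - s) hu').comp_ofReal
    simpa using this
  induction j with
  | zero =>
    have := h2.div_const (1 - s)
    refine this.congr_deriv ?_
    rw [logPowCpow]
    field_simp
  | succ j ih =>
    have h1 : HasDerivAt (fun u : ℝ => (Real.log u : ℂ)) ((u⁻¹ : ℝ) : ℂ) u :=
      (Real.hasDerivAt_log hu.ne').ofReal_comp
    have h3 := (((h1.pow (j + 1)).mul h2).div_const (1 - s)).sub (ih.const_mul ((j + 1) / (1 - s)))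
    refine h3.congr_deriv ?_
    have e : (u : ℂ) ^ (1 - s) = u * (u : ℂ) ^ (-s) := by
      rw [show 1 - s = 1 + -s by ring, Complex.cpow_add _ _ hu0, Complex.cpow_one]
    simp only [Pi.pow_apply, logPowCpow, e]
    push_cast
    field_simp
    ring

lemma norm_logPowCpowInt_one {s : ℂ} (j : ℕ) :
    ‖logPowCpowInt s j 1‖ = j.factorial / ‖s - 1‖ ^ (j + 1) := by
  induction j with
  | zero => simp [logPowCpowInt, norm_sub_rev]
  | succ j ih =>
    simp only [logPowCpowInt, Real.log_one, Complex.ofReal_zero]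
    rw [zero_pow (by omega), zero_mul, zero_div, zero_sub, norm_neg, norm_mul, ih, norm_div,
      norm_sub_rev 1 s, Nat.factorial_succ]
    have : ‖(j : ℂ) + 1‖ = j + 1 := by
      have := Complex.norm_natCast (j + 1)
      push_cast at this; exact this
    rw [this]
    push_cast
    rw [pow_succ _ (j + 1)]
    by_cases h : ‖s - 1‖ = 0
    · simp [h]
    · field_simp

lemma tendsto_logPowCpowInt {s : ℂ} (hs : 1 < s.re) (j : ℕ) :
    Filter.Tendsto (logPowCpowInt s j) Filter.atTop (nhds 0) := by
  have key (i : ℕ) : Filter.Tendsto (fun u : ℝ => (Real.log u : ℂ) ^ i * (u : ℂ) ^ (1 - s))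
      Filter.atTop (nhds 0) := by
    rw [tendsto_zero_iff_norm_tendsto_zero]
    have h1 : Filter.Tendsto (fun u : ℝ => Real.log u ^ i / u ^ (s.re - 1)) Filter.atTop (nhds 0) := by
      have := isLittleO_log_rpow_rpow_atTop (i : ℝ) (by linarith : 0 < s.re - 1)
      simpa using this.tendsto_div_nhds_zero
    refine h1.congr' ?_
    filter_upwards [Filter.eventually_ge_atTop 1] with u hu
    rw [norm_mul, norm_pow, Complex.norm_real, Real.norm_of_nonneg (Real.log_nonneg hu),
      Complex.norm_cpow_eq_rpow_re_of_pos (by linarith), div_eq_mul_inv,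
      ← Real.rpow_neg (by linarith)]
    simp
  induction j with
  | zero => simpa [logPowCpowInt] using (key 0).div_const (1 - s)
  | succ j ih =>
    have := ((key (j + 1)).div_const (1 - s)).sub (ih.const_mul ((j + 1) / (1 - s)))
    simpa [logPowCpowInt] using this

lemma norm_LSeries_one_mulLogPow_le (j : ℕ) : ∃ C : ℝ, 1 ≤ C ∧ ∀ s : ℂ, 1 < s.re →
    ‖LSeries (mulLogPow 1 j) s‖ ≤ C * (1 + ‖s‖) + j.factorial / ‖s - 1‖ ^ (j + 1) := by
  set K : ℝ := (2 * (j + 1 : ℝ)) ^ j with hK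
  have hK1 : 1 ≤ K := one_le_pow₀ (by nlinarith [(Nat.cast_nonneg j : (0 : ℝ) ≤ j)])
  refine ⟨4 * K * (j + 1), by nlinarith [(Nat.cast_nonneg j : (0 : ℝ) ≤ j)], fun s hs => ?_⟩
  have hs1 : s ≠ 1 := by rintro rfl; simp at hs
  have hsum := LSeriesSummable_mulLogPow
    (abscissaOfAbsConv_le_one_of_norm_le (f := 1) (by simp)) j hs
  have hlim1 := hsum.hasSum.tendsto_sum_nat
  have hlim2 := (tendsto_logPowCpowInt hs j).comp tendsto_natCast_atTop_atTop
  have hlim := (hlim1.sub hlim2).norm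
  rw [sub_zero] at hlim
  refine le_of_tendsto hlim ?_
  filter_upwards [Filter.eventually_ge_atTop 1] with N hN
  have e : ∑ i ∈ range N, LSeries.term (mulLogPow 1 j) s i - logPowCpowInt s j N =
      ∑ i ∈ Ico 1 N, (logPowCpow j s i -
        (logPowCpowInt s j ((i + 1 : ℕ) : ℝ) - logPowCpowInt s j (i : ℝ)))
      - logPowCpowInt s j 1 := by
    rw [sum_sub_distrib, Finset.sum_Ico_sub (fun i : ℕ => logPowCpowInt s j (i : ℝ)) hN,
      ← Finset.sum_range_add_sum_Ico _ hN]
    have : ∑ i ∈ Ico 1 N, LSeries.term (mulLogPow 1 j) s i = ∑ i ∈ Ico 1 N, logPowCpow j s i := by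
      refine sum_congr rfl fun i hi => ?_
      rw [mem_Ico] at hi
      rw [LSeries_term_mul_log_pow _ _ _ (by omega)]; simp
    rw [this]
    simp
    ring
  rw [Function.comp_apply, e]
  refine (norm_sub_le _ _).trans (add_le_add ?_ (norm_logPowCpowInt_one j).le)
  have h1 (i : ℕ) (hi : 1 ≤ i) : ‖logPowCpow j s i -
        (logPowCpowInt s j ((i + 1 : ℕ) : ℝ) - logPowCpowInt s j (i : ℝ))‖ ≤
        K * (j + ‖s‖) * (i : ℝ) ^ (-(3 / 2) : ℝ) := by
    have hi1 : (1 : ℝ) ≤ i := by exact_mod_cast hi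
    have := norm_image_sub_le_of_norm_deriv_le_segment' (a := (i : ℝ)) (b := ((i + 1 : ℕ) : ℝ))
      (f := fun u : ℝ => logPowCpowInt s j u - u * logPowCpow j s i)
      (f' := fun u : ℝ => logPowCpow j s u - logPowCpow j s i)
      (C := K * (j + ‖s‖) * (i : ℝ) ^ (-(3 / 2) : ℝ))
      (fun u hu => by
        have h := (hasDerivAt_logPowCpowInt hs1 j (by linarith [hu.1] : 0 < u)).sub
          (((hasDerivAt_id u).ofReal_comp).mul_const (logPowCpow j s i))
        exact (h.congr_deriv (by simp)).hasDerivWithinAt)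
      (fun u hu => by
        refine (norm_logPowCpow_sub_le j hs.le hi1 hu.1).trans ?_
        have : u - i ≤ 1 := by have := hu.2; push_cast at this; linarith
        exact mul_le_of_le_one_right (by positivity) this)
      ((i + 1 : ℕ) : ℝ) (Set.right_mem_Icc.2 (by push_cast; linarith))
    rw [norm_sub_rev]
    refine (le_of_eq ?_).trans (this.trans_eq ?_)
    · congr 1; push_cast; ring
    · push_cast; ring
  calc _ ≤ ∑ i ∈ Ico 1 N, K * (j + ‖s‖) * (i : ℝ) ^ (-(3 / 2) : ℝ) :=
        (norm_sum_le _ _).trans (sum_le_sum fun i hi => h1 i (mem_Ico.1 hi).1)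
    _ ≤ K * (j + ‖s‖) * (4 * ((1 : ℕ) : ℝ) ^ (-(1 / 2) : ℝ)) := by
        rw [← mul_sum]
        gcongr
        exact sum_Ico_rpow_neg_three_halves_le le_rfl hN
    _ = 4 * K * (j + ‖s‖) := by simp; ring
    _ ≤ _ := by
        rw [mul_assoc (4 * K)]
        have := norm_nonneg s
        have hj : (0 : ℝ) ≤ j := Nat.cast_nonneg j
        gcongr
        nlinarith [mul_nonneg hj this]

/-- The `L`-series of a principal character. -/
lemma norm_LSeries_principal_le : ∃ C : ℝ, 1 ≤ C ∧ ∀ q : ℕ, 1 ≤ q → ∀ s : ℂ, 1 < s.re →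
    ‖LSeries (fun n => (1 : DirichletCharacter ℂ q) n) s‖ ≤
      C * (1 + Real.log q) * (1 + ‖s‖) + 1 / ‖s - 1‖ := by
  obtain ⟨C, hC, h⟩ := norm_LSeries_mul_log_pow_le 0
  obtain ⟨C', hC', h'⟩ := norm_LSeries_one_mulLogPow_le 0
  refine ⟨C + C', by linarith, fun q hq s hs => ?_⟩
  have : NeZero q := ⟨by omega⟩
  have hq0 : (0 : ℝ) < q := by exact_mod_cast hq
  have hlq : 0 ≤ Real.log q := Real.log_nonneg (by exact_mod_cast hq)
  set χ : DirichletCharacter ℂ q := 1 with hχ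
  set c : ℝ := (∑ a : ZMod q, if IsUnit a then (1 : ℝ) else 0) / q with hc
  have hc0 : 0 ≤ c := div_nonneg (sum_nonneg fun a _ => by split_ifs <;> norm_num) hq0.le
  have hc1 : c ≤ 1 := by
    rw [hc, div_le_one hq0]
    calc _ ≤ ∑ a : ZMod q, (1 : ℝ) := sum_le_sum fun a _ => by split_ifs <;> norm_num
      _ = q := by simp [ZMod.card]
  have hval (a : ZMod q) : χ a = ((if IsUnit a then (1 : ℝ) else 0 : ℝ) : ℂ) := by
    split_ifs with ha
    · rw [hχ, MulChar.one_apply ha]; simp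
    · rw [MulChar.map_nonunit _ ha]; simp
  set f : ℕ → ℂ := fun n => χ n - c with hf
  have hf1 (n : ℕ) : ‖f n‖ ≤ 1 := by
    rw [hf]; simp only; rw [hval, ← Complex.ofReal_sub, Complex.norm_real, Real.norm_eq_abs, abs_le]
    split_ifs <;> constructor <;> linarith
  have hsum : ∑ i ∈ range q, f i = 0 := by
    simp only [hf]
    rw [sum_sub_distrib, sum_range_natCast_zmod (fun a => χ a)]
    simp only [hval]
    rw [← Complex.ofReal_sum]
    simp only [sum_const, card_range, nsmul_eq_mul, hc]
    have : (q : ℂ) ≠ 0 := by exact_mod_cast hq0.ne'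
    push_cast
    field_simp
    simp
  have hb := h f q hq hf1 (norm_sum_range_le_of_periodic hq (fun n => by simp [hf]) hsum hf1) s hs
    (LSeriesSummable_mulLogPow (abscissaOfAbsConv_le_one_of_norm_le hf1) 0 hs)
  simp only [pow_zero, mul_one, zero_add, pow_one] at hb
  have hz := h' s hs
  simp only [mulLogPow_zero, zero_add, pow_one, Nat.factorial_zero, Nat.cast_one] at hz
  have e : LSeries (fun n => χ n) s = LSeries f s + c * LSeries (fun n => (1 : ℕ → ℂ) n) s := by
    have h1 : (fun n : ℕ => χ n) = f + (c : ℂ) • (fun n => (1 : ℕ → ℂ) n) := by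
      funext n; simp [hf]
    rw [h1, LSeries_add, LSeries_smul]
    · exact LSeriesSummable_of_bounded_of_one_lt_re (fun n _ => hf1 n) hs
    · exact LSeriesSummable.smul _ (LSeriesSummable_of_bounded_of_one_lt_re (m := 1)
        (fun n _ => by simp) hs)
  rw [e]
  have hs0 := norm_nonneg s
  calc _ ≤ ‖LSeries f s‖ + c * ‖LSeries (fun n => (1 : ℕ → ℂ) n) s‖ := by
        refine (norm_add_le _ _).trans_eq ?_
        rw [norm_mul, Complex.norm_real, Real.norm_of_nonneg hc0]
    _ ≤ C * (1 + Real.log q) * (1 + ‖s‖) + 1 * (C' * (1 + ‖s‖) + 1 / ‖s - 1‖) := by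
        gcongr
    _ ≤ _ := by
        have : C' * (1 + ‖s‖) ≤ C' * (1 + Real.log q) * (1 + ‖s‖) := by
          gcongr
          exact le_mul_of_one_le_right (by linarith) (by linarith)
        linarith

/-! ### Lower bounds for `L`-series and bounds for logarithmic derivatives -/

lemma norm_LSeries_le_of_norm_le_one {f : ℕ → ℂ} (hf : ∀ n, ‖f n‖ ≤ 1) {σ : ℝ} (hσ : 1 < σ) :
    ‖LSeries f σ‖ ≤ ‖LSeries 1 σ‖ := by
  have h1 : LSeriesSummable 1 (σ : ℂ) :=
    LSeriesSummable_of_bounded_of_one_lt_re (m := 1) (fun n _ => by simp) (by simpa)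
  have hterm (n : ℕ) : LSeries.term 1 (σ : ℂ) n = (‖LSeries.term 1 (σ : ℂ) n‖ : ℝ) := by
    rcases eq_or_ne n 0 with rfl | hn
    · simp
    · rw [LSeries.term_of_ne_zero hn, Pi.one_apply, norm_div, Complex.norm_natCast_cpow_of_pos
        (Nat.pos_of_ne_zero hn), norm_one, Complex.ofReal_re]
      push_cast
      rw [Complex.ofReal_cpow (Nat.cast_nonneg n)]
      simp
  have e : ‖LSeries 1 (σ : ℂ)‖ = ∑' n, ‖LSeries.term 1 (σ : ℂ) n‖ := by
    rw [LSeries, tsum_congr hterm, ← Complex.ofReal_tsum, Complex.norm_real,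
      Real.norm_of_nonneg (tsum_nonneg fun n => norm_nonneg _)]
  rw [e]
  refine tsum_of_norm_bounded h1.norm.hasSum fun n => ?_
  exact LSeries.norm_term_le _ (by simpa using hf n)

lemma norm_LSeries_one_le : ∃ K : ℝ, 1 ≤ K ∧ ∀ σ : ℝ, 1 < σ → σ ≤ 2 →
    ‖LSeries 1 (σ : ℂ)‖ ≤ K / (σ - 1) := by
  obtain ⟨C, hC, h⟩ := norm_LSeries_one_mulLogPow_le 0
  refine ⟨3 * C + 1, by linarith, fun σ h1 h2 => ?_⟩
  have := h σ (by simpa)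
  rw [mulLogPow_zero] at this
  have e : ‖(σ : ℂ) - 1‖ = σ - 1 := by
    rw [← Complex.ofReal_one, ← Complex.ofReal_sub, Complex.norm_real,
      Real.norm_of_nonneg (by linarith)]
  simp only [Nat.factorial_zero, Nat.cast_one, zero_add, pow_one, e] at this
  rw [Complex.norm_real, Real.norm_of_nonneg (by linarith)] at this
  have h0 : 0 < σ - 1 := by linarith
  refine this.trans ?_
  rw [add_div]
  gcongr
  rw [le_div_iff₀ h0]
  have : (1 + σ) * (σ - 1) ≤ 3 := by nlinarith
  nlinarith

/-- Quantitative form of the `3-4-1` argument. -/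
lemma norm_LSeries_ge_of_bounds : ∃ c : ℝ, 0 < c ∧ ∀ (N : ℕ) (χ : DirichletCharacter ℂ N)
    (t B : ℝ), 1 ≤ B →
    (∀ σ : ℝ, 1 < σ → σ ≤ 2 → ‖LSeries (mulLogPow (fun n => χ n) 1) (σ + t * Complex.I)‖ ≤ B) →
    (∀ σ : ℝ, 1 < σ → σ ≤ 2 →
      ‖LSeries (fun n => (χ ^ 2) n) (σ + (2 * t : ℝ) * Complex.I)‖ ≤ B) →
    ∀ σ : ℝ, 1 < σ → σ ≤ 2 → c / B ^ 4 ≤ ‖LSeries (fun n => χ n) (σ + t * Complex.I)‖ := by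
  obtain ⟨K, hK, hzeta⟩ := norm_LSeries_one_le
  refine ⟨1 / (16 * K ^ 3), by positivity, fun N χ t B hB h1 h2 => ?_⟩
  have hB0 : 0 < B := by linarith
  have hlow (x : ℝ) (hx : 0 < x) (hx1 : x ≤ 1) :
      x ^ 3 / (K ^ 3 * B) ≤ ‖LSeries (fun n => χ n) ((1 + x : ℝ) + t * Complex.I)‖ ^ 4 := by
    have := DirichletCharacter.norm_LSeries_product_ge_one χ hx t
    rw [norm_mul, norm_mul, norm_pow, norm_pow] at this
    have e1 : (1 + (x : ℂ) + Complex.I * t) = ((1 + x : ℝ) + t * Complex.I) := by push_cast; ring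
    have e2 : (1 + (x : ℂ) + 2 * Complex.I * t) = ((1 + x : ℝ) + (2 * t : ℝ) * Complex.I) := by
      push_cast; ring
    have e3 : (1 + (x : ℂ)) = ((1 + x : ℝ) : ℂ) := by push_cast; ring
    rw [e1, e2, e3] at this
    have b1 : ‖LSeries (fun n => (1 : DirichletCharacter ℂ N) n) ((1 + x : ℝ) : ℂ)‖ ≤ K / x := by
      refine (norm_LSeries_le_of_norm_le_one (fun n => DirichletCharacter.norm_le_one _ _)
        (by linarith)).trans ?_
      simpa using hzeta (1 + x) (by linarith) (by linarith)
    have b2 := h2 (1 + x) (by linarith) (by linarith)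
    set L := ‖LSeries (fun n => χ n) ((1 + x : ℝ) + t * Complex.I)‖
    have : 1 ≤ (K / x) ^ 3 * L ^ 4 * B := by
      refine this.le.trans ?_
      gcongr
    rw [div_pow] at this
    rw [div_le_iff₀ (by positivity)]
    have h3 : 0 < x ^ 3 := by positivity
    calc x ^ 3 = x ^ 3 * 1 := by ring
      _ ≤ x ^ 3 * (K ^ 3 / x ^ 3 * L ^ 4 * B) := by gcongr
      _ = _ := by field_simp
  set y : ℝ := 1 / (16 * K ^ 3 * B ^ 5) with hy
  have hy0 : 0 < y := by positivity
  have hy1 : y ≤ 1 := by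
    rw [hy, div_le_one (by positivity)]
    nlinarith [one_le_pow₀ hK (n := 3), one_le_pow₀ hB (n := 5)]
  have hlow' (x : ℝ) (hx : y ≤ x) (hx1 : x ≤ 1) :
      2 * B * y ≤ ‖LSeries (fun n => χ n) ((1 + x : ℝ) + t * Complex.I)‖ := by
    refine le_of_pow_le_pow_left₀ (n := 4) (by norm_num) (norm_nonneg _) ?_
    refine le_trans ?_ (hlow x (hy0.trans_le hx) hx1)
    calc (2 * B * y) ^ 4 = y ^ 3 / (K ^ 3 * B) := by
          rw [show (2 * B * y) ^ 4 = 16 * B ^ 4 * y * y ^ 3 by ring]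
          nth_rewrite 1 [hy]; field_simp
      _ ≤ _ := by gcongr
  have hBy : 1 / (16 * K ^ 3) / B ^ 4 = B * y := by rw [hy]; field_simp
  rw [hBy]
  intro σ hσ hσ2
  rcases le_or_gt y (σ - 1) with h | h
  · have := hlow' (σ - 1) h (by linarith)
    rw [add_sub_cancel] at this
    nlinarith
  · have hd : ‖LSeries (fun n => χ n) ((1 + y : ℝ) + t * Complex.I) -
        LSeries (fun n => χ n) (σ + t * Complex.I)‖ ≤ B * ((1 + y) - σ) := by
      refine norm_image_sub_le_of_norm_deriv_le_segment' (a := σ) (b := 1 + y)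
        (f := fun u : ℝ => LSeries (fun n => χ n) (u + t * Complex.I))
        (f' := fun u : ℝ => - LSeries (mulLogPow (fun n => χ n) 1) (u + t * Complex.I))
        (fun u hu => ?_) (fun u hu => ?_) (1 + y) (Set.right_mem_Icc.2 (by linarith))
      · have hu1 : 1 < ((u : ℂ) + t * Complex.I).re := by simp; linarith [hu.1]
        have := hasDerivAt_LSeries_mulLogPow (f := fun n => χ n)
          (abscissaOfAbsConv_le_one_of_norm_le fun n => χ.norm_le_one _) 0 hu1
        rw [mulLogPow_zero] at this
        have h5 : HasDerivAt (fun u : ℝ => (u : ℂ) + t * Complex.I) 1 u :=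
          (Complex.ofRealCLM.hasDerivAt (x := u)).add_const _
        have := HasDerivAt.scomp (𝕜 := ℝ) u this h5
        simpa [Function.comp_def] using this.hasDerivWithinAt
      · rw [norm_neg]
        exact h1 u (by linarith [hu.1]) (by linarith [hu.2])
    have := hlow' y le_rfl hy1
    have h6 := norm_sub_norm_le (LSeries (fun n => χ n) ((1 + y : ℝ) + t * Complex.I))
      (LSeries (fun n => χ n) (σ + t * Complex.I))
    have : B * (1 + y - σ) ≤ B * y := by gcongr; linarith
    linarith

/-- Leibniz rule for the logarithmic derivative. -/
lemma sum_choose_mul_LSeries_vonMangoldt {N : ℕ} (χ : DirichletCharacter ℂ N) (k : ℕ) {s : ℂ}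
    (hs : 1 < s.re) :
    ∑ j ∈ range (k + 1), (k.choose j : ℂ) *
      (LSeries (mulLogPow (fun n => χ n * ArithmeticFunction.vonMangoldt n) j) s *
        LSeries (mulLogPow (fun n => χ n) (k - j)) s) = LSeries (mulLogPow (fun n => χ n) (k + 1)) s := by
  have hχ : LSeries.abscissaOfAbsConv (fun n => χ n) ≤ 1 :=
    abscissaOfAbsConv_le_one_of_norm_le fun n => χ.norm_le_one _
  have hΛ : LSeries.abscissaOfAbsConv (fun n => χ n * ArithmeticFunction.vonMangoldt n) ≤ 1 :=
    LSeries.abscissaOfAbsConv_le_of_forall_lt_LSeriesSummable fun y hy =>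
      DirichletCharacter.LSeriesSummable_twist_vonMangoldt χ (by simpa using hy)
  have hconv := DirichletCharacter.convolution_twist_vonMangoldt χ
  have e : mulLogPow (fun n => χ n) (k + 1) = ∑ j ∈ range (k + 1), (k.choose j : ℂ) •
      LSeries.convolution (mulLogPow (fun n => χ n * ArithmeticFunction.vonMangoldt n) j)
        (mulLogPow (fun n => χ n) (k - j)) := by
    funext n
    have h0 := congrFun hconv n
    rw [LSeries.convolution_def] at h0
    simp only [Pi.mul_apply] at h0
    simp only [LSeries.convolution_def, Finset.sum_apply, Pi.smul_apply, smul_eq_mul, mul_sum]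
    rw [sum_comm]
    have h1 : mulLogPow (fun n => χ n) (k + 1) n = (χ n * Complex.log n) * (Real.log n : ℂ) ^ k := by
      change χ n * (Real.log n : ℂ) ^ (k + 1) = _
      rw [Complex.ofReal_log (Nat.cast_nonneg n), Complex.ofReal_natCast]; ring
    rw [h1, ← h0, sum_mul]
    refine sum_congr rfl fun p hp => ?_
    have hp' := Nat.mem_divisorsAntidiagonal.1 hp
    have hl : (Real.log n : ℂ) = Real.log p.1 + Real.log p.2 := by
      rw [← Complex.ofReal_add, ← Real.log_mul, ← Nat.cast_mul, hp'.1]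
      · exact_mod_cast fun h => hp'.2 (by rw [← hp'.1, h, zero_mul])
      · exact_mod_cast fun h => hp'.2 (by rw [← hp'.1, h, mul_zero])
    rw [hl, add_pow, mul_sum]
    refine sum_congr rfl fun j _ => ?_
    change _ = (k.choose j : ℂ) * ((χ p.1 * ArithmeticFunction.vonMangoldt p.1 * (Real.log p.1 : ℂ) ^ j)
      * (χ p.2 * (Real.log p.2 : ℂ) ^ (k - j)))
    ring
  have hs1 (j : ℕ) := LSeriesSummable_mulLogPow hΛ j hs
  have hs2 (j : ℕ) := LSeriesSummable_mulLogPow hχ j hs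
  rw [e, LSeries_sum]
  · refine sum_congr rfl fun j _ => ?_
    rw [LSeries_smul, LSeries_convolution' (hs1 _) (hs2 _)]
  · intro j _
    exact LSeriesSummable.smul _ ((hs1 _).convolution (hs2 _))

lemma norm_LSeries_vonMangoldt_le (k : ℕ) : ∃ C : ℝ, 1 ≤ C ∧ ∀ (N : ℕ)
    (χ : DirichletCharacter ℂ N) (s : ℂ), 1 < s.re → ∀ B M : ℝ, 1 ≤ B → 1 ≤ M →
    (∀ j ≤ k + 1, ‖LSeries (mulLogPow (fun n => χ n) j) s‖ ≤ B) →
    M⁻¹ ≤ ‖LSeries (fun n => χ n) s‖ →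
    ‖LSeries (mulLogPow (fun n => χ n * ArithmeticFunction.vonMangoldt n) k) s‖ ≤
      C * (B * M) ^ (k + 1) := by
  induction k using Nat.strong_induction_on with
  | _ k ih =>
    choose! C hC1 hC using ih
    refine ⟨1 + ∑ j ∈ range k, (k.choose j : ℝ) * C j, le_add_of_nonneg_right (sum_nonneg fun j hj =>
      mul_nonneg (Nat.cast_nonneg _) (zero_le_one.trans (hC1 j (mem_range.1 hj)))), ?_⟩
    intro N χ s hs B M hB hM hL hlow
    have hBM : 1 ≤ B * M := by nlinarith
    have h := sum_choose_mul_LSeries_vonMangoldt χ k hs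
    rw [sum_range_succ, Nat.choose_self, Nat.sub_self, mulLogPow_zero, Nat.cast_one, one_mul] at h
    set F := fun j => LSeries (mulLogPow (fun n => χ n * ArithmeticFunction.vonMangoldt n) j) s
    set L := LSeries (fun n => χ n) s
    have hM0 : 0 < M := by linarith
    have hL0 : 0 < ‖L‖ := lt_of_lt_of_le (by positivity) hlow
    have hF : ‖F k‖ * ‖L‖ ≤ B + ∑ j ∈ range k, (k.choose j : ℝ) * (C j * (B * M) ^ k * B) := by
      rw [← norm_mul, show F k * L = LSeries (mulLogPow (fun n => χ n) (k + 1)) s -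
        ∑ j ∈ range k, (k.choose j : ℂ) * (F j * LSeries (mulLogPow (fun n => χ n) (k - j)) s) by
          rw [← h]; ring]
      refine (norm_sub_le _ _).trans (add_le_add (hL _ le_rfl) ((norm_sum_le _ _).trans
        (sum_le_sum fun j hj => ?_)))
      rw [mem_range] at hj
      rw [norm_mul, norm_mul, Complex.norm_natCast]
      gcongr
      · exact zero_le_one.trans (by have := hC1 j hj; nlinarith [one_le_pow₀ hBM (n := k)])
      · refine (hC j hj N χ s hs B M hB hM (fun i hi => hL i (by omega)) hlow).trans ?_
        have := hC1 j hj
        gcongr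
        omega
      · exact hL _ (by omega)
    have h1 : ‖F k‖ ≤ M * (‖F k‖ * ‖L‖) := by
      have : 1 ≤ M * ‖L‖ := by
        calc 1 = M * M⁻¹ := by field_simp
          _ ≤ _ := by gcongr
      nlinarith [norm_nonneg (F k)]
    refine h1.trans ((mul_le_mul_of_nonneg_left hF hM0.le).trans ?_)
    have h2 : ∑ j ∈ range k, (k.choose j : ℝ) * (C j * (B * M) ^ k * B) =
        (∑ j ∈ range k, (k.choose j : ℝ) * C j) * ((B * M) ^ k * B) := by
      rw [sum_mul]; exact sum_congr rfl fun j _ => by ring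
    rw [h2]
    have h3 : M * B ≤ (B * M) ^ (k + 1) := by
      rw [mul_comm]; exact le_self_pow₀ hBM (by omega)
    calc _ = M * B + (∑ j ∈ range k, (k.choose j : ℝ) * C j) * (B * M) ^ (k + 1) := by ring
      _ ≤ _ := by rw [add_mul, one_mul]; gcongr

/-! ### Nonexceptional characters and the repulsion of exceptional characters -/

/-- Lipschitz bound for `L(s, χ)` in bounded parts of the half plane `Re s > 1`. -/
lemma norm_LSeries_sub_le : ∃ C : ℝ, 1 ≤ C ∧ ∀ q : ℕ, 1 ≤ q → ∀ χ : DirichletCharacter ℂ q, χ ≠ 1 →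
    ∀ R : ℝ, ∀ s z : ℂ, 1 < s.re → ‖s‖ ≤ R → 1 < z.re → ‖z‖ ≤ R →
    ‖LSeries (fun n => χ n) s - LSeries (fun n => χ n) z‖ ≤
      C * (1 + Real.log q) ^ 2 * (1 + R) * ‖s - z‖ := by
  obtain ⟨C, hC, h⟩ := norm_LSeries_character_le 1
  refine ⟨C, hC, fun q hq χ hχ R s z hs hsR hz hzR => ?_⟩
  have hl : 0 ≤ Real.log q := Real.log_nonneg (by exact_mod_cast hq)
  refine Convex.norm_image_sub_le_of_norm_hasDerivWithin_le (𝕜 := ℂ)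
    (s := {w | 1 < w.re} ∩ Metric.closedBall 0 R)
    (f' := fun w => -LSeries (mulLogPow (fun n => χ n) 1) w) (fun w hw => ?_) (fun w hw => ?_)
    ((convex_halfSpace_re_gt 1).inter (convex_closedBall 0 R)) ⟨hz, by simpa using hzR⟩
    ⟨hs, by simpa using hsR⟩
  · have := hasDerivAt_LSeries_mulLogPow (f := fun n => χ n)
      (abscissaOfAbsConv_le_one_of_norm_le fun n => χ.norm_le_one _) 0 hw.1
    rw [mulLogPow_zero] at this
    exact this.hasDerivWithinAt
  · rw [norm_neg]
    refine (h q hq χ hχ w hw.1).trans ?_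
    have : ‖w‖ ≤ R := by simpa using hw.2
    gcongr

lemma norm_ofReal_add_mul_I_le {σ t : ℝ} (h1 : 1 < σ) (h2 : σ ≤ 2) :
    ‖(σ : ℂ) + t * Complex.I‖ ≤ 2 + |t| := by
  refine (norm_add_le _ _).trans ?_
  rw [norm_mul, Complex.norm_I, mul_one, Complex.norm_real, Complex.norm_real,
    Real.norm_of_nonneg (by linarith), Real.norm_eq_abs]
  linarith

/-- A lower bound for `L(s, χ)`, given a lower bound on the real segment when `χ` is real. -/
lemma norm_LSeries_character_ge : ∃ c : ℝ, 0 < c ∧ c ≤ 1 ∧ ∀ q : ℕ, 1 ≤ q →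
    ∀ χ : DirichletCharacter ℂ q, χ ≠ 1 → ∀ δ : ℝ, 0 < δ → δ ≤ 1 →
    (χ ^ 2 = 1 → ∀ σ : ℝ, 1 < σ → σ ≤ 2 → δ ≤ ‖LSeries (fun n => χ n) (σ : ℂ)‖) →
    ∀ σ : ℝ, 1 < σ → σ ≤ 2 → ∀ t : ℝ,
      c * (δ / ((1 + Real.log q) ^ 2 * (3 + |t|))) ^ 4 ≤
        ‖LSeries (fun n => χ n) (σ + t * Complex.I)‖ := by
  obtain ⟨c, hc, h341⟩ := norm_LSeries_ge_of_bounds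
  obtain ⟨C0, hC0, hb0⟩ := norm_LSeries_character_le 0
  obtain ⟨C1, hC1, hb1⟩ := norm_LSeries_character_le 1
  obtain ⟨C2, hC2, hb2⟩ := norm_LSeries_principal_le
  obtain ⟨C3, hC3, hb3⟩ := norm_LSeries_sub_le
  set C : ℝ := C1 + 2 * C0 + 2 * C2 + C3 with hC
  refine ⟨min 1 (min (1 / 2) (c / C ^ 4)), by positivity, min_le_left _ _, ?_⟩
  intro q hq χ hχ δ hδ hδ1 hreal σ hσ hσ2 t
  have hl : 0 ≤ Real.log q := Real.log_nonneg (by exact_mod_cast hq)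
  set ℓ : ℝ := 1 + Real.log q with hℓ
  have hℓ1 : 1 ≤ ℓ := by linarith
  have hℓ2 : ℓ ≤ ℓ ^ 2 := by nlinarith
  set τ : ℝ := 3 + |t| with hτ
  have hτ1 : 1 ≤ τ := by have := abs_nonneg t; linarith
  set D : ℝ := ℓ ^ 2 * τ with hD
  have hD1 : 1 ≤ D := by nlinarith
  have hD2 : ℓ * τ ≤ D := by rw [hD]; gcongr
  have hsmall : ∀ σ : ℝ, 1 < σ → σ ≤ 2 →
      ‖LSeries (mulLogPow (fun n => χ n) 1) (σ + t * Complex.I)‖ ≤ C1 * D := by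
    intro σ h1 h2
    refine (hb1 q hq χ hχ _ (by simpa)).trans ?_
    have := norm_ofReal_add_mul_I_le h1 h2 (t := t)
    calc _ ≤ C1 * ℓ ^ 2 * τ := by
          gcongr
          linarith
      _ = _ := by rw [hD]; ring
  have hn2 : ∀ σ : ℝ, 1 < σ → σ ≤ 2 → 1 + ‖(σ : ℂ) + (2 * t : ℝ) * Complex.I‖ ≤ 2 * τ := by
    intro σ h1 h2
    have := norm_ofReal_add_mul_I_le h1 h2 (t := 2 * t)
    rw [abs_mul, abs_two] at this
    linarith
  have hDδ : D ≤ D / δ := by rw [le_div_iff₀ hδ]; nlinarith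
  have hfin : ∀ B : ℝ, B = C * (D / δ) → c / B ^ 4 = c / C ^ 4 * (δ / D) ^ 4 := by
    rintro B rfl
    field_simp
  have hδD : (δ / D) ^ 4 ≤ 1 := pow_le_one₀ (by positivity) (by rw [div_le_one (by linarith)]; linarith)
  have hmain : ∀ B : ℝ, B = C * (D / δ) → (∀ σ : ℝ, 1 < σ → σ ≤ 2 →
      ‖LSeries (fun n => (χ ^ 2) n) (σ + (2 * t : ℝ) * Complex.I)‖ ≤ B) →
      min 1 (min (1 / 2) (c / C ^ 4)) * (δ / D) ^ 4 ≤
        ‖LSeries (fun n => χ n) (σ + t * Complex.I)‖ := by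
    intro B hB hB2
    have hBC : C1 * D ≤ B := by
      rw [hB]; exact mul_le_mul (by linarith) hDδ (by linarith) (by linarith)
    have := h341 q χ t B (by nlinarith) (fun σ h1 h2 => (hsmall σ h1 h2).trans hBC) hB2 σ hσ hσ2
    rw [hfin B hB] at this
    refine le_trans ?_ this
    gcongr
    exact (min_le_right _ _).trans (min_le_right _ _)
  by_cases h2 : χ ^ 2 = 1
  · rcases le_or_gt (|t|) (δ / (2 * (C3 * D))) with ht | ht
    · have h3 := hreal h2 σ hσ hσ2
      have h4 := hb3 q hq χ hχ (2 + |t|) (σ + t * Complex.I) σ (by simpa)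
        (norm_ofReal_add_mul_I_le hσ hσ2) (by simpa)
        (by have := norm_ofReal_add_mul_I_le hσ hσ2 (t := 0); simp at this ⊢
            linarith [abs_nonneg t])
      have h5 : ‖(σ : ℂ) + t * Complex.I - σ‖ = |t| := by simp
      rw [h5] at h4
      have h6 : C3 * ℓ ^ 2 * (1 + (2 + |t|)) * |t| ≤ δ / 2 := by
        calc _ = C3 * D * |t| := by rw [hD, hτ]; ring
          _ ≤ C3 * D * (δ / (2 * (C3 * D))) := by gcongr
          _ = δ / 2 := by field_simp
      have h7 := norm_sub_norm_le (LSeries (fun n => χ n) (σ : ℂ))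
        (LSeries (fun n => χ n) (σ + t * Complex.I))
      rw [norm_sub_rev] at h7
      have h8 : (δ / D) ^ 4 ≤ δ := by
        have : δ / D ≤ δ := div_le_self hδ.le hD1
        calc _ ≤ δ ^ 4 := by gcongr
          _ ≤ δ ^ 1 := pow_le_pow_of_le_one hδ.le hδ1 (by norm_num)
          _ = δ := pow_one _
      calc _ ≤ 1 / 2 * δ := by
            gcongr
            exact (min_le_right _ _).trans (min_le_left _ _)
        _ ≤ _ := by linarith
    · refine hmain _ rfl fun σ h1 h1' => ?_
      have ht0 : 0 < |t| := lt_of_le_of_lt (by positivity) ht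
      rw [h2]
      refine (hb2 q hq _ (by simpa)).trans ?_
      have h5 : 2 * |t| ≤ ‖(σ : ℂ) + (2 * t : ℝ) * Complex.I - 1‖ := by
        have := Complex.abs_im_le_norm ((σ : ℂ) + (2 * t : ℝ) * Complex.I - 1)
        simpa [abs_mul] using this
      have h6 : 1 / ‖(σ : ℂ) + (2 * t : ℝ) * Complex.I - 1‖ ≤ C3 * (D / δ) := by
        calc _ ≤ 1 / (2 * |t|) := by gcongr
          _ ≤ 1 / (2 * (δ / (2 * (C3 * D)))) := by gcongr
          _ = _ := by field_simp
      have h7 : C2 * ℓ * (1 + ‖(σ : ℂ) + (2 * t : ℝ) * Complex.I‖) ≤ 2 * C2 * (D / δ) := by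
        calc _ ≤ C2 * ℓ * (2 * τ) := by gcongr; exact hn2 σ h1 h1'
          _ = 2 * C2 * (ℓ * τ) := by ring
          _ ≤ _ := by gcongr; exact hD2.trans hDδ
      have : 0 < D / δ := by positivity
      rw [hC]
      nlinarith
  · refine hmain _ rfl fun σ h1 h1' => ?_
    have := hb0 q hq (χ ^ 2) h2 (σ + (2 * t : ℝ) * Complex.I) (by simpa)
    rw [mulLogPow_zero] at this
    refine this.trans ?_
    calc _ ≤ C0 * ℓ * (2 * τ) := by
          rw [zero_add, pow_one]; gcongr; exact hn2 σ h1 h1'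
      _ = 2 * C0 * (ℓ * τ) := by ring
      _ ≤ 2 * C0 * (D / δ) := by gcongr; exact hD2.trans hDδ
      _ ≤ _ := by gcongr; linarith

/-- Derivatives of the logarithmic derivative of `L(s, χ)` for nonexceptional `χ`. -/
lemma norm_LSeries_twist_vonMangoldt_le (k : ℕ) : ∃ C : ℝ, 1 ≤ C ∧ ∀ q : ℕ, 1 ≤ q →
    ∀ χ : DirichletCharacter ℂ q, χ ≠ 1 → ∀ δ : ℝ, 0 < δ → δ ≤ 1 →
    (χ ^ 2 = 1 → ∀ σ : ℝ, 1 < σ → σ ≤ 2 → δ ≤ ‖LSeries (fun n => χ n) (σ : ℂ)‖) →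
    ∀ σ : ℝ, 1 < σ → σ ≤ 2 → ∀ t : ℝ,
      ‖LSeries (mulLogPow (fun n => χ n * ArithmeticFunction.vonMangoldt n) k) (σ + t * Complex.I)‖ ≤
      C * ((1 + Real.log q) ^ (k + 10) * (3 + |t|) ^ 5 * (δ⁻¹) ^ 4) ^ (k + 1) := by
  obtain ⟨c, hc0, hc1, hc⟩ := norm_LSeries_character_ge
  choose Cs hCs1 hCs using norm_LSeries_character_le
  obtain ⟨C', hC'1, hC'⟩ := norm_LSeries_vonMangoldt_le k
  set A : ℝ := ∑ j ∈ range (k + 2), Cs j with hA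
  have hA0 : ∀ j ≤ k + 1, Cs j ≤ A := fun j hj =>
    single_le_sum (f := Cs) (fun i _ => by linarith [hCs1 i]) (mem_range.2 (by omega))
  have hA1 : 1 ≤ A := (hCs1 0).trans (hA0 0 (by omega))
  have hAc : 1 ≤ A / c := by rw [le_div_iff₀ hc0]; linarith
  refine ⟨C' * (A / c) ^ (k + 1), by nlinarith [one_le_pow₀ hAc (n := k + 1)], ?_⟩
  intro q hq χ hχ δ hδ hδ1 hreal σ hσ hσ2 t
  have hl : 0 ≤ Real.log q := Real.log_nonneg (by exact_mod_cast hq)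
  set ℓ : ℝ := 1 + Real.log q with hℓ
  have hℓ1 : 1 ≤ ℓ := by linarith
  set τ : ℝ := 3 + |t| with hτ
  have hτ1 : 1 ≤ τ := by have := abs_nonneg t; linarith
  have hlow := hc q hq χ hχ δ hδ hδ1 hreal σ hσ hσ2 t
  set B : ℝ := A * ℓ ^ (k + 2) * τ with hB
  set M : ℝ := (c * (δ / (ℓ ^ 2 * τ)) ^ 4)⁻¹ with hM
  have hB1 : 1 ≤ B := by
    rw [hB]; exact one_le_mul_of_one_le_of_one_le
      (one_le_mul_of_one_le_of_one_le hA1 (one_le_pow₀ hℓ1)) hτ1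
  have hM1 : 1 ≤ M := by
    rw [hM]; refine (one_le_inv₀ (by positivity)).2 (mul_le_one₀ hc1 (by positivity)
      (pow_le_one₀ (by positivity) ?_))
    rw [div_le_one (by positivity)]
    exact hδ1.trans (one_le_mul_of_one_le_of_one_le (one_le_pow₀ hℓ1) hτ1)
  have := hC' q χ (σ + t * Complex.I) (by simpa) B M hB1 hM1 (fun j hj => ?_) (by rw [hM, inv_inv]; exact hlow)
  · refine this.trans_eq ?_
    rw [mul_assoc C', ← mul_pow]
    congr 2
    rw [hB, hM]
    field_simp
    ring
  · refine (hCs j q hq χ hχ _ (by simpa)).trans ?_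
    have hpow : ℓ ^ (j + 1) ≤ ℓ ^ (k + 2) := pow_le_pow_right₀ hℓ1 (by omega)
    refine mul_le_mul (mul_le_mul (hA0 j hj) hpow (by positivity) (by linarith)) ?_
      (by positivity) (by positivity)
    · linarith [norm_ofReal_add_mul_I_le hσ hσ2 (t := t)]

lemma DirichletCharacter.apply_natCast_of_sq_eq_one {q : ℕ} {χ : DirichletCharacter ℂ q}
    (h : χ ^ 2 = 1) (n : ℕ) : χ n = 0 ∨ χ n = 1 ∨ χ n = -1 := by
  by_cases hn : IsUnit (n : ZMod q)
  · right
    have := congrArg (fun ψ : DirichletCharacter ℂ q => ψ n) h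
    simp only [MulChar.one_apply hn] at this
    rw [MulChar.pow_apply' _ (by norm_num)] at this
    rw [sq] at this
    exact mul_self_eq_one_iff.1 this
  · exact Or.inl (MulChar.map_nonunit _ hn)

lemma norm_LSeries_quadratic_product_ge_one {q r N : ℕ} {χ : DirichletCharacter ℂ q}
    {ψ : DirichletCharacter ℂ r} {ξ : DirichletCharacter ℂ N} (hχ : χ ^ 2 = 1) (hψ : ψ ^ 2 = 1)
    (hξ : ∀ n : ℕ, ξ n = χ n * ψ n) {σ : ℝ} (hσ : 1 < σ) :
    1 ≤ ‖LSeries 1 (σ : ℂ)‖ * ‖LSeries (fun n => χ n) (σ : ℂ)‖ *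
      ‖LSeries (fun n => ψ n) (σ : ℂ)‖ * ‖LSeries (fun n => ξ n) (σ : ℂ)‖ := by
  have hs : 1 < (σ : ℂ).re := by simpa
  have hone : (1 : ℕ → ℂ) = fun n : ℕ => (1 : DirichletCharacter ℂ 1) n := by
    funext n
    rw [MulChar.one_apply (isUnit_of_subsingleton _), Pi.one_apply]
  rw [hone]
  have H0 := DirichletCharacter.summable_neg_log_one_sub_mul_prime_cpow
    (1 : DirichletCharacter ℂ 1) hs
  have H1 := DirichletCharacter.summable_neg_log_one_sub_mul_prime_cpow χ hs
  have H2 := DirichletCharacter.summable_neg_log_one_sub_mul_prime_cpow ψ hs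
  have H3 := DirichletCharacter.summable_neg_log_one_sub_mul_prime_cpow ξ hs
  rw [← DirichletCharacter.LSeries_eulerProduct_exp_log _ hs,
    ← DirichletCharacter.LSeries_eulerProduct_exp_log χ hs,
    ← DirichletCharacter.LSeries_eulerProduct_exp_log ψ hs,
    ← DirichletCharacter.LSeries_eulerProduct_exp_log ξ hs, ← norm_mul, ← norm_mul, ← norm_mul,
    ← Complex.exp_add, ← Complex.exp_add, ← Complex.exp_add, Complex.norm_exp, Real.one_le_exp_iff,
    ← H0.tsum_add H1, ← (H0.add H1).tsum_add H2, ← ((H0.add H1).add H2).tsum_add H3,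
    Complex.re_tsum (((H0.add H1).add H2).add H3)]
  refine tsum_nonneg fun p => ?_
  have hp1 : (1 : ℝ) < (p : ℕ) := by exact_mod_cast p.2.one_lt
  set u : ℝ := ((p : ℕ) : ℝ) ^ (-σ) with hu
  have hu0 : 0 < u := by positivity
  have hu1 : u < 1 := Real.rpow_lt_one_of_one_lt_of_neg hp1 (by linarith)
  have e : ((p : ℕ) : ℂ) ^ (-(σ : ℂ)) = (u : ℂ) := by
    rw [hu, Complex.ofReal_cpow (by linarith)]; simp
  have hre (a : ℝ) (ha : |a| ≤ 1) : 0 < 1 - a * u := by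
    have := (abs_le.1 ha).2
    nlinarith
  have key (a b : ℝ) (ha : |a| ≤ 1) (hb : |b| ≤ 1) (hab : |a * b| ≤ 1)
      (hprod : (1 - u) * (1 - a * u) * (1 - b * u) * (1 - a * b * u) ≤ 1) :
      0 ≤ (-Complex.log (1 - 1 * u) + -Complex.log (1 - a * u) + -Complex.log (1 - b * u) +
        -Complex.log (1 - (a * b) * u)).re := by
    have h1 : (1 - 1 * (u : ℂ)) = ((1 - u : ℝ) : ℂ) := by push_cast; ring
    have h2 (a : ℝ) : (1 - (a : ℂ) * (u : ℂ)) = ((1 - a * u : ℝ) : ℂ) := by push_cast; ring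
    have h3 : (1 - ((a : ℂ) * b) * (u : ℂ)) = ((1 - a * b * u : ℝ) : ℂ) := by push_cast; ring
    rw [h1, h2, h2, h3]
    simp only [Complex.add_re, Complex.neg_re, Complex.log_ofReal_re]
    have p1 : 0 < 1 - u := by linarith
    have p2 := hre a ha
    have p3 := hre b hb
    have p4 := hre (a * b) hab
    have := Real.log_nonpos (by positivity) hprod
    rw [Real.log_mul (by positivity) (by positivity), Real.log_mul (by positivity) (by positivity),
      Real.log_mul (by positivity) (by positivity)] at this
    linarith
  rw [hξ, e, MulChar.one_apply (isUnit_of_subsingleton _)]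
  have hu2 : 0 < 1 - u ^ 2 := by nlinarith
  have hu3 : 1 - u ^ 2 ≤ 1 := by nlinarith
  rcases DirichletCharacter.apply_natCast_of_sq_eq_one hχ p with h1 | h1 | h1 <;>
  rcases DirichletCharacter.apply_natCast_of_sq_eq_one hψ p with h2 | h2 | h2 <;>
  rw [h1, h2]
  · simpa using key 0 0 (by simp) (by simp) (by simp) (by linarith)
  · simpa using key 0 1 (by simp) (by simp) (by simp) (by nlinarith)
  · simpa using key 0 (-1) (by simp) (by simp) (by simp) (by nlinarith)
  · simpa using key 1 0 (by simp) (by simp) (by simp) (by nlinarith)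
  · simpa using key 1 1 (by simp) (by simp) (by simp) (by
      have : (1 - u) ^ 4 ≤ 1 := pow_le_one₀ (by linarith) (by linarith)
      linarith)
  · simpa using key 1 (-1) (by simp) (by simp) (by simp) (by nlinarith)
  · simpa using key (-1) 0 (by simp) (by simp) (by simp) (by nlinarith)
  · simpa using key (-1) 1 (by simp) (by simp) (by simp) (by nlinarith)
  · simpa using key (-1) (-1) (by simp) (by simp) (by simp) (by nlinarith)

/-- `χ` is `δ`-exceptional if it is a real nonprincipal character with a small value
of its `L`-function on the segment `(1, 2]`. -/
def IsExceptional {q : ℕ} (χ : DirichletCharacter ℂ q) (δ : ℝ) : Prop :=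
  χ ≠ 1 ∧ χ ^ 2 = 1 ∧ ∃ σ : ℝ, 1 < σ ∧ σ ≤ 2 ∧ ‖LSeries (fun n => χ n) (σ : ℂ)‖ < δ

lemma exists_product_character {q r : ℕ} (hq : 1 ≤ q) (hr : 1 ≤ r) (hqr : q ≠ r)
    (χ : DirichletCharacter ℂ q) (ψ : DirichletCharacter ℂ r) (hχ : χ.IsPrimitive)
    (hψ : ψ.IsPrimitive) (hψ2 : ψ ^ 2 = 1) :
    ∃ ξ : DirichletCharacter ℂ (q * r), ξ ≠ 1 ∧ ∀ n : ℕ, ξ n = χ n * ψ n := by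
  have : NeZero (q * r) := ⟨by positivity⟩
  have hq' : q ∣ q * r := dvd_mul_right _ _
  have hr' : r ∣ q * r := dvd_mul_left _ _
  refine ⟨χ.changeLevel hq' * ψ.changeLevel hr', fun h => hqr ?_, fun n => ?_⟩
  · have h2 : ψ.changeLevel hr' * ψ.changeLevel hr' = 1 := by
      rw [← map_mul, ← sq, hψ2, map_one]
    have h3 : χ.changeLevel hq' = ψ.changeLevel hr' := mul_right_cancel (h.trans h2.symm)
    have h4 := DirichletCharacter.conductor_changeLevel χ hq'
    rw [h3, DirichletCharacter.conductor_changeLevel ψ hr', hχ, hψ] at h4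
    exact h4.symm
  · rw [MulChar.mul_apply]
    by_cases hn : n.Coprime (q * r)
    · have hn' : IsCoprime ((n : ℤ)) ((q * r : ℕ) : ℤ) := Nat.isCoprime_iff_coprime.2 hn
      have e1 := DirichletCharacter.changeLevel_eq_cast_of_dvd' χ hq' hn'
      have e2 := DirichletCharacter.changeLevel_eq_cast_of_dvd' ψ hr' hn'
      push_cast at e1 e2
      rw [e1, e2]
    · have e0 : (χ.changeLevel hq') (n : ZMod (q * r)) = 0 :=
        MulChar.map_nonunit _ (by rwa [ZMod.isUnit_iff_coprime])
      rw [e0, zero_mul]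
      rw [Nat.coprime_mul_iff_right, not_and_or] at hn
      rcases hn with hn | hn
      · rw [MulChar.map_nonunit χ (by rwa [ZMod.isUnit_iff_coprime]), zero_mul]
      · rw [MulChar.map_nonunit ψ (by rwa [ZMod.isUnit_iff_coprime]), mul_zero]

/-- A real zero-free type bound: the value at `σ` of a quadratic `L`-function is `≫ σ - 1`. -/
lemma norm_LSeries_quadratic_ge : ∃ K : ℝ, 1 ≤ K ∧ ∀ q : ℕ, ∀ χ : DirichletCharacter ℂ q,
    χ ^ 2 = 1 → ∀ σ : ℝ, 1 < σ → σ ≤ 2 → (σ - 1) / K ≤ ‖LSeries (fun n => χ n) (σ : ℂ)‖ := by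
  obtain ⟨K, hK, h⟩ := norm_LSeries_one_le
  refine ⟨K, hK, fun q χ hχ σ h1 h2 => ?_⟩
  have hone : (fun n : ℕ => (1 : DirichletCharacter ℂ 1) n) = 1 := by
    funext n
    rw [MulChar.one_apply (isUnit_of_subsingleton _), Pi.one_apply]
  have := norm_LSeries_quadratic_product_ge_one (χ := χ) (ψ := (1 : DirichletCharacter ℂ 1))
    (ξ := χ) hχ (one_pow _) (fun n => by
      rw [MulChar.one_apply (isUnit_of_subsingleton _), mul_one]) h1
  rw [hone] at this
  have hz := h σ h1 h2
  have hz0 : 0 < K / (σ - 1) := div_pos (by linarith) (by linarith)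
  set L := ‖LSeries (fun n => χ n) (σ : ℂ)‖
  have h3 : 1 ≤ (K / (σ - 1) * L) ^ 2 := by
    calc (1 : ℝ) ≤ _ := this
      _ = (‖LSeries 1 (σ : ℂ)‖ * L) ^ 2 := by ring
      _ ≤ _ := by gcongr
  have h4 : 1 ≤ K / (σ - 1) * L := by
    by_contra hlt
    push Not at hlt
    have : (K / (σ - 1) * L) ^ 2 < 1 := pow_lt_one₀ (by positivity) hlt (by norm_num)
    linarith
  rw [div_le_iff₀ (by linarith)]
  rw [div_mul_eq_mul_div, le_div_iff₀ (by linarith)] at h4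
  linarith

/-- Repulsion: two primitive characters of different moduli cannot both be exceptional. -/
lemma not_isExceptional_of_isExceptional : ∃ C : ℝ, 1 ≤ C ∧ ∀ q r : ℕ, 1 ≤ q → 1 ≤ r → q ≠ r →
    ∀ χ : DirichletCharacter ℂ q, ∀ ψ : DirichletCharacter ℂ r, χ.IsPrimitive → ψ.IsPrimitive →
    ∀ δ : ℝ, 0 < δ → C * (1 + Real.log q + Real.log r) ^ 5 * δ < 1 → IsExceptional χ δ →
    ¬ IsExceptional ψ δ := by
  obtain ⟨K, hK, hlow⟩ := norm_LSeries_quadratic_ge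
  obtain ⟨K', hK', hone⟩ := norm_LSeries_one_le
  obtain ⟨C1, hC1, hlip⟩ := norm_LSeries_sub_le
  obtain ⟨C0, hC0, hb0⟩ := norm_LSeries_character_le 0
  set D : ℝ := 1 + 3 * C1 * (K + 1) with hD
  have hD1 : 1 ≤ D := by rw [hD]; nlinarith
  have hC : 1 ≤ K' * D ^ 2 * (3 * C0) := one_le_mul_of_one_le_of_one_le
    (one_le_mul_of_one_le_of_one_le hK' (one_le_pow₀ hD1)) (by linarith)
  refine ⟨K' * D ^ 2 * (3 * C0), hC, ?_⟩
  intro q r hq hr hqr χ ψ hχ hψ δ hδ hsmall hEχ hEψ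
  have hlq : 0 ≤ Real.log q := Real.log_nonneg (by exact_mod_cast hq)
  have hlr : 0 ≤ Real.log r := Real.log_nonneg (by exact_mod_cast hr)
  set ℓ : ℝ := 1 + Real.log q + Real.log r with hℓ
  have hℓ1 : 1 ≤ ℓ := by linarith
  have hδ1 : δ < 1 := by
    have : 1 ≤ K' * D ^ 2 * (3 * C0) * ℓ ^ 5 :=
      one_le_mul_of_one_le_of_one_le hC (one_le_pow₀ hℓ1)
    exact lt_of_le_of_lt (le_mul_of_one_le_left hδ.le this) hsmall
  have key : ∀ (N : ℕ) (hN : 1 ≤ N) (η : DirichletCharacter ℂ N), 1 + Real.log N ≤ ℓ →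
      IsExceptional η δ → ‖LSeries (fun n => η n) ((1 + δ : ℝ) : ℂ)‖ ≤ D * ℓ ^ 2 * δ := by
    rintro N hN η hNℓ ⟨hη1, hη2, σ, h1, h2, h3⟩
    have hlN : 0 ≤ Real.log N := Real.log_nonneg (by exact_mod_cast hN)
    have h4 := hlow N η hη2 σ h1 h2
    have h5 : σ - 1 ≤ K * δ := by
      rw [div_le_iff₀ (by linarith)] at h4
      have : ‖LSeries (fun n => η n) (σ : ℂ)‖ * K ≤ δ * K := by gcongr
      linarith
    have h6 := hlip N hN η hη1 2 ((1 + δ : ℝ) : ℂ) (σ : ℂ) (by simpa) (by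
      rw [Complex.norm_real, Real.norm_of_nonneg (by linarith)]; linarith) (by simpa) (by
      rw [Complex.norm_real, Real.norm_of_nonneg (by linarith)]; linarith)
    have h7 : ‖((1 + δ : ℝ) : ℂ) - σ‖ ≤ (K + 1) * δ := by
      rw [← Complex.ofReal_sub, Complex.norm_real, Real.norm_eq_abs, abs_le]
      constructor <;> linarith [mul_pos (by linarith : 0 < K) hδ]
    have h8 := norm_sub_norm_le (LSeries (fun n => η n) ((1 + δ : ℝ) : ℂ))
      (LSeries (fun n => η n) (σ : ℂ))
    have h9 : C1 * (1 + Real.log N) ^ 2 * (1 + 2) * ‖((1 + δ : ℝ) : ℂ) - σ‖ ≤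
        C1 * ℓ ^ 2 * (1 + 2) * ((K + 1) * δ) := by gcongr
    have h10 : δ ≤ ℓ ^ 2 * δ := le_mul_of_one_le_left hδ.le (one_le_pow₀ hℓ1)
    rw [hD]
    linarith
  obtain ⟨ξ, hξ1, hξ⟩ := exists_product_character hq hr hqr χ ψ hχ hψ hEψ.2.1
  have hprod := norm_LSeries_quadratic_product_ge_one hEχ.2.1 hEψ.2.1 hξ
    (σ := 1 + δ) (by linarith)
  have e1 := key q hq χ (by linarith) hEχ
  have e2 := key r hr ψ (by linarith) hEψ
  have e3 := hone (1 + δ) (by linarith) (by linarith)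
  have e4 := hb0 (q * r) (by nlinarith) ξ hξ1 ((1 + δ : ℝ) : ℂ) (by simpa)
  rw [mulLogPow_zero, zero_add, pow_one, Nat.cast_mul, Real.log_mul (by positivity) (by positivity),
    ← add_assoc] at e4
  have e5 : ‖((1 + δ : ℝ) : ℂ)‖ ≤ 2 := by
    rw [Complex.norm_real, Real.norm_of_nonneg (by linarith)]; linarith
  rw [add_sub_cancel_left] at e3
  have : (1 : ℝ) ≤ K' / δ * (D * ℓ ^ 2 * δ) * (D * ℓ ^ 2 * δ) * (C0 * ℓ * (1 + 2)) := by
    refine hprod.trans ?_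
    gcongr
    exact e4.trans (by gcongr)
  have e6 : K' / δ * (D * ℓ ^ 2 * δ) * (D * ℓ ^ 2 * δ) * (C0 * ℓ * (1 + 2)) =
      K' * D ^ 2 * (3 * C0) * ℓ ^ 5 * δ := by field_simp; ring
  linarith

lemma exists_forall_not_isExceptional {q : ℕ} (hq : 1 ≤ q) (χ : DirichletCharacter ℂ q) :
    ∃ δ : ℝ, 0 < δ ∧ ¬ IsExceptional χ δ := by
  have : NeZero q := ⟨by omega⟩
  by_cases hχ : χ = 1
  · exact ⟨1, one_pos, fun h => h.1 hχ⟩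
  have hcont : ContinuousOn (fun σ : ℝ => ‖DirichletCharacter.LFunction χ σ‖) (Set.Icc 1 2) :=
    ((DirichletCharacter.differentiable_LFunction hχ).continuous.comp
      Complex.continuous_ofReal).norm.continuousOn
  obtain ⟨σ₀, h0, hmin⟩ := isCompact_Icc.exists_isMinOn ⟨1, by norm_num⟩ hcont
  refine ⟨_, norm_pos_iff.2 (DirichletCharacter.LFunction_ne_zero_of_one_le_re χ (Or.inl hχ)
    (s := σ₀) (by simpa using h0.1)), ?_⟩
  rintro ⟨-, -, σ, h1, h2, h3⟩
  rw [← DirichletCharacter.LFunction_eq_LSeries χ (by simpa)] at h3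
  exact absurd (isMinOn_iff.1 hmin σ ⟨h1.le, h2⟩) (by simpa using h3)

lemma exists_forall_le_not_isExceptional (K : ℕ) :
    ∃ δ : ℝ, 0 < δ ∧ ∀ q : ℕ, 1 ≤ q → q ≤ K → ∀ χ : DirichletCharacter ℂ q,
      ¬ IsExceptional χ δ := by
  induction K with
  | zero => exact ⟨1, one_pos, fun q h1 h2 => by omega⟩
  | succ K ih =>
    obtain ⟨δ, hδ, h⟩ := ih
    have : NeZero (K + 1) := ⟨by omega⟩
    choose f hf0 hf using fun χ : DirichletCharacter ℂ (K + 1) =>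
      exists_forall_not_isExceptional (by omega : 1 ≤ K + 1) χ
    obtain ⟨m, hm⟩ := Finite.exists_min f
    refine ⟨min δ (f m), lt_min hδ (hf0 m), fun q h1 h2 χ => ?_⟩
    rcases Nat.lt_or_ge K q with hK | hK
    · obtain rfl : q = K + 1 := by omega
      rintro ⟨a, b, σ, c, d, e⟩
      exact hf χ ⟨a, b, σ, c, d, e.trans_le ((min_le_right _ _).trans (hm χ))⟩
    · rintro ⟨a, b, σ, c, d, e⟩
      exact h q h1 hK χ ⟨a, b, σ, c, d, e.trans_le (min_le_left _ _)⟩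

/-- Up to `X ^ A` there is at most one exceptional modulus, and it tends to infinity with `X`. -/
lemma exists_exceptional_modulus (A : ℕ) (K : ℕ) : ∀ᶠ X : ℝ in Filter.atTop,
    ∃ q₁ : ℕ, K < q₁ ∧ ∀ r : ℕ, 1 ≤ r → (r : ℝ) ≤ X ^ A → r ≠ q₁ →
      ∀ χ : DirichletCharacter ℂ r, χ.IsPrimitive → ¬ IsExceptional χ (X ^ (-(1 / 8 : ℝ))) := by
  obtain ⟨C, hC, hrep⟩ := not_isExceptional_of_isExceptional
  obtain ⟨δ, hδ, hfin⟩ := exists_forall_le_not_isExceptional K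
  have lim1 : Filter.Tendsto (fun X : ℝ => X ^ (-(1 / 8 : ℝ))) Filter.atTop (nhds 0) :=
    tendsto_rpow_neg_atTop (by norm_num)
  have lim2 : Filter.Tendsto (fun X : ℝ => C * (1 + 2 * A * Real.log X) ^ 5 * X ^ (-(1 / 8 : ℝ)))
      Filter.atTop (nhds 0) := by
    have h1 : (fun X : ℝ => (1 + 2 * A * Real.log X)) =o[Filter.atTop]
        fun X : ℝ => X ^ (1 / 100 : ℝ) := by
      refine Asymptotics.IsLittleO.add ?_ ?_
      · exact Asymptotics.isLittleO_const_left.2 (Or.inr (tendsto_norm_atTop_atTop.comp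
          (tendsto_rpow_atTop (by norm_num))))
      · exact (isLittleO_log_rpow_atTop (by norm_num)).const_mul_left _
    have h2 := (h1.pow (n := 5) (by norm_num)).tendsto_div_nhds_zero
    have h3 := (h2.const_mul C).mul (lim1.comp (tendsto_rpow_atTop (by norm_num : (0 : ℝ) < 3 / 5)))
    simp only [mul_zero] at h3
    refine h3.congr' ?_
    filter_upwards [Filter.eventually_gt_atTop 0] with X hX
    have e1 : (X ^ (1 / 100 : ℝ)) ^ 5 = X ^ (1 / 20 : ℝ) := by
      rw [← Real.rpow_natCast, ← Real.rpow_mul hX.le]; norm_num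
    have e2 : (X ^ (3 / 5 : ℝ)) ^ (-(1 / 8 : ℝ)) = X ^ (-(3 / 40) : ℝ) := by
      rw [← Real.rpow_mul hX.le]; norm_num
    have e3 : X ^ (-(1 / 8) : ℝ) = X ^ (-(3 / 40) : ℝ) * (X ^ (1 / 20 : ℝ))⁻¹ := by
      rw [← Real.rpow_neg hX.le, ← Real.rpow_add hX]; norm_num
    simp only [Function.comp_apply, e1, e2]
    rw [e3]
    ring
  filter_upwards [lim1.eventually (gt_mem_nhds hδ), lim2.eventually (gt_mem_nhds one_pos),
    Filter.eventually_ge_atTop 1] with X h1 h2 hX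
  set δ' : ℝ := X ^ (-(1 / 8 : ℝ)) with hδ'
  have hδ'0 : 0 < δ' := by positivity
  have hlog : ∀ r : ℕ, 1 ≤ r → (r : ℝ) ≤ X ^ A → Real.log r ≤ A * Real.log X := by
    intro r hr hrX
    rw [← Real.log_pow]
    exact Real.log_le_log (by exact_mod_cast hr) hrX
  by_cases hex : ∃ q₁ : ℕ, 1 ≤ q₁ ∧ (q₁ : ℝ) ≤ X ^ A ∧ ∃ χ : DirichletCharacter ℂ q₁,
      χ.IsPrimitive ∧ IsExceptional χ δ'
  · obtain ⟨q₁, hq1, hqX, χ, hχ, hχE⟩ := hex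
    refine ⟨q₁, ?_, fun r hr hrX hrq ψ hψ hE => ?_⟩
    · by_contra hK
      push Not at hK
      obtain ⟨a, b, σ, c, d, e⟩ := hχE
      exact hfin q₁ hq1 hK χ ⟨a, b, σ, c, d, e.trans h1⟩
    · refine hrep q₁ r hq1 hr hrq.symm χ ψ hχ hψ δ' hδ'0 (lt_of_le_of_lt ?_ h2) hχE hE
      have l1 := hlog q₁ hq1 hqX
      have l2 := hlog r hr hrX
      have l3 : 0 ≤ Real.log q₁ := Real.log_nonneg (by exact_mod_cast hq1)
      have l4 : 0 ≤ Real.log r := Real.log_nonneg (by exact_mod_cast hr)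
      have l5 : 1 + Real.log q₁ + Real.log r ≤ 1 + 2 * A * Real.log X := by linarith
      have l6 : 0 ≤ 1 + Real.log q₁ + Real.log r := by linarith
      gcongr
  · push Not at hex
    exact ⟨K + 1, by omega, fun r hr hrX _ χ hχ => hex r hr hrX χ hχ⟩

/-! ### Smoothed sums of Dirichlet coefficients by Fourier inversion -/

lemma exists_fourier_representation {g : ℝ → ℂ} (hg : ContDiff ℝ (⊤ : ℕ∞) g)
    (hc : HasCompactSupport g) :
    ∃ h : ℝ → ℂ, Continuous h ∧
      (∀ e : ℕ, MeasureTheory.Integrable fun ξ => (3 + |2 * Real.pi * ξ|) ^ e * ‖h ξ‖) ∧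
      ∀ u : ℝ, g u = ∫ ξ, Complex.exp ((2 * Real.pi * ξ * u : ℝ) * Complex.I) * h ξ := by
  open FourierTransform in
  set f : SchwartzMap ℝ ℂ := hc.toSchwartzMap hg with hf
  refine ⟨(𝓕 f : SchwartzMap ℝ ℂ), (𝓕 f : SchwartzMap ℝ ℂ).continuous, fun e => ?_, fun u => ?_⟩
  · have h0 := (𝓕 f : SchwartzMap ℝ ℂ).integrable_pow_mul MeasureTheory.volume 0
    have he := (𝓕 f : SchwartzMap ℝ ℂ).integrable_pow_mul MeasureTheory.volume e
    refine ((h0.add he).const_mul (14 ^ e)).mono' ?_ (Filter.Eventually.of_forall fun ξ => ?_)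
    · exact (Continuous.mul (by fun_prop)
        (𝓕 f : SchwartzMap ℝ ℂ).continuous.norm).aestronglyMeasurable
    · rw [Real.norm_of_nonneg (by positivity)]
      simp only [Pi.add_apply, pow_zero, one_mul]
      rw [← one_add_mul, ← mul_assoc]
      gcongr
      have hpi := Real.pi_le_four
      have h1 : |2 * Real.pi * ξ| ≤ 8 * |ξ| := by
        rw [abs_mul, abs_of_pos (by positivity)]
        nlinarith [abs_nonneg ξ]
      rw [Real.norm_eq_abs]
      rcases le_total |ξ| 1 with h | h
      · calc (3 + |2 * Real.pi * ξ|) ^ e ≤ 14 ^ e := by gcongr; linarith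
          _ ≤ _ := le_mul_of_one_le_right (by positivity) (by simp)
      · calc (3 + |2 * Real.pi * ξ|) ^ e ≤ (14 * |ξ|) ^ e := by gcongr; linarith
          _ = 14 ^ e * |ξ| ^ e := mul_pow _ _ _
          _ ≤ _ := by gcongr; linarith
  · have h1 : 𝓕⁻ (𝓕 f : SchwartzMap ℝ ℂ) = f := FourierTransform.fourierInv_fourier_eq f
    have h2 : g u = f u := rfl
    rw [h2]
    conv_lhs => rw [← h1]
    rw [SchwartzMap.fourierInv_coe, Real.fourierInv_eq']
    refine MeasureTheory.integral_congr_ae (Filter.Eventually.of_forall fun ξ => ?_)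
    simp only [smul_eq_mul, RCLike.inner_apply, conj_trivial]
    congr 4
    ring

lemma norm_tsum_term_mul_le {g : ℝ → ℂ} (hg : ContDiff ℝ (⊤ : ℕ∞) g)
    (hc : HasCompactSupport g) (e : ℕ) : ∃ C : ℝ, 0 ≤ C ∧ ∀ (a : ℕ → ℂ) (σ X Q : ℝ), 0 ≤ Q →
      LSeriesSummable a σ → (∀ t : ℝ, ‖LSeries a (σ + t * Complex.I)‖ ≤ Q * (3 + |t|) ^ e) →
      ‖∑' n, LSeries.term a σ n * g (Real.log n - X)‖ ≤ C * Q := by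
  obtain ⟨h, hcont, h_integ, hrep⟩ := exists_fourier_representation hg hc
  refine ⟨∫ ξ, (3 + |2 * Real.pi * ξ|) ^ e * ‖h ξ‖,
    MeasureTheory.integral_nonneg fun ξ => by positivity, ?_⟩
  intro a σ X Q hQ hs hbound
  have h_integ0 : MeasureTheory.Integrable h := by
    have := h_integ 0
    simp only [pow_zero, one_mul] at this
    exact (MeasureTheory.integrable_norm_iff hcont.aestronglyMeasurable).1 this
  set F : ℕ → ℝ → ℂ := fun n ξ => LSeries.term a σ n *
    (Complex.exp ((2 * Real.pi * ξ * (Real.log n - X) : ℝ) * Complex.I) * h ξ) with hF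
  have hFint (n : ℕ) : MeasureTheory.Integrable (F n) := by
    refine MeasureTheory.Integrable.const_mul ?_ _
    refine h_integ0.norm.mono' (Continuous.aestronglyMeasurable (by fun_prop))
      (Filter.Eventually.of_forall fun ξ => ?_)
    rw [norm_mul, Complex.norm_exp_ofReal_mul_I, one_mul]
  have norm_F (n : ℕ) (ξ : ℝ) : ‖F n ξ‖ = ‖LSeries.term a σ n‖ * ‖h ξ‖ := by
    rw [hF]; simp only [norm_mul, Complex.norm_exp_ofReal_mul_I, one_mul]
  have hsum : Summable fun n => ∫ ξ, ‖F n ξ‖ := by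
    simp_rw [norm_F, MeasureTheory.integral_const_mul]
    exact hs.norm.mul_right _
  have e1 : ∑' n, LSeries.term a σ n * g (Real.log n - X) = ∫ ξ, ∑' n, F n ξ := by
    rw [← MeasureTheory.integral_tsum_of_summable_integral_norm hFint hsum]
    refine tsum_congr fun n => ?_
    rw [hrep, ← MeasureTheory.integral_const_mul]
  rw [e1, mul_comm, ← MeasureTheory.integral_const_mul]
  refine MeasureTheory.norm_integral_le_of_norm_le ((h_integ e).const_mul Q)
    (Filter.Eventually.of_forall fun ξ => ?_)
  have e2 : ∑' n, F n ξ = LSeries a (σ + (-(2 * Real.pi * ξ) : ℝ) * Complex.I) *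
      (Complex.exp ((-(2 * Real.pi * ξ * X) : ℝ) * Complex.I) * h ξ) := by
    rw [LSeries, ← tsum_mul_right]
    refine tsum_congr fun n => ?_
    rcases eq_or_ne n 0 with rfl | hn
    · simp [hF]
    have hn' : (n : ℂ) ≠ 0 := by exact_mod_cast hn
    rw [hF]
    simp only [LSeries.term_of_ne_zero hn]
    have hz : ((n : ℂ) ^ (((-(2 * Real.pi * ξ) : ℝ) : ℂ) * Complex.I))⁻¹ =
        Complex.exp (Real.log n * -((-(2 * Real.pi * ξ) : ℝ) * Complex.I)) := by
      rw [← Complex.cpow_neg, Complex.cpow_def_of_ne_zero hn', Complex.natCast_log]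
    have : Complex.exp ((2 * Real.pi * ξ * (Real.log n - X) : ℝ) * Complex.I) =
        Complex.exp (Real.log n * -((-(2 * Real.pi * ξ) : ℝ) * Complex.I)) *
        Complex.exp ((-(2 * Real.pi * ξ * X) : ℝ) * Complex.I) := by
      rw [← Complex.exp_add]
      congr 1
      push_cast
      ring
    rw [this, ← hz, Complex.cpow_add _ _ hn', div_eq_mul_inv, div_eq_mul_inv, mul_inv]
    ring
  rw [e2, norm_mul, norm_mul, Complex.norm_exp_ofReal_mul_I, one_mul, ← mul_assoc]
  gcongr
  simpa using hbound (-(2 * Real.pi * ξ))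

/-- Repeated integration by parts, in the form of the identity
`X g(u - X) = u g(u - X) - (u - X) g(u - X)`. -/
lemma norm_tsum_term_mul_le_rpow (e m : ℕ) : ∀ {g : ℝ → ℂ}, ContDiff ℝ (⊤ : ℕ∞) g →
    HasCompactSupport g → ∃ C : ℝ, 0 ≤ C ∧ ∀ (a : ℕ → ℂ) (σ X Q : ℝ), 0 ≤ Q → 0 < X →
      (∀ k ≤ m, LSeriesSummable (mulLogPow a k) σ) →
      (∀ k ≤ m, ∀ t : ℝ, ‖LSeries (mulLogPow a k) (σ + t * Complex.I)‖ ≤ Q * (3 + |t|) ^ e) →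
      ‖∑' n, LSeries.term a σ n * g (Real.log n - X)‖ ≤ C * Q / X ^ m := by
  induction m with
  | zero =>
    intro g hg hc
    obtain ⟨C, hC, h⟩ := norm_tsum_term_mul_le hg hc e
    refine ⟨C, hC, fun a σ X Q hQ hX hs hb => ?_⟩
    have h1 := hs 0 le_rfl
    have h2 := hb 0 le_rfl
    rw [mulLogPow_zero] at h1 h2
    simpa using h a σ X Q hQ h1 h2
  | succ m ih =>
    intro g hg hc
    obtain ⟨C1, hC1, h1⟩ := ih hg hc
    obtain ⟨C2, hC2, h2⟩ := ih (g := fun v => (v : ℂ) * g v)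
      ((Complex.ofRealCLM.contDiff).mul hg) hc.mul_left
    refine ⟨C1 + C2, by positivity, fun a σ X Q hQ hX hs hb => ?_⟩
    have hmm (k : ℕ) : mulLogPow (mulLogPow a 1) k = mulLogPow a (k + 1) := by
      funext n; simp only [mulLogPow]; ring
    have b1 := h1 (mulLogPow a 1) σ X Q hQ hX (fun k hk => by rw [hmm]; exact hs _ (by omega))
      (fun k hk => by rw [hmm]; exact hb _ (by omega))
    have b2 := h2 a σ X Q hQ hX (fun k hk => hs k (by omega)) (fun k hk => hb k (by omega))
    obtain ⟨B, hB⟩ := hc.exists_bound_of_continuous hg.continuous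
    obtain ⟨B', hB'⟩ := (hc.mul_left (f := fun v : ℝ => (v : ℂ))).exists_bound_of_continuous
      (Complex.continuous_ofReal.mul hg.continuous)
    have hs0 := hs 0 (by omega)
    rw [mulLogPow_zero] at hs0
    have hs1 := hs 1 (by omega)
    have sum1 : Summable fun n => LSeries.term (mulLogPow a 1) σ n * g (Real.log n - X) := by
      refine Summable.of_norm_bounded (hs1.norm.mul_right B) fun n => ?_
      rw [norm_mul]
      gcongr
      exact hB _
    have sum2 : Summable fun n => LSeries.term a σ n *
        (((Real.log n - X : ℝ) : ℂ) * g (Real.log n - X)) := by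
      refine Summable.of_norm_bounded (hs0.norm.mul_right B') fun n => ?_
      rw [norm_mul]
      gcongr
      exact hB' _
    have key : (X : ℂ) * ∑' n, LSeries.term a σ n * g (Real.log n - X) =
        ∑' n, LSeries.term (mulLogPow a 1) σ n * g (Real.log n - X) -
        ∑' n, LSeries.term a σ n * (((Real.log n - X : ℝ) : ℂ) * g (Real.log n - X)) := by
      rw [← sum1.tsum_sub sum2, ← tsum_mul_left]
      refine tsum_congr fun n => ?_
      rcases eq_or_ne n 0 with rfl | hn
      · simp
      simp only [LSeries.term_of_ne_zero hn, mulLogPow, pow_one]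
      push_cast
      ring
    have : X * ‖∑' n, LSeries.term a σ n * g (Real.log n - X)‖ ≤ (C1 + C2) * Q / X ^ m := by
      calc _ = ‖(X : ℂ) * ∑' n, LSeries.term a σ n * g (Real.log n - X)‖ := by
            rw [norm_mul, Complex.norm_real, Real.norm_of_nonneg hX.le]
        _ ≤ _ := by rw [key]; exact norm_sub_le _ _
        _ ≤ C1 * Q / X ^ m + C2 * Q / X ^ m := add_le_add b1 b2
        _ = _ := by ring
    rw [pow_succ, ← div_div, le_div_iff₀ hX]
    linarith

/-- The limit `σ → 1` of `norm_tsum_term_mul_le_rpow`. -/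
lemma norm_sum_div_mul_le_rpow (e m : ℕ) {g : ℝ → ℂ} (hg : ContDiff ℝ (⊤ : ℕ∞) g)
    (hc : HasCompactSupport g) : ∃ C : ℝ, 0 ≤ C ∧ ∀ (a : ℕ → ℂ) (X Q : ℝ), 0 ≤ Q → 0 < X →
      (∀ σ : ℝ, 1 < σ → σ ≤ 2 → ∀ k ≤ m, LSeriesSummable (mulLogPow a k) σ) →
      (∀ σ : ℝ, 1 < σ → σ ≤ 2 → ∀ k ≤ m, ∀ t : ℝ,
        ‖LSeries (mulLogPow a k) (σ + t * Complex.I)‖ ≤ Q * (3 + |t|) ^ e) →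
      ∀ N : ℕ, (∀ n, N ≤ n → g (Real.log n - X) = 0) →
      ‖∑ n ∈ range N, a n / n * g (Real.log n - X)‖ ≤ C * Q / X ^ m := by
  obtain ⟨C, hC, h⟩ := norm_tsum_term_mul_le_rpow e m hg hc
  refine ⟨C, hC, fun a X Q hQ hX hs hb N hN => ?_⟩
  have h1 : ∀ σ : ℝ, ∑' n, LSeries.term a σ n * g (Real.log n - X) =
      ∑ n ∈ range N, LSeries.term a σ n * g (Real.log n - X) := fun σ =>
    tsum_eq_sum fun n hn => by rw [hN n (by simpa using hn), mul_zero]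
  have hlim : Filter.Tendsto (fun σ : ℝ => ∑ n ∈ range N, LSeries.term a σ n * g (Real.log n - X))
      (nhdsWithin 1 (Set.Ioi 1)) (nhds (∑ n ∈ range N, a n / n * g (Real.log n - X))) := by
    refine tendsto_finsetSum _ fun n _ => ?_
    refine Filter.Tendsto.mul_const _ ?_
    rcases eq_or_ne n 0 with rfl | hn
    · simp
    simp only [LSeries.term_of_ne_zero hn]
    have hn' : (n : ℂ) ≠ 0 := by exact_mod_cast hn
    have hcont : Continuous fun σ : ℝ => a n / (n : ℂ) ^ (σ : ℂ) := by
      refine continuous_const.div ?_ fun σ => by simp [Complex.cpow_eq_zero_iff, hn']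
      exact (Complex.continuous_ofReal).const_cpow (Or.inl hn')
    have := (hcont.tendsto 1).mono_left (nhdsWithin_le_nhds (s := Set.Ioi 1))
    simpa using this
  refine le_of_tendsto hlim.norm ?_
  filter_upwards [Ioc_mem_nhdsGT (show (1 : ℝ) < 2 by norm_num)] with σ hσ
  rw [← h1]
  exact h a σ X Q hQ hX (hs σ hσ.1 hσ.2) (hb σ hσ.1 hσ.2)

lemma abscissaOfAbsConv_twist_vonMangoldt_le_one {q : ℕ} (χ : DirichletCharacter ℂ q) :
    LSeries.abscissaOfAbsConv (fun n => χ n * ArithmeticFunction.vonMangoldt n) ≤ 1 := by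
  refine LSeries.abscissaOfAbsConv_le_of_forall_lt_LSeriesSummable fun y hy => ?_
  exact DirichletCharacter.LSeriesSummable_twist_vonMangoldt χ (by simpa using hy)

/-- Smoothed prime sums twisted by characters of small modulus that are not exceptional. -/
lemma norm_sum_character_vonMangoldt_le (A B : ℕ) {g : ℝ → ℂ} (hg : ContDiff ℝ (⊤ : ℕ∞) g)
    (hc : HasCompactSupport g) : ∀ᶠ X : ℝ in Filter.atTop,
      ∀ r : ℕ, 1 ≤ r → (r : ℝ) ≤ X ^ A → ∀ χ : DirichletCharacter ℂ r, χ ≠ 1 →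
      ¬ IsExceptional χ (X ^ (-(1 / 8 : ℝ))) → ∀ N : ℕ, (∀ n, N ≤ n → g (Real.log n - X) = 0) →
      ‖∑ n ∈ range N, χ n * ArithmeticFunction.vonMangoldt n / n * g (Real.log n - X)‖ ≤
        1 / X ^ B := by
  set m : ℕ := 2 * B + 5 with hm
  obtain ⟨C, hC, hmain⟩ := norm_sum_div_mul_le_rpow (5 * (m + 1)) m hg hc
  choose Cs hCs1 hCs using norm_LSeries_twist_vonMangoldt_le
  set D : ℝ := ∑ j ∈ range (m + 1), Cs j with hD
  have hD0 : ∀ j ≤ m, Cs j ≤ D := fun j hj =>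
    single_le_sum (f := Cs) (fun i _ => by linarith [hCs1 i]) (mem_range.2 (by omega))
  have hD1 : 1 ≤ D := (hCs1 0).trans (hD0 0 (by omega))
  have hlim : ∀ᶠ X : ℝ in Filter.atTop,
      C * D * (1 + A * Real.log X) ^ ((m + 10) * (m + 1)) ≤ X := by
    have h1 : (fun X : ℝ => (1 + A * Real.log X)) =o[Filter.atTop]
        fun X : ℝ => X ^ (1 / ((m + 10) * (m + 1)) : ℝ) := by
      refine Asymptotics.IsLittleO.add ?_ ?_
      · exact Asymptotics.isLittleO_const_left.2 (Or.inr (tendsto_norm_atTop_atTop.comp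
          (tendsto_rpow_atTop (by positivity))))
      · exact (isLittleO_log_rpow_atTop (by positivity)).const_mul_left _
    have h2 := ((h1.pow (n := (m + 10) * (m + 1)) (by positivity)).const_mul_left (C * D)).def one_pos
    filter_upwards [h2, Filter.eventually_gt_atTop 0] with X hX hX0
    refine (le_abs_self _).trans (hX.trans ?_)
    rw [one_mul, ← Real.rpow_natCast, ← Real.rpow_mul hX0.le]
    push_cast
    rw [one_div_mul_cancel (by positivity), Real.rpow_one, Real.norm_of_nonneg hX0.le]
  filter_upwards [hlim, Filter.eventually_ge_atTop 1] with X hX hX1 r hr hrX χ hχ hE N hN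
  have hX0 : 0 < X := by linarith
  have hlr : 0 ≤ Real.log r := Real.log_nonneg (by exact_mod_cast hr)
  have hlrX : Real.log r ≤ A * Real.log X := by
    rw [← Real.log_pow]
    exact Real.log_le_log (by exact_mod_cast hr) hrX
  set δ : ℝ := X ^ (-(1 / 8 : ℝ)) with hδ
  have hδ0 : 0 < δ := by positivity
  have hδ1 : δ ≤ 1 := Real.rpow_le_one_of_one_le_of_nonpos hX1 (by norm_num)
  have hδ4 : (δ⁻¹ ^ 4) ^ (m + 1) = X ^ (B + 3) := by
    rw [hδ, ← Real.rpow_neg hX0.le, ← pow_mul, ← Real.rpow_natCast, ← Real.rpow_mul hX0.le,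
      ← Real.rpow_natCast X]
    congr 1
    rw [hm]
    push_cast
    ring
  set ℓ : ℝ := 1 + Real.log r with hℓ
  have hℓ1 : 1 ≤ ℓ := by linarith
  have hδi : 1 ≤ δ⁻¹ := (one_le_inv₀ hδ0).2 hδ1
  set Q : ℝ := D * (ℓ ^ (m + 10) * δ⁻¹ ^ 4) ^ (m + 1) with hQ
  have hb := hmain (fun n => χ n * ArithmeticFunction.vonMangoldt n) X Q (by positivity) hX0
    (fun σ h1 h2 k hk => LSeriesSummable_mulLogPow
      (abscissaOfAbsConv_twist_vonMangoldt_le_one χ) k (by simpa)) (fun σ h1 h2 k hk t => ?_) N hN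
  · refine hb.trans ?_
    rw [div_le_div_iff₀ (by positivity) (by positivity), one_mul]
    calc C * Q * X ^ B = C * D * ℓ ^ ((m + 10) * (m + 1)) * (X ^ (B + 3) * X ^ B) := by
          rw [hQ, mul_pow, hδ4, ← pow_mul]; ring
      _ ≤ C * D * (1 + A * Real.log X) ^ ((m + 10) * (m + 1)) * (X ^ (B + 3) * X ^ B) := by
          gcongr
          linarith
      _ ≤ X * (X ^ (B + 3) * X ^ B) := by gcongr
      _ = X ^ (2 * B + 4) := by ring
      _ ≤ X ^ m := pow_le_pow_right₀ hX1 (by omega)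
  · refine (hCs k r hr χ hχ δ hδ0 hδ1 (fun h2 σ h1 h2' => ?_) σ h1 h2 t).trans ?_
    · by_contra hlt
      exact hE ⟨hχ, h2, σ, h1, h2', not_le.1 hlt⟩
    · have hτ : 1 ≤ 3 + |t| := by linarith [abs_nonneg t]
      have hbase : 1 ≤ ℓ ^ (m + 10) * (3 + |t|) ^ 5 * δ⁻¹ ^ 4 :=
        one_le_mul_of_one_le_of_one_le (one_le_mul_of_one_le_of_one_le (one_le_pow₀ hℓ1)
          (one_le_pow₀ hτ)) (one_le_pow₀ hδi)
      have hpow : ℓ ^ (k + 10) ≤ ℓ ^ (m + 10) := pow_le_pow_right₀ hℓ1 (by omega)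
      calc _ ≤ D * (ℓ ^ (m + 10) * (3 + |t|) ^ 5 * δ⁻¹ ^ 4) ^ (k + 1) := by
            gcongr
            exact hD0 k hk
        _ ≤ D * (ℓ ^ (m + 10) * (3 + |t|) ^ 5 * δ⁻¹ ^ 4) ^ (m + 1) := by
            have := pow_le_pow_right₀ hbase (by omega : k + 1 ≤ m + 1)
            gcongr
        _ = _ := by rw [hQ, pow_mul, mul_right_comm, mul_pow _ ((3 + |t|) ^ 5), mul_assoc D]

/-! ### The prime number theorem in smoothed form -/

lemma one_eq_character_one : (1 : ℕ → ℂ) = fun n : ℕ => (1 : DirichletCharacter ℂ 1) n := by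
  funext n
  rw [MulChar.one_apply (isUnit_of_subsingleton _), Pi.one_apply]

/-- Bounds for `ζ'/ζ` and its derivatives away from the real axis. -/
lemma norm_LSeries_mulLogPow_vonMangoldt_le (k : ℕ) : ∃ C : ℝ, 1 ≤ C ∧ ∀ σ : ℝ, 1 < σ → σ ≤ 2 →
    ∀ t : ℝ, 1 ≤ |t| →
    ‖LSeries (mulLogPow (fun n => (ArithmeticFunction.vonMangoldt n : ℂ)) k) (σ + t * Complex.I)‖ ≤
      C * (3 + |t|) ^ (5 * (k + 1)) := by
  obtain ⟨c, hc0, hc⟩ := norm_LSeries_ge_of_bounds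
  choose Cs hCs1 hCs using norm_LSeries_one_mulLogPow_le
  obtain ⟨C', hC'1, hC'⟩ := norm_LSeries_vonMangoldt_le k
  set A : ℝ := ∑ j ∈ range (k + 2), (2 * Cs j + j.factorial) with hA
  have hA0 : ∀ j ≤ k + 1, 2 * Cs j + j.factorial ≤ A := fun j hj =>
    single_le_sum (f := fun j => 2 * Cs j + (j.factorial : ℝ))
      (fun i _ => by have := hCs1 i; positivity) (mem_range.2 (by omega))
  have hA1 : 1 ≤ A := by
    have := hA0 0 (by omega); have := hCs1 0; simp at *; linarith
  have hbd : ∀ j ≤ k + 1, ∀ σ : ℝ, 1 < σ → σ ≤ 2 → ∀ t u : ℝ, 1 ≤ |t| → |t| ≤ |u| → |u| ≤ 2 * |t| →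
      ‖LSeries (mulLogPow 1 j) (σ + u * Complex.I)‖ ≤ A * (3 + |t|) := by
    intro j hj σ h1 h2 t u ht htu hut
    refine (hCs j _ (by simpa)).trans ((?_ : _ ≤ (2 * Cs j + j.factorial) * (3 + |t|)).trans
      (by gcongr; exact hA0 j hj))
    have e1 := norm_ofReal_add_mul_I_le h1 h2 (t := u)
    have e2 : 1 ≤ ‖(σ : ℂ) + u * Complex.I - 1‖ := by
      have := Complex.abs_im_le_norm ((σ : ℂ) + u * Complex.I - 1)
      simp at this
      linarith
    have e3 : (j.factorial : ℝ) / ‖(σ : ℂ) + u * Complex.I - 1‖ ^ (j + 1) ≤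
        j.factorial * (3 + |t|) := by
      calc _ ≤ (j.factorial : ℝ) / 1 := by gcongr; exact one_le_pow₀ e2
        _ ≤ _ := by rw [div_one]; exact le_mul_of_one_le_right (by positivity) (by linarith)
    have e4 : Cs j * (1 + ‖(σ : ℂ) + u * Complex.I‖) ≤ Cs j * (2 * (3 + |t|)) := by
      have := hCs1 j
      gcongr
      linarith
    linarith
  refine ⟨C' * (A * (1 + A ^ 4 / c)) ^ (k + 1), ?_, ?_⟩
  · refine one_le_mul_of_one_le_of_one_le hC'1 (one_le_pow₀
      (one_le_mul_of_one_le_of_one_le hA1 ?_))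
    have : 0 < A ^ 4 / c := by positivity
    linarith
  intro σ h1 h2 t ht
  set τ : ℝ := 3 + |t| with hτ
  have hτ1 : 1 ≤ τ := by linarith
  have hB1 : 1 ≤ A * τ := one_le_mul_of_one_le_of_one_le hA1 hτ1
  have hlow := hc 1 1 t (A * τ) hB1 (fun σ h1 h2 => by
      rw [← one_eq_character_one]
      exact hbd 1 (by omega) σ h1 h2 t t ht le_rfl (by linarith)) (fun σ h1 h2 => by
      rw [one_pow, ← one_eq_character_one]
      have := hbd 0 (by omega) σ h1 h2 t (2 * t) ht (by rw [abs_mul, abs_two]; linarith)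
        (by rw [abs_mul, abs_two])
      rwa [mulLogPow_zero] at this) σ h1 h2
  have hbase : 0 < (A * τ) ^ 4 / c := by positivity
  have := hC' 1 1 (σ + t * Complex.I) (by simpa) (A * τ) (1 + (A * τ) ^ 4 / c) hB1 (by linarith)
    (fun j hj => by
      rw [← one_eq_character_one]
      exact hbd j hj σ h1 h2 t t ht le_rfl (by linarith))
    (le_trans (by
      have e : c / (A * τ) ^ 4 = ((A * τ) ^ 4 / c)⁻¹ := (inv_div _ _).symm
      rw [e]
      exact inv_anti₀ hbase (by linarith)) hlow)
  have e : (fun n : ℕ => (1 : DirichletCharacter ℂ 1) n * (ArithmeticFunction.vonMangoldt n : ℂ)) =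
      fun n => (ArithmeticFunction.vonMangoldt n : ℂ) := by
    funext n
    rw [MulChar.one_apply (isUnit_of_subsingleton _), one_mul]
  rw [e] at this
  refine this.trans ?_
  rw [pow_mul, mul_assoc C', ← mul_pow]
  have h4 : 1 ≤ τ ^ 4 := one_le_pow₀ hτ1
  refine mul_le_mul_of_nonneg_left (pow_le_pow_left₀ (by positivity) ?_ _) (by positivity)
  calc A * τ * (1 + (A * τ) ^ 4 / c) ≤ A * τ * (τ ^ 4 + (A * τ) ^ 4 / c) := by gcongr
    _ = _ := by ring

/-- `Λ - 1` has a Dirichlet series extending analytically to the line `Re s = 1`. -/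
lemma exists_analytic_extension : ∃ (U : Set ℂ) (H : ℂ → ℂ), IsOpen U ∧ {s | 1 ≤ s.re} ⊆ U ∧
    DifferentiableOn ℂ H U ∧ ∀ s : ℂ, 1 < s.re →
      LSeries (fun n => (ArithmeticFunction.vonMangoldt n : ℂ) - 1) s = H s := by
  set Z : ℂ → ℂ := DirichletCharacter.LFunctionTrivChar₁ 1 with hZ
  have hZd : Differentiable ℂ Z := DirichletCharacter.differentiable_LFunctionTrivChar₁ 1
  have hZ1 : Z 1 = 1 := by simp [hZ]
  have hZe : ∀ s, s ≠ 1 → Z s = (s - 1) * riemannZeta s := fun s hs => by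
    rw [hZ, DirichletCharacter.LFunctionTrivChar₁, Function.update_of_ne hs,
      DirichletCharacter.LFunctionTrivChar,
      DirichletCharacter.LFunction_modOne_eq]
  refine ⟨{s | Z s ≠ 0}, fun s => -deriv Z s / Z s - dslope Z 1 s,
    isOpen_ne_fun hZd.continuous continuous_const, fun s hs => ?_, ?_, fun s hs => ?_⟩
  · rcases eq_or_ne s 1 with rfl | h
    · simp [hZ1]
    · simp only [Set.mem_ofPred_eq, hZe s h]
      exact mul_ne_zero (sub_ne_zero.2 h) (riemannZeta_ne_zero_of_one_le_re hs)
  · refine DifferentiableOn.sub (DifferentiableOn.div ?_ hZd.differentiableOn fun s hs => hs) ?_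
    · exact (hZd.contDiff (n := 2).differentiable_deriv_two).neg.differentiableOn
    · exact ((Complex.differentiableOn_dslope (c := 1) Filter.univ_mem).2
        hZd.differentiableOn).mono (Set.subset_univ _)
  · have h1 : s ≠ 1 := by rintro rfl; simp at hs
    have hz : riemannZeta s ≠ 0 := riemannZeta_ne_zero_of_one_le_re hs.le
    have hs1 : s - 1 ≠ 0 := sub_ne_zero.2 h1
    have e1 : LSeries (fun n => (ArithmeticFunction.vonMangoldt n : ℂ) - 1) s =
        -deriv riemannZeta s / riemannZeta s - riemannZeta s := by
      rw [← ArithmeticFunction.LSeries_vonMangoldt_eq_deriv_riemannZeta_div hs,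
        ← LSeries_one_eq_riemannZeta hs]
      exact LSeries_sub (ArithmeticFunction.LSeriesSummable_vonMangoldt hs)
        (LSeriesSummable_one_iff.2 hs)
    have e2 : deriv Z s = (s - 1) * deriv riemannZeta s + riemannZeta s := by
      rw [hZ, DirichletCharacter.deriv_LFunctionTrivChar₁_apply_of_ne_one 1 h1,
        DirichletCharacter.LFunctionTrivChar,
      DirichletCharacter.LFunction_modOne_eq]
    change _ = -deriv Z s / Z s - dslope Z 1 s
    rw [e1, dslope_of_ne _ h1, slope_def_field, hZ1, e2, hZe s h1]
    field_simp
    ring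

lemma LSeriesSummable_vonMangoldt_sub_one {s : ℂ} (hs : 1 < s.re) :
    LSeriesSummable (fun n => (ArithmeticFunction.vonMangoldt n : ℂ) - 1) s :=
  (ArithmeticFunction.LSeriesSummable_vonMangoldt hs).sub (LSeriesSummable_one_iff.2 hs)

lemma abscissaOfAbsConv_vonMangoldt_sub_one_le : LSeries.abscissaOfAbsConv
    (fun n => (ArithmeticFunction.vonMangoldt n : ℂ) - 1) ≤ 1 := by
  refine LSeries.abscissaOfAbsConv_le_of_forall_lt_LSeriesSummable fun y hy => ?_
  exact LSeriesSummable_vonMangoldt_sub_one (by simpa using hy)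

/-- The Dirichlet series of `Λ - 1` and its derivative have polynomial growth for `Re s > 1`. -/
lemma norm_LSeries_vonMangoldt_sub_one_le : ∃ (Q : ℝ) (e : ℕ), 0 ≤ Q ∧ ∀ σ : ℝ, 1 < σ → σ ≤ 2 →
    ∀ k ≤ 1, ∀ t : ℝ,
    ‖LSeries (mulLogPow (fun n => (ArithmeticFunction.vonMangoldt n : ℂ) - 1) k)
      (σ + t * Complex.I)‖ ≤ Q * (3 + |t|) ^ e := by
  obtain ⟨U, H, hU, hsub, hH, hHe⟩ := exists_analytic_extension
  set b : ℕ → ℂ := fun n => (ArithmeticFunction.vonMangoldt n : ℂ) - 1 with hb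
  have hcomp : IsCompact (Set.Icc (1 : ℝ) 2 ×ℂ Set.Icc (-1 : ℝ) 1) :=
    isCompact_Icc.reProdIm isCompact_Icc
  have hKU : Set.Icc (1 : ℝ) 2 ×ℂ Set.Icc (-1 : ℝ) 1 ⊆ U := fun s hs => hsub hs.1.1
  obtain ⟨B0, hB0⟩ := hcomp.exists_bound_of_continuousOn (hH.continuousOn.mono hKU)
  obtain ⟨B1, hB1⟩ := hcomp.exists_bound_of_continuousOn ((hH.deriv hU).continuousOn.mono hKU)
  choose CL hCL1 hCL using norm_LSeries_mulLogPow_vonMangoldt_le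
  choose Cs hCs1 hCs using norm_LSeries_one_mulLogPow_le
  have habs : LSeries.abscissaOfAbsConv (fun n => (ArithmeticFunction.vonMangoldt n : ℂ)) ≤ 1 := by
    refine LSeries.abscissaOfAbsConv_le_of_forall_lt_LSeriesSummable fun y hy => ?_
    exact ArithmeticFunction.LSeriesSummable_vonMangoldt (by simpa using hy)
  have habs1 : LSeries.abscissaOfAbsConv (1 : ℕ → ℂ) ≤ 1 := by
    refine LSeries.abscissaOfAbsConv_le_of_forall_lt_LSeriesSummable fun y hy => ?_
    exact LSeriesSummable_one_iff.2 (by simpa using hy)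
  set D : ℕ → ℝ := fun k => CL k + 2 * Cs k + k.factorial with hD
  have hD1 : ∀ k, 0 ≤ D k := fun k => by
    have := hCL1 k; have := hCs1 k; positivity
  refine ⟨|B0| + |B1| + D 0 + D 1, 10, by have := hD1 0; have := hD1 1; positivity, ?_⟩
  intro σ h1 h2 k hk t
  have hre : 1 < ((σ : ℂ) + t * Complex.I).re := by simpa
  have hT : 1 ≤ (3 + |t|) ^ 10 := one_le_pow₀ (by have := abs_nonneg t; linarith)
  have h0 := hD1 0
  have h0' := hD1 1
  rcases le_total |t| 1 with ht | ht
  · have hmem : (σ : ℂ) + t * Complex.I ∈ Set.Icc (1 : ℝ) 2 ×ℂ Set.Icc (-1 : ℝ) 1 := by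
      rw [Complex.mem_reProdIm]
      simpa using ⟨⟨h1.le, h2⟩, abs_le.1 ht⟩
    have key : ‖LSeries (mulLogPow b k) (σ + t * Complex.I)‖ ≤ |B0| + |B1| := by
      interval_cases k
      · rw [mulLogPow_zero, hHe _ hre]
        exact (hB0 _ hmem).trans ((le_abs_self _).trans (by linarith [abs_nonneg B1]))
      · have hd := hasDerivAt_LSeries_mulLogPow abscissaOfAbsConv_vonMangoldt_sub_one_le 0 hre
        rw [mulLogPow_zero] at hd
        have he : LSeries b =ᶠ[nhds ((σ : ℂ) + t * Complex.I)] H := by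
          filter_upwards [(isOpen_lt continuous_const Complex.continuous_re).mem_nhds hre] with s hs
          exact hHe s hs
        have := he.deriv_eq
        rw [hd.deriv] at this
        rw [← norm_neg, this]
        exact (hB1 _ hmem).trans ((le_abs_self _).trans (by linarith [abs_nonneg B0]))
    refine key.trans ?_
    calc _ ≤ (|B0| + |B1| + D 0 + D 1) * 1 := by linarith
      _ ≤ _ := by gcongr
  · have esub : LSeries (mulLogPow b k) (σ + t * Complex.I) =
        LSeries (mulLogPow (fun n => (ArithmeticFunction.vonMangoldt n : ℂ)) k) (σ + t * Complex.I) -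
        LSeries (mulLogPow 1 k) (σ + t * Complex.I) := by
      rw [← LSeries_sub (LSeriesSummable_mulLogPow habs k hre)
        (LSeriesSummable_mulLogPow habs1 k hre)]
      congr 1
      funext n
      simp [hb, mulLogPow, sub_mul]
    have hT1 : 1 ≤ 3 + |t| := by linarith
    have hT2 : 3 + |t| ≤ (3 + |t|) ^ 10 := le_self_pow₀ hT1 (by norm_num)
    have e2 : 1 ≤ ‖(σ : ℂ) + t * Complex.I - 1‖ := by
      have := Complex.abs_im_le_norm ((σ : ℂ) + t * Complex.I - 1)
      simp at this
      linarith
    have e1 := norm_ofReal_add_mul_I_le h1 h2 (t := t)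
    have b1 : ‖LSeries (mulLogPow (fun n => (ArithmeticFunction.vonMangoldt n : ℂ)) k)
        (σ + t * Complex.I)‖ ≤ CL k * (3 + |t|) ^ 10 := by
      refine (hCL k σ h1 h2 t ht).trans ?_
      have := hCL1 k
      exact mul_le_mul_of_nonneg_left (pow_le_pow_right₀ hT1 (by omega)) (by linarith)
    have b2 : ‖LSeries (mulLogPow 1 k) (σ + t * Complex.I)‖ ≤
        (2 * Cs k + k.factorial) * (3 + |t|) ^ 10 := by
      refine (hCs k _ hre).trans ?_
      have hc := hCs1 k
      have p1 : Cs k * (1 + ‖(σ : ℂ) + t * Complex.I‖) ≤ Cs k * (2 * (3 + |t|) ^ 10) := by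
        gcongr
        linarith
      have p2 : (k.factorial : ℝ) / ‖(σ : ℂ) + t * Complex.I - 1‖ ^ (k + 1) ≤
          k.factorial * (3 + |t|) ^ 10 := by
        calc _ ≤ (k.factorial : ℝ) / 1 := by gcongr; exact one_le_pow₀ e2
          _ ≤ _ := by rw [div_one]; exact le_mul_of_one_le_right (by positivity) hT
      linarith
    have hDk : D k ≤ |B0| + |B1| + D 0 + D 1 := by
      have := abs_nonneg B0
      have := abs_nonneg B1
      interval_cases k <;> linarith
    rw [esub]
    calc _ ≤ CL k * (3 + |t|) ^ 10 + (2 * Cs k + k.factorial) * (3 + |t|) ^ 10 :=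
          (norm_sub_le _ _).trans (add_le_add b1 b2)
      _ = D k * (3 + |t|) ^ 10 := by rw [hD]; ring
      _ ≤ _ := by gcongr

/-- Riemann sums: `∑ g(log n - X) / n` tends to `∫ g`. -/
lemma tendsto_sum_div_mul_comp_log {g : ℝ → ℂ} (hg : ContDiff ℝ (⊤ : ℕ∞) g)
    (hc : HasCompactSupport g) {ε : ℝ} (hε : 0 < ε) : ∀ᶠ X : ℝ in Filter.atTop, ∀ N : ℕ,
    (∀ n : ℕ, N ≤ n → g (Real.log n - X) = 0) →
    ‖∑ n ∈ range N, 1 / (n : ℂ) * g (Real.log n - X) - ∫ u, g u‖ ≤ ε := by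
  have hgd : Differentiable ℝ g := hg.differentiable (by simp)
  have hg' : Continuous (deriv g) := hg.continuous_deriv (by simp)
  obtain ⟨C0, hC0⟩ := hc.exists_bound_of_continuous hg.continuous
  obtain ⟨C1, hC1⟩ := hc.deriv.exists_bound_of_continuous hg'
  obtain ⟨R, hR⟩ := hc.isCompact.isBounded.subset_closedBall 0
  have hsupp : ∀ u, R < |u| → g u = 0 := fun u hu => by
    by_contra h
    have := hR (subset_tsupport g h)
    simp at this
    linarith
  set C : ℝ := C0 + C1 with hC
  have hC0' : 0 ≤ C0 := (norm_nonneg _).trans (hC0 0)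
  have hC1' : 0 ≤ C1 := (norm_nonneg _).trans (hC1 0)
  set S : ℝ := ∑' n : ℕ, 1 / (n : ℝ) ^ (3 / 2 : ℝ) with hS
  have hSs : Summable fun n : ℕ => 1 / (n : ℝ) ^ (3 / 2 : ℝ) :=
    Real.summable_one_div_nat_rpow.2 (by norm_num)
  have hS0 : 0 ≤ S := tsum_nonneg fun n => by positivity
  have hlim : Filter.Tendsto (fun X : ℝ => C * S * (Real.exp (X - |R|) / 2) ^ (-(1 / 2) : ℝ))
      Filter.atTop (nhds 0) := by
    rw [show (0 : ℝ) = C * S * 0 by ring]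
    refine ((tendsto_rpow_neg_atTop (by norm_num : (0 : ℝ) < 1 / 2)).comp
      (Filter.Tendsto.atTop_div_const (by norm_num) (Real.tendsto_exp_atTop.comp
        (Filter.tendsto_atTop_add_const_right _ _ Filter.tendsto_id)))).const_mul _
  filter_upwards [hlim.eventually (ge_mem_nhds hε), Filter.eventually_gt_atTop (|R| + 1)]
    with X hX hXR N hN
  have hX0 : 0 < X := by linarith [abs_nonneg R]
  set f : ℝ → ℂ := fun u => (1 / u : ℝ) • g (Real.log u - X) with hf
  set F : ℝ → ℂ := fun u => ∫ v in (-X)..(Real.log u - X), g v with hF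
  have hlog : ∀ u : ℝ, 0 < u → HasDerivAt (fun u => Real.log u - X) (1 / u) u := fun u hu => by
    simpa using (Real.hasDerivAt_log hu.ne').sub_const X
  have hFd : ∀ u : ℝ, 0 < u → HasDerivAt F (f u) u := fun u hu =>
    HasDerivAt.scomp u (intervalIntegral.integral_hasDerivAt_right
      (hg.continuous.intervalIntegrable _ _) (hg.continuous.stronglyMeasurableAtFilter _ _)
      hg.continuous.continuousAt) (hlog u hu)
  have hfd : ∀ u : ℝ, 0 < u → HasDerivAt f ((1 / u : ℝ) • ((1 / u : ℝ) • deriv g (Real.log u - X))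
      + (-(1 / u ^ 2) : ℝ) • g (Real.log u - X)) u := fun u hu => by
    have h1 : HasDerivAt (fun u : ℝ => 1 / u) (-(1 / u ^ 2)) u := by
      simpa using hasDerivAt_inv hu.ne'
    have h2 : HasDerivAt (fun u => g (Real.log u - X)) ((1 / u : ℝ) • deriv g (Real.log u - X)) u :=
      HasDerivAt.scomp u (hgd _).hasDerivAt (hlog u hu)
    exact h1.smul h2
  have hfb : ∀ n : ℕ, 1 ≤ n → ∀ u ∈ Set.Icc (n : ℝ) (n + 1), ‖f u - f n‖ ≤ C / (n : ℝ) ^ 2 := by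
    intro n hn u hu
    have hn0 : (0 : ℝ) < n := by exact_mod_cast hn
    have := (convex_Icc (n : ℝ) (n + 1)).norm_image_sub_le_of_norm_hasDerivWithin_le
      (f := f) (C := C / (n : ℝ) ^ 2)
      (fun v hv => (hfd v (hn0.trans_le hv.1)).hasDerivWithinAt) (fun v hv => ?_)
      (Set.left_mem_Icc.2 (by linarith)) hu
    · refine this.trans (mul_le_of_le_one_right (by positivity) ?_)
      rw [Real.norm_eq_abs, abs_of_nonneg (by linarith [hu.1])]
      linarith [hu.2]
    · have hv0 : 0 < v := hn0.trans_le hv.1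
      refine (norm_add_le _ _).trans ?_
      rw [norm_smul, norm_smul, norm_smul, Real.norm_eq_abs, Real.norm_eq_abs, abs_neg,
        abs_of_pos (by positivity), abs_of_pos (by positivity)]
      calc _ = (‖g (Real.log v - X)‖ + ‖deriv g (Real.log v - X)‖) / v ^ 2 := by
            field_simp; ring
        _ ≤ C / (n : ℝ) ^ 2 := by
          gcongr
          · exact add_le_add (hC0 _) (hC1 _)
          · exact hv.1
  have hFb : ∀ n : ℕ, 1 ≤ n → ‖F ((n + 1 : ℕ) : ℝ) - F n - f n‖ ≤ C / (n : ℝ) ^ 2 := by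
    intro n hn
    have hn0 : (0 : ℝ) < n := by exact_mod_cast hn
    have := (convex_Icc (n : ℝ) (n + 1)).norm_image_sub_le_of_norm_hasDerivWithin_le
      (f := fun u => F u - u • f n) (C := C / (n : ℝ) ^ 2) (f' := fun u => f u - f n)
      (fun v hv => ?_) (fun v hv => hfb n hn v hv)
      (Set.left_mem_Icc.2 (by linarith)) (Set.right_mem_Icc.2 (by linarith))
    · push_cast
      calc _ = ‖F (n + 1) - ((n : ℝ) + 1) • f n - (F n - (n : ℝ) • f n)‖ := by
            congr 1; rw [add_smul, one_smul]; ring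
        _ ≤ _ := this
        _ = _ := by simp
    · have h3 : HasDerivAt (fun u : ℝ => u • f n) ((1 : ℝ) • f n) v :=
        (hasDerivAt_id v).smul_const (f n)
      rw [one_smul] at h3
      exact ((hFd v (hn0.trans_le hv.1)).sub h3).hasDerivWithinAt
  have hfz : ∀ u : ℝ, 0 < u → u < Real.exp (X - |R|) → f u = 0 := fun u hu hu2 => by
    rw [hf]
    have : Real.log u < X - |R| := (Real.log_lt_iff_lt_exp hu).2 hu2
    simp only
    rw [hsupp, smul_zero]
    rw [abs_of_neg (by linarith [abs_nonneg R])]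
    linarith [le_abs_self R]
  have hFz : ∀ u : ℝ, 0 < u → u < Real.exp (X - |R|) → F u = 0 := fun u hu hu2 => by
    rw [hF]
    have : Real.log u < X - |R| := (Real.log_lt_iff_lt_exp hu).2 hu2
    refine intervalIntegral.integral_zero_ae (Filter.Eventually.of_forall fun v hv => hsupp v ?_)
    rcases Set.mem_uIoc.1 hv with h | h
    · rw [abs_of_neg (by linarith [abs_nonneg R])]
      linarith [le_abs_self R]
    · rw [abs_of_neg (by linarith [abs_nonneg R])]
      linarith [le_abs_self R]
  have hterm : ∀ n : ℕ, 1 ≤ n → ‖F ((n + 1 : ℕ) : ℝ) - F n - f n‖ ≤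
      C * (Real.exp (X - |R|) / 2) ^ (-(1 / 2) : ℝ) * (1 / (n : ℝ) ^ (3 / 2 : ℝ)) := by
    intro n hn
    have hn1 : (1 : ℝ) ≤ n := by exact_mod_cast hn
    have hn0 : (0 : ℝ) < n := by linarith
    rcases lt_or_ge ((n : ℝ) + 1) (Real.exp (X - |R|)) with h | h
    · rw [hFz _ (by positivity) (by push_cast; exact h), hFz _ hn0 (by linarith),
        hfz _ hn0 (by linarith)]
      simp only [sub_zero, norm_zero]
      positivity
    · refine (hFb n hn).trans ?_
      have e : C / (n : ℝ) ^ 2 = C * (n : ℝ) ^ (-(1 / 2) : ℝ) * (1 / (n : ℝ) ^ (3 / 2 : ℝ)) := by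
        rw [Real.rpow_neg hn0.le, mul_one_div, ← div_eq_mul_inv, div_div, ← Real.rpow_add hn0]
        norm_num
      rw [e]
      gcongr ?_ * ?_ * ?_
      refine Real.rpow_le_rpow_of_nonpos (by positivity) (by linarith) (by norm_num)
  obtain ⟨M, hM⟩ := exists_nat_gt (Real.exp (X + |R|))
  set N' := max (max N M) 1 with hN'
  have hext : ∑ n ∈ range N, 1 / (n : ℂ) * g (Real.log n - X) =
      ∑ n ∈ range N', 1 / (n : ℂ) * g (Real.log n - X) := by
    refine sum_subset (range_mono (by omega)) fun n _ hn => ?_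
    rw [hN n (by simpa using hn), mul_zero]
  have hN'M : Real.exp (X + |R|) < N' := hM.trans_le (by exact_mod_cast by omega)
  have hFN : F N' = ∫ u, g u := by
    rw [hF]
    have hlogN : X + |R| < Real.log N' := by
      rwa [Real.lt_log_iff_exp_lt (by exact_mod_cast (by omega : 0 < N'))]
    refine intervalIntegral.integral_eq_integral_of_support_subset fun u hu => ?_
    have : |u| ≤ R := by
      by_contra h
      exact hu (hsupp u (by linarith))
    have h2 := abs_le.1 (this.trans (le_abs_self R))
    constructor <;> linarith
  have htel : ∑ n ∈ Ico 1 N', (F ((n + 1 : ℕ) : ℝ) - F n) = ∫ u, g u := by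
    rw [sum_Ico_sub (fun n : ℕ => F n) (by omega), hFN, Nat.cast_one,
      hFz 1 one_pos (by rw [Real.one_lt_exp_iff]; linarith), sub_zero]
  have hzero : ∑ n ∈ range N', 1 / (n : ℂ) * g (Real.log n - X) = ∑ n ∈ Ico 1 N', f n := by
    rw [range_eq_Ico, sum_eq_sum_Ico_succ_bot (by omega)]
    simp [hf]
  rw [hext, hzero, ← htel, ← sum_sub_distrib, ← norm_neg, ← sum_neg_distrib]
  calc _ ≤ ∑ n ∈ Ico 1 N', C * (Real.exp (X - |R|) / 2) ^ (-(1 / 2) : ℝ) *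
        (1 / (n : ℝ) ^ (3 / 2 : ℝ)) := by
        refine norm_sum_le_of_le _ fun n hn => ?_
        rw [neg_sub]
        exact hterm n (mem_Ico.1 hn).1
    _ ≤ C * (Real.exp (X - |R|) / 2) ^ (-(1 / 2) : ℝ) * S := by
        rw [← mul_sum]
        refine mul_le_mul_of_nonneg_left (hSs.sum_le_tsum _ fun n _ => by positivity)
          (by positivity)
    _ ≤ ε := by linarith

/-- The smoothed prime number theorem. -/
theorem eventually_norm_sum_vonMangoldt_sub_integral_le {g : ℝ → ℂ} (hg : ContDiff ℝ (⊤ : ℕ∞) g)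
    (hc : HasCompactSupport g) {ε : ℝ} (hε : 0 < ε) : ∀ᶠ X : ℝ in Filter.atTop, ∀ N : ℕ,
    (∀ n : ℕ, N ≤ n → g (Real.log n - X) = 0) →
    ‖∑ n ∈ range N, (ArithmeticFunction.vonMangoldt n : ℂ) / n * g (Real.log n - X) -
      ∫ u, g u‖ ≤ ε := by
  obtain ⟨Q, e, hQ, hbd⟩ := norm_LSeries_vonMangoldt_sub_one_le
  obtain ⟨C, hC, h⟩ := norm_sum_div_mul_le_rpow e 1 hg hc
  have hlim : Filter.Tendsto (fun X : ℝ => C * Q / X ^ 1) Filter.atTop (nhds 0) := by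
    simpa using tendsto_const_nhds.div_atTop Filter.tendsto_id
  filter_upwards [tendsto_sum_div_mul_comp_log hg hc (half_pos hε),
    hlim.eventually (ge_mem_nhds (half_pos hε)), Filter.eventually_gt_atTop 0] with X h1 h2 hX N hN
  have h3 := h (fun n => (ArithmeticFunction.vonMangoldt n : ℂ) - 1) X Q hQ hX
    (fun σ hσ _ k hk => LSeriesSummable_mulLogPow abscissaOfAbsConv_vonMangoldt_sub_one_le k
      (by simpa using hσ))
    hbd N hN
  have h4 := h1 N hN
  calc _ = ‖∑ n ∈ range N, ((ArithmeticFunction.vonMangoldt n : ℂ) - 1) / n * g (Real.log n - X) +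
        (∑ n ∈ range N, 1 / (n : ℂ) * g (Real.log n - X) - ∫ u, g u)‖ := by
        rw [← add_sub_assoc, ← sum_add_distrib]
        congr 3
        funext n
        ring
    _ ≤ ε / 2 + ε / 2 := (norm_add_le _ _).trans (add_le_add (h3.trans h2) h4)
    _ = ε := by ring

/-! ### The large sieve inequality -/

/-- The Sobolev-type inequality of Gallagher. -/
lemma norm_le_integral_add_integral_deriv {F F' : ℝ → ℂ} (hF : ∀ u, HasDerivAt F (F' u) u)
    (hF' : Continuous F') {δ : ℝ} (hδ : 0 < δ) (α : ℝ) :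
    ‖F α‖ ≤ ∫ u in Set.Ioc (α - δ / 2) (α + δ / 2), (δ⁻¹ * ‖F u‖ + ‖F' u‖) := by
  have hFc : Continuous F := continuous_iff_continuousAt.2 fun u => (hF u).continuousAt
  have h_integ : ∀ a b, IntervalIntegrable (fun u => ‖F' u‖) MeasureTheory.volume a b :=
    fun a b => hF'.norm.intervalIntegrable _ _
  have hpt : ∀ u ∈ Set.Icc (α - δ / 2) (α + δ / 2),
      ‖F α‖ ≤ ‖F u‖ + ∫ v in (α - δ / 2)..(α + δ / 2), ‖F' v‖ := by
    intro u hu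
    have e : F α = F u - ∫ v in α..u, F' v := by
      rw [intervalIntegral.integral_eq_sub_of_hasDerivAt (fun v _ => hF v)
        (hF'.intervalIntegrable _ _)]
      ring
    rw [e]
    refine (norm_sub_le _ _).trans (add_le_add_right ?_ _)
    refine (intervalIntegral.norm_integral_le_abs_integral_norm).trans ?_
    rw [abs_le]
    rcases le_total α u with h | h
    · refine ⟨?_, intervalIntegral.integral_mono_interval (by linarith) h hu.2
        (Filter.Eventually.of_forall fun _ => norm_nonneg _) (h_integ _ _)⟩
      have h1 : 0 ≤ ∫ v in α..u, ‖F' v‖ := intervalIntegral.integral_nonneg h fun _ _ => norm_nonneg _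
      have h2 : 0 ≤ ∫ v in (α - δ / 2)..(α + δ / 2), ‖F' v‖ :=
        intervalIntegral.integral_nonneg (by linarith) fun _ _ => norm_nonneg _
      linarith
    · have h1 : 0 ≤ ∫ v in u..α, ‖F' v‖ := intervalIntegral.integral_nonneg h fun _ _ => norm_nonneg _
      have h2 : ∫ v in u..α, ‖F' v‖ ≤ ∫ v in (α - δ / 2)..(α + δ / 2), ‖F' v‖ :=
        intervalIntegral.integral_mono_interval hu.1 h (by linarith)
        (Filter.Eventually.of_forall fun _ => norm_nonneg _) (h_integ _ _)
      rw [intervalIntegral.integral_symm u α]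
      constructor <;> linarith
  have hcont : Continuous fun u => ‖F u‖ + ∫ v in (α - δ / 2)..(α + δ / 2), ‖F' v‖ :=
    hFc.norm.add continuous_const
  have hmono := intervalIntegral.integral_mono_on (μ := MeasureTheory.volume)
    (by linarith : α - δ / 2 ≤ α + δ / 2) (continuous_const.intervalIntegrable _ _)
    (hcont.intervalIntegrable _ _) hpt
  rw [intervalIntegral.integral_const, intervalIntegral.integral_add
    (hFc.norm.intervalIntegrable _ _) (continuous_const.intervalIntegrable _ _),
    intervalIntegral.integral_const, smul_eq_mul, smul_eq_mul,
    show α + δ / 2 - (α - δ / 2) = δ by ring] at hmono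
  have hcont2 : Continuous fun u => δ⁻¹ * ‖F u‖ := by fun_prop
  rw [← intervalIntegral.integral_of_le (by linarith), intervalIntegral.integral_add
    (hcont2.intervalIntegrable _ _) (h_integ _ _),
    intervalIntegral.integral_const_mul]
  have := mul_le_mul_of_nonneg_left hmono (inv_nonneg.2 hδ.le)
  rw [mul_add, ← mul_assoc, ← mul_assoc, inv_mul_cancel₀ hδ.ne', one_mul, one_mul] at this
  exact this

/-- The trigonometric polynomial with coefficients `a`. -/
noncomputable def trigPoly (N : ℕ) (a : ℕ → ℂ) (α : ℝ) : ℂ :=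
  ∑ n ∈ range N, a n * Complex.exp (2 * Real.pi * Complex.I * n * α)

lemma hasDerivAt_trigPoly (N : ℕ) (a : ℕ → ℂ) (α : ℝ) : HasDerivAt (trigPoly N a)
    (trigPoly N (fun n => 2 * Real.pi * Complex.I * n * a n) α) α := by
  unfold trigPoly
  refine HasDerivAt.fun_sum fun n _ => ?_
  have h : HasDerivAt (fun α : ℝ => 2 * Real.pi * Complex.I * n * (α : ℂ))
      (2 * Real.pi * Complex.I * n * 1) α := (Complex.ofRealCLM.hasDerivAt (x := α)).const_mul _
  have h2 := (h.cexp).const_mul (a n)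
  rw [mul_one] at h2
  have e : 2 * Real.pi * Complex.I * n * a n * Complex.exp (2 * Real.pi * Complex.I * n * α) =
      a n * (Complex.exp (2 * Real.pi * Complex.I * n * α) * (2 * Real.pi * Complex.I * n)) := by
    ring
  exact e ▸ h2

lemma continuous_trigPoly (N : ℕ) (a : ℕ → ℂ) : Continuous (trigPoly N a) :=
  continuous_iff_continuousAt.2 fun u => (hasDerivAt_trigPoly N a u).continuousAt

lemma integral_norm_sq_trigPoly (N : ℕ) (a : ℕ → ℂ) :
    ∫ α in (-1 : ℝ)..2, ‖trigPoly N a α‖ ^ 2 = 3 * ∑ n ∈ range N, ‖a n‖ ^ 2 := by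
  have h1 : ∀ α : ℝ, ((‖trigPoly N a α‖ ^ 2 : ℝ) : ℂ) = ∑ n ∈ range N, ∑ m ∈ range N,
      a n * (starRingEnd ℂ) (a m) *
        Complex.exp (((2 * Real.pi * Complex.I) * ((n : ℂ) - m)) * α) := by
    intro α
    have : (starRingEnd ℂ) (trigPoly N a α) = ∑ m ∈ range N,
        (starRingEnd ℂ) (a m) * Complex.exp (-(2 * Real.pi * Complex.I * m * α)) := by
      rw [trigPoly, map_sum]
      refine sum_congr rfl fun m _ => ?_
      rw [map_mul, ← Complex.exp_conj]
      congr 2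
      simp [Complex.conj_ofReal, Complex.conj_ofNat]
    rw [Complex.ofReal_pow, ← Complex.mul_conj', this, trigPoly, sum_mul_sum]
    refine sum_congr rfl fun n _ => sum_congr rfl fun m _ => ?_
    rw [mul_mul_mul_comm, ← Complex.exp_add]
    congr 2
    ring
  have h2 : ((∫ α in (-1 : ℝ)..2, ‖trigPoly N a α‖ ^ 2 : ℝ) : ℂ) =
      ((3 * ∑ n ∈ range N, ‖a n‖ ^ 2 : ℝ) : ℂ) := by
    rw [← intervalIntegral.integral_ofReal]
    simp_rw [h1]
    rw [intervalIntegral.integral_finsetSum fun n _ => Continuous.intervalIntegrable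
      (by fun_prop) _ _]
    push_cast
    rw [mul_sum]
    refine sum_congr rfl fun n hn => ?_
    rw [intervalIntegral.integral_finsetSum fun m _ => Continuous.intervalIntegrable
      (by fun_prop) _ _, sum_eq_single n]
    · simp [Complex.mul_conj', mul_comm]
      norm_num
    · intro m _ hmn
      rw [intervalIntegral.integral_const_mul]
      have hne : (2 * Real.pi * Complex.I) * ((n : ℂ) - m) ≠ 0 :=
        mul_ne_zero Complex.two_pi_I_ne_zero (sub_ne_zero.2 (by exact_mod_cast hmn.symm))
      rw [integral_exp_mul_complex hne]
      have e : ∀ k : ℤ, Complex.exp ((2 * Real.pi * Complex.I) * ((n : ℂ) - m) * ((k : ℝ) : ℂ)) = 1 :=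
        fun k => by
          rw [Complex.exp_eq_one_iff]
          exact ⟨((n : ℤ) - m) * k, by push_cast; ring⟩
      have e1 := e (-1)
      have e2 := e 2
      push_cast at e1 e2 ⊢
      rw [e1, e2]
      simp
    · intro h; exact absurd hn h
  exact_mod_cast h2

/-- The additive large sieve inequality. -/
lemma sum_norm_sq_trigPoly_le {ι : Type*} (I : Finset ι) (α : ι → ℝ) {δ : ℝ} (hδ : 0 < δ)
    (hδ1 : δ ≤ 1) (h01 : ∀ i ∈ I, α i ∈ Set.Icc (0 : ℝ) 1)
    (hsep : ∀ i ∈ I, ∀ j ∈ I, i ≠ j → δ ≤ |α i - α j|) (N : ℕ) (a : ℕ → ℂ) :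
    ∑ i ∈ I, ‖trigPoly N a (α i)‖ ^ 2 ≤ 150 * (N + δ⁻¹) * ∑ n ∈ range N, ‖a n‖ ^ 2 := by
  rcases Nat.eq_zero_or_pos N with rfl | hN
  · simp [trigPoly]
  have hN0 : (0 : ℝ) < N := by exact_mod_cast hN
  set S := trigPoly N a with hS
  set S' := trigPoly N (fun n => 2 * Real.pi * Complex.I * n * a n) with hS'
  have hSc : Continuous S := continuous_trigPoly _ _
  have hSc' : Continuous S' := continuous_trigPoly _ _
  have hd : ∀ u, HasDerivAt (fun u => S u ^ 2) (2 * S u * S' u) u := fun u => by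
    have := (hasDerivAt_trigPoly N a u).fun_pow 2
    simp only [Nat.cast_ofNat, Nat.add_one_sub_one, pow_one] at this
    exact this
  set w : ℝ → ℝ := fun u => (δ⁻¹ + N) * ‖S u‖ ^ 2 + (N : ℝ)⁻¹ * ‖S' u‖ ^ 2 with hw
  have hwc : Continuous w := by fun_prop
  have hw0 : ∀ u, 0 ≤ w u := fun u => by positivity
  have hpt : ∀ i ∈ I, ‖S (α i)‖ ^ 2 ≤
      ∫ u in Set.Ioc (α i - δ / 2) (α i + δ / 2), w u := by
    intro i _
    rw [← norm_pow]
    refine (norm_le_integral_add_integral_deriv hd (by fun_prop) hδ (α i)).trans ?_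
    refine MeasureTheory.setIntegral_mono (Continuous.integrableOn_Ioc (by fun_prop))
      hwc.integrableOn_Ioc fun u => ?_
    simp only [hw, norm_mul, norm_pow, Complex.norm_ofNat]
    have : 2 * ‖S u‖ * ‖S' u‖ ≤ N * ‖S u‖ ^ 2 + (N : ℝ)⁻¹ * ‖S' u‖ ^ 2 := by
      have h := sq_nonneg (N * ‖S u‖ - ‖S' u‖)
      have : N * ‖S u‖ ^ 2 + (N : ℝ)⁻¹ * ‖S' u‖ ^ 2 - 2 * ‖S u‖ * ‖S' u‖ =
          (N : ℝ)⁻¹ * (N * ‖S u‖ - ‖S' u‖) ^ 2 := by field_simp; ring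
      have h2 : 0 ≤ (N : ℝ)⁻¹ * (N * ‖S u‖ - ‖S' u‖) ^ 2 := by positivity
      linarith
    linarith
  have hdisj : (I : Set ι).Pairwise
      (Function.onFun Disjoint fun i => Set.Ioc (α i - δ / 2) (α i + δ / 2)) := by
    intro i hi j hj hij
    rw [Function.onFun, Set.disjoint_left]
    intro u hu hu'
    have h1 := hsep i hi j hj hij
    rcases le_abs.1 h1 with h | h <;> linarith [hu.1, hu.2, hu'.1, hu'.2]
  have hsub : (⋃ i ∈ I, Set.Ioc (α i - δ / 2) (α i + δ / 2)) ⊆ Set.Ioc (-1) 2 := by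
    refine Set.iUnion₂_subset fun i hi u hu => ?_
    have := h01 i hi
    constructor <;> linarith [hu.1, hu.2, this.1, this.2]
  calc ∑ i ∈ I, ‖S (α i)‖ ^ 2 ≤ ∑ i ∈ I, ∫ u in Set.Ioc (α i - δ / 2) (α i + δ / 2), w u :=
        sum_le_sum hpt
    _ = ∫ u in ⋃ i ∈ I, Set.Ioc (α i - δ / 2) (α i + δ / 2), w u :=
        (MeasureTheory.integral_biUnion_finset I (fun i _ => measurableSet_Ioc) hdisj
          fun i _ => hwc.integrableOn_Ioc).symm
    _ ≤ ∫ u in Set.Ioc (-1) 2, w u :=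
        MeasureTheory.setIntegral_mono_set hwc.integrableOn_Ioc
          (Filter.Eventually.of_forall hw0) (Filter.Eventually.of_forall hsub)
    _ = (δ⁻¹ + N) * (3 * ∑ n ∈ range N, ‖a n‖ ^ 2) + (N : ℝ)⁻¹ *
        (3 * ∑ n ∈ range N, ‖2 * Real.pi * Complex.I * n * a n‖ ^ 2) := by
        rw [← intervalIntegral.integral_of_le (by norm_num), hw, intervalIntegral.integral_add
          (Continuous.intervalIntegrable (by fun_prop) _ _)
          (Continuous.intervalIntegrable (by fun_prop) _ _), intervalIntegral.integral_const_mul,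
          intervalIntegral.integral_const_mul, hS, hS', integral_norm_sq_trigPoly,
          integral_norm_sq_trigPoly]
    _ ≤ (δ⁻¹ + N) * (3 * ∑ n ∈ range N, ‖a n‖ ^ 2) + (N : ℝ)⁻¹ *
        (3 * (41 * N ^ 2 * ∑ n ∈ range N, ‖a n‖ ^ 2)) := by
        gcongr
        rw [mul_sum]
        refine sum_le_sum fun n hn => ?_
        have hnN : (n : ℝ) ≤ N := by exact_mod_cast (mem_range.1 hn).le
        simp only [norm_mul, Complex.norm_ofNat, Complex.norm_real, Complex.norm_I, mul_pow,
          Complex.norm_natCast, Real.norm_eq_abs, sq_abs]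
        have hpi : Real.pi ^ 2 ≤ 10.25 := by
          have := Real.pi_lt_d2
          have := Real.pi_pos
          nlinarith
        have hn2 : (n : ℝ) ^ 2 ≤ (N : ℝ) ^ 2 := by gcongr
        calc _ = 4 * (Real.pi ^ 2 * (n : ℝ) ^ 2) * ‖a n‖ ^ 2 := by ring
          _ ≤ 4 * (10.25 * (N : ℝ) ^ 2) * ‖a n‖ ^ 2 := by gcongr
          _ = _ := by ring
    _ = (3 * δ⁻¹ + 126 * N) * ∑ n ∈ range N, ‖a n‖ ^ 2 := by field_simp; ring
    _ ≤ _ := by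
        gcongr
        have := inv_pos.2 hδ
        linarith

/-- Distinct reduced fractions with denominators at most `Q` are `Q⁻²`-separated. -/
lemma inv_sq_le_abs_div_sub_div {Q q r b c : ℕ} (hq : 0 < q) (hr : 0 < r) (hqQ : q ≤ Q)
    (hrQ : r ≤ Q) (hb : b.Coprime q) (hc : c.Coprime r) (hne : (q, b) ≠ (r, c)) :
    ((Q : ℝ) ^ 2)⁻¹ ≤ |(b : ℝ) / q - c / r| := by
  have hq0 : (0 : ℝ) < q := by exact_mod_cast hq
  have hr0 : (0 : ℝ) < r := by exact_mod_cast hr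
  have hz : (b : ℤ) * r - q * c ≠ 0 := by
    intro h
    have h2 : b * r = q * c := by zify; linarith
    have d1 : q ∣ r := (Nat.Coprime.symm hb).dvd_of_dvd_mul_left ⟨c, h2⟩
    have d2 : r ∣ q := (Nat.Coprime.symm hc).dvd_of_dvd_mul_right ⟨b, by linarith⟩
    have hqr := Nat.dvd_antisymm d1 d2
    subst hqr
    exact hne (by rw [Nat.eq_of_mul_eq_mul_left hq (by linarith : q * b = q * c)])
  have h1 : (1 : ℝ) ≤ |(b : ℝ) * r - q * c| := by
    have : (1 : ℤ) ≤ |(b : ℤ) * r - q * c| := Int.one_le_abs hz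
    exact_mod_cast this
  rw [div_sub_div _ _ hq0.ne' hr0.ne', abs_div, abs_of_pos (mul_pos hq0 hr0)]
  calc ((Q : ℝ) ^ 2)⁻¹ ≤ 1 / ((q : ℝ) * r) := by
        rw [inv_eq_one_div, sq]
        gcongr
    _ ≤ _ := by gcongr

/-- The large sieve inequality for Farey fractions. -/
lemma sum_farey_norm_sq_trigPoly_le (Q N : ℕ) (hQ : 1 ≤ Q) (a : ℕ → ℂ) :
    ∑ q ∈ Icc 1 Q, ∑ b ∈ (range q).filter (fun b => b.Coprime q),
      ‖trigPoly N a ((b : ℝ) / q)‖ ^ 2 ≤ 150 * (N + Q ^ 2) * ∑ n ∈ range N, ‖a n‖ ^ 2 := by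
  rw [sum_sigma']
  have hQ1 : (1 : ℝ) ≤ Q := by exact_mod_cast hQ
  have := sum_norm_sq_trigPoly_le
    ((Icc 1 Q).sigma fun q => (range q).filter (fun b => b.Coprime q))
    (fun x => (x.2 : ℝ) / x.1) (δ := ((Q : ℝ) ^ 2)⁻¹) (by positivity)
    (inv_le_one_of_one_le₀ (one_le_pow₀ hQ1)) ?_ ?_ N a
  · simpa using this
  · rintro ⟨q, b⟩ h
    simp only [mem_sigma, mem_Icc, mem_filter, mem_range] at h
    refine ⟨by positivity, div_le_one_of_le₀ (by exact_mod_cast h.2.1.le) (by positivity)⟩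
  · rintro ⟨q, b⟩ h ⟨r, c⟩ h' hne
    simp only [mem_sigma, mem_Icc, mem_filter, mem_range] at h h'
    refine inv_sq_le_abs_div_sub_div h.1.1 h'.1.1 h.1.2 h'.1.2 h.2.2 h'.2.2 fun he => hne ?_
    rw [Prod.mk.injEq] at he
    obtain ⟨rfl, rfl⟩ := he
    rfl

/-- The Gauss sum of a primitive character has absolute value `√q`. -/
lemma norm_sq_gaussSum_of_isPrimitive {q : ℕ} [NeZero q] {χ : DirichletCharacter ℂ q}
    (hχ : χ.IsPrimitive) : ‖gaussSum χ (ZMod.stdAddChar (N := q))‖ ^ 2 = q := by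
  set ψ := ZMod.stdAddChar (N := q) with hψ
  have h : (gaussSum χ ψ) * (starRingEnd ℂ) (gaussSum χ ψ) = q := by
    have h1 : (starRingEnd ℂ) (gaussSum χ ψ) = ∑ b : ZMod q, χ⁻¹ b * ψ (-b) := by
      rw [gaussSum, map_sum]
      refine sum_congr rfl fun b _ => ?_
      rw [map_mul, ← MulChar.star_apply', AddChar.map_neg_eq_conj]
      rfl
    rw [h1, mul_sum]
    calc ∑ b : ZMod q, gaussSum χ ψ * (χ⁻¹ b * ψ (-b))
        = ∑ b : ZMod q, ∑ c : ZMod q, χ c * ψ (b * (c - 1)) := by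
          refine sum_congr rfl fun b _ => ?_
          have := gaussSum_mulShift_of_isPrimitive ψ hχ b
          rw [← mul_assoc, mul_comm (gaussSum χ ψ), ← this, gaussSum, sum_mul]
          refine sum_congr rfl fun c _ => ?_
          rw [mul_assoc, AddChar.mulShift_apply, ← AddChar.map_add_eq_mul]
          congr 2
          ring
      _ = ∑ c : ZMod q, χ c * ∑ b : ZMod q, ψ (b * (c - 1)) := by
          rw [sum_comm]
          simp_rw [mul_sum]
      _ = q := by
          have e : ∀ c : ZMod q, ∑ b : ZMod q, ψ (b * (c - 1)) =
              if c - 1 = 0 then ((Fintype.card (ZMod q) : ℕ) : ℂ) else 0 := fun c => by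
            rw [AddChar.sum_mulShift (c - 1) (ZMod.isPrimitive_stdAddChar q)]
            split_ifs <;> simp
          simp_rw [e]
          rw [sum_eq_single 1]
          · simp [ZMod.card]
          · intro c _ hc
            simp [sub_eq_zero, hc]
          · simp
  rw [Complex.mul_conj'] at h
  exact_mod_cast h

/-- Parseval's identity for Dirichlet characters. -/
lemma sum_norm_sq_sum_character {q : ℕ} [NeZero q] (S : ZMod q → ℂ) :
    ∑ χ : DirichletCharacter ℂ q, ‖∑ b : ZMod q, χ b * S b‖ ^ 2 =
      q.totient * ∑ b : ZMod q, if IsUnit b then ‖S b‖ ^ 2 else 0 := by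
  have hconj : ∀ (χ : DirichletCharacter ℂ q) (c : ZMod q), IsUnit c →
      (starRingEnd ℂ) (χ c) = χ c⁻¹ := fun χ c hc => by
    rw [starRingEnd_apply, MulChar.star_apply', MulChar.inv_apply_eq_inv']
    refine (eq_inv_of_mul_eq_one_left ?_).symm
    rw [← map_mul, ZMod.inv_mul_of_unit c hc, map_one]
  have h : ((∑ χ : DirichletCharacter ℂ q, ‖∑ b : ZMod q, χ b * S b‖ ^ 2 : ℝ) : ℂ) =
      ((q.totient * ∑ b : ZMod q, if IsUnit b then ‖S b‖ ^ 2 else 0 : ℝ) : ℂ) := by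
    push_cast
    calc ∑ χ : DirichletCharacter ℂ q, (‖∑ b : ZMod q, χ b * S b‖ : ℂ) ^ 2
        = ∑ χ : DirichletCharacter ℂ q, ∑ c : ZMod q, ∑ b : ZMod q,
          (if IsUnit c then (χ c⁻¹ * χ b) * (S b * (starRingEnd ℂ) (S c)) else 0) := by
          refine sum_congr rfl fun χ _ => ?_
          rw [← Complex.conj_mul', map_sum, sum_mul_sum]
          refine sum_congr rfl fun c _ => sum_congr rfl fun b _ => ?_
          rw [map_mul]
          split_ifs with hc
          · rw [hconj χ c hc]; ring
          · rw [χ.map_nonunit hc]; simp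
      _ = ∑ c : ZMod q, ∑ b : ZMod q, (if IsUnit c then
          (∑ χ : DirichletCharacter ℂ q, χ c⁻¹ * χ b) * (S b * (starRingEnd ℂ) (S c)) else 0) := by
          rw [sum_comm]
          refine sum_congr rfl fun c _ => ?_
          rw [sum_comm]
          refine sum_congr rfl fun b _ => ?_
          split_ifs with hc
          · rw [sum_mul]
          · simp
      _ = _ := by
          rw [mul_sum]
          refine sum_congr rfl fun c _ => ?_
          split_ifs with hc
          · simp_rw [DirichletCharacter.sum_char_inv_mul_char_eq ℂ hc]
            simp [Complex.mul_conj']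
          · simp
  exact_mod_cast h

open Classical in
/-- The finite set of primitive Dirichlet characters modulo `q`. -/
noncomputable def primitiveCharacters (q : ℕ) : Finset (DirichletCharacter ℂ q) :=
  if h : q = 0 then ∅ else
    have : NeZero q := ⟨h⟩
    univ.filter fun χ => χ.IsPrimitive

lemma mem_primitiveCharacters {q : ℕ} (hq : q ≠ 0) {χ : DirichletCharacter ℂ q} :
    χ ∈ primitiveCharacters q ↔ χ.IsPrimitive := by
  simp [primitiveCharacters, hq]

lemma sum_primitiveCharacters_norm_sq_le {q : ℕ} (hq : q ≠ 0) (N : ℕ) (a : ℕ → ℂ) :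
    (q : ℝ) * ∑ χ ∈ primitiveCharacters q, ‖∑ n ∈ range N, a n * χ n‖ ^ 2 ≤
      q.totient * ∑ b ∈ (range q).filter (fun b => b.Coprime q),
        ‖trigPoly N (fun n => (starRingEnd ℂ) (a n)) ((b : ℝ) / q)‖ ^ 2 := by
  have : NeZero q := ⟨hq⟩
  set ψ := ZMod.stdAddChar (N := q) with hψ
  set S : ZMod q → ℂ := fun b => ∑ n ∈ range N, (starRingEnd ℂ) (a n) * ψ (n * b) with hS
  have hS' : ∀ b : ℕ, S b = trigPoly N (fun n => (starRingEnd ℂ) (a n)) ((b : ℝ) / q) := fun b => by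
    rw [hS, trigPoly]
    refine sum_congr rfl fun n _ => ?_
    have := ZMod.stdAddChar_coe (N := q) ((n * b : ℕ) : ℤ)
    rw [hψ]
    push_cast at this ⊢
    rw [this]
    congr 2
    ring
  have h1 : ∀ χ ∈ primitiveCharacters q, (q : ℝ) * ‖∑ n ∈ range N, a n * χ n‖ ^ 2 =
      ‖∑ b : ZMod q, χ b * S b‖ ^ 2 := fun χ hχ => by
    have hp := (mem_primitiveCharacters hq).1 hχ
    have e : ∑ b : ZMod q, χ b * S b =
        (starRingEnd ℂ) (∑ n ∈ range N, a n * χ n) * gaussSum χ ψ := by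
      rw [map_sum, sum_mul]
      simp_rw [hS, mul_sum]
      rw [sum_comm]
      refine sum_congr rfl fun n _ => ?_
      rw [map_mul, starRingEnd_apply (χ n), MulChar.star_apply', mul_assoc,
        ← gaussSum_mulShift_of_isPrimitive ψ hp, gaussSum, mul_sum]
      refine sum_congr rfl fun b _ => ?_
      rw [AddChar.mulShift_apply]
      ring
    rw [e, norm_mul, mul_pow, norm_sq_gaussSum_of_isPrimitive hp, RCLike.norm_conj, mul_comm]
  rw [mul_sum, sum_congr rfl h1]
  calc _ ≤ ∑ χ : DirichletCharacter ℂ q, ‖∑ b : ZMod q, χ b * S b‖ ^ 2 :=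
        sum_le_sum_of_subset_of_nonneg (subset_univ _) fun _ _ _ => by positivity
    _ = _ := by
        rw [sum_norm_sq_sum_character, ← sum_range_natCast_zmod, sum_filter]
        congr 1
        refine sum_congr rfl fun b _ => ?_
        simp only [hS', ZMod.isUnit_iff_coprime]

/-- The multiplicative large sieve inequality. -/
theorem large_sieve (Q N : ℕ) (hQ : 1 ≤ Q) (a : ℕ → ℂ) :
    ∑ q ∈ Icc 1 Q, ∑ χ ∈ primitiveCharacters q, ‖∑ n ∈ range N, a n * χ n‖ ^ 2 ≤
      150 * (N + Q ^ 2) * ∑ n ∈ range N, ‖a n‖ ^ 2 := by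
  have h := sum_farey_norm_sq_trigPoly_le Q N hQ fun n => (starRingEnd ℂ) (a n)
  simp only [RCLike.norm_conj] at h
  refine le_trans (sum_le_sum fun q hq => ?_) h
  have hq1 := (mem_Icc.1 hq).1
  have hq0 : (0 : ℝ) < q := by exact_mod_cast hq1
  have h2 := sum_primitiveCharacters_norm_sq_le (by omega : q ≠ 0) N a
  have h3 : (q.totient : ℝ) ≤ q := by exact_mod_cast q.totient_le
  refine le_of_mul_le_mul_left (h2.trans ?_) hq0
  gcongr

/-! ### Type I sums -/

/-- A smooth weight on the scale `u ≈ exp X`. -/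
noncomputable def logBump (g : ℝ → ℂ) (X u : ℝ) : ℂ := g (Real.log u - X) / u

lemma logBump_eq_zero {g : ℝ → ℂ} (hsupp : ∀ u, 1 < |u| → g u = 0) {X u : ℝ} (hu : 0 < u)
    (h : u < Real.exp (X - 1) ∨ Real.exp (X + 1) < u) : logBump g X u = 0 := by
  rw [logBump, hsupp, zero_div]
  rcases h with h | h
  · have := (Real.log_lt_iff_lt_exp hu).2 h
    rw [lt_abs]; right; linarith
  · have := (Real.lt_log_iff_exp_lt hu).2 h
    rw [lt_abs]; left; linarith

lemma norm_logBump_le {g : ℝ → ℂ} (hsupp : ∀ u, 1 < |u| → g u = 0) {C : ℝ} (hC : ∀ u, ‖g u‖ ≤ C)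
    {X u : ℝ} (hu : 0 < u) : ‖logBump g X u‖ ≤ C * Real.exp (1 - X) := by
  have hC0 := (norm_nonneg _).trans (hC 0)
  rcases lt_or_ge u (Real.exp (X - 1)) with h | h
  · rw [logBump_eq_zero hsupp hu (Or.inl h), norm_zero]; positivity
  · rw [logBump, norm_div, Complex.norm_real, Real.norm_of_nonneg hu.le, div_eq_mul_inv,
      show 1 - X = -(X - 1) by ring, Real.exp_neg]
    gcongr
    exact hC _

lemma norm_logBump_sub_le {g : ℝ → ℂ} (hg : ContDiff ℝ (⊤ : ℕ∞) g) (hc : HasCompactSupport g)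
    (hsupp : ∀ u, 1 < |u| → g u = 0) : ∃ C : ℝ, 0 ≤ C ∧ ∀ X u v : ℝ, 0 < u → u ≤ v →
    ‖logBump g X v - logBump g X u‖ ≤ C * Real.exp (-2 * X) * (v - u) := by
  have hgd : Differentiable ℝ g := hg.differentiable (by simp)
  obtain ⟨C0, hC0⟩ := hc.exists_bound_of_continuous hg.continuous
  obtain ⟨C1, hC1⟩ := hc.deriv.exists_bound_of_continuous (hg.continuous_deriv (by simp))
  have hC0' : 0 ≤ C0 := (norm_nonneg _).trans (hC0 0)
  have hC1' : 0 ≤ C1 := (norm_nonneg _).trans (hC1 0)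
  have hd0 : ∀ u, 1 < |u| → deriv g u = 0 := fun u hu => by
    have : g =ᶠ[nhds u] fun _ => 0 := by
      filter_upwards [(isOpen_lt continuous_const continuous_abs).mem_nhds hu] with v hv
      exact hsupp v hv
    rw [this.deriv_eq]
    simp
  refine ⟨(C0 + C1) * Real.exp 2, by positivity, fun X u v hu huv => ?_⟩
  have hfd : ∀ w : ℝ, 0 < w → HasDerivAt (logBump g X)
      (((1 / w : ℝ) • deriv g (Real.log w - X) * w - g (Real.log w - X) * 1) / (w : ℂ) ^ 2) w := by
    intro w hw
    have h1 : HasDerivAt (fun w => Real.log w - X) (1 / w) w := by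
      simpa using (Real.hasDerivAt_log hw.ne').sub_const X
    have h2 : HasDerivAt (fun w => g (Real.log w - X)) ((1 / w : ℝ) • deriv g (Real.log w - X)) w :=
      HasDerivAt.scomp w (hgd _).hasDerivAt h1
    exact h2.div (Complex.ofRealCLM.hasDerivAt (x := w)) (by exact_mod_cast hw.ne')
  have := (convex_Icc u v).norm_image_sub_le_of_norm_hasDerivWithin_le
      (f := logBump g X) (C := (C0 + C1) * Real.exp 2 * Real.exp (-2 * X))
      (fun w hw => (hfd w (hu.trans_le hw.1)).hasDerivWithinAt) (fun w hw => ?_)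
      (Set.left_mem_Icc.2 huv) (Set.right_mem_Icc.2 huv)
  · rwa [Real.norm_of_nonneg (by linarith)] at this
  · have hw0 : 0 < w := hu.trans_le hw.1
    have hwc : (w : ℂ) ≠ 0 := by exact_mod_cast hw0.ne'
    rcases lt_or_ge w (Real.exp (X - 1)) with h | h
    · have hlt : 1 < |Real.log w - X| := by
        have := (Real.log_lt_iff_lt_exp hw0).2 h
        rw [lt_abs]; right; linarith
      rw [hsupp _ hlt, hd0 _ hlt]
      simp only [smul_zero, zero_mul, sub_zero, zero_div, norm_zero]
      positivity
    · have e : ((1 / w : ℝ) • deriv g (Real.log w - X) * w - g (Real.log w - X) * 1) =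
          deriv g (Real.log w - X) - g (Real.log w - X) := by
        rw [Complex.real_smul]
        push_cast
        field_simp
      rw [e, norm_div, norm_pow, Complex.norm_real, Real.norm_of_nonneg hw0.le, div_eq_mul_inv,
        mul_assoc, ← Real.exp_add, show (2 : ℝ) + -2 * X = -((X - 1) + (X - 1)) by ring,
        Real.exp_neg, Real.exp_add, ← sq]
      gcongr
      refine (norm_sub_le _ _).trans ?_
      linarith [hC0 (Real.log w - X), hC1 (Real.log w - X)]

lemma norm_sum_range_character_le {r : ℕ} (hr : 1 ≤ r) {χ : DirichletCharacter ℂ r} (hχ : χ ≠ 1)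
    (n : ℕ) : ‖∑ i ∈ range n, χ i‖ ≤ r := by
  have : NeZero r := ⟨by omega⟩
  refine norm_sum_range_le_of_periodic (f := fun i : ℕ => χ i) (by omega) (fun n => by simp) ?_
    (fun n => χ.norm_le_one _) n
  rw [sum_range_natCast_zmod (fun a => χ a)]
  exact χ.sum_eq_zero_of_ne_one hχ

/-- A smooth character sum over multiples of `m`. -/
lemma norm_sum_character_logBump_le {g : ℝ → ℂ} (hg : ContDiff ℝ (⊤ : ℕ∞) g)
    (hc : HasCompactSupport g) (hsupp : ∀ u, 1 < |u| → g u = 0) : ∃ C : ℝ, 0 ≤ C ∧ ∀ X : ℝ,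
    ∀ r : ℕ, 1 ≤ r → ∀ χ : DirichletCharacter ℂ r, χ ≠ 1 → ∀ m : ℕ, 1 ≤ m → ∀ N : ℕ,
    ‖∑ l ∈ range N, χ ((m * l : ℕ) : ZMod r) * logBump g X ((m * l : ℕ) : ℝ)‖ ≤
      C * r * Real.exp (-X) := by
  obtain ⟨C, hC0, hC⟩ := norm_logBump_sub_le hg hc hsupp
  obtain ⟨C0, hC0'⟩ := hc.exists_bound_of_continuous hg.continuous
  have hC00 : 0 ≤ C0 := (norm_nonneg _).trans (hC0' 0)
  refine ⟨2 * (C0 * Real.exp 1) + C * Real.exp 1, by positivity, ?_⟩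
  intro X r hr χ hχ m hm N
  have hm0 : (0 : ℝ) < m := by exact_mod_cast hm
  have e : ∑ l ∈ range N, χ ((m * l : ℕ) : ZMod r) * logBump g X ((m * l : ℕ) : ℝ) =
      χ m * ∑ l ∈ range N, χ l * logBump g X ((m * l : ℕ) : ℝ) := by
    rw [mul_sum]
    refine sum_congr rfl fun l _ => ?_
    push_cast
    rw [map_mul, mul_assoc]
  rw [e, norm_mul]
  refine (mul_le_of_le_one_left (norm_nonneg _) (χ.norm_le_one _)).trans ?_
  rcases Nat.eq_zero_or_pos N with rfl | hN
  · simp only [range_zero, sum_empty, norm_zero]; positivity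
  have e2 : ∑ l ∈ range N, χ l * logBump g X ((m * l : ℕ) : ℝ) =
      ∑ l ∈ Ico 1 N, χ l * logBump g X ((m * l : ℕ) : ℝ) := by
    rw [range_eq_Ico, sum_eq_sum_Ico_succ_bot (by omega)]
    simp [logBump]
  rw [e2]
  refine (norm_sum_Ico_mul_le_of_partialSums (f := fun l : ℕ => χ l)
    (g := fun l : ℕ => logBump g X ((m * l : ℕ) : ℝ))
    (norm_sum_range_character_le hr hχ) hN).trans ?_
  have hend : ∀ l : ℕ, 1 ≤ l → ‖logBump g X ((m * l : ℕ) : ℝ)‖ ≤ C0 * Real.exp 1 * Real.exp (-X) :=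
    fun l hl => by
      have := norm_logBump_le hsupp hC0' (X := X) (u := ((m * l : ℕ) : ℝ))
        (by exact_mod_cast Nat.mul_pos hm hl)
      rwa [sub_eq_add_neg, Real.exp_add, ← mul_assoc] at this
  have hvar : ∑ l ∈ Ico 1 N, ‖logBump g X ((m * (l + 1) : ℕ) : ℝ) - logBump g X ((m * l : ℕ) : ℝ)‖ ≤
      C * Real.exp 1 * Real.exp (-X) := by
    set K := ⌊Real.exp (X + 1) / m⌋₊ with hK
    calc _ ≤ ∑ l ∈ Ico 1 (K + 1), C * Real.exp (-2 * X) * m := by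
          rw [← sum_filter_add_sum_filter_not (Ico 1 N) (fun l => l ≤ K)]
          have h2 : ∑ l ∈ (Ico 1 N).filter (fun l => ¬ l ≤ K),
              ‖logBump g X ((m * (l + 1) : ℕ) : ℝ) - logBump g X ((m * l : ℕ) : ℝ)‖ = 0 := by
            refine sum_eq_zero fun l hl => ?_
            rw [mem_filter, mem_Ico, not_le] at hl
            have h3 : Real.exp (X + 1) < (m : ℝ) * l := by
              have := Nat.lt_of_floor_lt hl.2
              rwa [div_lt_iff₀ hm0, mul_comm] at this
            have hl0 : (0 : ℝ) < l := by exact_mod_cast hl.1.1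
            rw [logBump_eq_zero hsupp (by push_cast; positivity) (Or.inr (by push_cast; nlinarith)),
              logBump_eq_zero hsupp (by push_cast; positivity) (Or.inr (by push_cast; exact h3))]
            simp
          rw [h2, add_zero]
          refine (sum_le_sum fun l hl => ?_).trans
            (sum_le_sum_of_subset_of_nonneg (t := Ico 1 (K + 1)) ?_ fun _ _ _ => by positivity)
          · rw [mem_filter, mem_Ico] at hl
            have hl0 : (0 : ℝ) < l := by exact_mod_cast hl.1.1
            have := hC X ((m * l : ℕ) : ℝ) ((m * (l + 1) : ℕ) : ℝ) (by push_cast; positivity)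
              (by push_cast; nlinarith)
            refine this.trans (le_of_eq ?_)
            push_cast
            ring
          · intro l hl
            simp only [mem_filter, mem_Ico] at hl ⊢
            omega
      _ = K * (C * Real.exp (-2 * X) * m) := by simp
      _ ≤ Real.exp (X + 1) / m * (C * Real.exp (-2 * X) * m) := by
          gcongr
          exact Nat.floor_le (by positivity)
      _ = C * Real.exp 1 * Real.exp (-X) := by
          field_simp
          rw [mul_comm (Real.exp (X + 1)) C, mul_assoc, ← Real.exp_add, mul_assoc, ← Real.exp_add]
          ring_nf
  have h1 := hend 1 le_rfl
  have h2 := hend N hN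
  calc _ ≤ (r : ℝ) * (C0 * Real.exp 1 * Real.exp (-X) + C0 * Real.exp 1 * Real.exp (-X) +
        C * Real.exp 1 * Real.exp (-X)) := by gcongr
    _ = _ := by ring

/-! ### Type II sums -/

/-- Summation of a Dirichlet convolution against a finitely supported weight. -/
lemma sum_range_mul_convolution {N : ℕ} {F : ℕ → ℂ} (hF : ∀ k, N ≤ k → F k = 0)
    (f g : ArithmeticFunction ℝ) :
    ∑ n ∈ range N, ((f * g) n : ℝ) * F n = ∑ m ∈ range N, ∑ l ∈ range N, (f m : ℂ) * g l * F (m * l) := by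
  have hR : ∑ m ∈ range N, ∑ l ∈ range N, (f m : ℂ) * g l * F (m * l) =
      ∑ p ∈ (range N ×ˢ range N).filter (fun p => p.1 * p.2 < N ∧ p.1 * p.2 ≠ 0),
        (f p.1 : ℂ) * g p.2 * F (p.1 * p.2) := by
    rw [← sum_product', sum_filter_of_ne]
    rintro ⟨m, l⟩ - h
    refine ⟨?_, fun h0 => h ?_⟩
    · by_contra h1
      exact h (by rw [hF _ (not_lt.1 h1), mul_zero])
    · rcases mul_eq_zero.1 h0 with h2 | h2 <;> simp only at h2 <;> simp [h2]
  have hmaps : ∀ p ∈ (range N ×ˢ range N).filter (fun p => p.1 * p.2 < N ∧ p.1 * p.2 ≠ 0),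
      p.1 * p.2 ∈ range N := fun p hp => mem_range.2 (mem_filter.1 hp).2.1
  rw [hR, ← sum_fiberwise_of_maps_to hmaps]
  refine sum_congr rfl fun n hn => ?_
  rw [ArithmeticFunction.mul_apply, Complex.ofReal_sum, sum_mul]
  have hset : ((range N ×ˢ range N).filter (fun p => p.1 * p.2 < N ∧ p.1 * p.2 ≠ 0)).filter
      (fun p => p.1 * p.2 = n) = n.divisorsAntidiagonal := by
    ext ⟨m, l⟩
    simp only [mem_filter, mem_product, mem_range, Nat.mem_divisorsAntidiagonal] at hn ⊢
    constructor
    · rintro ⟨⟨-, -, h⟩, rfl⟩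
      exact ⟨rfl, h⟩
    · rintro ⟨rfl, h⟩
      have hm : 0 < m := Nat.pos_of_ne_zero fun h0 => h (by simp [h0])
      have hl : 0 < l := Nat.pos_of_ne_zero fun h0 => h (by simp [h0])
      exact ⟨⟨⟨lt_of_le_of_lt (Nat.le_mul_of_pos_right _ hl) hn,
        lt_of_le_of_lt (Nat.le_mul_of_pos_left _ hm) hn⟩, hn, h⟩, rfl⟩
  rw [hset]
  refine sum_congr rfl fun p hp => ?_
  rw [(Nat.mem_divisorsAntidiagonal.1 hp).1, Complex.ofReal_mul]

/-- Separation of variables in bilinear forms by Fourier inversion. -/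
lemma sum_norm_bilinear_le {g h : ℝ → ℂ} (h_integ : MeasureTheory.Integrable h)
    (hrep : ∀ u : ℝ, g u = ∫ ξ, Complex.exp ((2 * Real.pi * ξ * u : ℝ) * Complex.I) * h ξ)
    {ι : Type*} (I : Finset ι) (α β : ι → ℕ → ℂ) (M L : Finset ℕ) (X K : ℝ)
    (hK : ∀ ξ : ℝ, ∑ i ∈ I,
      ‖∑ m ∈ M, α i m * Complex.exp ((2 * Real.pi * ξ * Real.log m : ℝ) * Complex.I)‖ *
      ‖∑ l ∈ L, β i l * Complex.exp ((2 * Real.pi * ξ * Real.log l : ℝ) * Complex.I)‖ ≤ K) :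
    ∑ i ∈ I, ‖∑ m ∈ M, ∑ l ∈ L, α i m * β i l * g (Real.log m + Real.log l - X)‖ ≤
      K * ∫ ξ, ‖h ξ‖ := by
  set e : ℝ → ℝ → ℂ := fun ξ u => Complex.exp ((2 * Real.pi * ξ * u : ℝ) * Complex.I) with he
  have hen : ∀ ξ u, ‖e ξ u‖ = 1 := fun ξ u => Complex.norm_exp_ofReal_mul_I _
  have hec : ∀ u, Continuous fun ξ => e ξ u := fun u => by fun_prop
  have e_mul_add : ∀ ξ u v, e ξ (u + v) = e ξ u * e ξ v := fun ξ u v => by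
    rw [he]; simp only; rw [← Complex.exp_add]; congr 1; push_cast; ring
  have hsum_int : ∀ i, MeasureTheory.Integrable fun ξ =>
      (∑ m ∈ M, α i m * e ξ (Real.log m)) * (∑ l ∈ L, β i l * e ξ (Real.log l)) *
        (e ξ (-X) * h ξ) := fun i => by
    have hb : ∀ ξ, ‖(∑ m ∈ M, α i m * e ξ (Real.log m)) * (∑ l ∈ L, β i l * e ξ (Real.log l)) *
        e ξ (-X)‖ ≤ (∑ m ∈ M, ‖α i m‖) * (∑ l ∈ L, ‖β i l‖) := fun ξ => by
      rw [norm_mul, norm_mul, hen, mul_one]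
      gcongr
      · exact norm_sum_le_of_le _ fun m _ => by rw [norm_mul, hen, mul_one]
      · exact norm_sum_le_of_le _ fun m _ => by rw [norm_mul, hen, mul_one]
    have := h_integ.bdd_mul (c := (∑ m ∈ M, ‖α i m‖) * (∑ l ∈ L, ‖β i l‖))
      (f := fun ξ => (∑ m ∈ M, α i m * e ξ (Real.log m)) * (∑ l ∈ L, β i l * e ξ (Real.log l)) *
        e ξ (-X)) (Continuous.aestronglyMeasurable (by fun_prop)) (Filter.Eventually.of_forall hb)
    simpa only [mul_assoc] using this
  have hterm_int : ∀ u, MeasureTheory.Integrable fun ξ => e ξ u * h ξ := fun u =>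
    h_integ.bdd_mul (c := 1) (hec u).aestronglyMeasurable
      (Filter.Eventually.of_forall fun ξ => (hen ξ u).le)
  have hrepr : ∀ i, ∑ m ∈ M, ∑ l ∈ L, α i m * β i l * g (Real.log m + Real.log l - X) =
      ∫ ξ, (∑ m ∈ M, α i m * e ξ (Real.log m)) * (∑ l ∈ L, β i l * e ξ (Real.log l)) *
        (e ξ (-X) * h ξ) := fun i => by
    have e1 : ∀ ξ, (∑ m ∈ M, α i m * e ξ (Real.log m)) * (∑ l ∈ L, β i l * e ξ (Real.log l)) *
        (e ξ (-X) * h ξ) = ∑ m ∈ M, ∑ l ∈ L, α i m * β i l *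
          (e ξ (Real.log m + Real.log l - X) * h ξ) := fun ξ => by
      rw [sum_mul_sum, sum_mul]
      refine sum_congr rfl fun m _ => ?_
      rw [sum_mul]
      refine sum_congr rfl fun l _ => ?_
      rw [sub_eq_add_neg, e_mul_add, e_mul_add]
      ring
    simp_rw [e1]
    rw [MeasureTheory.integral_finsetSum _ fun m _ =>
      MeasureTheory.integrable_finsetSum _ fun l _ => (hterm_int _).const_mul _]
    refine sum_congr rfl fun m _ => ?_
    rw [MeasureTheory.integral_finsetSum _ fun l _ => (hterm_int _).const_mul _]
    refine sum_congr rfl fun l _ => ?_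
    rw [MeasureTheory.integral_const_mul, hrep]
  calc _ ≤ ∑ i ∈ I, ∫ ξ, ‖(∑ m ∈ M, α i m * e ξ (Real.log m)) *
        (∑ l ∈ L, β i l * e ξ (Real.log l)) * (e ξ (-X) * h ξ)‖ :=
        sum_le_sum fun i _ => by rw [hrepr i]; exact MeasureTheory.norm_integral_le_integral_norm _
    _ = ∫ ξ, ∑ i ∈ I, ‖(∑ m ∈ M, α i m * e ξ (Real.log m)) *
        (∑ l ∈ L, β i l * e ξ (Real.log l)) * (e ξ (-X) * h ξ)‖ :=
        (MeasureTheory.integral_finsetSum _ fun i _ => (hsum_int i).norm).symm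
    _ ≤ ∫ ξ, K * ‖h ξ‖ := by
        refine MeasureTheory.integral_mono
          (MeasureTheory.integrable_finsetSum _ fun i _ => (hsum_int i).norm)
          (h_integ.norm.const_mul K) fun ξ => ?_
        simp only [norm_mul, hen, one_mul]
        rw [← sum_mul]
        gcongr
        exact hK ξ
    _ = _ := MeasureTheory.integral_const_mul _ _

/-- The large sieve for sums over a subset of an initial segment, twisted by a unimodular
function. -/
lemma large_sieve_subset {R N : ℕ} (hR : 1 ≤ R) {M : Finset ℕ} (hM : M ⊆ range N) (a e : ℕ → ℂ)
    (he : ∀ n, ‖e n‖ = 1) :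
    ∑ q ∈ Icc 1 R, ∑ χ ∈ primitiveCharacters q, ‖∑ n ∈ M, a n * χ n * e n‖ ^ 2 ≤
      150 * (N + R ^ 2) * ∑ n ∈ M, ‖a n‖ ^ 2 := by
  have h := large_sieve R N hR (fun n => if n ∈ M then a n * e n else 0)
  have e1 : ∀ (q : ℕ) (χ : DirichletCharacter ℂ q), ∑ n ∈ M, a n * χ n * e n =
      ∑ n ∈ range N, (if n ∈ M then a n * e n else 0) * χ n := fun q χ => by
    rw [← sum_subset hM fun n _ hn => by rw [if_neg hn, zero_mul]]
    exact sum_congr rfl fun n hn => by rw [if_pos hn]; ring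
  have e2 : ∑ n ∈ M, ‖a n‖ ^ 2 = ∑ n ∈ range N, ‖if n ∈ M then a n * e n else 0‖ ^ 2 := by
    rw [← sum_subset hM fun n _ hn => by rw [if_neg hn]; simp]
    exact sum_congr rfl fun n hn => by rw [if_pos hn, norm_mul, he, mul_one]
  rw [e2]
  simp_rw [e1]
  exact h

/-- A bilinear large sieve inequality with a smooth weight depending on the product of the
variables. -/
lemma large_sieve_bilinear {g h : ℝ → ℂ} (h_integ : MeasureTheory.Integrable h)
    (hrep : ∀ u : ℝ, g u = ∫ ξ, Complex.exp ((2 * Real.pi * ξ * u : ℝ) * Complex.I) * h ξ)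
    {R N₁ N₂ : ℕ} (hR : 1 ≤ R) {M L : Finset ℕ} (hM : M ⊆ range N₁) (hL : L ⊆ range N₂)
    (a b : ℕ → ℂ) (X : ℝ) :
    ∑ q ∈ Icc 1 R, ∑ χ ∈ primitiveCharacters q,
      ‖∑ m ∈ M, ∑ l ∈ L, a m * χ m * (b l * χ l) * g (Real.log m + Real.log l - X)‖ ≤
      Real.sqrt (150 * (N₁ + R ^ 2) * ∑ m ∈ M, ‖a m‖ ^ 2) *
        Real.sqrt (150 * (N₂ + R ^ 2) * ∑ l ∈ L, ‖b l‖ ^ 2) * ∫ ξ, ‖h ξ‖ := by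
  have := sum_norm_bilinear_le h_integ hrep ((Icc 1 R).sigma fun q => primitiveCharacters q)
    (fun i m => a m * i.2 m) (fun i l => b l * i.2 l) M L X
    (Real.sqrt (150 * (N₁ + R ^ 2) * ∑ m ∈ M, ‖a m‖ ^ 2) *
        Real.sqrt (150 * (N₂ + R ^ 2) * ∑ l ∈ L, ‖b l‖ ^ 2)) fun ξ => by
      refine (Real.sum_mul_le_sqrt_mul_sqrt _ _ _).trans ?_
      rw [sum_sigma, sum_sigma]
      have h1 := large_sieve_subset hR hM a
        (fun m => Complex.exp ((2 * Real.pi * ξ * Real.log m : ℝ) * Complex.I))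
        fun m => Complex.norm_exp_ofReal_mul_I _
      have h2 := large_sieve_subset hR hL b
        (fun m => Complex.exp ((2 * Real.pi * ξ * Real.log m : ℝ) * Complex.I))
        fun m => Complex.norm_exp_ofReal_mul_I _
      exact mul_le_mul (Real.sqrt_le_sqrt h1) (Real.sqrt_le_sqrt h2) (Real.sqrt_nonneg _)
        (Real.sqrt_nonneg _)
  rwa [sum_sigma] at this

set_option maxHeartbeats 1000000 in
/-- One dyadic block of a type II sum. -/
lemma sum_norm_dyadic_block_le {g h : ℝ → ℂ} (h_integ : MeasureTheory.Integrable h)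
    (hrep : ∀ u : ℝ, g u = ∫ ξ, Complex.exp ((2 * Real.pi * ξ * u : ℝ) * Complex.I) * h ξ)
    {R : ℕ} (hR : 1 ≤ R) {X U V B P : ℝ} (hU : 1 ≤ U) (hV : 1 ≤ V) (hB : 0 ≤ B) (hP : 1 ≤ P)
    {α b : ℕ → ℂ} (hα : ∀ m, ‖α m‖ ≤ 1) (hαU : ∀ m : ℕ, (m : ℝ) ≤ U → α m = 0)
    (hb : ∀ l : ℕ, (l : ℝ) ≤ Real.exp (X + 1) → ‖b l‖ ≤ B)
    (hbV : ∀ l : ℕ, (l : ℝ) ≤ V → b l = 0)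
    {M L : Finset ℕ} (hM : ∀ m ∈ M, P ≤ m ∧ (m : ℝ) < 2 * P)
    (hL : ∀ l ∈ L, Real.exp (X - 1) ≤ 2 * P * l ∧ P * l ≤ Real.exp (X + 1)) :
    ∑ q ∈ Icc 1 R, ∑ χ ∈ primitiveCharacters q,
      ‖∑ m ∈ M, ∑ l ∈ L, α m / m * χ m * (b l / l * χ l) * g (Real.log m + Real.log l - X)‖ ≤
      17000 * B * (1 + 2 * R / Real.sqrt U + 2 * R / Real.sqrt V + R ^ 2 * Real.exp (-X / 2)) *
        ∫ ξ, ‖h ξ‖ := by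
  have hI : 0 ≤ ∫ ξ, ‖h ξ‖ := MeasureTheory.integral_nonneg fun _ => norm_nonneg _
  have hP0 : 0 < P := by linarith
  have hRHS : 0 ≤ 17000 * B * (1 + 2 * R / Real.sqrt U + 2 * R / Real.sqrt V +
      R ^ 2 * Real.exp (-X / 2)) * ∫ ξ, ‖h ξ‖ := by positivity
  by_cases hPU : 2 * P ≤ U
  · refine le_trans (le_of_eq ?_) hRHS
    refine sum_eq_zero fun q _ => sum_eq_zero fun χ _ => ?_
    rw [norm_eq_zero]
    refine sum_eq_zero fun m hm => sum_eq_zero fun l _ => ?_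
    rw [hαU m (by linarith [(hM m hm).2])]
    simp
  by_cases hPV : Real.exp (X + 1) ≤ P * V
  · refine le_trans (le_of_eq ?_) hRHS
    refine sum_eq_zero fun q _ => sum_eq_zero fun χ _ => ?_
    rw [norm_eq_zero]
    refine sum_eq_zero fun m hm => sum_eq_zero fun l hl => ?_
    rw [hbV l (le_of_mul_le_mul_left ((hL l hl).2.trans hPV) hP0)]
    simp
  push Not at hPU hPV
  set Y : ℝ := Real.exp X / P with hY
  have hY0 : 0 < Y := by positivity
  have he3 : Real.exp 1 ≤ 3 := by have := Real.exp_one_lt_d9; linarith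
  have he0 := Real.exp_pos 1
  have heY : Real.exp (X + 1) = Real.exp 1 * Y * P := by
    rw [hY, Real.exp_add]; field_simp
  have hYV : V < 3 * Y := by
    rw [heY] at hPV
    have : V < Real.exp 1 * Y := lt_of_mul_lt_mul_left (by linarith) hP0.le
    nlinarith
  set N₁ := ⌊2 * P⌋₊ + 1
  set N₂ := ⌊3 * Y⌋₊ + 1
  have hM' : M ⊆ range N₁ := fun m hm => mem_range.2 (Nat.lt_succ_of_le
    (Nat.le_floor (hM m hm).2.le))
  have hl3 : ∀ l ∈ L, (l : ℝ) ≤ 3 * Y := fun l hl => by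
    have h1 := (hL l hl).2
    rw [heY] at h1
    have : (l : ℝ) ≤ Real.exp 1 * Y := le_of_mul_le_mul_left (by linarith) hP0
    nlinarith
  have hL' : L ⊆ range N₂ := fun l hl => mem_range.2 (Nat.lt_succ_of_le
    (Nat.le_floor (hl3 l hl)))
  have hN₁ : (N₁ : ℝ) ≤ 3 * P := by
    have := Nat.floor_le (a := 2 * P) (by positivity)
    push_cast [N₁]; linarith
  have hN₂ : (N₂ : ℝ) ≤ 6 * Y := by
    have := Nat.floor_le (a := 3 * Y) (by positivity)
    push_cast [N₂]; linarith
  refine (large_sieve_bilinear h_integ hrep hR hM' hL' (fun m => α m / m) (fun l => b l / l) X).trans ?_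
  refine mul_le_mul_of_nonneg_right ?_ hI
  have hsM : ∑ m ∈ M, ‖α m / m‖ ^ 2 ≤ 3 / P := by
    calc _ ≤ ∑ m ∈ M, 1 / P ^ 2 := sum_le_sum fun m hm => by
          have h1 := (hM m hm).1
          rw [norm_div, Complex.norm_natCast, div_pow]
          have h2 : ‖α m‖ ^ 2 ≤ 1 := pow_le_one₀ (norm_nonneg _) (hα m)
          gcongr
      _ = (M.card : ℝ) * (1 / P ^ 2) := by simp
      _ ≤ (3 * P) * (1 / P ^ 2) := by
          have h1 : (M.card : ℝ) ≤ N₁ := by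
            have := card_le_card hM'
            rw [card_range] at this
            exact_mod_cast this
          gcongr
          linarith
      _ = 3 / P := by field_simp
  have hsL : ∑ l ∈ L, ‖b l / l‖ ^ 2 ≤ 216 * B ^ 2 / Y := by
    calc _ ≤ ∑ l ∈ L, B ^ 2 * 36 / Y ^ 2 := sum_le_sum fun l hl => by
          have h1 := (hL l hl).1
          have h4 : Y ≤ 6 * l := by
            rw [hY, div_le_iff₀ hP0]
            have h5 : Real.exp X = Real.exp 1 * Real.exp (X - 1) := by
              rw [← Real.exp_add]; ring_nf
            rw [h5]
            have h6 : 0 ≤ Real.exp (X - 1) := (Real.exp_pos _).le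
            nlinarith
          have hl0 : (0 : ℝ) < l := by linarith
          have h2 := hb l (by
            have h3 := (hL l hl).2
            nlinarith)
          rw [norm_div, Complex.norm_natCast, div_pow]
          have h7 : ‖b l‖ ^ 2 ≤ B ^ 2 := pow_le_pow_left₀ (norm_nonneg _) h2 2
          have h8 : Y ^ 2 ≤ 36 * (l : ℝ) ^ 2 := by nlinarith
          rw [div_le_div_iff₀ (by positivity) (by positivity)]
          calc _ ≤ B ^ 2 * (36 * (l : ℝ) ^ 2) := mul_le_mul h7 h8 (by positivity) (by positivity)
            _ = _ := by ring
      _ = (L.card : ℝ) * (B ^ 2 * 36 / Y ^ 2) := by simp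
      _ ≤ (6 * Y) * (B ^ 2 * 36 / Y ^ 2) := by
          have h1 : (L.card : ℝ) ≤ N₂ := by
            have := card_le_card hL'
            rw [card_range] at this
            exact_mod_cast this
          gcongr
          linarith
      _ = 216 * B ^ 2 / Y := by field_simp; ring
  have hR0 : (0 : ℝ) ≤ R := Nat.cast_nonneg R
  have hA : 150 * ((N₁ : ℝ) + R ^ 2) * ∑ m ∈ M, ‖α m / m‖ ^ 2 ≤ 1350 * (1 + R ^ 2 / P) := by
    calc _ ≤ 150 * (3 * P + (R : ℝ) ^ 2) * (3 / P) := by gcongr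
      _ = 1350 + 450 * (R ^ 2 / P) := by field_simp; ring
      _ ≤ _ := by have : 0 ≤ (R : ℝ) ^ 2 / P := by positivity
                  linarith
  have hBb : 150 * ((N₂ : ℝ) + R ^ 2) * ∑ l ∈ L, ‖b l / l‖ ^ 2 ≤
      194400 * B ^ 2 * (1 + R ^ 2 / Y) := by
    calc _ ≤ 150 * (6 * Y + (R : ℝ) ^ 2) * (216 * B ^ 2 / Y) := by gcongr
      _ = B ^ 2 * (194400 + 32400 * (R ^ 2 / Y)) := by field_simp; ring
      _ ≤ _ := by have : 0 ≤ (R : ℝ) ^ 2 / Y := by positivity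
                  have : 0 ≤ B ^ 2 * ((R : ℝ) ^ 2 / Y) := by positivity
                  linarith
  rw [← Real.sqrt_mul (by positivity)]
  refine Real.sqrt_le_iff.2 ⟨by positivity, ?_⟩
  refine (mul_le_mul hA hBb (by positivity) (by positivity)).trans ?_
  have hs : (R : ℝ) ^ 2 / P ≤ 2 * (R / Real.sqrt U) ^ 2 := by
    rw [div_pow, Real.sq_sqrt (by linarith), mul_div_assoc', div_le_div_iff₀ hP0 (by linarith)]
    have : 0 ≤ (R : ℝ) ^ 2 := by positivity
    nlinarith
  have ht : (R : ℝ) ^ 2 / Y ≤ 3 * (R / Real.sqrt V) ^ 2 := by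
    rw [div_pow, Real.sq_sqrt (by linarith), mul_div_assoc', div_le_div_iff₀ hY0 (by linarith)]
    have : 0 ≤ (R : ℝ) ^ 2 := by positivity
    nlinarith
  have hw : (R : ℝ) ^ 2 / P * (R ^ 2 / Y) = (R ^ 2 * Real.exp (-X / 2)) ^ 2 := by
    rw [mul_pow, ← Real.exp_nat_mul, show ((2 : ℕ) : ℝ) * (-X / 2) = -X by push_cast; ring,
      Real.exp_neg, hY]
    field_simp
  have hs0 : 0 ≤ (R : ℝ) / Real.sqrt U := by positivity
  have ht0 : 0 ≤ (R : ℝ) / Real.sqrt V := by positivity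
  have hw0 : 0 ≤ (R : ℝ) ^ 2 * Real.exp (-X / 2) := by positivity
  rw [mul_div_assoc, mul_div_assoc]
  have hp0 : 0 ≤ (R : ℝ) ^ 2 / P := by positivity
  have hy0 : 0 ≤ (R : ℝ) ^ 2 / Y := by positivity
  generalize (R : ℝ) / Real.sqrt U = s at *
  generalize (R : ℝ) / Real.sqrt V = t at *
  generalize (R : ℝ) ^ 2 * Real.exp (-X / 2) = w at *
  generalize (R : ℝ) ^ 2 / P = p at *
  generalize (R : ℝ) ^ 2 / Y = y at *
  have h1 : (1 + p) * (1 + y) ≤ (1 + 2 * s + 2 * t + w) ^ 2 := by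
    have : (1 + p) * (1 + y) = 1 + p + y + p * y := by ring
    rw [this, hw]
    have e : (1 + 2 * s + 2 * t + w) ^ 2 = 1 + 4 * s ^ 2 + 4 * t ^ 2 + w ^ 2 + (4 * s + 4 * t +
      2 * w + 8 * (s * t) + 4 * (s * w) + 4 * (t * w)) := by ring
    have e2 : 0 ≤ 4 * s + 4 * t + 2 * w + 8 * (s * t) + 4 * (s * w) + 4 * (t * w) := by positivity
    rw [e]
    have := sq_nonneg s
    have := sq_nonneg t
    linarith
  calc _ = 262440000 * B ^ 2 * ((1 + p) * (1 + y)) := by ring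
    _ ≤ 289000000 * B ^ 2 * (1 + 2 * s + 2 * t + w) ^ 2 := by
        refine mul_le_mul ?_ h1 ?_ (by positivity)
        · have := sq_nonneg B; linarith
        · positivity
    _ = _ := by ring

/-- The type II estimate: bilinear sums against primitive characters of conductor at most `R`. -/
theorem sum_norm_typeII_le {g : ℝ → ℂ} (hg : ContDiff ℝ (⊤ : ℕ∞) g) (hc : HasCompactSupport g)
    (hsupp : ∀ u, 1 < |u| → g u = 0) : ∃ C : ℝ, 0 ≤ C ∧ ∀ (X U V B : ℝ) (R N : ℕ) (α b : ℕ → ℂ),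
    1 ≤ X → 1 ≤ U → 1 ≤ V → 0 ≤ B → 1 ≤ R → (N : ℝ) ≤ 2 * Real.exp (X + 1) →
    (∀ m, ‖α m‖ ≤ 1) → (∀ m : ℕ, (m : ℝ) ≤ U → α m = 0) →
    (∀ l : ℕ, (l : ℝ) ≤ Real.exp (X + 1) → ‖b l‖ ≤ B) → (∀ l : ℕ, (l : ℝ) ≤ V → b l = 0) →
    ∑ q ∈ Icc 1 R, ∑ χ ∈ primitiveCharacters q,
      ‖∑ m ∈ range N, ∑ l ∈ range N, α m * b l *
        (χ ((m * l : ℕ) : ZMod q) * logBump g X ((m * l : ℕ) : ℝ))‖ ≤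
      C * X * B * (1 + R / Real.sqrt U + R / Real.sqrt V + R ^ 2 * Real.exp (-X / 2)) := by
  obtain ⟨h, hhc, h_integ, hrep⟩ := exists_fourier_representation hg hc
  have h_integ0 : MeasureTheory.Integrable h := by
    rw [← MeasureTheory.integrable_norm_iff hhc.aestronglyMeasurable]
    simpa using h_integ 0
  have hI : 0 ≤ ∫ ξ, ‖h ξ‖ := MeasureTheory.integral_nonneg fun _ => norm_nonneg _
  refine ⟨7 * 34000 * ∫ ξ, ‖h ξ‖, by positivity, ?_⟩
  intro X U V B R N α b hX hU hV hB hR hN hα hαU hb hbV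
  set J := Nat.log 2 N + 1 with hJ
  set M : ℕ → Finset ℕ := fun j => (range N).filter fun m => m ≠ 0 ∧ Nat.log 2 m = j with hMdef
  set L : ℕ → Finset ℕ := fun j => (range N).filter fun l => Real.exp (X - 1) ≤ 2 * 2 ^ j * l ∧
    2 ^ j * l ≤ Real.exp (X + 1) with hLdef
  have hMprop : ∀ j, ∀ m ∈ M j, (2 : ℝ) ^ j ≤ m ∧ (m : ℝ) < 2 * 2 ^ j := fun j m hm => by
    rw [hMdef, mem_filter] at hm
    obtain ⟨-, h0, rfl⟩ := hm
    have h1 := Nat.pow_log_le_self 2 h0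
    have h2 := Nat.lt_pow_succ_log_self (b := 2) (by norm_num) m
    rw [pow_succ, mul_comm] at h2
    exact ⟨by exact_mod_cast h1, by exact_mod_cast h2⟩
  have hdecomp : ∀ (q : ℕ) (χ : DirichletCharacter ℂ q),
      ∑ m ∈ range N, ∑ l ∈ range N, α m * b l *
        (χ ((m * l : ℕ) : ZMod q) * logBump g X ((m * l : ℕ) : ℝ)) =
      ∑ j ∈ range J, ∑ m ∈ M j, ∑ l ∈ L j,
        α m / m * χ m * (b l / l * χ l) * g (Real.log m + Real.log l - X) := fun q χ => by
    have e1 : ∑ m ∈ range N, ∑ l ∈ range N, α m * b l *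
        (χ ((m * l : ℕ) : ZMod q) * logBump g X ((m * l : ℕ) : ℝ)) =
        ∑ m ∈ (range N).filter (fun m => m ≠ 0), ∑ l ∈ range N, α m * b l *
        (χ ((m * l : ℕ) : ZMod q) * logBump g X ((m * l : ℕ) : ℝ)) := by
      rw [sum_filter_of_ne]
      rintro m - hm rfl
      apply hm
      rw [hαU 0 (by push_cast; linarith)]
      simp
    have hmaps : ∀ m ∈ (range N).filter (fun m => m ≠ 0), Nat.log 2 m ∈ range J := fun m hm => by
      rw [mem_filter, mem_range] at hm
      exact mem_range.2 (Nat.lt_succ_of_le (Nat.log_mono_right hm.1.le))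
    rw [e1, ← sum_fiberwise_of_maps_to hmaps]
    refine sum_congr rfl fun j _ => ?_
    rw [filter_filter]
    refine sum_congr rfl fun m hm => ?_
    have hmp := hMprop j m hm
    have hm0 : (0 : ℝ) < m := lt_of_lt_of_le (by positivity) hmp.1
    have hLN : L j ⊆ range N := filter_subset _ _
    rw [← sum_subset hLN]
    · refine sum_congr rfl fun l hl => ?_
      rw [hLdef, mem_filter] at hl
      have hl0 : (0 : ℝ) < l := by
        rcases (Nat.cast_nonneg (α := ℝ) l).eq_or_lt with h0 | h0
        · have := hl.2.1
          rw [← h0, mul_zero] at this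
          linarith [Real.exp_pos (X - 1)]
        · exact h0
      rw [logBump]
      push_cast
      rw [Real.log_mul hm0.ne' hl0.ne', map_mul]
      have : (m : ℂ) ≠ 0 := by exact_mod_cast hm0.ne'
      have : (l : ℂ) ≠ 0 := by exact_mod_cast hl0.ne'
      field_simp
    · intro l hl hlL
      rcases Nat.eq_zero_or_pos l with rfl | hl0
      · simp [logBump]
      have hl0 : (0 : ℝ) < l := by exact_mod_cast hl0
      have : ¬ (Real.exp (X - 1) ≤ 2 * 2 ^ j * l ∧ 2 ^ j * l ≤ Real.exp (X + 1)) := fun h =>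
        hlL (mem_filter.2 ⟨hl, h⟩)
      rw [logBump_eq_zero hsupp (by push_cast; positivity), mul_zero, mul_zero]
      push_cast
      by_contra hcon
      push Not at hcon
      refine this ⟨?_, ?_⟩
      · nlinarith [hcon.1]
      · nlinarith [hcon.2]
  have hJX : (J : ℝ) ≤ 7 * X := by
    rcases Nat.eq_zero_or_pos N with rfl | hN0
    · simp [hJ]; linarith
    have h1 : ((2 : ℝ)) ^ Nat.log 2 N ≤ 2 * Real.exp (X + 1) :=
      le_trans (by exact_mod_cast Nat.pow_log_le_self 2 hN0.ne') hN
    have h2 := Real.log_le_log (by positivity) h1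
    rw [Real.log_pow, Real.log_mul (by norm_num) (Real.exp_pos _).ne', Real.log_exp] at h2
    have h3 := Real.log_two_gt_d9
    have h4 := Real.log_two_lt_d9
    have h5 : (0 : ℝ) ≤ Nat.log 2 N := Nat.cast_nonneg _
    push_cast [hJ]
    nlinarith
  calc _ ≤ ∑ q ∈ Icc 1 R, ∑ χ ∈ primitiveCharacters q, ∑ j ∈ range J, ‖∑ m ∈ M j, ∑ l ∈ L j,
        α m / m * χ m * (b l / l * χ l) * g (Real.log m + Real.log l - X)‖ :=
        sum_le_sum fun q _ => sum_le_sum fun χ _ => by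
          rw [hdecomp]; exact norm_sum_le _ _
    _ = ∑ j ∈ range J, ∑ q ∈ Icc 1 R, ∑ χ ∈ primitiveCharacters q, ‖∑ m ∈ M j, ∑ l ∈ L j,
        α m / m * χ m * (b l / l * χ l) * g (Real.log m + Real.log l - X)‖ := by
        rw [sum_comm]
        refine sum_congr rfl fun q _ => sum_comm
    _ ≤ ∑ j ∈ range J, 17000 * B * (1 + 2 * R / Real.sqrt U + 2 * R / Real.sqrt V +
          R ^ 2 * Real.exp (-X / 2)) * ∫ ξ, ‖h ξ‖ :=
        sum_le_sum fun j _ => sum_norm_dyadic_block_le h_integ0 hrep hR hU hV hB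
          (one_le_pow₀ (by norm_num)) hα hαU hb hbV (hMprop j)
          fun l hl => (mem_filter.1 hl).2
    _ = J * (17000 * B * (1 + 2 * R / Real.sqrt U + 2 * R / Real.sqrt V +
          R ^ 2 * Real.exp (-X / 2)) * ∫ ξ, ‖h ξ‖) := by simp
    _ ≤ (7 * X) * (17000 * B * (2 * (1 + R / Real.sqrt U + R / Real.sqrt V +
          R ^ 2 * Real.exp (-X / 2))) * ∫ ξ, ‖h ξ‖) := by
        have h1 : 1 + 2 * R / Real.sqrt U + 2 * R / Real.sqrt V + R ^ 2 * Real.exp (-X / 2) ≤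
          2 * (1 + R / Real.sqrt U + R / Real.sqrt V + R ^ 2 * Real.exp (-X / 2)) := by
          have : 0 ≤ (R : ℝ) ^ 2 * Real.exp (-X / 2) := by positivity
          rw [mul_div_assoc, mul_div_assoc]
          linarith
        refine mul_le_mul hJX ?_ (by positivity) (by positivity)
        refine mul_le_mul_of_nonneg_right ?_ hI
        exact mul_le_mul_of_nonneg_left h1 (by positivity)
    _ = _ := by ring

/-! ### Vaughan's identity -/

section Vaughan

open ArithmeticFunction
open scoped ArithmeticFunction.zeta ArithmeticFunction.Moebius

/-- The restriction of an arithmetic function to `n ≤ U`. -/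
noncomputable def ArithmeticFunction.lowPart (f : ArithmeticFunction ℝ) (U : ℕ) :
    ArithmeticFunction ℝ := ⟨fun n => if n ≤ U then f n else 0, by simp⟩

/-- The restriction of an arithmetic function to `n > U`. -/
noncomputable def ArithmeticFunction.highPart (f : ArithmeticFunction ℝ) (U : ℕ) :
    ArithmeticFunction ℝ := ⟨fun n => if n ≤ U then 0 else f n, by simp⟩

lemma ArithmeticFunction.lowPart_apply (f : ArithmeticFunction ℝ) (U n : ℕ) :
    f.lowPart U n = if n ≤ U then f n else 0 := rfl

lemma ArithmeticFunction.highPart_apply (f : ArithmeticFunction ℝ) (U n : ℕ) :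
    f.highPart U n = if n ≤ U then 0 else f n := rfl

lemma ArithmeticFunction.lowPart_add_highPart (f : ArithmeticFunction ℝ) (U : ℕ) :
    f.lowPart U + f.highPart U = f := by
  ext n
  rw [ArithmeticFunction.add_apply, lowPart_apply, highPart_apply]
  split_ifs <;> simp

/-- Vaughan's identity. -/
lemma vaughan_identity (U : ℕ) :
    vonMangoldt.highPart U = (μ : ArithmeticFunction ℝ).lowPart U * log -
      (μ : ArithmeticFunction ℝ).lowPart U * vonMangoldt.lowPart U * ζ +
      (μ : ArithmeticFunction ℝ).highPart U * (ζ * vonMangoldt.highPart U) := by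
  have h1 : (μ : ArithmeticFunction ℝ).highPart U =
      (μ : ArithmeticFunction ℝ) - (μ : ArithmeticFunction ℝ).lowPart U :=
    eq_sub_of_add_eq' (lowPart_add_highPart _ U)
  have h2 : vonMangoldt.lowPart U = vonMangoldt - vonMangoldt.highPart U := eq_sub_of_add_eq (lowPart_add_highPart _ U)
  have h3 : (μ : ArithmeticFunction ℝ) * (ζ : ArithmeticFunction ℝ) = 1 := coe_moebius_mul_coe_zeta
  rw [h1, h2, ← vonMangoldt_mul_zeta]
  calc vonMangoldt.highPart U = ((μ : ArithmeticFunction ℝ) * (ζ : ArithmeticFunction ℝ)) * vonMangoldt.highPart U := by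
        rw [h3, one_mul]
    _ = _ := by ring

lemma abs_sum_divisors_vonMangoldt_le {n : ℕ} {c : ℕ × ℕ → ℝ}
    (hc : ∀ p ∈ n.divisorsAntidiagonal, |c p| ≤ vonMangoldt p.2) :
    |∑ p ∈ n.divisorsAntidiagonal, c p| ≤ Real.log n := by
  refine (abs_sum_le_sum_abs _ _).trans ((sum_le_sum hc).trans (le_of_eq ?_))
  rw [← vonMangoldt_sum]
  exact Nat.sum_divisorsAntidiagonal' (fun _ j => vonMangoldt j)

lemma abs_lowPart_mul_lowPart_le (U n : ℕ) :
    |((μ : ArithmeticFunction ℝ).lowPart U * vonMangoldt.lowPart U) n| ≤ Real.log n := by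
  rw [ArithmeticFunction.mul_apply]
  refine abs_sum_divisors_vonMangoldt_le fun p _ => ?_
  rw [abs_mul, lowPart_apply, lowPart_apply]
  have h1 : |if p.1 ≤ U then ((μ : ArithmeticFunction ℝ) p.1) else 0| ≤ 1 := by
    split_ifs
    · rw [intCoe_apply]; exact_mod_cast abs_moebius_le_one
    · simp
  have h2 : |if p.2 ≤ U then vonMangoldt p.2 else 0| ≤ vonMangoldt p.2 := by
    split_ifs
    · rw [abs_of_nonneg vonMangoldt_nonneg]
    · simp
  calc _ ≤ 1 * vonMangoldt p.2 := mul_le_mul h1 h2 (abs_nonneg _) zero_le_one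
    _ = _ := one_mul _

lemma lowPart_mul_lowPart_eq_zero {U n : ℕ} (hn : U ^ 2 < n) :
    ((μ : ArithmeticFunction ℝ).lowPart U * vonMangoldt.lowPart U) n = 0 := by
  rw [ArithmeticFunction.mul_apply]
  refine sum_eq_zero fun p hp => ?_
  rw [lowPart_apply, lowPart_apply]
  have h := (Nat.mem_divisorsAntidiagonal.1 hp).1
  split_ifs with h1 h2
  · exfalso
    nlinarith [Nat.mul_le_mul h1 h2]
  all_goals simp

lemma abs_zeta_mul_highPart_le (U n : ℕ) :
    |((ζ : ArithmeticFunction ℝ) * vonMangoldt.highPart U) n| ≤ Real.log n := by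
  rw [ArithmeticFunction.mul_apply]
  refine abs_sum_divisors_vonMangoldt_le fun p _ => ?_
  rw [abs_mul, highPart_apply]
  have h1 : |((ζ : ArithmeticFunction ℝ) p.1)| ≤ 1 := by
    rw [natCoe_apply, zeta_apply]
    split_ifs <;> simp
  have h2 : |if p.2 ≤ U then 0 else vonMangoldt p.2| ≤ vonMangoldt p.2 := by
    split_ifs
    · simp
    · rw [abs_of_nonneg vonMangoldt_nonneg]
  calc _ ≤ 1 * vonMangoldt p.2 := mul_le_mul h1 h2 (abs_nonneg _) zero_le_one
    _ = _ := one_mul _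

lemma zeta_mul_highPart_eq_zero {U n : ℕ} (hn : n ≤ U) :
    ((ζ : ArithmeticFunction ℝ) * vonMangoldt.highPart U) n = 0 := by
  rw [ArithmeticFunction.mul_apply]
  refine sum_eq_zero fun p hp => ?_
  obtain ⟨h, h0⟩ := Nat.mem_divisorsAntidiagonal.1 hp
  rw [highPart_apply, if_pos, mul_zero]
  have : p.2 ≤ n := Nat.le_of_dvd (Nat.pos_of_ne_zero h0) (Dvd.intro_left _ h)
  omega

lemma abs_highPart_moebius_le_one (U n : ℕ) : |(μ : ArithmeticFunction ℝ).highPart U n| ≤ 1 := by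
  rw [highPart_apply]
  split_ifs
  · simp
  · rw [intCoe_apply]; exact_mod_cast abs_moebius_le_one

set_option maxHeartbeats 1000000 in
/-- The type I part of Vaughan's identity. -/
lemma norm_sum_character_typeI_le {g : ℝ → ℂ} (hg : ContDiff ℝ (⊤ : ℕ∞) g)
    (hc : HasCompactSupport g) (hsupp : ∀ u, 1 < |u| → g u = 0) : ∃ C : ℝ, 0 ≤ C ∧ ∀ X : ℝ, 1 ≤ X →
    ∀ r : ℕ, 1 ≤ r → ∀ χ : DirichletCharacter ℂ r, χ ≠ 1 → ∀ U N : ℕ, 1 ≤ U →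
    (U : ℝ) ^ 2 ≤ Real.exp X → (∀ n : ℕ, N ≤ n → logBump g X n = 0) →
    ‖∑ n ∈ range N, (((μ : ArithmeticFunction ℝ).lowPart U * log -
      (μ : ArithmeticFunction ℝ).lowPart U * vonMangoldt.lowPart U * ζ) n : ℝ) *
        (χ n * logBump g X n)‖ ≤ C * X * U ^ 2 * r * Real.exp (-X) := by
  have hg' : ContDiff ℝ (⊤ : ℕ∞) fun u : ℝ => (u : ℂ) * g u :=
    Complex.ofRealCLM.contDiff.mul hg
  obtain ⟨C₁, hC₁, h₁⟩ := norm_sum_character_logBump_le hg hc hsupp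
  obtain ⟨C₂, hC₂, h₂⟩ := norm_sum_character_logBump_le hg' hc.mul_left
    (fun u hu => by rw [hsupp u hu, mul_zero])
  refine ⟨5 * C₁ + 2 * C₂, by positivity, ?_⟩
  intro X hX r hr χ hχ U N hU hUX hN
  have hU1 : (1 : ℝ) ≤ U := by exact_mod_cast hU
  have hF : ∀ k, N ≤ k → χ k * logBump g X k = 0 := fun k hk => by rw [hN k hk, mul_zero]
  set E := (r : ℝ) * Real.exp (-X) with hE
  have hE0 : 0 ≤ E := by positivity
  have hlogU : ∀ m : ℕ, m ≤ U ^ 2 → Real.log m ≤ X := fun m hm => by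
    rcases Nat.eq_zero_or_pos m with rfl | h0
    · simp; linarith
    rw [Real.log_le_iff_le_exp (by exact_mod_cast h0)]
    exact le_trans (by exact_mod_cast hm) hUX
  have hpart1 : ‖∑ n ∈ range N, (((μ : ArithmeticFunction ℝ).lowPart U * log) n : ℝ) *
      (χ n * logBump g X n)‖ ≤ (4 * C₁ + 2 * C₂) * X * U ^ 2 * E := by
    rw [sum_range_mul_convolution hF]
    have hin : ∀ m ∈ range N, ‖∑ l ∈ range N, (((μ : ArithmeticFunction ℝ).lowPart U m : ℝ) : ℂ) *
        (log l : ℝ) * (χ ((m * l : ℕ) : ZMod r) * logBump g X ((m * l : ℕ) : ℝ))‖ ≤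
        if m ≤ U then (2 * C₁ + C₂) * X * E else 0 := fun m hm => by
      rw [lowPart_apply]
      split_ifs with hmU
      · rcases Nat.eq_zero_or_pos m with rfl | hm0
        · simp only [ArithmeticFunction.map_zero, Complex.ofReal_zero, zero_mul, sum_const_zero, norm_zero]
          positivity
        simp_rw [mul_assoc]
        rw [← mul_sum, norm_mul]
        have hmu : ‖(((μ : ArithmeticFunction ℝ) m : ℝ) : ℂ)‖ ≤ 1 := by
          rw [Complex.norm_real, intCoe_apply, Real.norm_eq_abs]
          exact_mod_cast abs_moebius_le_one
        have hid : ∑ l ∈ range N, ((log l : ℝ) : ℂ) *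
            (χ ((m * l : ℕ) : ZMod r) * logBump g X ((m * l : ℕ) : ℝ)) =
            ((X : ℂ) - Real.log m) *
              ∑ l ∈ range N, χ ((m * l : ℕ) : ZMod r) * logBump g X ((m * l : ℕ) : ℝ) +
            ∑ l ∈ range N, χ ((m * l : ℕ) : ZMod r) *
              logBump (fun u : ℝ => (u : ℂ) * g u) X ((m * l : ℕ) : ℝ) := by
          rw [mul_sum, ← sum_add_distrib]
          refine sum_congr rfl fun l _ => ?_
          rcases Nat.eq_zero_or_pos l with rfl | hl0
          · simp [logBump]
          rw [logBump, logBump, log_apply]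
          have e : Real.log ((m * l : ℕ) : ℝ) = Real.log m + Real.log l := by
            push_cast
            exact Real.log_mul (by exact_mod_cast hm0.ne') (by exact_mod_cast hl0.ne')
          rw [e]
          push_cast
          ring
        rw [hid]
        have hm1 : (1 : ℝ) ≤ m := by exact_mod_cast hm0
        have hlog0 := Real.log_nonneg hm1
        have hlogX := hlogU m (hmU.trans (Nat.le_self_pow (by norm_num) U))
        have hn1 : ‖(X : ℂ) - Real.log m‖ ≤ X := by
          rw [← Complex.ofReal_sub, Complex.norm_real, Real.norm_of_nonneg (by linarith)]
          linarith
        have k1 := h₁ X r hr χ hχ m hm0 N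
        have k2 := h₂ X r hr χ hχ m hm0 N
        rw [mul_assoc, ← hE] at k1 k2
        calc _ ≤ 1 * (X * (C₁ * E) + C₂ * E) := by
              refine mul_le_mul hmu ?_ (norm_nonneg _) zero_le_one
              refine (norm_add_le _ _).trans (add_le_add ?_ k2)
              rw [norm_mul]
              exact mul_le_mul hn1 k1 (norm_nonneg _) (by linarith)
          _ ≤ _ := by
              have : 0 ≤ C₁ * E * X := by positivity
              have : 0 ≤ C₂ * E := by positivity
              nlinarith
      · simp
    refine (norm_sum_le_of_le _ hin).trans ?_
    rw [← sum_filter, sum_const, nsmul_eq_mul]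
    have hcard : (((range N).filter fun m => m ≤ U).card : ℝ) ≤ 2 * U ^ 2 := by
      have : ((range N).filter fun m => m ≤ U).card ≤ (range (U + 1)).card :=
        card_le_card fun m hm => by
          rw [mem_filter] at hm
          exact mem_range.2 (by omega)
      rw [card_range] at this
      have : (((range N).filter fun m => m ≤ U).card : ℝ) ≤ U + 1 := by exact_mod_cast this
      nlinarith
    calc _ ≤ (2 * (U : ℝ) ^ 2) * ((2 * C₁ + C₂) * X * E) := by gcongr
      _ = _ := by ring
  have hpart2 : ‖∑ n ∈ range N, (((μ : ArithmeticFunction ℝ).lowPart U * vonMangoldt.lowPart U *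
      (ζ : ArithmeticFunction ℝ)) n : ℝ) * (χ n * logBump g X n)‖ ≤ C₁ * X * U ^ 2 * E := by
    rw [sum_range_mul_convolution hF]
    have hin : ∀ m ∈ range N, ‖∑ l ∈ range N,
        ((((μ : ArithmeticFunction ℝ).lowPart U * vonMangoldt.lowPart U) m : ℝ) : ℂ) *
        ((ζ : ArithmeticFunction ℝ) l : ℝ) *
          (χ ((m * l : ℕ) : ZMod r) * logBump g X ((m * l : ℕ) : ℝ))‖ ≤
        if m ∈ Icc 1 (U ^ 2) then C₁ * X * E else 0 := fun m hm => by
      split_ifs with hmU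
      · rw [mem_Icc] at hmU
        have hid : ∑ l ∈ range N,
            ((((μ : ArithmeticFunction ℝ).lowPart U * vonMangoldt.lowPart U) m : ℝ) : ℂ) *
            ((ζ : ArithmeticFunction ℝ) l : ℝ) *
            (χ ((m * l : ℕ) : ZMod r) * logBump g X ((m * l : ℕ) : ℝ)) =
            ((((μ : ArithmeticFunction ℝ).lowPart U * vonMangoldt.lowPart U) m : ℝ) : ℂ) *
            ∑ l ∈ range N, χ ((m * l : ℕ) : ZMod r) * logBump g X ((m * l : ℕ) : ℝ) := by
          rw [mul_sum]
          refine sum_congr rfl fun l _ => ?_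
          rcases Nat.eq_zero_or_pos l with rfl | hl0
          · simp [logBump]
          rw [natCoe_apply, zeta_apply, if_neg hl0.ne']
          simp
        rw [hid, norm_mul, Complex.norm_real, Real.norm_eq_abs]
        have k1 := h₁ X r hr χ hχ m hmU.1 N
        rw [mul_assoc, ← hE] at k1
        calc _ ≤ X * (C₁ * E) := mul_le_mul
              ((abs_lowPart_mul_lowPart_le U m).trans (hlogU m hmU.2)) k1 (norm_nonneg _)
              (by linarith)
          _ = _ := by ring
      · rw [mem_Icc, not_and_or] at hmU
        have : ((μ : ArithmeticFunction ℝ).lowPart U * vonMangoldt.lowPart U) m = 0 := by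
          rcases hmU with h | h
          · rw [show m = 0 by omega]; simp
          · exact lowPart_mul_lowPart_eq_zero (by omega)
        simp [this]
    refine (norm_sum_le_of_le _ hin).trans ?_
    rw [← sum_filter, sum_const, nsmul_eq_mul]
    have hcard : (((range N).filter fun m => m ∈ Icc 1 (U ^ 2)).card : ℝ) ≤ U ^ 2 := by
      have : ((range N).filter fun m => m ∈ Icc 1 (U ^ 2)).card ≤ (Icc 1 (U ^ 2)).card :=
        card_le_card fun m hm => (mem_filter.1 hm).2
      rw [Nat.card_Icc, Nat.add_sub_cancel] at this
      exact_mod_cast this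
    calc _ ≤ (U : ℝ) ^ 2 * (C₁ * X * E) := by gcongr
      _ = _ := by ring
  have hsplit : ∑ n ∈ range N, (((μ : ArithmeticFunction ℝ).lowPart U * log -
      (μ : ArithmeticFunction ℝ).lowPart U * vonMangoldt.lowPart U * ζ) n : ℝ) *
        (χ n * logBump g X n) =
      ∑ n ∈ range N, (((μ : ArithmeticFunction ℝ).lowPart U * log) n : ℝ) *
        (χ n * logBump g X n) -
      ∑ n ∈ range N, (((μ : ArithmeticFunction ℝ).lowPart U * vonMangoldt.lowPart U *
      (ζ : ArithmeticFunction ℝ)) n : ℝ) * (χ n * logBump g X n) := by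
    rw [← sum_sub_distrib]
    refine sum_congr rfl fun n _ => ?_
    rw [sub_eq_add_neg, ArithmeticFunction.add_apply, ArithmeticFunction.neg_apply]
    push_cast
    ring
  rw [hsplit]
  refine (norm_sub_le _ _).trans ((add_le_add hpart1 hpart2).trans (le_of_eq ?_))
  rw [hE]
  ring

/-- The smoothly weighted sum of `χ(n)Λ(n)/n` over `n ≈ exp X`. -/
noncomputable def vonMangoldtSum (g : ℝ → ℂ) (X : ℝ) {q : ℕ} (χ : DirichletCharacter ℂ q) : ℂ :=
  ∑ n ∈ range (⌊Real.exp (X + 1)⌋₊ + 1), (vonMangoldt n : ℂ) * (χ n * logBump g X n)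

lemma ne_one_of_mem_primitiveCharacters {q : ℕ} (hq : 2 ≤ q) {χ : DirichletCharacter ℂ q}
    (hχ : χ ∈ primitiveCharacters q) : χ ≠ 1 := by
  have : NeZero q := ⟨by omega⟩
  rintro rfl
  have := (mem_primitiveCharacters (by omega)).1 hχ
  rw [DirichletCharacter.isPrimitive_def, DirichletCharacter.conductor_one] at this
  omega

lemma card_primitiveCharacters_le {q : ℕ} : (primitiveCharacters q).card ≤ q.totient := by
  rcases eq_or_ne q 0 with rfl | hq
  · simp [primitiveCharacters]
  have : NeZero q := ⟨hq⟩
  refine (card_le_univ _).trans (le_of_eq ?_)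
  rw [← Nat.card_eq_fintype_card]
  exact DirichletCharacter.card_eq_totient_of_hasEnoughRootsOfUnity ℂ q

lemma logBump_natCast_eq_zero {g : ℝ → ℂ} (hsupp : ∀ u, 1 < |u| → g u = 0) {X : ℝ} {n : ℕ}
    (hn : ⌊Real.exp (X + 1)⌋₊ + 1 ≤ n) : logBump g X n = 0 := by
  have h : Real.exp (X + 1) < n := Nat.lt_of_floor_lt (by omega)
  exact logBump_eq_zero hsupp ((Real.exp_pos _).trans h) (Or.inr h)

/-- Mean value estimate for sums over primes twisted by primitive characters. -/
theorem sum_norm_vonMangoldtSum_le {g : ℝ → ℂ} (hg : ContDiff ℝ (⊤ : ℕ∞) g)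
    (hc : HasCompactSupport g) (hsupp : ∀ u, 1 < |u| → g u = 0) : ∃ C : ℝ, 0 ≤ C ∧ ∀ X : ℝ, 1 ≤ X →
    ∀ U R : ℕ, 1 ≤ U → 1 ≤ R → (U : ℝ) ^ 2 ≤ Real.exp X → (U : ℝ) < Real.exp (X - 1) →
    ∑ q ∈ Icc 2 R, ∑ χ ∈ primitiveCharacters q, ‖vonMangoldtSum g X χ‖ ≤
      C * X ^ 2 * (1 + R / Real.sqrt U + R ^ 2 * Real.exp (-X / 2) +
        R ^ 3 * U ^ 2 * Real.exp (-X)) := by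
  obtain ⟨C₁, hC₁, h₁⟩ := norm_sum_character_typeI_le hg hc hsupp
  obtain ⟨C₂, hC₂, h₂⟩ := sum_norm_typeII_le hg hc hsupp
  refine ⟨C₁ + 4 * C₂, by positivity, ?_⟩
  intro X hX U R hU hR hUX hUX'
  set N := ⌊Real.exp (X + 1)⌋₊ + 1 with hN
  have hU1 : (1 : ℝ) ≤ U := by exact_mod_cast hU
  have hNX : (N : ℝ) ≤ 2 * Real.exp (X + 1) := by
    have h1 := Nat.floor_le (Real.exp_pos (X + 1)).le
    have h2 := Real.one_le_exp (show 0 ≤ X + 1 by linarith)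
    push_cast [hN]
    linarith
  set α : ℕ → ℂ := fun m => (((μ : ArithmeticFunction ℝ).highPart U m : ℝ) : ℂ) with hα
  set b : ℕ → ℂ := fun l => ((((ζ : ArithmeticFunction ℝ) * vonMangoldt.highPart U) l : ℝ) : ℂ)
    with hb
  have hII := h₂ X U U (2 * X) R N α b hX hU1 hU1 (by linarith) hR hNX
    (fun m => by
      rw [hα, Complex.norm_real, Real.norm_eq_abs]; exact abs_highPart_moebius_le_one U m)
    (fun m hm => by
      have hm' : m ≤ U := by exact_mod_cast hm
      simp only [hα, highPart_apply, if_pos hm', Complex.ofReal_zero])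
    (fun l hl => by
      rw [hb, Complex.norm_real, Real.norm_eq_abs]
      refine (abs_zeta_mul_highPart_le U l).trans ?_
      rcases Nat.eq_zero_or_pos l with rfl | hl0
      · simp; linarith
      have := (Real.log_le_iff_le_exp (by exact_mod_cast hl0)).2 hl
      linarith)
    (fun l hl => by
      have hl' : l ≤ U := by exact_mod_cast hl
      simp only [hb, zeta_mul_highPart_eq_zero hl', Complex.ofReal_zero])
  have hterm : ∀ q ∈ Icc 2 R, ∀ χ ∈ primitiveCharacters q, ‖vonMangoldtSum g X χ‖ ≤
      C₁ * X * U ^ 2 * R * Real.exp (-X) + ‖∑ m ∈ range N, ∑ l ∈ range N, α m * b l *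
        (χ ((m * l : ℕ) : ZMod q) * logBump g X ((m * l : ℕ) : ℝ))‖ := fun q hq χ hχ => by
    rw [mem_Icc] at hq
    have hF : ∀ k, N ≤ k → χ k * logBump g X k = 0 := fun k hk => by
      rw [logBump_natCast_eq_zero hsupp hk, mul_zero]
    have hI := h₁ X hX q (by omega) χ (ne_one_of_mem_primitiveCharacters hq.1 hχ) U N hU hUX
      fun n hn => logBump_natCast_eq_zero hsupp hn
    have e : vonMangoldtSum g X χ = ∑ n ∈ range N, (((μ : ArithmeticFunction ℝ).lowPart U * log -
        (μ : ArithmeticFunction ℝ).lowPart U * vonMangoldt.lowPart U * ζ) n : ℝ) *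
        (χ n * logBump g X n) + ∑ m ∈ range N, ∑ l ∈ range N, α m * b l *
        (χ ((m * l : ℕ) : ZMod q) * logBump g X ((m * l : ℕ) : ℝ)) := by
      rw [← sum_range_mul_convolution hF ((μ : ArithmeticFunction ℝ).highPart U)
        ((ζ : ArithmeticFunction ℝ) * vonMangoldt.highPart U), ← sum_add_distrib, vonMangoldtSum]
      refine sum_congr rfl fun n hn => ?_
      rw [← add_mul, ← Complex.ofReal_add, ← ArithmeticFunction.add_apply, ← vaughan_identity,
        highPart_apply]
      split_ifs with hnU
      · have : logBump g X n = 0 := by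
          rcases Nat.eq_zero_or_pos n with rfl | hn0
          · simp [logBump]
          · exact logBump_eq_zero hsupp (by exact_mod_cast hn0)
              (Or.inl (lt_of_le_of_lt (by exact_mod_cast hnU) hUX'))
        rw [this]
        simp
      · rfl
    rw [e]
    refine (norm_add_le _ _).trans (add_le_add (hI.trans ?_) le_rfl)
    have : (q : ℝ) ≤ R := by exact_mod_cast hq.2
    gcongr
  have hR0 : (0 : ℝ) ≤ R := Nat.cast_nonneg R
  calc _ ≤ ∑ q ∈ Icc 2 R, ∑ χ ∈ primitiveCharacters q, (C₁ * X * U ^ 2 * R * Real.exp (-X) +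
        ‖∑ m ∈ range N, ∑ l ∈ range N, α m * b l *
        (χ ((m * l : ℕ) : ZMod q) * logBump g X ((m * l : ℕ) : ℝ))‖) :=
        sum_le_sum fun q hq => sum_le_sum (hterm q hq)
    _ = ∑ q ∈ Icc 2 R, ((primitiveCharacters q).card * (C₁ * X * U ^ 2 * R * Real.exp (-X))) +
        ∑ q ∈ Icc 2 R, ∑ χ ∈ primitiveCharacters q, ‖∑ m ∈ range N, ∑ l ∈ range N, α m * b l *
        (χ ((m * l : ℕ) : ZMod q) * logBump g X ((m * l : ℕ) : ℝ))‖ := by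
        rw [← sum_add_distrib]
        refine sum_congr rfl fun q _ => ?_
        rw [sum_add_distrib, sum_const, nsmul_eq_mul]
    _ ≤ R * (R * (C₁ * X * U ^ 2 * R * Real.exp (-X))) +
        C₂ * X * (2 * X) * (1 + R / Real.sqrt U + R / Real.sqrt U +
          R ^ 2 * Real.exp (-X / 2)) := by
        refine add_le_add ?_ (le_trans (sum_le_sum_of_subset_of_nonneg
          (Icc_subset_Icc_left (by norm_num)) fun _ _ _ => sum_nonneg fun _ _ => norm_nonneg _) hII)
        have h3 : ∀ q ∈ Icc 2 R, ((primitiveCharacters q).card : ℝ) *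
            (C₁ * X * U ^ 2 * R * Real.exp (-X)) ≤ R * (C₁ * X * U ^ 2 * R * Real.exp (-X)) :=
          fun q hq => by
            have : ((primitiveCharacters q).card : ℝ) ≤ R := by
              exact_mod_cast card_primitiveCharacters_le.trans
                ((Nat.totient_le q).trans (mem_Icc.1 hq).2)
            gcongr
        refine (sum_le_card_nsmul _ _ _ h3).trans ?_
        rw [nsmul_eq_mul, Nat.card_Icc]
        have : ((R + 1 - 2 : ℕ) : ℝ) ≤ R := by exact_mod_cast (by omega : R + 1 - 2 ≤ R)
        gcongr
    _ ≤ _ := by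
        have e1 : 0 ≤ (R : ℝ) / Real.sqrt U := by positivity
        have e2 : 0 ≤ (R : ℝ) ^ 2 * Real.exp (-X / 2) := by positivity
        have e3 : 0 ≤ (R : ℝ) ^ 3 * U ^ 2 * Real.exp (-X) := by positivity
        have f1 : (R : ℝ) * (R * (C₁ * X * U ^ 2 * R * Real.exp (-X))) ≤
            C₁ * X ^ 2 * ((R : ℝ) ^ 3 * U ^ 2 * Real.exp (-X)) := by
          have : C₁ * X * ((R : ℝ) ^ 3 * U ^ 2 * Real.exp (-X)) ≤
            C₁ * X ^ 2 * ((R : ℝ) ^ 3 * U ^ 2 * Real.exp (-X)) := by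
            refine mul_le_mul_of_nonneg_right ?_ e3
            refine mul_le_mul_of_nonneg_left ?_ hC₁
            nlinarith
          refine le_trans (le_of_eq ?_) this
          ring
        have g1 : 0 ≤ C₁ * X ^ 2 := by positivity
        have g2 : 0 ≤ C₂ * X ^ 2 := by positivity
        generalize (R : ℝ) / Real.sqrt U = s at *
        generalize (R : ℝ) ^ 2 * Real.exp (-X / 2) = t at *
        generalize (R : ℝ) ^ 3 * U ^ 2 * Real.exp (-X) = w at *
        have k1 : C₂ * X * (2 * X) * (1 + s + s + t) ≤ 4 * (C₂ * X ^ 2) * (1 + s + t + w) := by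
          have : 0 ≤ (C₂ * X ^ 2) * (2 + 2 * t + 4 * w) := by positivity
          nlinarith
        have k2 : 0 ≤ C₁ * X ^ 2 * (1 + s + t) := by positivity
        nlinarith

end Vaughan

/-! ### Averages over primitive characters -/

lemma exists_pow_card_primeFactors_le (c : ℝ) (hc : 1 ≤ c) {δ : ℝ} (hδ : 0 < δ) :
    ∃ C : ℝ, 0 < C ∧ ∀ n : ℕ, n ≠ 0 → c ^ n.primeFactors.card ≤ C * (n : ℝ) ^ δ := by
  set P₀ := ⌈c ^ (1 / δ)⌉₊ with hP₀
  refine ⟨c ^ P₀, by positivity, fun n hn => ?_⟩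
  have hp : ∀ p : ℕ, P₀ ≤ p → c ≤ (p : ℝ) ^ δ := fun p hp => by
    have h1 : c ^ (1 / δ) ≤ p := (Nat.le_ceil _).trans (by exact_mod_cast hp)
    have h2 := Real.rpow_le_rpow (by positivity) h1 hδ.le
    rwa [← Real.rpow_mul (by linarith), one_div, inv_mul_cancel₀ hδ.ne', Real.rpow_one] at h2
  rw [← prod_const, ← prod_filter_mul_prod_filter_not n.primeFactors (fun p => p < P₀)]
  refine mul_le_mul ?_ ?_ (prod_nonneg fun _ _ => by linarith) (by positivity)
  · rw [prod_const]
    refine pow_le_pow_right₀ hc ?_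
    calc _ ≤ (range P₀).card := card_le_card fun p hp => mem_range.2 (mem_filter.1 hp).2
      _ = P₀ := card_range _
  · calc _ ≤ ∏ p ∈ n.primeFactors with ¬ p < P₀, (p : ℝ) ^ δ := by
          refine prod_le_prod (fun _ _ => by linarith) fun p hp' => hp p ?_
          exact not_lt.1 (mem_filter.1 hp').2
      _ ≤ ∏ p ∈ n.primeFactors, (p : ℝ) ^ δ := by
          refine prod_le_prod_of_subset_of_one_le (filter_subset _ _) (fun _ _ => by positivity)
            fun p hp' _ => Real.one_le_rpow ?_ hδ.le
          exact_mod_cast (Nat.prime_of_mem_primeFactors hp').one_lt.le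
      _ = ((∏ p ∈ n.primeFactors, p : ℕ) : ℝ) ^ δ := by
          rw [Real.finsetProd_rpow _ _ fun _ _ => Nat.cast_nonneg _]
          push_cast
          rfl
      _ ≤ _ := by
          refine Real.rpow_le_rpow (Nat.cast_nonneg _) ?_ hδ.le
          exact_mod_cast Nat.le_of_dvd (Nat.pos_of_ne_zero hn) (Nat.prod_primeFactors_dvd n)

lemma natCast_le_two_pow_mul_totient (n : ℕ) : (n : ℝ) ≤ 2 ^ n.primeFactors.card * n.totient := by
  have h : (n.totient : ℝ) = n * ∏ p ∈ n.primeFactors, (1 - (p : ℝ)⁻¹) := by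
    have := Nat.totient_eq_mul_prod_factors n
    have h2 := congrArg (Rat.cast (K := ℝ)) this
    push_cast at h2
    exact h2
  have h3 : 1 ≤ 2 ^ n.primeFactors.card * ∏ p ∈ n.primeFactors, (1 - (p : ℝ)⁻¹) := by
    rw [← prod_const, ← prod_mul_distrib]
    refine Finset.one_le_prod fun p hp => ?_
    have h2 : (2 : ℝ) ≤ p := by exact_mod_cast (Nat.prime_of_mem_primeFactors hp).two_le
    have := inv_anti₀ (by norm_num) h2
    norm_num at this ⊢
    linarith
  rw [h]
  calc (n : ℝ) = n * 1 := (mul_one _).symm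
    _ ≤ n * (2 ^ n.primeFactors.card * ∏ p ∈ n.primeFactors, (1 - (p : ℝ)⁻¹)) :=
        mul_le_mul_of_nonneg_left h3 (Nat.cast_nonneg _)
    _ = _ := by ring

lemma exists_three_pow_div_totient_le {δ : ℝ} (hδ : 0 < δ) : ∃ C : ℝ, 0 < C ∧ ∀ n : ℕ, n ≠ 0 →
    (3 : ℝ) ^ n.primeFactors.card / n.totient ≤ C * (n : ℝ) ^ (δ - 1) := by
  obtain ⟨C, hC, h⟩ := exists_pow_card_primeFactors_le 6 (by norm_num) hδ
  refine ⟨C, hC, fun n hn => ?_⟩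
  have hn0 : (0 : ℝ) < n := by exact_mod_cast Nat.pos_of_ne_zero hn
  have ht : (0 : ℝ) < n.totient := by exact_mod_cast Nat.totient_pos.2 (Nat.pos_of_ne_zero hn)
  rw [div_le_iff₀ ht, Real.rpow_sub_one hn0.ne']
  have h1 := natCast_le_two_pow_mul_totient n
  have h2 := h n hn
  rw [show (6 : ℝ) = 3 * 2 by norm_num, mul_pow] at h2
  have h3 : (0 : ℝ) < 3 ^ n.primeFactors.card := by positivity
  rw [mul_div_assoc', div_mul_eq_mul_div, le_div_iff₀ hn0]
  calc _ ≤ (3 : ℝ) ^ n.primeFactors.card * (2 ^ n.primeFactors.card * n.totient) := by gcongr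
    _ = (3 : ℝ) ^ n.primeFactors.card * 2 ^ n.primeFactors.card * n.totient := by ring
    _ ≤ _ := by gcongr

/-- Dyadic summation: a sum weighted by a decreasing power. -/
lemma sum_rpow_mul_le_dyadic {w b : ℕ → ℝ} {C κ E Y : ℝ} {D : ℕ} (hC : 0 ≤ C)
    (hE0 : 0 ≤ E) (hκ : 0 ≤ κ) (hκ1 : κ ≤ 1)
    (hw : ∀ r, r ≠ 0 → w r ≤ C * (r : ℝ) ^ (-κ)) (hb : ∀ r, 0 ≤ b r)
    (hE : ∀ R : ℕ, Y ≤ R → R ≤ 2 * D → ∑ r ∈ Icc 2 R, b r ≤ E * (R : ℝ) ^ κ) :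
    ∑ r ∈ (Icc 2 D).filter (fun r : ℕ => Y < r), w r * b r ≤ (Nat.log 2 D + 1) * (2 * C * E) := by
  have hmaps : ∀ r ∈ (Icc 2 D).filter (fun r : ℕ => Y < r), Nat.log 2 r ∈ range (Nat.log 2 D + 1) :=
    fun r hr => mem_range.2 (Nat.lt_succ_of_le (Nat.log_mono_right
      (mem_Icc.1 (mem_filter.1 hr).1).2))
  rw [← sum_fiberwise_of_maps_to hmaps]
  have hblock : ∀ j ∈ range (Nat.log 2 D + 1), ∑ r ∈ (Icc 2 D).filter (fun r : ℕ => Y < r) with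
      Nat.log 2 r = j, w r * b r ≤ 2 * C * E := fun j hj => by
    have hj' : j ≤ Nat.log 2 D := by have := mem_range.1 hj; omega
    rcases (((Icc 2 D).filter (fun r : ℕ => Y < r)).filter
      (fun r => Nat.log 2 r = j)).eq_empty_or_nonempty with h0 | ⟨r₀, hr₀⟩
    · rw [h0, sum_empty]
      positivity
    simp only [mem_filter, mem_Icc] at hr₀
    have hlt : ∀ r, Nat.log 2 r = j → r < 2 ^ (j + 1) := fun r hr => by
      rw [← hr]; exact Nat.lt_pow_succ_log_self (by norm_num) r
    have hge : ∀ r, r ≠ 0 → Nat.log 2 r = j → 2 ^ j ≤ r := fun r h0 hr => by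
      rw [← hr]; exact Nat.pow_log_le_self 2 h0
    have hYR : Y ≤ ((2 ^ (j + 1) : ℕ) : ℝ) := by
      have := hlt r₀ hr₀.2
      exact hr₀.1.2.le.trans (by exact_mod_cast this.le)
    have hRD : 2 ^ (j + 1) ≤ 2 * D := by
      have := hge r₀ (by omega) hr₀.2
      rw [pow_succ]; omega
    have hsum := hE _ hYR hRD
    have hpos : (0 : ℝ) < 2 ^ j := by positivity
    calc _ ≤ ∑ r ∈ (Icc 2 D).filter (fun r : ℕ => Y < r) with Nat.log 2 r = j,
          C * ((2 : ℝ) ^ j) ^ (-κ) * b r := sum_le_sum fun r hr => by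
          simp only [mem_filter, mem_Icc] at hr
          refine mul_le_mul_of_nonneg_right ((hw r (by omega)).trans ?_) (hb r)
          refine mul_le_mul_of_nonneg_left ?_ hC
          refine Real.rpow_le_rpow_of_nonpos hpos ?_ (by linarith)
          exact_mod_cast hge r (by omega) hr.2
      _ ≤ C * ((2 : ℝ) ^ j) ^ (-κ) * ∑ r ∈ Icc 2 (2 ^ (j + 1)), b r := by
          rw [← mul_sum]
          refine mul_le_mul_of_nonneg_left ?_ (by positivity)
          refine sum_le_sum_of_subset_of_nonneg (fun r hr => ?_) fun r _ _ => hb r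
          simp only [mem_filter, mem_Icc] at hr ⊢
          exact ⟨hr.1.1.1, (hlt r hr.2).le⟩
      _ ≤ C * ((2 : ℝ) ^ j) ^ (-κ) * (E * ((2 ^ (j + 1) : ℕ) : ℝ) ^ κ) := by gcongr
      _ = 2 ^ κ * C * E := by
          push_cast
          rw [pow_succ, Real.mul_rpow hpos.le (by norm_num), Real.rpow_neg hpos.le]
          have : ((2 : ℝ) ^ j) ^ κ ≠ 0 := by positivity
          field_simp
      _ ≤ _ := by
          have : (2 : ℝ) ^ κ ≤ 2 := by
            calc (2 : ℝ) ^ κ ≤ 2 ^ (1 : ℝ) := Real.rpow_le_rpow_of_exponent_le (by norm_num) hκ1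
              _ = 2 := Real.rpow_one 2
          gcongr
  refine (sum_le_card_nsmul _ _ _ hblock).trans (le_of_eq ?_)
  rw [card_range, nsmul_eq_mul]
  push_cast
  ring

/-- The weight `3 ^ ω(r) / φ(r)` attached to the modulus `r`. -/
noncomputable def modulusWeight (r : ℕ) : ℝ := (3 : ℝ) ^ r.primeFactors.card / r.totient

lemma modulusWeight_nonneg (r : ℕ) : 0 ≤ modulusWeight r := by
  unfold modulusWeight; positivity

lemma natLog_floor_exp_le {X : ℝ} (hX : 0 ≤ X) : (Nat.log 2 ⌊Real.exp (11 / 25 * X)⌋₊ : ℝ) ≤ X := by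
  set D := ⌊Real.exp (11 / 25 * X)⌋₊
  rcases Nat.eq_zero_or_pos D with h0 | hD
  · rw [h0]; simpa using hX
  have h1 : (2 : ℝ) ^ Nat.log 2 D ≤ Real.exp (11 / 25 * X) :=
    le_trans (by exact_mod_cast Nat.pow_log_le_self 2 hD.ne') (Nat.floor_le (Real.exp_pos _).le)
  have h2 := Real.log_le_log (by positivity) h1
  rw [Real.log_pow, Real.log_exp] at h2
  have h3 := Real.log_two_gt_d9
  have h5 : (0 : ℝ) ≤ Nat.log 2 D := Nat.cast_nonneg _
  nlinarith

lemma sum_norm_vonMangoldtSum_le_rpow {g : ℝ → ℂ} (hg : ContDiff ℝ (⊤ : ℕ∞) g)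
    (hc : HasCompactSupport g) (hsupp : ∀ u, 1 < |u| → g u = 0) : ∃ C : ℝ, 0 ≤ C ∧
    ∀ X : ℝ, 40 ≤ X → ∀ A R : ℕ, X ^ (2 * A) ≤ R → (R : ℝ) ≤ 2 * Real.exp (11 / 25 * X) →
    ∑ q ∈ Icc 2 R, ∑ χ ∈ primitiveCharacters q, ‖vonMangoldtSum g X χ‖ ≤
      C * X ^ 2 * (1 / X ^ A + 16 * Real.exp (-X / 200)) * (R : ℝ) ^ (99 / 100 : ℝ) := by
  obtain ⟨C, hC, h⟩ := sum_norm_vonMangoldtSum_le hg hc hsupp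
  refine ⟨C, hC, fun X hX A R hR hRX => ?_⟩
  have hX0 : 0 < X := by linarith
  have hR1 : (1 : ℝ) ≤ R := (one_le_pow₀ (by linarith)).trans hR
  set U := ⌊Real.exp (X / 40)⌋₊ with hU
  have hexp : 2 ≤ Real.exp (X / 40) := by
    have := Real.add_one_le_exp (X / 40); linarith
  have hU1 : (U : ℝ) ≤ Real.exp (X / 40) := Nat.floor_le (Real.exp_pos _).le
  have hU2 : Real.exp (X / 40) / 4 ≤ U := by
    have := Nat.lt_floor_add_one (Real.exp (X / 40)); linarith
  have hU3 : 1 ≤ U := Nat.le_floor (by push_cast; linarith)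
  have hUX : (U : ℝ) ^ 2 ≤ Real.exp (X / 20) := by
    calc (U : ℝ) ^ 2 ≤ Real.exp (X / 40) ^ 2 := by gcongr
      _ = _ := by rw [← Real.exp_nat_mul]; congr 1; push_cast; ring
  have h1 := h X (by linarith) U R hU3 (by exact_mod_cast hR1)
    (hUX.trans (Real.exp_le_exp.2 (by linarith)))
    (hU1.trans_lt (Real.exp_lt_exp.2 (by linarith)))
  refine h1.trans ?_
  rw [mul_assoc (C * X ^ 2)]
  refine mul_le_mul_of_nonneg_left ?_ (by positivity)
  have hR0 : (0 : ℝ) < R := by linarith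
  set K := (R : ℝ) ^ (99 / 100 : ℝ) with hK
  have hK0 : 0 < K := by positivity
  have hRK : (R : ℝ) ≤ K * (2 * Real.exp (11 / 2500 * X)) := by
    have e : (R : ℝ) = K * (R : ℝ) ^ (1 / 100 : ℝ) := by
      rw [hK, ← Real.rpow_add hR0]; norm_num
    have e2 : (R : ℝ) ^ (1 / 100 : ℝ) ≤ 2 * Real.exp (11 / 2500 * X) := by
      calc _ ≤ (2 * Real.exp (11 / 25 * X)) ^ (1 / 100 : ℝ) :=
            Real.rpow_le_rpow hR0.le hRX (by norm_num)
        _ = 2 ^ (1 / 100 : ℝ) * Real.exp (11 / 2500 * X) := by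
            rw [Real.mul_rpow (by norm_num) (Real.exp_pos _).le, ← Real.exp_mul]
            ring_nf
        _ ≤ _ := by
            refine mul_le_mul_of_nonneg_right ?_ (Real.exp_pos _).le
            calc (2 : ℝ) ^ (1 / 100 : ℝ) ≤ 2 ^ (1 : ℝ) :=
                  Real.rpow_le_rpow_of_exponent_le (by norm_num) (by norm_num)
              _ = 2 := Real.rpow_one 2
    calc (R : ℝ) = K * (R : ℝ) ^ (1 / 100 : ℝ) := e
      _ ≤ _ := mul_le_mul_of_nonneg_left e2 hK0.le
  have t1 : 1 ≤ 1 / X ^ A * K := by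
    rw [one_div, inv_mul_eq_div, one_le_div (by positivity), hK]
    calc X ^ A ≤ (X ^ (2 * A)) ^ (99 / 100 : ℝ) := by
          rw [← Real.rpow_natCast, ← Real.rpow_natCast, ← Real.rpow_mul hX0.le]
          refine Real.rpow_le_rpow_of_exponent_le (by linarith) ?_
          push_cast
          have : (0 : ℝ) ≤ A := Nat.cast_nonneg A
          linarith
      _ ≤ _ := Real.rpow_le_rpow (by positivity) hR (by norm_num)
  have hmono : ∀ {y z : ℝ}, y ≤ z → Real.exp y ≤ Real.exp z := fun h => Real.exp_le_exp.2 h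
  have t2 : (R : ℝ) / Real.sqrt U ≤ 4 * Real.exp (-X / 200) * K := by
    have hs : Real.exp (X / 80) / 2 ≤ Real.sqrt U := by
      refine Real.le_sqrt_of_sq_le ?_
      rw [div_pow, ← Real.exp_nat_mul]
      refine le_trans (le_of_eq ?_) hU2
      norm_num
      ring_nf
    rw [div_le_iff₀ (by positivity)]
    calc (R : ℝ) ≤ K * (2 * Real.exp (11 / 2500 * X)) := hRK
      _ ≤ K * (2 * Real.exp (-X / 200 + X / 80)) := by
          have := hmono (show 11 / 2500 * X ≤ -X / 200 + X / 80 by linarith)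
          gcongr
      _ = 4 * Real.exp (-X / 200) * K * (Real.exp (X / 80) / 2) := by rw [Real.exp_add]; ring
      _ ≤ _ := by gcongr
  have t3 : (R : ℝ) ^ 2 * Real.exp (-X / 2) ≤ 4 * Real.exp (-X / 200) * K := by
    calc (R : ℝ) ^ 2 * Real.exp (-X / 2) = R * R * Real.exp (-X / 2) := by ring
      _ ≤ (K * (2 * Real.exp (11 / 2500 * X))) * (2 * Real.exp (11 / 25 * X)) *
          Real.exp (-X / 2) := by gcongr
      _ = 4 * Real.exp (11 / 2500 * X + 11 / 25 * X + -X / 2) * K := by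
          rw [Real.exp_add, Real.exp_add]; ring
      _ ≤ _ := by
          have := hmono (show 11 / 2500 * X + 11 / 25 * X + -X / 2 ≤ -X / 200 by linarith)
          gcongr
  have t4 : (R : ℝ) ^ 3 * U ^ 2 * Real.exp (-X) ≤ 8 * Real.exp (-X / 200) * K := by
    calc (R : ℝ) ^ 3 * U ^ 2 * Real.exp (-X) = R * (R * R) * U ^ 2 * Real.exp (-X) := by ring
      _ ≤ (K * (2 * Real.exp (11 / 2500 * X))) * ((2 * Real.exp (11 / 25 * X)) *
          (2 * Real.exp (11 / 25 * X))) * Real.exp (X / 20) * Real.exp (-X) := by gcongr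
      _ = 8 * Real.exp (11 / 2500 * X + 11 / 25 * X + 11 / 25 * X + X / 20 + -X) * K := by
          rw [Real.exp_add, Real.exp_add, Real.exp_add, Real.exp_add]; ring
      _ ≤ _ := by
          have := hmono (show 11 / 2500 * X + 11 / 25 * X + 11 / 25 * X + X / 20 + -X ≤
            -X / 200 by linarith)
          gcongr
  linarith

/-- The contribution of the large moduli. -/
lemma eventually_sum_large_moduli_le {g : ℝ → ℂ} (hg : ContDiff ℝ (⊤ : ℕ∞) g)
    (hc : HasCompactSupport g) (hsupp : ∀ u, 1 < |u| → g u = 0) (B : ℕ) : ∀ᶠ X : ℝ in Filter.atTop,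
    ∑ r ∈ (Icc 2 ⌊Real.exp (11 / 25 * X)⌋₊).filter (fun r : ℕ => X ^ (2 * (B + 4)) < r),
      modulusWeight r * ∑ χ ∈ primitiveCharacters r, ‖vonMangoldtSum g X χ‖ ≤ 1 / X ^ B := by
  obtain ⟨C, hC, h⟩ := sum_norm_vonMangoldtSum_le_rpow hg hc hsupp
  obtain ⟨C', hC', hw⟩ := exists_three_pow_div_totient_le (δ := 1 / 100) (by norm_num)
  have hexp : ∀ᶠ X : ℝ in Filter.atTop, X ^ (B + 4) * Real.exp (-X / 200) ≤ 1 := by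
    have := (Real.tendsto_pow_mul_exp_neg_atTop_nhds_zero (B + 4)).comp
      (Filter.tendsto_id.atTop_div_const (show (0 : ℝ) < 200 by norm_num))
    have h2 := this.const_mul ((200 : ℝ) ^ (B + 4))
    rw [mul_zero] at h2
    filter_upwards [h2.eventually (gt_mem_nhds one_pos)] with X hX
    simp only [Function.comp, id] at hX
    rw [div_pow] at hX
    refine le_trans (le_of_eq ?_) hX.le
    rw [neg_div]
    field_simp
  filter_upwards [hexp, Filter.eventually_ge_atTop 40,
    Filter.eventually_ge_atTop (68 * C' * C)] with X hX1 hX40 hXC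
  have hX0 : 0 < X := by linarith
  set D := ⌊Real.exp (11 / 25 * X)⌋₊ with hD
  have hDX : (D : ℝ) ≤ Real.exp (11 / 25 * X) := Nat.floor_le (Real.exp_pos _).le
  have hmain := sum_rpow_mul_le_dyadic (w := modulusWeight)
    (b := fun r => ∑ χ ∈ primitiveCharacters r, ‖vonMangoldtSum g X χ‖) (C := C') (κ := 99 / 100)
    (E := C * X ^ 2 * (1 / X ^ (B + 4) + 16 * Real.exp (-X / 200))) (Y := X ^ (2 * (B + 4))) (D := D)
    hC'.le (by positivity) (by norm_num) (by norm_num)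
    (fun r hr => by have := hw r hr; norm_num at this ⊢; exact this)
    (fun r => sum_nonneg fun _ _ => norm_nonneg _)
    (fun R hR hRD => h X hX40 (B + 4) R hR (by
      have : (R : ℝ) ≤ 2 * D := by exact_mod_cast hRD
      linarith))
  refine hmain.trans ?_
  have hlog := natLog_floor_exp_le hX0.le
  have he : Real.exp (-X / 200) ≤ 1 / X ^ (B + 4) := by
    rw [le_div_iff₀ (by positivity), mul_comm]; exact hX1
  calc _ ≤ (2 * X) * (2 * C' * (C * X ^ 2 * (1 / X ^ (B + 4) + 16 * (1 / X ^ (B + 4))))) := by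
        refine mul_le_mul (by linarith) ?_ (by positivity) (by positivity)
        gcongr
    _ = (68 * C' * C / X) * (1 / X ^ B) := by
        rw [pow_add]; field_simp; ring
    _ ≤ 1 * (1 / X ^ B) := by
        refine mul_le_mul_of_nonneg_right ?_ (by positivity)
        rw [div_le_one hX0]; exact hXC
    _ = _ := one_mul _

lemma vonMangoldtSum_eq (g : ℝ → ℂ) (X : ℝ) {q : ℕ} (χ : DirichletCharacter ℂ q) :
    vonMangoldtSum g X χ = ∑ n ∈ range (⌊Real.exp (X + 1)⌋₊ + 1),
      χ n * (ArithmeticFunction.vonMangoldt n : ℂ) / n * g (Real.log n - X) := by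
  refine sum_congr rfl fun n _ => ?_
  rw [logBump]
  push_cast
  ring

/-- Weighted mean value of prime sums over primitive characters, omitting at most one modulus. -/
theorem eventually_sum_modulusWeight_mul_le {g : ℝ → ℂ} (hg : ContDiff ℝ (⊤ : ℕ∞) g)
    (hc : HasCompactSupport g) (hsupp : ∀ u, 1 < |u| → g u = 0) (B K : ℕ) :
    ∀ᶠ X : ℝ in Filter.atTop, ∃ q₁ : ℕ, K < q₁ ∧
    ∑ r ∈ (Icc 2 ⌊Real.exp (11 / 25 * X)⌋₊).filter (fun r : ℕ => r ≠ q₁),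
      modulusWeight r * ∑ χ ∈ primitiveCharacters r, ‖vonMangoldtSum g X χ‖ ≤ 1 / X ^ B := by
  set A := 2 * (B + 1 + 4) with hA
  obtain ⟨C, hC, hC3⟩ := exists_pow_card_primeFactors_le 3 (by norm_num) (δ := 1) one_pos
  filter_upwards [eventually_sum_large_moduli_le hg hc hsupp (B + 1),
    norm_sum_character_vonMangoldt_le A (2 * A + B + 1) hg hc, exists_exceptional_modulus A K,
    Filter.eventually_ge_atTop 2, Filter.eventually_ge_atTop (2 * C)] with X hlarge hsmall hexc hX2 hXC
  obtain ⟨q₁, hq₁, hexc⟩ := hexc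
  refine ⟨q₁, hq₁, ?_⟩
  have hX0 : 0 < X := by linarith
  set D := ⌊Real.exp (11 / 25 * X)⌋₊ with hD
  set f : ℕ → ℝ := fun r => modulusWeight r * ∑ χ ∈ primitiveCharacters r, ‖vonMangoldtSum g X χ‖
  have hf0 : ∀ r, 0 ≤ f r := fun r =>
    mul_nonneg (modulusWeight_nonneg r) (sum_nonneg fun _ _ => norm_nonneg _)
  have hsm : ∀ r ∈ ((Icc 2 D).filter fun r : ℕ => r ≠ q₁).filter (fun r : ℕ => ¬ X ^ A < r),
      f r ≤ C * X ^ A * (1 / X ^ (2 * A + B + 1)) := fun r hr => by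
    simp only [mem_filter, mem_Icc, not_lt] at hr
    obtain ⟨⟨⟨hr2, -⟩, hrq⟩, hrX⟩ := hr
    have hbound : ∀ χ ∈ primitiveCharacters r, ‖vonMangoldtSum g X χ‖ ≤ 1 / X ^ (2 * A + B + 1) :=
      fun χ hχ => by
        rw [vonMangoldtSum_eq]
        refine hsmall r (by omega) hrX χ (ne_one_of_mem_primitiveCharacters hr2 hχ)
          (hexc r (by omega) hrX hrq χ ((mem_primitiveCharacters (by omega)).1 hχ)) _ fun n hn => ?_
        have hn0 : (0 : ℝ) < n := by exact_mod_cast (by omega : 0 < n)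
        have h := logBump_natCast_eq_zero hsupp hn
        rw [logBump, div_eq_zero_iff] at h
        rcases h with h | h
        · exact h
        · exact absurd h (by exact_mod_cast hn0.ne')
    have ht : (0 : ℝ) < r.totient := by exact_mod_cast Nat.totient_pos.2 (by omega)
    have h3 := hC3 r (by omega)
    rw [Real.rpow_one] at h3
    calc f r ≤ modulusWeight r * (r.totient * (1 / X ^ (2 * A + B + 1))) := by
          refine mul_le_mul_of_nonneg_left ?_ (modulusWeight_nonneg r)
          refine (sum_le_card_nsmul _ _ _ hbound).trans ?_
          rw [nsmul_eq_mul]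
          refine mul_le_mul_of_nonneg_right ?_ (by positivity)
          exact_mod_cast card_primitiveCharacters_le
      _ = (3 : ℝ) ^ r.primeFactors.card * (1 / X ^ (2 * A + B + 1)) := by
          rw [modulusWeight]; field_simp
      _ ≤ _ := by
          refine mul_le_mul_of_nonneg_right (h3.trans ?_) (by positivity)
          exact mul_le_mul_of_nonneg_left hrX hC.le
  rw [← sum_filter_not_add_sum_filter _ (fun r : ℕ => X ^ A < r)]
  have hcard : ((((Icc 2 D).filter fun r : ℕ => r ≠ q₁).filter
      (fun r : ℕ => ¬ X ^ A < r)).card : ℝ) ≤ X ^ A := by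
    have : (((Icc 2 D).filter fun r : ℕ => r ≠ q₁).filter
        (fun r : ℕ => ¬ X ^ A < r)).card ≤ (Icc 1 ⌊X ^ A⌋₊).card := card_le_card fun r hr => by
      simp only [mem_filter, mem_Icc, not_lt] at hr ⊢
      exact ⟨by omega, Nat.le_floor hr.2⟩
    rw [Nat.card_Icc, Nat.add_sub_cancel] at this
    exact le_trans (by exact_mod_cast this) (Nat.floor_le (by positivity))
  have h1 : ∑ r ∈ ((Icc 2 D).filter fun r : ℕ => r ≠ q₁).filter (fun r : ℕ => ¬ X ^ A < r), f r ≤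
      C / X * (1 / X ^ B) := by
    refine (sum_le_card_nsmul _ _ _ hsm).trans ?_
    rw [nsmul_eq_mul]
    calc _ ≤ X ^ A * (C * X ^ A * (1 / X ^ (2 * A + B + 1))) := by gcongr
      _ = _ := by rw [pow_add, pow_add, two_mul, pow_add]; field_simp
  have h2 : ∑ r ∈ ((Icc 2 D).filter fun r : ℕ => r ≠ q₁).filter (fun r : ℕ => X ^ A < r), f r ≤
      1 / X * (1 / X ^ B) := by
    refine (sum_le_sum_of_subset_of_nonneg (fun r hr => ?_) fun r _ _ => hf0 r).trans
      (hlarge.trans (le_of_eq ?_))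
    · simp only [mem_filter] at hr ⊢
      exact ⟨hr.1.1, hr.2⟩
    · rw [pow_succ]; field_simp
  calc _ ≤ C / X * (1 / X ^ B) + 1 / X * (1 / X ^ B) := add_le_add h1 h2
    _ = (C / X + 1 / X) * (1 / X ^ B) := by ring
    _ ≤ 1 * (1 / X ^ B) := by
        refine mul_le_mul_of_nonneg_right ?_ (by positivity)
        rw [← add_div, div_le_one hX0]
        linarith
    _ = _ := one_mul _

/-! ### Primes in arithmetic progressions on average -/

lemma totient_mul_norm_sum_sub_le {k : ℕ} (hk : k ≠ 0) {b : ZMod k} (hb : IsUnit b) (N : ℕ)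
    (c : ℕ → ℂ) (hc : ∀ n < N, ¬ n.Coprime k → c n = 0) :
    (k.totient : ℝ) * ‖∑ n ∈ range N with ((n : ℕ) : ZMod k) = b, c n -
        1 / (k.totient : ℂ) * ∑ n ∈ range N, c n‖ ≤
      ∑ r ∈ k.divisors.erase 1, ∑ χ ∈ primitiveCharacters r, ‖∑ n ∈ range N, c n * χ n‖ := by
  have : NeZero k := ⟨hk⟩
  set S : DirichletCharacter ℂ k → ℂ := fun χ => ∑ n ∈ range N, c n * χ n with hS
  have hφ : (k.totient : ℂ) ≠ 0 := by
    exact_mod_cast (Nat.totient_pos.2 (Nat.pos_of_ne_zero hk)).ne'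
  have h1 : ∑ χ : DirichletCharacter ℂ k, χ b⁻¹ * S χ =
      k.totient * ∑ n ∈ range N with ((n : ℕ) : ZMod k) = b, c n := by
    simp only [hS, mul_sum]
    rw [sum_comm, sum_filter]
    refine sum_congr rfl fun n _ => ?_
    have := DirichletCharacter.sum_char_inv_mul_char_eq ℂ hb (n : ZMod k)
    calc _ = c n * ∑ χ : DirichletCharacter ℂ k, χ b⁻¹ * χ n := by
          rw [mul_sum]; exact sum_congr rfl fun χ _ => by ring
      _ = _ := by
          rw [this]
          by_cases h : b = (n : ZMod k)
          · rw [if_pos h, if_pos h.symm]; ring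
          · rw [if_neg h, if_neg fun h' => h h'.symm]; ring
  have h2 : S 1 = ∑ n ∈ range N, c n := by
    refine sum_congr rfl fun n hn => ?_
    by_cases h : n.Coprime k
    · rw [MulChar.one_apply ((ZMod.isUnit_iff_coprime n k).2 h), mul_one]
    · rw [hc n (mem_range.1 hn) h, zero_mul]
  have hbi : IsUnit b⁻¹ := by
    obtain ⟨u, rfl⟩ := hb
    rw [ZMod.inv_coe_unit]; exact u⁻¹.isUnit
  have h3 : (k.totient : ℂ) * (∑ n ∈ range N with ((n : ℕ) : ZMod k) = b, c n -
      1 / (k.totient : ℂ) * ∑ n ∈ range N, c n) =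
      ∑ χ ∈ (univ : Finset (DirichletCharacter ℂ k)).erase 1, χ b⁻¹ * S χ := by
    rw [mul_sub, ← h1, ← add_sum_erase univ _ (mem_univ (1 : DirichletCharacter ℂ k)), h2,
      MulChar.one_apply hbi]
    field_simp
    ring
  have h4 : (k.totient : ℝ) * ‖∑ n ∈ range N with ((n : ℕ) : ZMod k) = b, c n -
        1 / (k.totient : ℂ) * ∑ n ∈ range N, c n‖ =
      ‖∑ χ ∈ (univ : Finset (DirichletCharacter ℂ k)).erase 1, χ b⁻¹ * S χ‖ := by
    rw [← h3, norm_mul, Complex.norm_natCast]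
  rw [h4]
  have h5 : ‖∑ χ ∈ (univ : Finset (DirichletCharacter ℂ k)).erase 1, χ b⁻¹ * S χ‖ ≤
      ∑ χ ∈ (univ : Finset (DirichletCharacter ℂ k)).erase 1, ‖S χ‖ := by
    refine (norm_sum_le _ _).trans (sum_le_sum fun χ _ => ?_)
    rw [norm_mul]
    exact mul_le_of_le_one_left (norm_nonneg _) (χ.norm_le_one _)
  refine h5.trans ?_
  have hmaps : ∀ χ ∈ (univ : Finset (DirichletCharacter ℂ k)).erase 1,
      χ.conductor ∈ k.divisors.erase 1 := fun χ hχ => by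
    rw [mem_erase] at hχ ⊢
    exact ⟨fun h => hχ.1 (DirichletCharacter.eq_one_iff_conductor_eq_one.2 h),
      Nat.mem_divisors.2 ⟨χ.conductor_dvd_level, hk⟩⟩
  rw [← sum_fiberwise_of_maps_to hmaps]
  refine sum_le_sum fun r hr => ?_
  have hrk : r ∣ k := Nat.dvd_of_mem_divisors (mem_of_mem_erase hr)
  have hr0 : r ≠ 0 := fun h => hk (by simpa [h] using hrk)
  classical
  have hsub : ((univ : Finset (DirichletCharacter ℂ k)).erase 1).filter (fun χ => χ.conductor = r) ⊆
      (primitiveCharacters r).image (DirichletCharacter.changeLevel hrk) := by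
    intro χ hχ
    obtain ⟨-, rfl⟩ := mem_filter.1 hχ
    exact mem_image.2 ⟨χ.primitiveCharacter,
      (mem_primitiveCharacters hr0).2 χ.primitiveCharacter_isPrimitive,
      χ.changeLevel_primitiveCharacter⟩
  refine (sum_le_sum_of_subset_of_nonneg hsub fun _ _ _ => norm_nonneg _).trans ?_
  rw [sum_image fun _ _ _ _ h => DirichletCharacter.changeLevel_injective hrk h]
  refine (sum_congr rfl fun χ _ => ?_).le
  congr 1
  refine sum_congr rfl fun n hn => ?_
  by_cases h : n.Coprime k
  · have := DirichletCharacter.changeLevel_eq_cast_of_dvd' χ hrk (a := (n : ℤ))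
      (Nat.isCoprime_iff_coprime.2 h)
    simp only [Int.cast_natCast] at this
    rw [this]
  · rw [hc n (mem_range.1 hn) h, zero_mul, zero_mul]

lemma add_one_pow_card_primeFactors_le (j : ℝ) (hj : 0 ≤ j) {m : ℕ} (hm : m ≠ 0) :
    (j + 1) ^ m.primeFactors.card ≤ ∑ d ∈ m.divisors, j ^ d.primeFactors.card := by
  have hpf : ∀ t ∈ m.primeFactors.powerset, (∏ p ∈ t, p).primeFactors = t := fun t ht =>
    Nat.primeFactors_prod fun p hp => Nat.prime_of_mem_primeFactors (mem_powerset.1 ht hp)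
  have h1 : ∑ t ∈ m.primeFactors.powerset, j ^ t.card = (j + 1) ^ m.primeFactors.card := by
    rw [← sum_pow_mul_eq_add_pow]
    simp
  have h2 : ∑ t ∈ m.primeFactors.powerset, j ^ t.card =
      ∑ d ∈ m.primeFactors.powerset.image (fun t => ∏ p ∈ t, p), j ^ d.primeFactors.card := by
    rw [sum_image fun t ht s hs h => by
      rw [← hpf t ht, ← hpf s hs]; exact congrArg Nat.primeFactors h]
    exact sum_congr rfl fun t ht => by rw [hpf t ht]
  rw [← h1, h2]
  refine sum_le_sum_of_subset_of_nonneg ?_ fun _ _ _ => by positivity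
  intro d hd
  obtain ⟨t, ht, rfl⟩ := mem_image.1 hd
  refine Nat.mem_divisors.2 ⟨?_, hm⟩
  exact (prod_dvd_prod_of_subset _ _ _ (mem_powerset.1 ht)).trans (Nat.prod_primeFactors_dvd m)

/-- Summation over multiples of the divisors of the indices. -/
lemma sum_Icc_sum_divisors_le {F : ℕ → ℕ → ℝ} (hF : ∀ d m, 0 ≤ F d m) (D : ℕ) :
    ∑ k ∈ Icc 1 D, ∑ d ∈ k.divisors, F d (k / d) ≤ ∑ d ∈ Icc 1 D, ∑ m ∈ Icc 1 D, F d m := by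
  rw [← sum_product', sum_sigma']
  have hinj : Set.InjOn (fun x : (_ : ℕ) × ℕ => (x.2, x.1 / x.2))
      ((Icc 1 D).sigma fun k => k.divisors : Finset ((_ : ℕ) × ℕ)) := by
    rintro ⟨k, d⟩ h ⟨k', d'⟩ h' heq
    simp only [coe_sigma, Set.mem_sigma_iff, mem_coe, Nat.mem_divisors] at h h'
    simp only [Prod.mk.injEq] at heq
    obtain ⟨rfl, h2⟩ := heq
    have : k = k' := by
      rw [← Nat.div_mul_cancel h.2.1, h2, Nat.div_mul_cancel h'.2.1]
    subst this
    rfl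
  have h1 : ∑ x ∈ (Icc 1 D).sigma fun k => k.divisors, F x.2 (x.1 / x.2) =
      ∑ y ∈ ((Icc 1 D).sigma fun k => k.divisors).image (fun x : (_ : ℕ) × ℕ => (x.2, x.1 / x.2)),
        F y.1 y.2 := by
    rw [sum_image hinj]
  rw [h1]
  refine sum_le_sum_of_subset_of_nonneg ?_ fun _ _ _ => hF _ _
  intro y hy
  obtain ⟨⟨k, d⟩, hx, rfl⟩ := mem_image.1 hy
  simp only [mem_sigma, mem_Icc, Nat.mem_divisors] at hx
  have hd : 0 < d := Nat.pos_of_dvd_of_pos hx.2.1 hx.1.1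
  have hdk : d ≤ k := Nat.le_of_dvd hx.1.1 hx.2.1
  simp only [mem_product, mem_Icc]
  exact ⟨⟨hd, hdk.trans hx.1.2⟩, Nat.div_pos hdk hd, (Nat.div_le_self _ _).trans hx.1.2⟩

lemma sum_pow_card_primeFactors_div_le (j D : ℕ) :
    ∑ m ∈ Icc 1 D, ((j + 1 : ℕ) : ℝ) ^ m.primeFactors.card / m ≤ (1 + Real.log D) ^ (j + 1) := by
  have hH : ∑ m ∈ Icc 1 D, (1 : ℝ) / m ≤ 1 + Real.log D := by
    have := harmonic_le_one_add_log D
    rw [harmonic_eq_sum_Icc] at this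
    push_cast at this
    simpa only [one_div] using this
  have hL : 0 ≤ 1 + Real.log D := le_trans (sum_nonneg fun _ _ => by positivity) hH
  induction j with
  | zero => simpa using hH
  | succ j ih =>
    calc ∑ m ∈ Icc 1 D, ((j + 1 + 1 : ℕ) : ℝ) ^ m.primeFactors.card / m
        ≤ ∑ m ∈ Icc 1 D, ∑ d ∈ m.divisors,
          ((j + 1 : ℕ) : ℝ) ^ d.primeFactors.card / d * (1 / ((m / d : ℕ) : ℝ)) := by
          refine sum_le_sum fun m hm => ?_
          have hm0 : m ≠ 0 := by have := (mem_Icc.1 hm).1; omega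
          have h1 := add_one_pow_card_primeFactors_le ((j + 1 : ℕ) : ℝ) (by positivity) hm0
          push_cast at h1 ⊢
          refine (div_le_div_of_nonneg_right h1 (Nat.cast_nonneg _)).trans (le_of_eq ?_)
          rw [sum_div]
          refine sum_congr rfl fun d hd => ?_
          have hdm := Nat.dvd_of_mem_divisors hd
          have hd0 : (d : ℝ) ≠ 0 := by
            exact_mod_cast (Nat.pos_of_mem_divisors hd).ne'
          rw [Nat.cast_div hdm hd0]
          have : (m : ℝ) ≠ 0 := by exact_mod_cast hm0
          field_simp
      _ ≤ ∑ d ∈ Icc 1 D, ∑ m ∈ Icc 1 D,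
          ((j + 1 : ℕ) : ℝ) ^ d.primeFactors.card / d * (1 / (m : ℝ)) :=
          sum_Icc_sum_divisors_le (F := fun d m =>
            ((j + 1 : ℕ) : ℝ) ^ d.primeFactors.card / d * (1 / (m : ℝ)))
            (fun d m => by positivity) D
      _ = (∑ d ∈ Icc 1 D, ((j + 1 : ℕ) : ℝ) ^ d.primeFactors.card / d) *
          ∑ m ∈ Icc 1 D, (1 : ℝ) / m := by rw [sum_mul_sum]
      _ ≤ (1 + Real.log D) ^ (j + 1) * (1 + Real.log D) :=
          mul_le_mul ih hH (sum_nonneg fun _ _ => by positivity) (by positivity)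
      _ = _ := by ring

lemma modulusWeight_mul_le {r m : ℕ} (hr : r ≠ 0) (hm : m ≠ 0) :
    modulusWeight (r * m) ≤ modulusWeight r * modulusWeight m := by
  have hφr : (0 : ℝ) < r.totient := by exact_mod_cast Nat.totient_pos.2 (Nat.pos_of_ne_zero hr)
  have hφm : (0 : ℝ) < m.totient := by exact_mod_cast Nat.totient_pos.2 (Nat.pos_of_ne_zero hm)
  unfold modulusWeight
  rw [div_mul_div_comm, ← pow_add]
  refine div_le_div₀ (by positivity) (pow_le_pow_right₀ (by norm_num) ?_) (by positivity) ?_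
  · rw [Nat.primeFactors_mul hr hm]; exact card_union_le _ _
  · exact_mod_cast Nat.totient_super_multiplicative r m

lemma sum_modulusWeight_le (D : ℕ) :
    ∑ m ∈ Icc 1 D, modulusWeight m ≤ (1 + Real.log D) ^ 6 := by
  refine le_trans (sum_le_sum fun m hm => ?_) (sum_pow_card_primeFactors_div_le 5 D)
  have hm0 : 0 < m := (mem_Icc.1 hm).1
  have hφm : (0 : ℝ) < m.totient := by exact_mod_cast Nat.totient_pos.2 hm0
  have h1 := natCast_le_two_pow_mul_totient m
  have hm1 : (0 : ℝ) < m := by exact_mod_cast hm0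
  unfold modulusWeight
  rw [div_le_div_iff₀ hφm hm1]
  calc (3 : ℝ) ^ m.primeFactors.card * m ≤ 3 ^ m.primeFactors.card *
        (2 ^ m.primeFactors.card * m.totient) := mul_le_mul_of_nonneg_left h1 (by positivity)
    _ = _ := by rw [← mul_assoc, ← mul_pow]; norm_num

/-- A sum over the moduli of the contribution of the nontrivial divisors. -/
lemma sum_modulusWeight_mul_sum_divisors_le {F : ℕ → ℝ} (hF : ∀ r, 0 ≤ F r) (D q₁ : ℕ) :
    ∑ k ∈ (Icc 1 D).filter (fun k => ¬ q₁ ∣ k), modulusWeight k * ∑ r ∈ k.divisors.erase 1, F r ≤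
      (1 + Real.log D) ^ 6 * ∑ r ∈ (Icc 2 D).filter (fun r => r ≠ q₁), modulusWeight r * F r := by
  set G : ℕ → ℝ := fun r => if r ≠ 1 ∧ r ≠ q₁ then F r else 0 with hG
  have hG0 : ∀ r, 0 ≤ G r := fun r => by
    simp only [hG]; split_ifs; exacts [hF r, le_rfl]
  have h1 : ∀ k ∈ (Icc 1 D).filter (fun k => ¬ q₁ ∣ k),
      modulusWeight k * ∑ r ∈ k.divisors.erase 1, F r ≤
        ∑ r ∈ k.divisors, modulusWeight r * G r * modulusWeight (k / r) := fun k hk => by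
    obtain ⟨hk1, hk2⟩ := mem_filter.1 hk
    have hk0 : k ≠ 0 := by have := (mem_Icc.1 hk1).1; omega
    rw [mul_sum]
    refine le_trans (sum_le_sum (g := fun r => modulusWeight r * G r * modulusWeight (k / r))
      fun r hr => ?_) (sum_le_sum_of_subset_of_nonneg
      (erase_subset _ _) fun r _ _ => mul_nonneg (mul_nonneg (modulusWeight_nonneg _) (hG0 r))
        (modulusWeight_nonneg _))
    obtain ⟨hr1, hr2⟩ := mem_erase.1 hr
    have hrk := Nat.dvd_of_mem_divisors hr2
    have hr0 : r ≠ 0 := (Nat.pos_of_mem_divisors hr2).ne'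
    have hGr : G r = F r := if_pos ⟨hr1, fun h => hk2 (h ▸ hrk)⟩
    have hq0 : k / r ≠ 0 := (Nat.div_pos (Nat.le_of_dvd (Nat.pos_of_ne_zero hk0) hrk)
      (Nat.pos_of_ne_zero hr0)).ne'
    have h2 := modulusWeight_mul_le hr0 hq0
    rw [Nat.mul_div_cancel' hrk] at h2
    rw [hGr]
    calc modulusWeight k * F r ≤ modulusWeight r * modulusWeight (k / r) * F r :=
          mul_le_mul_of_nonneg_right h2 (hF r)
      _ = _ := by ring
  have h3 : ∑ r ∈ Icc 1 D, modulusWeight r * G r =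
      ∑ r ∈ (Icc 2 D).filter (fun r => r ≠ q₁), modulusWeight r * F r := by
    simp only [hG, mul_ite, mul_zero]
    rw [← sum_filter]
    refine sum_congr ?_ fun _ _ => rfl
    ext r
    simp only [mem_filter, mem_Icc]
    constructor
    · rintro ⟨h, h', h''⟩; exact ⟨⟨by omega, h.2⟩, h''⟩
    · rintro ⟨h, h'⟩; exact ⟨⟨by omega, h.2⟩, by omega, h'⟩
  calc _ ≤ ∑ k ∈ (Icc 1 D).filter (fun k => ¬ q₁ ∣ k),
        ∑ r ∈ k.divisors, modulusWeight r * G r * modulusWeight (k / r) := sum_le_sum h1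
    _ ≤ ∑ k ∈ Icc 1 D, ∑ r ∈ k.divisors, modulusWeight r * G r * modulusWeight (k / r) :=
        sum_le_sum_of_subset_of_nonneg (filter_subset _ _) fun k _ _ => sum_nonneg fun r _ =>
          mul_nonneg (mul_nonneg (modulusWeight_nonneg _) (hG0 r)) (modulusWeight_nonneg _)
    _ ≤ ∑ r ∈ Icc 1 D, ∑ m ∈ Icc 1 D, modulusWeight r * G r * modulusWeight m :=
        sum_Icc_sum_divisors_le (F := fun r m => modulusWeight r * G r * modulusWeight m)
          (fun r m => mul_nonneg (mul_nonneg (modulusWeight_nonneg _) (hG0 r))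
            (modulusWeight_nonneg _)) D
    _ = (∑ m ∈ Icc 1 D, modulusWeight m) * ∑ r ∈ Icc 1 D, modulusWeight r * G r := by
        rw [← sum_mul_sum, mul_comm]
    _ ≤ _ := by
        rw [h3]
        exact mul_le_mul_of_nonneg_right (sum_modulusWeight_le D)
          (sum_nonneg fun r _ => mul_nonneg (modulusWeight_nonneg _) (hF r))

/-- The smooth weight `log p / p`, localised at primes `p ≈ exp X`. -/
noncomputable def primeWeight (Ψ : ℝ → ℝ) (X : ℝ) (n : ℕ) : ℝ :=
  if n.Prime then Real.log n * (Ψ (Real.log n - X) / n) else 0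

lemma primeWeight_nonneg {Ψ : ℝ → ℝ} (hΨ : ∀ u, 0 ≤ Ψ u) (X : ℝ) (n : ℕ) :
    0 ≤ primeWeight Ψ X n := by
  unfold primeWeight
  split_ifs with h
  · exact mul_nonneg (Real.log_natCast_nonneg n) (div_nonneg (hΨ _) (Nat.cast_nonneg _))
  · exact le_rfl

lemma ofReal_primeWeight (Ψ : ℝ → ℝ) (X : ℝ) (n : ℕ) : (primeWeight Ψ X n : ℂ) =
    if n.Prime then (ArithmeticFunction.vonMangoldt n : ℂ) * logBump (fun u => (Ψ u : ℂ)) X n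
    else 0 := by
  unfold primeWeight logBump
  split_ifs with h
  · rw [ArithmeticFunction.vonMangoldt_apply_prime h]; push_cast; ring
  · simp

/-- Prime powers contribute little to the smooth sums. -/
lemma norm_vonMangoldtSum_sub_le {Ψ : ℝ → ℝ} (hsupp : ∀ u, 1 < |u| → Ψ u = 0) {C : ℝ}
    (hC : ∀ u, |Ψ u| ≤ C) {X : ℝ} (hX : 0 ≤ X) {q : ℕ} (χ : DirichletCharacter ℂ q) :
    ‖∑ n ∈ range (⌊Real.exp (X + 1)⌋₊ + 1), (primeWeight Ψ X n : ℂ) * χ n -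
      vonMangoldtSum (fun u => (Ψ u : ℂ)) X χ‖ ≤
      2 * C * Real.exp (3 / 2) * (X + 1) * Real.exp (-(X / 2)) := by
  have hC0 : 0 ≤ C := (abs_nonneg _).trans (hC 0)
  set N := ⌊Real.exp (X + 1)⌋₊ with hN
  have hg : ∀ u, 1 < |u| → (fun u => (Ψ u : ℂ)) u = 0 := fun u hu => by
    simp [hsupp u hu]
  have hgC : ∀ u, ‖(fun u => (Ψ u : ℂ)) u‖ ≤ C := fun u => by
    simpa [Complex.norm_real] using hC u
  have h1 : ∀ n ∈ range (N + 1),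
      ‖(primeWeight Ψ X n : ℂ) * χ n - (ArithmeticFunction.vonMangoldt n : ℂ) *
        (χ n * logBump (fun u => (Ψ u : ℂ)) X n)‖ ≤
      if ¬ n.Prime then ArithmeticFunction.vonMangoldt n * (C * Real.exp (1 - X)) else 0 := by
    intro n _
    rw [ofReal_primeWeight]
    by_cases hp : n.Prime
    · rw [if_pos hp, if_neg (by simpa using hp)]
      refine le_of_eq ?_
      rw [norm_eq_zero]
      ring
    · rw [if_neg hp, if_pos hp, zero_mul, zero_sub, norm_neg, norm_mul, norm_mul,
        Complex.norm_real, Real.norm_of_nonneg ArithmeticFunction.vonMangoldt_nonneg]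
      refine mul_le_mul_of_nonneg_left ?_ ArithmeticFunction.vonMangoldt_nonneg
      rcases Nat.eq_zero_or_pos n with rfl | hn
      · simp only [logBump, Nat.cast_zero]
        simp only [Complex.ofReal_zero, div_zero, norm_zero, mul_zero]
        positivity
      · have hn' : (0 : ℝ) < n := by exact_mod_cast hn
        calc _ ≤ 1 * (C * Real.exp (1 - X)) := mul_le_mul (χ.norm_le_one _)
              (norm_logBump_le hg hgC hn') (norm_nonneg _) zero_le_one
          _ = _ := one_mul _
  rw [vonMangoldtSum, ← sum_sub_distrib]
  refine (norm_sum_le _ _).trans ((sum_le_sum h1).trans ?_)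
  rw [← sum_filter, ← sum_mul]
  have h2 : ∑ n ∈ range (N + 1) with ¬ n.Prime, ArithmeticFunction.vonMangoldt n ≤
      2 * √(Real.exp (X + 1)) * Real.log (Real.exp (X + 1)) := by
    refine le_trans (le_of_eq ?_) (Chebyshev.psi_sub_theta_le (Real.one_le_exp (by linarith)))
    rw [Chebyshev.psi_sub_theta_eq_sum_not_prime]
    symm
    refine sum_subset ?_ fun n hn hn' => ?_
    · intro n hn
      simp only [mem_filter, mem_Ioc, mem_range] at hn ⊢
      exact ⟨by omega, hn.2⟩
    · simp only [mem_filter, mem_Ioc, mem_range] at hn hn'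
      have : n = 0 := by
        by_contra h
        exact hn' ⟨⟨Nat.pos_of_ne_zero h, by omega⟩, hn.2⟩
      rw [this, ArithmeticFunction.map_zero]
  rw [Real.log_exp, Real.sqrt_eq_rpow, ← Real.exp_mul] at h2
  calc _ ≤ 2 * Real.exp ((X + 1) * (1 / 2)) * (X + 1) * (C * Real.exp (1 - X)) :=
        mul_le_mul_of_nonneg_right h2 (by positivity)
    _ = 2 * C * (Real.exp ((X + 1) * (1 / 2)) * Real.exp (1 - X)) * (X + 1) := by ring
    _ = 2 * C * (Real.exp (3 / 2) * Real.exp (-(X / 2))) * (X + 1) := by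
        rw [← Real.exp_add, ← Real.exp_add]; ring_nf
    _ = _ := by ring

lemma primeWeight_eq_zero_of_not_coprime {Ψ : ℝ → ℝ} (hsupp : ∀ u, 1 < |u| → Ψ u = 0) {X : ℝ}
    {k n : ℕ} (hk : k ≠ 0) (hkX : (k : ℝ) < Real.exp (X - 1)) (h : ¬ n.Coprime k) :
    primeWeight Ψ X n = 0 := by
  unfold primeWeight
  split_ifs with hp
  · have hnk : n ≤ k := by
      rw [hp.coprime_iff_not_dvd, not_not] at h
      exact Nat.le_of_dvd (Nat.pos_of_ne_zero hk) h
    have hn0 : (0 : ℝ) < n := by exact_mod_cast hp.pos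
    have h1 : Real.log n < X - 1 := by
      rw [Real.log_lt_iff_lt_exp hn0]
      exact lt_of_le_of_lt (by exact_mod_cast hnk) hkX
    rw [hsupp _ (by rw [abs_of_neg (by linarith)]; linarith), zero_div, mul_zero]
  · rfl

/-- Error term for primes `p ≡ -a` modulo `k` in the smooth count. -/
noncomputable def progressionError (Ψ : ℝ → ℝ) (X : ℝ) (a k : ℕ) : ℝ :=
  ∑ n ∈ range (⌊Real.exp (X + 1)⌋₊ + 1) with k ∣ n + a, primeWeight Ψ X n -
    1 / (k.totient : ℝ) * ∑ n ∈ range (⌊Real.exp (X + 1)⌋₊ + 1), primeWeight Ψ X n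

lemma totient_mul_abs_progressionError_le {Ψ : ℝ → ℝ} (hsupp : ∀ u, 1 < |u| → Ψ u = 0) {X : ℝ}
    {a k : ℕ} (hk : k ≠ 0) (hkX : (k : ℝ) < Real.exp (X - 1)) (hak : k.Coprime a) :
    (k.totient : ℝ) * |progressionError Ψ X a k| ≤
      ∑ r ∈ k.divisors.erase 1, ∑ χ ∈ primitiveCharacters r,
        ‖∑ n ∈ range (⌊Real.exp (X + 1)⌋₊ + 1), (primeWeight Ψ X n : ℂ) * χ n‖ := by
  have hb : IsUnit (-(a : ZMod k)) := ((ZMod.isUnit_iff_coprime a k).2 hak.symm).neg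
  refine le_trans (le_of_eq ?_) (totient_mul_norm_sum_sub_le hk hb
    (⌊Real.exp (X + 1)⌋₊ + 1) (fun n => (primeWeight Ψ X n : ℂ)) fun n _ hn => by
      simp only [primeWeight_eq_zero_of_not_coprime hsupp hk hkX hn, Complex.ofReal_zero])
  have hiff : ∀ n : ℕ, ((n : ℕ) : ZMod k) = -(a : ZMod k) ↔ k ∣ n + a := fun n => by
    rw [eq_neg_iff_add_eq_zero, ← Nat.cast_add, ZMod.natCast_eq_zero_iff]
  congr 1
  rw [← Real.norm_eq_abs, ← Complex.norm_real, progressionError]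
  push_cast
  simp only [hiff]

/-- **Bombieri–Vinogradov** at level `11/25`, for a fixed residue class, with divisor weights, the
moduli divisible by a possible exceptional modulus being left out. -/
theorem eventually_sum_abs_progressionError_le {Ψ : ℝ → ℝ} (hΨ : ContDiff ℝ (⊤ : ℕ∞) Ψ)
    (hsupp : ∀ u, 1 < |u| → Ψ u = 0) (a K : ℕ) : ∀ᶠ X : ℝ in Filter.atTop, ∃ q₁ : ℕ, K < q₁ ∧
    ∑ k ∈ (Icc 1 ⌊Real.exp (11 / 25 * X)⌋₊).filter (fun k => k.Coprime a ∧ ¬ q₁ ∣ k),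
      (3 : ℝ) ^ k.primeFactors.card * |progressionError Ψ X a k| ≤ 1 / X := by
  have hg : ContDiff ℝ (⊤ : ℕ∞) (fun u => (Ψ u : ℂ)) := Complex.ofRealCLM.contDiff.comp hΨ
  have hgs : ∀ u, 1 < |u| → (fun u => (Ψ u : ℂ)) u = 0 := fun u hu => by simp [hsupp u hu]
  have hΨc : HasCompactSupport Ψ := HasCompactSupport.intro (isCompact_Icc (a := -1) (b := 1))
    fun u hu => hsupp u (by
      by_contra h
      exact hu (abs_le.1 (not_lt.1 h)))
  have hgc : HasCompactSupport (fun u => (Ψ u : ℂ)) := by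
    refine HasCompactSupport.intro (isCompact_Icc (a := -1) (b := 1)) fun u hu => hgs u (by
      by_contra h
      exact hu (abs_le.1 (not_lt.1 h)))
  obtain ⟨C₀, hC₀⟩ := hΨc.exists_bound_of_continuous hΨ.continuous
  have hC : ∀ u, |Ψ u| ≤ C₀ := hC₀
  have hC0 : 0 ≤ C₀ := (abs_nonneg _).trans (hC 0)
  obtain ⟨C', hC', hC3⟩ := exists_pow_card_primeFactors_le 3 (by norm_num) (δ := 1 / 20) (by norm_num)
  set c := C' * (2 * C₀ * Real.exp (3 / 2)) * 2 with hc
  have hexp : ∀ᶠ X : ℝ in Filter.atTop, c * (X ^ 9 * Real.exp (-X / 40)) ≤ 1 := by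
    have := (Real.tendsto_pow_mul_exp_neg_atTop_nhds_zero 9).comp
      (Filter.tendsto_id.atTop_div_const (show (0 : ℝ) < 40 by norm_num))
    have h2 := this.const_mul (c * (40 : ℝ) ^ 9)
    rw [mul_zero] at h2
    filter_upwards [h2.eventually (gt_mem_nhds one_pos)] with X hX
    simp only [Function.comp, id] at hX
    rw [div_pow] at hX
    refine le_trans (le_of_eq ?_) hX.le
    rw [neg_div]
    field_simp
  filter_upwards [hexp, Filter.eventually_ge_atTop 128,
    eventually_sum_modulusWeight_mul_le hg hgc hgs 8 K] with X hexp hX hmain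
  obtain ⟨q₁, hq₁, hmain⟩ := hmain
  refine ⟨q₁, hq₁, ?_⟩
  have hX0 : 0 < X := by linarith
  set D := ⌊Real.exp (11 / 25 * X)⌋₊ with hD
  have hDX : (D : ℝ) ≤ Real.exp (11 / 25 * X) := Nat.floor_le (Real.exp_pos _).le
  have hD1 : 1 ≤ D := Nat.le_floor (by simpa using Real.one_le_exp (by positivity))
  set N := ⌊Real.exp (X + 1)⌋₊ + 1 with hN
  set E := 2 * C₀ * Real.exp (3 / 2) * (X + 1) * Real.exp (-(X / 2)) with hE
  have hE0 : 0 ≤ E := by positivity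
  set P : (r : ℕ) → DirichletCharacter ℂ r → ℝ := fun r χ =>
    ‖∑ n ∈ range N, (primeWeight Ψ X n : ℂ) * χ n‖ with hP
  have hstep : ∀ k ∈ (Icc 1 D).filter (fun k => k.Coprime a ∧ ¬ q₁ ∣ k),
      (3 : ℝ) ^ k.primeFactors.card * |progressionError Ψ X a k| ≤
        modulusWeight k * ∑ r ∈ k.divisors.erase 1, ∑ χ ∈ primitiveCharacters r, P r χ := by
    intro k hk
    obtain ⟨hk1, hka, -⟩ := mem_filter.1 hk
    obtain ⟨hk1, hkD⟩ := mem_Icc.1 hk1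
    have hkX : (k : ℝ) < Real.exp (X - 1) := by
      have : (k : ℝ) ≤ D := by exact_mod_cast hkD
      refine lt_of_le_of_lt (this.trans hDX) (Real.exp_lt_exp.2 (by linarith))
    have h := totient_mul_abs_progressionError_le hsupp (by omega) hkX hka
    have hφ : (0 : ℝ) < k.totient := by exact_mod_cast Nat.totient_pos.2 hk1
    calc _ = modulusWeight k * (k.totient * |progressionError Ψ X a k|) := by
          rw [modulusWeight]; field_simp
      _ ≤ _ := mul_le_mul_of_nonneg_left h (modulusWeight_nonneg k)
  have hsub : (Icc 1 D).filter (fun k => k.Coprime a ∧ ¬ q₁ ∣ k) ⊆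
      (Icc 1 D).filter (fun k => ¬ q₁ ∣ k) := fun k hk => by
    simp only [mem_filter] at hk ⊢
    exact ⟨hk.1, hk.2.2⟩
  have hPr : ∀ r, 0 ≤ ∑ χ ∈ primitiveCharacters r, P r χ := fun r =>
    sum_nonneg fun _ _ => norm_nonneg _
  have hPle : ∀ r ∈ (Icc 2 D).filter (fun r => r ≠ q₁),
      modulusWeight r * ∑ χ ∈ primitiveCharacters r, P r χ ≤
      modulusWeight r * ∑ χ ∈ primitiveCharacters r, ‖vonMangoldtSum (fun u => (Ψ u : ℂ)) X χ‖ +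
        3 ^ r.primeFactors.card * E := by
    intro r hr
    have hr2 := (mem_Icc.1 (mem_filter.1 hr).1).1
    have hφ : (0 : ℝ) < r.totient := by exact_mod_cast Nat.totient_pos.2 (by omega)
    have h1 : ∑ χ ∈ primitiveCharacters r, P r χ ≤
        ∑ χ ∈ primitiveCharacters r, ‖vonMangoldtSum (fun u => (Ψ u : ℂ)) X χ‖ + r.totient * E := by
      calc _ ≤ ∑ χ ∈ primitiveCharacters r, (‖vonMangoldtSum (fun u => (Ψ u : ℂ)) X χ‖ + E) := by
            refine sum_le_sum fun χ _ => ?_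
            have h2 := norm_vonMangoldtSum_sub_le hsupp hC hX0.le χ
            have h3 := norm_sub_norm_le (∑ n ∈ range N, (primeWeight Ψ X n : ℂ) * χ n)
              (vonMangoldtSum (fun u => (Ψ u : ℂ)) X χ)
            simp only [hP]
            linarith
        _ ≤ _ := by
            rw [sum_add_distrib, sum_const, nsmul_eq_mul]
            refine add_le_add le_rfl (mul_le_mul_of_nonneg_right ?_ hE0)
            exact_mod_cast card_primitiveCharacters_le
    calc _ ≤ modulusWeight r * (∑ χ ∈ primitiveCharacters r,
          ‖vonMangoldtSum (fun u => (Ψ u : ℂ)) X χ‖ + r.totient * E) :=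
          mul_le_mul_of_nonneg_left h1 (modulusWeight_nonneg r)
      _ = _ := by rw [mul_add]; congr 1; rw [modulusWeight]; field_simp
  have h3 : ∑ r ∈ (Icc 2 D).filter (fun r => r ≠ q₁), (3 : ℝ) ^ r.primeFactors.card ≤
      C' * Real.exp (231 / 500 * X) := by
    calc _ ≤ ∑ r ∈ Icc 1 D, (3 : ℝ) ^ r.primeFactors.card :=
          sum_le_sum_of_subset_of_nonneg (fun r hr => by
            simp only [mem_filter, mem_Icc] at hr ⊢; omega) fun _ _ _ => by positivity
      _ ≤ ∑ r ∈ Icc 1 D, C' * Real.exp (11 / 500 * X) := by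
          refine sum_le_sum fun r hr => ?_
          obtain ⟨hr1, hrD⟩ := mem_Icc.1 hr
          refine (hC3 r (by omega)).trans (mul_le_mul_of_nonneg_left ?_ hC'.le)
          have : (r : ℝ) ≤ Real.exp (11 / 25 * X) := le_trans (by exact_mod_cast hrD) hDX
          refine (Real.rpow_le_rpow (Nat.cast_nonneg _) this (by norm_num)).trans (le_of_eq ?_)
          rw [← Real.exp_mul]; ring_nf
      _ = D * (C' * Real.exp (11 / 500 * X)) := by
          rw [sum_const, Nat.card_Icc, nsmul_eq_mul]; norm_num
      _ ≤ Real.exp (11 / 25 * X) * (C' * Real.exp (11 / 500 * X)) :=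
          mul_le_mul_of_nonneg_right hDX (by positivity)
      _ = C' * (Real.exp (11 / 25 * X) * Real.exp (11 / 500 * X)) := by ring
      _ = _ := by rw [← Real.exp_add]; ring_nf
  have h4 : ∑ r ∈ (Icc 2 D).filter (fun r => r ≠ q₁), (3 : ℝ) ^ r.primeFactors.card * E ≤
      1 / X ^ 8 := by
    rw [← sum_mul]
    calc _ ≤ C' * Real.exp (231 / 500 * X) * E := mul_le_mul_of_nonneg_right h3 hE0
      _ = C' * (2 * C₀ * Real.exp (3 / 2)) * (X + 1) *
          (Real.exp (231 / 500 * X) * Real.exp (-(X / 2))) := by rw [hE]; ring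
      _ = C' * (2 * C₀ * Real.exp (3 / 2)) * (X + 1) * Real.exp (-19 / 500 * X) := by
          rw [← Real.exp_add]; ring_nf
      _ ≤ C' * (2 * C₀ * Real.exp (3 / 2)) * (2 * X) * Real.exp (-X / 40) := by
          refine mul_le_mul (mul_le_mul_of_nonneg_left (by linarith) (by positivity))
            (Real.exp_le_exp.2 (by linarith)) (Real.exp_pos _).le (by positivity)
      _ = c * (X ^ 9 * Real.exp (-X / 40)) / X ^ 8 := by rw [hc]; field_simp
      _ ≤ _ := div_le_div_of_nonneg_right hexp (by positivity)
  have hlogD : (1 + Real.log D) ^ 6 ≤ (2 * X) ^ 6 := by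
    have hDpos : (0 : ℝ) < D := by exact_mod_cast hD1
    have h5 : Real.log D ≤ 11 / 25 * X := by
      rw [Real.log_le_iff_le_exp hDpos]; exact hDX
    have h6 : 0 ≤ Real.log D := Real.log_natCast_nonneg D
    exact pow_le_pow_left₀ (by linarith) (by linarith) 6
  calc _ ≤ ∑ k ∈ (Icc 1 D).filter (fun k => k.Coprime a ∧ ¬ q₁ ∣ k),
        modulusWeight k * ∑ r ∈ k.divisors.erase 1, ∑ χ ∈ primitiveCharacters r, P r χ :=
        sum_le_sum hstep
    _ ≤ ∑ k ∈ (Icc 1 D).filter (fun k => ¬ q₁ ∣ k),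
        modulusWeight k * ∑ r ∈ k.divisors.erase 1, ∑ χ ∈ primitiveCharacters r, P r χ :=
        sum_le_sum_of_subset_of_nonneg hsub fun k _ _ =>
          mul_nonneg (modulusWeight_nonneg k) (sum_nonneg fun r _ => hPr r)
    _ ≤ (1 + Real.log D) ^ 6 * ∑ r ∈ (Icc 2 D).filter (fun r => r ≠ q₁),
        modulusWeight r * ∑ χ ∈ primitiveCharacters r, P r χ :=
        sum_modulusWeight_mul_sum_divisors_le hPr D q₁
    _ ≤ (2 * X) ^ 6 * (1 / X ^ 8 + 1 / X ^ 8) := by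
        refine mul_le_mul hlogD ?_ (sum_nonneg fun r _ =>
          mul_nonneg (modulusWeight_nonneg r) (hPr r)) (by positivity)
        refine (sum_le_sum hPle).trans ?_
        rw [sum_add_distrib]
        exact add_le_add hmain h4
    _ = 128 / X * (1 / X) := by field_simp; ring
    _ ≤ 1 * (1 / X) := by
        refine mul_le_mul_of_nonneg_right ?_ (by positivity)
        rw [div_le_one hX0]; exact hX
    _ = _ := one_mul _

/-! ### Selberg's quadratic form on finite sets -/

lemma prod_one_add_inv_eq_sum (h : ℕ → ℝ) (A : Finset ℕ) :
    ∏ q ∈ A, (1 + (h q)⁻¹) = ∑ L ∈ A.powerset, (∏ q ∈ L, h q)⁻¹ := by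
  rw [prod_one_add]
  exact sum_congr rfl fun L _ => by rw [prod_inv_distrib]

/-- Selberg's weights for a family `𝓡` of finite sets. -/
noncomputable def selbergWeight (𝓡 : Finset (Finset ℕ)) (h : ℕ → ℝ) (T : Finset ℕ) : ℝ :=
  (-1) ^ T.card * (∏ q ∈ T, (1 + (h q)⁻¹)) *
    (∑ L ∈ 𝓡 with T ⊆ L, ∏ q ∈ L, h q) / ∑ L ∈ 𝓡, ∏ q ∈ L, h q

section Selberg

variable {𝓡 : Finset (Finset ℕ)} {h : ℕ → ℝ}

lemma sum_prod_pos (hempty : ∅ ∈ 𝓡) (hh : ∀ L ∈ 𝓡, ∀ q ∈ L, 0 < h q) :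
    0 < ∑ L ∈ 𝓡, ∏ q ∈ L, h q :=
  sum_pos (fun L hL => prod_pos (hh L hL)) ⟨∅, hempty⟩

lemma selbergWeight_empty (hempty : ∅ ∈ 𝓡) (hh : ∀ L ∈ 𝓡, ∀ q ∈ L, 0 < h q) :
    selbergWeight 𝓡 h ∅ = 1 := by
  have := sum_prod_pos hempty hh
  simp [selbergWeight, this.ne']

lemma abs_selbergWeight_le_one (hdown : ∀ L ∈ 𝓡, ∀ T ⊆ L, T ∈ 𝓡)
    (hempty : ∅ ∈ 𝓡) (hh : ∀ L ∈ 𝓡, ∀ q ∈ L, 0 < h q) {T : Finset ℕ} (hT : T ∈ 𝓡) :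
    |selbergWeight 𝓡 h T| ≤ 1 := by
  have hG := sum_prod_pos hempty hh
  have h0 : 0 ≤ ∑ L ∈ 𝓡 with T ⊆ L, ∏ q ∈ L, h q :=
    sum_nonneg fun L hL => prod_nonneg fun q hq => (hh L (mem_filter.1 hL).1 q hq).le
  have h1 : 0 ≤ ∏ q ∈ T, (1 + (h q)⁻¹) := prod_nonneg fun q hq => by
    have := hh T hT q hq; positivity
  rw [selbergWeight, abs_div, abs_mul, abs_mul, abs_pow, abs_neg, abs_one, one_pow, one_mul,
    abs_of_nonneg h0, abs_of_nonneg h1, abs_of_pos hG, div_le_one hG, prod_one_add_inv_eq_sum,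
    sum_mul_sum, ← sum_product']
  have hinj : Set.InjOn (fun x : Finset ℕ × Finset ℕ => x.2 \ x.1)
      (T.powerset ×ˢ (𝓡.filter fun L => T ⊆ L) : Finset (Finset ℕ × Finset ℕ)) := by
    rintro ⟨A, L⟩ hx ⟨A', L'⟩ hx' heq
    simp only [coe_product, Set.mem_prod, mem_coe, mem_powerset, mem_filter] at hx hx' heq
    obtain ⟨hA, -, hL⟩ := hx
    obtain ⟨hA', -, hL'⟩ := hx'
    have e1 : A = T \ (L \ A) := by
      ext q
      have a1 := @hA q
      have a2 := @hL q
      simp only [mem_sdiff]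
      tauto
    have e1' : A' = T \ (L' \ A') := by
      ext q
      have a1 := @hA' q
      have a2 := @hL' q
      simp only [mem_sdiff]
      tauto
    have e2 : L = (L \ A) ∪ T := by
      ext q
      have a1 := @hA q
      have a2 := @hL q
      simp only [mem_sdiff, mem_union]
      tauto
    have e2' : L' = (L' \ A') ∪ T := by
      ext q
      have a1 := @hA' q
      have a2 := @hL' q
      simp only [mem_sdiff, mem_union]
      tauto
    rw [heq] at e1 e2
    rw [Prod.mk.injEq]
    exact ⟨e1.trans e1'.symm, e2.trans e2'.symm⟩
  have h2 : ∑ x ∈ T.powerset ×ˢ (𝓡.filter fun L => T ⊆ L), (∏ q ∈ x.1, h q)⁻¹ * ∏ q ∈ x.2, h q =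
      ∑ B ∈ (T.powerset ×ˢ (𝓡.filter fun L => T ⊆ L)).image (fun x => x.2 \ x.1),
        ∏ q ∈ B, h q := by
    rw [sum_image hinj]
    refine sum_congr rfl fun x hx => ?_
    obtain ⟨hx1, hx2⟩ := mem_product.1 hx
    have hsub : x.1 ⊆ x.2 := (mem_powerset.1 hx1).trans (mem_filter.1 hx2).2
    have hne : ∏ q ∈ x.1, h q ≠ 0 := (prod_pos fun q hq =>
      hh x.2 (mem_filter.1 hx2).1 q (hsub hq)).ne'
    rw [← prod_sdiff hsub]
    field_simp
  rw [h2]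
  refine sum_le_sum_of_subset_of_nonneg ?_ fun L hL _ => prod_nonneg fun q hq => (hh L hL q hq).le
  intro B hB
  obtain ⟨x, hx, rfl⟩ := mem_image.1 hB
  exact hdown _ (mem_filter.1 (mem_product.1 hx).2).1 _ sdiff_subset

lemma sum_neg_one_pow_card_filter_subset (hdown : ∀ L ∈ 𝓡, ∀ T ⊆ L, T ∈ 𝓡) {A L : Finset ℕ}
    (hL : L ∈ 𝓡) :
    ∑ T ∈ 𝓡 with A ⊆ T ∧ T ⊆ L, (-1 : ℝ) ^ T.card = if A = L then (-1 : ℝ) ^ A.card else 0 := by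
  by_cases hAL : A ⊆ L
  · have h1 : ∑ T ∈ 𝓡 with A ⊆ T ∧ T ⊆ L, (-1 : ℝ) ^ T.card =
        ∑ B ∈ (L \ A).powerset, (-1 : ℝ) ^ A.card * (-1) ^ B.card := by
      symm
      refine sum_bij (fun B _ => A ∪ B) ?_ ?_ ?_ ?_
      · intro B hB
        rw [mem_powerset] at hB
        have : A ∪ B ⊆ L := union_subset hAL (hB.trans sdiff_subset)
        exact mem_filter.2 ⟨hdown L hL _ this, subset_union_left, this⟩
      · intro B hB B' hB' heq
        rw [mem_powerset] at hB hB'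
        ext q
        have a1 := @hB q
        have a2 := @hB' q
        have a3 := Finset.ext_iff.1 heq q
        simp only [mem_sdiff, mem_union] at a1 a2 a3
        tauto
      · intro T hT
        obtain ⟨-, h1, h2⟩ := mem_filter.1 hT
        exact ⟨T \ A, mem_powerset.2 (sdiff_subset_sdiff h2 subset_rfl), union_sdiff_of_subset h1⟩
      · intro B hB
        rw [mem_powerset] at hB
        rw [card_union_of_disjoint (disjoint_sdiff.mono_right hB), pow_add]
    rw [h1, ← mul_sum]
    have h2 := Finset.sum_powerset_neg_one_pow_card (x := L \ A)
    have h3 : ∑ B ∈ (L \ A).powerset, (-1 : ℝ) ^ B.card = if L \ A = ∅ then 1 else 0 := by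
      have := congrArg (fun z : ℤ => (z : ℝ)) h2
      push_cast at this
      exact this
    rw [h3]
    by_cases hEq : A = L
    · rw [if_pos hEq, if_pos (by rw [hEq, sdiff_self]; rfl), mul_one]
    · rw [if_neg hEq, if_neg fun hE => hEq (hAL.antisymm (sdiff_eq_empty_iff_subset.1 hE)), mul_zero]
  · rw [if_neg fun hE => hAL hE.subset, filter_false_of_mem, sum_empty]
    exact fun T _ hT => hAL (hT.1.trans hT.2)

lemma sum_selbergWeight_mul (hdown : ∀ L ∈ 𝓡, ∀ T ⊆ L, T ∈ 𝓡)
    (hh : ∀ L ∈ 𝓡, ∀ q ∈ L, 0 < h q) {A : Finset ℕ} (hA : A ∈ 𝓡) :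
    ∑ T ∈ 𝓡 with A ⊆ T, selbergWeight 𝓡 h T * (∏ q ∈ T, (1 + (h q)⁻¹))⁻¹ =
      (-1) ^ A.card * (∏ q ∈ A, h q) / ∑ L ∈ 𝓡, ∏ q ∈ L, h q := by
  have h1 : ∀ T ∈ 𝓡.filter fun T => A ⊆ T,
      selbergWeight 𝓡 h T * (∏ q ∈ T, (1 + (h q)⁻¹))⁻¹ =
      (∑ L ∈ 𝓡, if T ⊆ L then (-1) ^ T.card * ∏ q ∈ L, h q else 0) / ∑ L ∈ 𝓡, ∏ q ∈ L, h q := by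
    intro T hT
    have hne : ∏ q ∈ T, (1 + (h q)⁻¹) ≠ 0 := (prod_pos fun q hq => by
      have := hh T (mem_filter.1 hT).1 q hq; positivity).ne'
    rw [← sum_filter, ← mul_sum, selbergWeight]
    generalize ∏ q ∈ T, (1 + (h q)⁻¹) = y at *
    field_simp
  rw [sum_congr rfl h1, ← sum_div, sum_comm]
  congr 1
  have h2 : ∀ L ∈ 𝓡, ∑ T ∈ 𝓡 with A ⊆ T, (if T ⊆ L then (-1 : ℝ) ^ T.card * ∏ q ∈ L, h q else 0) =
      if A = L then (-1 : ℝ) ^ A.card * ∏ q ∈ L, h q else 0 := by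
    intro L hL
    rw [← sum_filter, filter_filter, ← sum_mul, sum_neg_one_pow_card_filter_subset hdown hL]
    split_ifs <;> simp
  rw [sum_congr rfl h2, sum_ite_eq, if_pos hA]

/-- The minimal value of Selberg's quadratic form. -/
theorem sum_selbergWeight_mul_selbergWeight (hdown : ∀ L ∈ 𝓡, ∀ T ⊆ L, T ∈ 𝓡) (hempty : ∅ ∈ 𝓡)
    (hh : ∀ L ∈ 𝓡, ∀ q ∈ L, 0 < h q) :
    ∑ T₁ ∈ 𝓡, ∑ T₂ ∈ 𝓡, selbergWeight 𝓡 h T₁ * selbergWeight 𝓡 h T₂ *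
      (∏ q ∈ T₁ ∪ T₂, (1 + (h q)⁻¹))⁻¹ = (∑ L ∈ 𝓡, ∏ q ∈ L, h q)⁻¹ := by
  set G := ∑ L ∈ 𝓡, ∏ q ∈ L, h q with hGdef
  have hG : 0 < G := sum_prod_pos hempty hh
  set z : Finset ℕ → ℝ := fun T => selbergWeight 𝓡 h T * (∏ q ∈ T, (1 + (h q)⁻¹))⁻¹ with hz
  have hne : ∀ T ∈ 𝓡, ∏ q ∈ T, (1 + (h q)⁻¹) ≠ 0 := fun T hT => (prod_pos fun q hq => by
      have := hh T hT q hq; positivity).ne'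
  have h1 : ∀ T₁ ∈ 𝓡, ∀ T₂ ∈ 𝓡, selbergWeight 𝓡 h T₁ * selbergWeight 𝓡 h T₂ *
      (∏ q ∈ T₁ ∪ T₂, (1 + (h q)⁻¹))⁻¹ =
      ∑ L ∈ 𝓡, if L ⊆ T₁ ∧ L ⊆ T₂ then z T₁ * z T₂ * (∏ q ∈ L, h q)⁻¹ else 0 := by
    intro T₁ hT₁ T₂ hT₂
    have h2 := prod_union_inter (s₁ := T₁) (s₂ := T₂) (f := fun q => 1 + (h q)⁻¹)
    have h_integ : T₁ ∩ T₂ ∈ 𝓡 := hdown T₁ hT₁ _ inter_subset_left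
    have h3 : ∑ L ∈ 𝓡, (if L ⊆ T₁ ∧ L ⊆ T₂ then z T₁ * z T₂ * (∏ q ∈ L, h q)⁻¹ else 0) =
        z T₁ * z T₂ * ∏ q ∈ T₁ ∩ T₂, (1 + (h q)⁻¹) := by
      rw [← sum_filter, ← mul_sum, prod_one_add_inv_eq_sum]
      congr 1
      refine sum_congr ?_ fun _ _ => rfl
      ext L
      simp only [mem_filter, mem_powerset, subset_inter_iff]
      exact ⟨fun hx => hx.2, fun hx => ⟨hdown T₁ hT₁ L hx.1, hx⟩⟩
    have hun : ∏ q ∈ T₁ ∪ T₂, (1 + (h q)⁻¹) ≠ 0 := by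
      intro h0
      rw [h0, zero_mul] at h2
      exact mul_ne_zero (hne _ hT₁) (hne _ hT₂) h2.symm
    rw [h3, hz]
    have hn1 := hne _ hT₁
    have hn2 := hne _ hT₂
    simp only
    generalize ∏ q ∈ T₁, (1 + (h q)⁻¹) = y₁ at *
    generalize ∏ q ∈ T₂, (1 + (h q)⁻¹) = y₂ at *
    generalize ∏ q ∈ T₁ ∪ T₂, (1 + (h q)⁻¹) = y₃ at *
    generalize ∏ q ∈ T₁ ∩ T₂, (1 + (h q)⁻¹) = y₄ at *
    field_simp
    linear_combination -(selbergWeight 𝓡 h T₁ * selbergWeight 𝓡 h T₂) * h2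
  have h4 : ∑ T₁ ∈ 𝓡, ∑ T₂ ∈ 𝓡, selbergWeight 𝓡 h T₁ * selbergWeight 𝓡 h T₂ *
      (∏ q ∈ T₁ ∪ T₂, (1 + (h q)⁻¹))⁻¹ =
      ∑ L ∈ 𝓡, (∏ q ∈ L, h q)⁻¹ * (∑ T ∈ 𝓡 with L ⊆ T, z T) ^ 2 := by
    rw [sum_congr rfl fun T₁ hT₁ => sum_congr rfl fun T₂ hT₂ => h1 T₁ hT₁ T₂ hT₂]
    rw [sum_congr rfl fun T₁ _ => sum_comm, sum_comm]
    refine sum_congr rfl fun L hL => ?_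
    rw [sq, sum_mul_sum, mul_sum, sum_filter]
    refine sum_congr rfl fun T₁ _ => ?_
    by_cases h5 : L ⊆ T₁
    · rw [if_pos h5, mul_sum, sum_filter]
      refine sum_congr rfl fun T₂ _ => ?_
      by_cases h6 : L ⊆ T₂
      · rw [if_pos ⟨h5, h6⟩, if_pos h6]; ring
      · rw [if_neg fun hx => h6 hx.2, if_neg h6]
    · rw [if_neg h5]
      exact sum_eq_zero fun T₂ _ => if_neg fun hx => h5 hx.1
  rw [h4, sum_congr rfl fun L hL => by rw [hz, sum_selbergWeight_mul hdown hh hL]]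
  have h7 : ∀ L ∈ 𝓡, (∏ q ∈ L, h q)⁻¹ * ((-1) ^ L.card * (∏ q ∈ L, h q) / G) ^ 2 =
      (∏ q ∈ L, h q) / G ^ 2 := by
    intro L hL
    have h8 : ∏ q ∈ L, h q ≠ 0 := (prod_pos (hh L hL)).ne'
    have h9 : ((-1 : ℝ) ^ L.card) ^ 2 = 1 := by rw [← pow_mul, mul_comm, pow_mul]; norm_num
    rw [div_pow, mul_pow, h9]
    field_simp
  rw [sum_congr rfl h7, ← sum_div, ← hGdef]
  field_simp

end Selberg

/-- The upper bound sieve inequality for the weights `2 ^ (-|A|)`. -/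
lemma inv_two_pow_card_le_sum {𝓡 : Finset (Finset ℕ)} (hempty : ∅ ∈ 𝓡) {c : Finset ℕ → ℝ}
    (hc : c ∅ = 1) (A : Finset ℕ) :
    ((2 : ℝ) ^ A.card)⁻¹ ≤ ∑ T₁ ∈ 𝓡, ∑ T₂ ∈ 𝓡,
      if T₁ ∪ T₂ ⊆ A then c T₁ * c T₂ * ((2 : ℝ) ^ (T₁ ∪ T₂).card)⁻¹ else 0 := by
  have h1 : ∑ S ∈ A.powerset, (∑ T ∈ 𝓡 with T ⊆ S, c T) ^ 2 = (2 : ℝ) ^ A.card *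
      ∑ T₁ ∈ 𝓡, ∑ T₂ ∈ 𝓡,
      if T₁ ∪ T₂ ⊆ A then c T₁ * c T₂ * ((2 : ℝ) ^ (T₁ ∪ T₂).card)⁻¹ else 0 := by
    have h2 : ∀ S ∈ A.powerset, (∑ T ∈ 𝓡 with T ⊆ S, c T) ^ 2 =
        ∑ T₁ ∈ 𝓡, ∑ T₂ ∈ 𝓡, if T₁ ∪ T₂ ⊆ S then c T₁ * c T₂ else 0 := by
      intro S _
      rw [sq, sum_mul_sum, sum_filter]
      refine sum_congr rfl fun T₁ _ => ?_
      by_cases h5 : T₁ ⊆ S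
      · rw [if_pos h5, sum_filter]
        refine sum_congr rfl fun T₂ _ => ?_
        by_cases h6 : T₂ ⊆ S
        · rw [if_pos h6, if_pos (union_subset h5 h6)]
        · rw [if_neg h6, if_neg fun hx => h6 (subset_union_right.trans hx)]
      · rw [if_neg h5]
        exact (sum_eq_zero fun T₂ _ => if_neg fun hx => h5 (subset_union_left.trans hx)).symm
    rw [sum_congr rfl h2, sum_comm, mul_sum]
    refine sum_congr rfl fun T₁ _ => ?_
    rw [sum_comm, mul_sum]
    refine sum_congr rfl fun T₂ _ => ?_
    rw [← sum_filter, sum_const, nsmul_eq_mul]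
    by_cases hU : T₁ ∪ T₂ ⊆ A
    · have h3 : A.powerset.filter (fun S => T₁ ∪ T₂ ⊆ S) = Icc (T₁ ∪ T₂) A := by
        ext S
        simp only [mem_filter, mem_powerset, mem_Icc]
        tauto
      rw [if_pos hU, h3, card_Icc_finset hU]
      push_cast
      rw [pow_sub₀ _ two_ne_zero (card_le_card hU)]
      ring
    · rw [if_neg hU, mul_zero, filter_false_of_mem, card_empty, Nat.cast_zero, zero_mul]
      exact fun S hS hx => hU (hx.trans (mem_powerset.1 hS))
  have h4 : 1 ≤ ∑ S ∈ A.powerset, (∑ T ∈ 𝓡 with T ⊆ S, c T) ^ 2 := by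
    have h5 : (∑ T ∈ 𝓡 with T ⊆ ∅, c T) ^ 2 = 1 := by
      have : 𝓡.filter (fun T => T ⊆ ∅) = {∅} := by
        ext T
        simp only [mem_filter, subset_empty, mem_singleton]
        exact ⟨fun hx => hx.2, fun hx => ⟨hx ▸ hempty, hx⟩⟩
      rw [this, sum_singleton, hc, one_pow]
    rw [← h5]
    exact single_le_sum (f := fun S => (∑ T ∈ 𝓡 with T ⊆ S, c T) ^ 2)
      (fun S _ => sq_nonneg _) (empty_mem_powerset A)
  rw [h1] at h4
  rw [inv_le_iff_one_le_mul₀' (by positivity)]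
  exact h4

/-! ### The denominator of the sieve -/

/-- Sets of primes outside `B` whose product is at most `R`. -/
noncomputable def roughSets (R : ℕ) (B : Finset ℕ) : Finset (Finset ℕ) :=
  ((Icc 1 R).filter fun p => p.Prime ∧ p ∉ B).powerset.filter fun T => ∏ p ∈ T, p ≤ R

lemma mem_roughSets {R : ℕ} {B T : Finset ℕ} :
    T ∈ roughSets R B ↔ (∀ p ∈ T, p.Prime ∧ p ∉ B) ∧ ∏ p ∈ T, p ≤ R := by
  simp only [roughSets, mem_filter, mem_powerset]
  constructor
  · rintro ⟨h1, h2⟩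
    exact ⟨fun p hp => (mem_filter.1 (h1 hp)).2, h2⟩
  · rintro ⟨h1, h2⟩
    refine ⟨fun p hp => mem_filter.2 ⟨mem_Icc.2 ⟨(h1 p hp).1.one_lt.le, ?_⟩, h1 p hp⟩, h2⟩
    exact (Nat.le_of_dvd (prod_pos fun q hq => (h1 q hq).1.pos) (dvd_prod_of_mem _ hp)).trans h2

lemma empty_mem_roughSets {R : ℕ} (hR : 1 ≤ R) (B : Finset ℕ) : ∅ ∈ roughSets R B := by
  simpa [mem_roughSets] using hR

lemma mem_roughSets_of_subset {R : ℕ} {B L T : Finset ℕ} (hL : L ∈ roughSets R B) (hT : T ⊆ L) :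
    T ∈ roughSets R B := by
  rw [mem_roughSets] at hL ⊢
  refine ⟨fun p hp => hL.1 p (hT hp), le_trans ?_ hL.2⟩
  exact Nat.le_of_dvd (prod_pos fun q hq => (hL.1 q hq).1.pos) (prod_dvd_prod_of_subset _ _ _ hT)

/-- The density function of the sieve. -/
noncomputable def sieveDensity (q : ℕ) : ℝ := 1 / (2 * q - 3)

lemma sieveDensity_pos {q : ℕ} (hq : 2 ≤ q) : 0 < sieveDensity q := by
  have : (2 : ℝ) ≤ q := by exact_mod_cast hq
  unfold sieveDensity
  have : (0 : ℝ) < 2 * q - 3 := by linarith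
  positivity

lemma sum_inv_prod_roughSets_le (R : ℕ) (B : Finset ℕ) :
    ∑ T ∈ roughSets R B, (∏ p ∈ T, (p : ℝ))⁻¹ ≤
      (∑ T ∈ roughSets R B, ∏ p ∈ T, sieveDensity p) ^ 2 := by
  have hpos : ∀ T ∈ roughSets R B, ∀ p ∈ T, 0 < sieveDensity p := fun T hT p hp =>
    sieveDensity_pos ((mem_roughSets.1 hT).1 p hp).1.two_le
  have h1 : ∀ T ∈ roughSets R B, (∏ p ∈ T, (p : ℝ))⁻¹ ≤
      ∑ A ∈ T.powerset, (∏ p ∈ A, sieveDensity p) * ∏ p ∈ T \ A, sieveDensity p := by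
    intro T hT
    have h2 : ∀ A ∈ T.powerset, (∏ p ∈ A, sieveDensity p) * ∏ p ∈ T \ A, sieveDensity p =
        ∏ p ∈ T, sieveDensity p := fun A hA => by
      rw [mul_comm, prod_sdiff (mem_powerset.1 hA)]
    rw [sum_congr rfl h2, sum_const, card_powerset, nsmul_eq_mul, ← prod_inv_distrib]
    push_cast
    rw [← prod_const, ← prod_mul_distrib]
    refine prod_le_prod (fun p _ => by positivity) fun p hp => ?_
    have : (2 : ℝ) ≤ p := by exact_mod_cast ((mem_roughSets.1 hT).1 p hp).1.two_le
    rw [sieveDensity, mul_one_div, inv_eq_one_div, div_le_div_iff₀ (by linarith) (by linarith)]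
    linarith
  rw [sq, sum_mul_sum, ← sum_product']
  refine (sum_le_sum h1).trans ?_
  rw [sum_sigma']
  have hinj : Set.InjOn (fun x : (_ : Finset ℕ) × Finset ℕ => (x.2, x.1 \ x.2))
      ((roughSets R B).sigma fun T => T.powerset : Finset ((_ : Finset ℕ) × Finset ℕ)) := by
    rintro ⟨T, A⟩ hx ⟨T', A'⟩ hx' heq
    simp only [coe_sigma, Set.mem_sigma_iff, mem_coe, mem_powerset] at hx hx'
    simp only [Prod.mk.injEq] at heq
    obtain ⟨rfl, h2⟩ := heq
    have : T = T' := by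
      rw [← union_sdiff_of_subset hx.2, h2, union_sdiff_of_subset hx'.2]
    subst this
    rfl
  have h3 : ∑ x ∈ (roughSets R B).sigma fun T => T.powerset,
      (∏ p ∈ x.2, sieveDensity p) * ∏ p ∈ x.1 \ x.2, sieveDensity p =
      ∑ y ∈ ((roughSets R B).sigma fun T => T.powerset).image
        (fun x : (_ : Finset ℕ) × Finset ℕ => (x.2, x.1 \ x.2)),
        (∏ p ∈ y.1, sieveDensity p) * ∏ p ∈ y.2, sieveDensity p := by
    rw [sum_image hinj]
  rw [h3]
  refine sum_le_sum_of_subset_of_nonneg ?_ fun y hy _ => ?_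
  · intro y hy
    obtain ⟨x, hx, rfl⟩ := mem_image.1 hy
    rw [mem_sigma, mem_powerset] at hx
    exact mem_product.2 ⟨mem_roughSets_of_subset hx.1 hx.2, mem_roughSets_of_subset hx.1 sdiff_subset⟩
  · rw [mem_product] at hy
    exact mul_nonneg (prod_nonneg fun p hp => (hpos _ hy.1 p hp).le)
      (prod_nonneg fun p hp => (hpos _ hy.2 p hp).le)

lemma exists_eq_factored_mul (B : Finset ℕ) (n : ℕ) : n ≠ 0 →
    ∃ m r : ℕ, n = m * r ∧ m ∈ Nat.factoredNumbers B ∧ ∀ p, p.Prime → p ∣ r → p ∉ B := by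
  induction n using Nat.strong_induction_on with
  | _ n ih =>
    intro hn
    by_cases h : ∃ p, p.Prime ∧ p ∣ n ∧ p ∈ B
    · obtain ⟨p, hp, ⟨k, rfl⟩, hpB⟩ := h
      have hk : k ≠ 0 := right_ne_zero_of_mul hn
      obtain ⟨m, r, h1, h2, h3⟩ := ih k (by
        have := hp.two_le
        nlinarith [Nat.pos_of_ne_zero hk]) hk
      refine ⟨p * m, r, by rw [h1, mul_assoc], Nat.mul_mem_factoredNumbers ?_ h2, h3⟩
      refine Nat.mem_factoredNumbers'.2 fun q hq hqp => ?_
      rw [(Nat.prime_dvd_prime_iff_eq hq hp).1 hqp]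
      exact hpB
    · push Not at h
      refine ⟨1, n, (one_mul n).symm, ?_, h⟩
      exact Nat.mem_factoredNumbers'.2 fun q hq hq1 => absurd (Nat.dvd_one.1 hq1) hq.ne_one

lemma sum_factoredNumbers_inv_le {B : Finset ℕ} (hB : ∀ p ∈ B, p.Prime) (R : ℕ) [DecidablePred
    (· ∈ Nat.factoredNumbers B)] :
    ∑ m ∈ (Icc 1 R).filter (· ∈ Nat.factoredNumbers B), (m : ℝ)⁻¹ ≤
      ∏ p ∈ B, (1 - (p : ℝ)⁻¹)⁻¹ := by
  let f : ℕ →* ℝ :=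
    { toFun := fun n => (n : ℝ)⁻¹
      map_one' := by simp
      map_mul' := fun m n => by push_cast; rw [mul_inv] }
  have h := (EulerProduct.summable_and_hasSum_factoredNumbers_prod_filter_prime_geometric (f := f)
    (fun {p} hp => by
      have : (1 : ℝ) < p := by exact_mod_cast hp.one_lt
      change ‖(p : ℝ)⁻¹‖ < 1
      rw [norm_inv, Real.norm_natCast]
      exact inv_lt_one_of_one_lt₀ this) B).2
  rw [filter_true_of_mem hB] at h
  have h2 := h.tsum_eq
  have h3 : ∑ m ∈ (Icc 1 R).filter (· ∈ Nat.factoredNumbers B), (m : ℝ)⁻¹ =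
      ∑ m ∈ ((Icc 1 R).filter (· ∈ Nat.factoredNumbers B)).subtype (· ∈ Nat.factoredNumbers B),
        f m := by
    rw [sum_subtype_eq_sum_filter (f := fun n => f n), filter_filter]
    simp only [and_self]
    rfl
  rw [h3]
  exact sum_le_hasSum _ (fun m _ => inv_nonneg.2 (Nat.cast_nonneg _)) h

lemma log_le_mul_sq_sum_sieveDensity {w R : ℕ} {B : Finset ℕ} (hw : 1 ≤ w) (hR : 1 ≤ R)
    (hB : ∀ p ∈ B, p.Prime) (hBw : ∀ p, p.Prime → p ≤ w → p ∈ B) :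
    Real.log R ≤ (∏ p ∈ B, (1 - (p : ℝ)⁻¹)⁻¹) * (1 + 2 / w) *
      (∑ T ∈ roughSets R B, ∏ p ∈ T, sieveDensity p) ^ 2 := by
  classical
  set M := (Icc 1 R).filter (· ∈ Nat.factoredNumbers B) with hM
  set S := (Icc 1 R).filter (fun b => b = 1 ∨ w < b) with hS
  have hlog : Real.log R ≤ ∑ n ∈ Icc 1 R, (n : ℝ)⁻¹ := by
    have h1 := log_add_one_le_harmonic R
    rw [harmonic_eq_sum_Icc] at h1
    push_cast at h1
    refine le_trans (Real.log_le_log (by exact_mod_cast hR) (by linarith)) h1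
  have hsq : ∑ b ∈ S, ((b : ℝ) ^ 2)⁻¹ ≤ 1 + 2 / w := by
    have h1 : ∑ b ∈ S, ((b : ℝ) ^ 2)⁻¹ ≤ ∑ b ∈ insert 1 (Ioo w (R + 1)), ((b : ℝ) ^ 2)⁻¹ :=
      sum_le_sum_of_subset_of_nonneg (fun b hb => by
        simp only [hS, mem_filter, mem_Icc, mem_insert, mem_Ioo] at hb ⊢; omega)
        fun _ _ _ => by positivity
    rw [sum_insert (by simp only [mem_Ioo]; omega)] at h1
    have h2 : ∑ i ∈ Ioo w (R + 1), ((i : ℝ) ^ 2)⁻¹ ≤ 2 / (w + 1) := sum_Ioo_inv_sq_le w (R + 1)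
    have hw0 : (0 : ℝ) < w := by exact_mod_cast hw
    have h3 : (2 : ℝ) / (w + 1) ≤ 2 / w := div_le_div_of_nonneg_left (by norm_num) hw0 (by linarith)
    norm_num at h1
    linarith
  have hex : ∀ n : ℕ, ∃ x : ℕ × ℕ × Finset ℕ, n ∈ Icc 1 R →
      (x ∈ M ×ˢ S ×ˢ roughSets R B ∧ n = x.1 * (x.2.1 ^ 2 * ∏ p ∈ x.2.2, p)) := by
    intro n
    by_cases hn : n ∈ Icc 1 R
    swap
    · exact ⟨(0, 0, ∅), fun h => absurd h hn⟩
    obtain ⟨hn1, hnR⟩ := mem_Icc.1 hn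
    obtain ⟨m, r, hmr, hm, hr⟩ := exists_eq_factored_mul B n (by omega)
    have hr0 : 0 < r := Nat.pos_of_ne_zero fun h => by simp [h] at hmr; omega
    have hm0 : 0 < m := Nat.pos_of_ne_zero fun h => by simp [h] at hmr; omega
    obtain ⟨a, b, ha, hb, hab, hsqf⟩ := Nat.sq_mul_squarefree_of_pos hr0
    have hprod := Nat.prod_primeFactors_of_squarefree hsqf
    have hmn : m ≤ n := Nat.le_of_dvd hn1 ⟨r, hmr⟩
    have hrn : r ≤ n := Nat.le_of_dvd hn1 ⟨m, by rw [hmr, mul_comm]⟩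
    have har : a ∣ r := ⟨b ^ 2, by rw [← hab, mul_comm]⟩
    have hbr : b ∣ r := ⟨b * a, by rw [← hab]; ring⟩
    have harle : a ≤ r := Nat.le_of_dvd hr0 har
    have hbrle : b ≤ r := Nat.le_of_dvd hr0 hbr
    refine ⟨(m, b, a.primeFactors), fun _ => ⟨?_, ?_⟩⟩
    · simp only [mem_product, hM, hS, mem_filter, mem_Icc]
      refine ⟨⟨⟨hm0, hmn.trans hnR⟩, hm⟩, ⟨⟨hb, by omega⟩, ?_⟩, ?_⟩
      · by_contra hcon
        push Not at hcon
        have hmf := Nat.minFac_prime hcon.1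
        have hle : b.minFac ≤ w := (Nat.minFac_le hb).trans hcon.2
        exact hr _ hmf ((Nat.minFac_dvd b).trans hbr) (hBw _ hmf hle)
      · rw [mem_roughSets, hprod]
        refine ⟨fun p hp => ?_, by omega⟩
        have hpp := Nat.prime_of_mem_primeFactors hp
        exact ⟨hpp, hr p hpp ((Nat.dvd_of_mem_primeFactors hp).trans har)⟩
    · simp only [hprod, hab, hmr]
  choose φ hφ using hex
  have hinj : Set.InjOn φ (Icc 1 R : Finset ℕ) := fun n hn n' hn' h => by
    rw [(hφ n hn).2, (hφ n' hn').2, h]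
  have hcover : ∑ n ∈ Icc 1 R, (n : ℝ)⁻¹ ≤
      (∑ m ∈ M, (m : ℝ)⁻¹) * ((∑ b ∈ S, ((b : ℝ) ^ 2)⁻¹) *
        ∑ T ∈ roughSets R B, (∏ p ∈ T, (p : ℝ))⁻¹) := by
    rw [sum_mul_sum S, ← sum_product', sum_mul_sum, ← sum_product']
    have h1 : ∑ n ∈ Icc 1 R, (n : ℝ)⁻¹ = ∑ x ∈ (Icc 1 R).image φ,
        (x.1 : ℝ)⁻¹ * (((x.2.1 : ℝ) ^ 2)⁻¹ * (∏ p ∈ x.2.2, (p : ℝ))⁻¹) := by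
      rw [sum_image hinj]
      refine sum_congr rfl fun n hn => ?_
      have h2 := congrArg (fun z : ℕ => (z : ℝ)) (hφ n hn).2
      push_cast at h2
      rw [← mul_inv, ← mul_inv, ← h2]
    rw [h1]
    refine sum_le_sum_of_subset_of_nonneg ?_ fun _ _ _ => by positivity
    intro x hx
    obtain ⟨n, hn, rfl⟩ := mem_image.1 hx
    exact (hφ n hn).1
  have hm := sum_factoredNumbers_inv_le hB R
  have hT := sum_inv_prod_roughSets_le R B
  have hT0 : 0 ≤ ∑ T ∈ roughSets R B, (∏ p ∈ T, (p : ℝ))⁻¹ := sum_nonneg fun _ _ => by positivity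
  have hM0 : 0 ≤ ∑ m ∈ M, (m : ℝ)⁻¹ := sum_nonneg fun _ _ => by positivity
  calc Real.log R ≤ _ := hlog.trans hcover
    _ ≤ (∏ p ∈ B, (1 - (p : ℝ)⁻¹)⁻¹) * ((1 + 2 / w) *
        (∑ T ∈ roughSets R B, ∏ p ∈ T, sieveDensity p) ^ 2) := by
        refine mul_le_mul hm (mul_le_mul hsq hT hT0 (by positivity))
          (mul_nonneg (sum_nonneg fun _ _ => by positivity) hT0) (hM0.trans hm)
    _ = _ := by ring

/-! ### Small primes -/

/-- A sum of a multiplicative function over the divisors of a product of prime powers. -/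
lemma sum_divisors_prod_prime_pow {F : ℕ → ℝ} (h1 : F 1 = 1)
    (hF : ∀ m n : ℕ, m.Coprime n → F (m * n) = F m * F n) (j : ℕ) (S : Finset ℕ) :
    (∀ q ∈ S, q.Prime) →
    ∑ e ∈ (∏ q ∈ S, q ^ j).divisors, F e = ∏ q ∈ S, ∑ i ∈ range (j + 1), F (q ^ i) := by
  induction S using Finset.induction_on with
  | empty => intro; simp [h1]
  | insert q S hq ih =>
    intro hS
    have hqp := hS q (mem_insert_self _ _)
    have hco : (q ^ j).Coprime (∏ q ∈ S, q ^ j) := by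
      refine Nat.Coprime.prod_right fun p hp => Nat.Coprime.pow _ _ ?_
      rw [Nat.coprime_primes hqp (hS p (mem_insert_of_mem hp))]
      rintro rfl
      exact hq hp
    rw [prod_insert hq, prod_insert hq, ← ih fun p hp => hS p (mem_insert_of_mem hp),
      ← Nat.sum_divisors_prime_pow hqp]
    let f : ArithmeticFunction ℝ := ⟨fun n => if n = 0 then 0 else F n, by simp⟩
    have hf : f.IsMultiplicative := by
      refine ArithmeticFunction.IsMultiplicative.iff_ne_zero.2 ⟨by simp [f, h1], ?_⟩
      intro m n hm hn hmn
      simp [f, hm, hn, hF m n hmn]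
    have hfs : ∀ n : ℕ, (f * (ArithmeticFunction.zeta : ArithmeticFunction ℝ)) n =
        ∑ e ∈ n.divisors, F e := by
      intro n
      rw [ArithmeticFunction.coe_mul_zeta_apply]
      refine sum_congr rfl fun e he => ?_
      simp [f, (Nat.pos_of_mem_divisors he).ne']
    rw [← hfs, ← hfs, ← hfs]
    exact (hf.mul ArithmeticFunction.isMultiplicative_zeta.natCast).map_mul_of_coprime hco

/-- The multiplicative function with `smallCoeff (q ^ j) = -1 / (j * (j + 1))` for `1 ≤ j`. -/
noncomputable def smallCoeff (e : ℕ) : ℝ :=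
  ∏ p ∈ e.primeFactors, -(1 / ((e.factorization p : ℝ) * (e.factorization p + 1)))

lemma smallCoeff_mul {m n : ℕ} (h : m.Coprime n) :
    smallCoeff (m * n) = smallCoeff m * smallCoeff n := by
  rw [smallCoeff, smallCoeff, smallCoeff, h.primeFactors_mul,
    prod_union h.disjoint_primeFactors]
  congr 1
  · refine prod_congr rfl fun p hp => ?_
    rw [Nat.factorization_eq_of_coprime_left h (by simpa using hp)]
  · refine prod_congr rfl fun p hp => ?_
    rw [Nat.factorization_eq_of_coprime_right h (by simpa using hp)]

lemma smallCoeff_one : smallCoeff 1 = 1 := by simp [smallCoeff]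

lemma smallCoeff_prime_pow {q : ℕ} (hq : q.Prime) (j : ℕ) :
    smallCoeff (q ^ (j + 1)) = 1 / ((j : ℝ) + 2) - 1 / ((j : ℝ) + 1) := by
  rw [smallCoeff, Nat.primeFactors_prime_pow (by omega) hq, prod_singleton, hq.factorization_pow]
  simp only [Finsupp.single_eq_same]
  push_cast
  have : (j : ℝ) + 1 ≠ 0 := by positivity
  have : (j : ℝ) + 2 ≠ 0 := by positivity
  field_simp
  ring

lemma abs_smallCoeff_le_one (e : ℕ) : |smallCoeff e| ≤ 1 := by
  rw [smallCoeff, abs_prod]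
  refine prod_le_one (fun _ _ => abs_nonneg _) fun p hp => ?_
  have h1 : (1 : ℝ) ≤ e.factorization p := by
    have := (Nat.prime_of_mem_primeFactors hp).factorization_pos_of_dvd
      (Nat.pos_of_mem_primeFactors hp |> fun _ => (Nat.mem_primeFactors.1 hp).2.2)
      (Nat.dvd_of_mem_primeFactors hp)
    exact_mod_cast this
  rw [abs_neg, abs_of_nonneg (by positivity)]
  exact (div_le_one (by positivity)).2 (by nlinarith)

lemma sum_range_smallCoeff {q : ℕ} (hq : q.Prime) (v : ℕ) :
    ∑ i ∈ range (v + 1), smallCoeff (q ^ i) = 1 / ((v : ℝ) + 1) := by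
  induction v with
  | zero => simp [smallCoeff_one]
  | succ v ih =>
    rw [sum_range_succ, ih, smallCoeff_prime_pow hq]
    push_cast
    ring

lemma sum_smallCoeff_dvd {j : ℕ} {S : Finset ℕ} (hS : ∀ q ∈ S, q.Prime) {m : ℕ} (hm : m ≠ 0) :
    ∑ e ∈ (∏ q ∈ S, q ^ j).divisors, (if e ∣ m then smallCoeff e else 0) =
      ∏ q ∈ S, 1 / ((min (m.factorization q) j : ℕ) + 1 : ℝ) := by
  rw [sum_divisors_prod_prime_pow (by simp [smallCoeff_one]) _ j S hS]
  · refine prod_congr rfl fun q hq => ?_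
    rw [← sum_range_smallCoeff (hS q hq), ← sum_filter]
    refine sum_congr ?_ fun _ _ => rfl
    ext i
    simp only [mem_filter, mem_range, (hS q hq).pow_dvd_iff_le_factorization hm]
    omega
  · intro k n hkn
    rw [smallCoeff_mul hkn]
    have : k * n ∣ m ↔ k ∣ m ∧ n ∣ m :=
      ⟨fun h => ⟨(dvd_mul_right _ _).trans h, (dvd_mul_left _ _).trans h⟩,
        fun h => hkn.mul_dvd_of_dvd_of_dvd h.1 h.2⟩
    by_cases h1 : k ∣ m <;> by_cases h2 : n ∣ m <;> simp [this, h1, h2]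

lemma sum_smallCoeff_div_totient {j : ℕ} {S : Finset ℕ} (hS : ∀ q ∈ S, q.Prime) :
    ∑ e ∈ (∏ q ∈ S, q ^ j).divisors, smallCoeff e / (e.totient : ℝ) =
      ∏ q ∈ S, ∑ i ∈ range (j + 1), smallCoeff (q ^ i) / ((q ^ i).totient : ℝ) := by
  rw [sum_divisors_prod_prime_pow (by simp [smallCoeff_one]) _ j S hS]
  intro k n hkn
  rw [smallCoeff_mul hkn, Nat.totient_mul hkn]
  push_cast
  rw [mul_div_mul_comm]

/-- The reciprocal of the divisor function is bounded by the contribution of the primes in `S`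
times a power of two for each of the other primes. -/
lemma inv_card_divisors_le (j : ℕ) (S A : Finset ℕ) (hS : ∀ q ∈ S, q.Prime) {m : ℕ} (hm : m ≠ 0)
    (hA : A ⊆ m.primeFactors) (hSA : Disjoint S A) :
    (1 : ℝ) / (m.divisors.card : ℝ) ≤
      (∑ e ∈ (∏ q ∈ S, q ^ j).divisors, (if e ∣ m then smallCoeff e else 0)) *
        ((2 : ℝ) ^ A.card)⁻¹ := by
  rw [sum_smallCoeff_dvd hS hm, Nat.card_divisors hm]
  have h1 : ∏ q ∈ S, (1 / ((min (m.factorization q) j : ℕ) + 1 : ℝ)) =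
      (∏ q ∈ S, ((min (m.factorization q) j : ℕ) + 1 : ℝ))⁻¹ := by
    rw [← prod_inv_distrib]
    simp
  rw [h1, ← mul_inv, one_div]
  refine inv_anti₀ (mul_pos (prod_pos fun _ _ => by positivity) (by positivity)) ?_
  have h2 : ∏ q ∈ m.primeFactors, (m.factorization q + 1) =
      ∏ q ∈ m.primeFactors ∪ S, (m.factorization q + 1) := by
    refine prod_subset subset_union_left fun q hq hqm => ?_
    rw [Nat.factorization_eq_zero_of_not_dvd, zero_add]
    intro h
    refine hqm (Nat.mem_primeFactors.2 ⟨hS q ?_, h, hm⟩)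
    simp only [mem_union] at hq
    tauto
  have h3 : (∏ q ∈ S, ((min (m.factorization q) j : ℕ) + 1)) * 2 ^ A.card ≤
      ∏ q ∈ m.primeFactors ∪ S, (m.factorization q + 1) := by
    calc _ ≤ (∏ q ∈ S, (m.factorization q + 1)) * ∏ q ∈ A, (m.factorization q + 1) := by
          refine Nat.mul_le_mul (prod_le_prod' fun q _ => by omega) ?_
          rw [← prod_const]
          refine prod_le_prod' fun q hq => ?_
          have := Nat.mem_primeFactors.1 (hA hq)
          have := this.1.factorization_pos_of_dvd hm this.2.1
          omega
      _ = ∏ q ∈ S ∪ A, (m.factorization q + 1) := (prod_union hSA).symm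
      _ ≤ _ := prod_le_prod_of_subset_of_one_le' 
          (union_subset subset_union_right (hA.trans subset_union_left)) fun _ _ _ => by omega
  rw [h2]
  exact_mod_cast h3

/-- The local factor of the constant at the prime `q`. -/
noncomputable def localFactor (q : ℕ) : ℝ :=
  (q : ℝ) * Real.log ((q : ℝ) / ((q : ℝ) - 1)) - 1 / ((q : ℝ) - 1)

lemma tendsto_sum_smallCoeff_div_totient {q : ℕ} (hq : q.Prime) :
    Filter.Tendsto (fun j => ∑ i ∈ range (j + 1), smallCoeff (q ^ i) / ((q ^ i).totient : ℝ))
      Filter.atTop (nhds (localFactor q)) := by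
  have hq1 : (1 : ℝ) < q := by exact_mod_cast hq.one_lt
  have hq0 : (0 : ℝ) < q := by linarith
  have hq2 : (q : ℝ) - 1 ≠ 0 := by linarith
  have hx : |(q : ℝ)⁻¹| < 1 := by
    rw [abs_of_pos (by positivity)]
    exact inv_lt_one_of_one_lt₀ hq1
  have h1 := Real.hasSum_pow_div_log_of_abs_lt_one hx
  have h2 := (hasSum_nat_add_iff' 1).2 h1
  have h3 := ((h2.mul_left (q : ℝ)).sub h1).mul_left ((q : ℝ) / (q - 1))
  have h4 : ∀ i : ℕ, smallCoeff (q ^ (i + 1)) / ((q ^ (i + 1)).totient : ℝ) =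
      (q : ℝ) / (q - 1) * (q * ((q : ℝ)⁻¹ ^ (i + 1 + 1) / (((i + 1 : ℕ) : ℝ) + 1)) -
        (q : ℝ)⁻¹ ^ (i + 1) / (i + 1)) := by
    intro i
    rw [smallCoeff_prime_pow hq, Nat.totient_prime_pow hq (by omega)]
    push_cast [hq.one_le]
    rw [inv_pow, inv_pow]
    have : (i : ℝ) + 1 ≠ 0 := by positivity
    have : (i : ℝ) + 2 ≠ 0 := by positivity
    have : (i : ℝ) + 1 + 1 ≠ 0 := by positivity
    field_simp
    ring
  have h5 := h3.tendsto_sum_nat.const_add 1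
  have h6 : -Real.log (1 - (q : ℝ)⁻¹) = Real.log ((q : ℝ) / (q - 1)) := by
    rw [← Real.log_inv]
    congr 1
    field_simp
  rw [h6] at h5
  convert h5 using 2 with j
  · rw [sum_range_succ', add_comm]
    congr 1
    · simp [smallCoeff_one]
    · exact sum_congr rfl fun i _ => h4 i
  · simp only [localFactor, sum_range_one, zero_add, pow_one, Nat.cast_zero, div_one]
    generalize Real.log ((q : ℝ) / (q - 1)) = y
    field_simp
    ring

/-! ### The sieve -/

lemma prod_id_dvd_iff {U : Finset ℕ} (hU : ∀ p ∈ U, p.Prime) {m : ℕ} (hm : m ≠ 0) :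
    ∏ p ∈ U, p ∣ m ↔ U ⊆ m.primeFactors := by
  constructor
  · exact fun h p hp => Nat.mem_primeFactors.2 ⟨hU p hp, (dvd_prod_of_mem _ hp).trans h, hm⟩
  · exact fun h => (prod_dvd_prod_of_subset _ _ _ h).trans (Nat.prod_primeFactors_dvd m)

lemma prod_id_ne_zero {U : Finset ℕ} (hU : ∀ p ∈ U, p.Prime) : ∏ p ∈ U, p ≠ 0 :=
  prod_ne_zero_iff.2 fun p hp => (hU p hp).ne_zero

lemma primeFactors_prod_id {U : Finset ℕ} (hU : ∀ p ∈ U, p.Prime) :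
    (∏ p ∈ U, p).primeFactors = U := Nat.primeFactors_prod hU

lemma totient_prod_id {U : Finset ℕ} (hU : ∀ p ∈ U, p.Prime) :
    (∏ p ∈ U, p).totient = ∏ p ∈ U, (p - 1) := by
  induction U using Finset.induction_on with
  | empty => simp
  | insert q U hq ih =>
    have hU' : ∀ p ∈ U, p.Prime := fun p hp => hU p (mem_insert_of_mem hp)
    have hqp := hU q (mem_insert_self _ _)
    rw [prod_insert hq, prod_insert hq, Nat.totient_mul, ih hU', Nat.totient_prime hqp]
    refine Nat.Coprime.prod_right fun p hp => (Nat.coprime_primes hqp (hU' p hp)).2 ?_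
    rintro rfl
    exact hq hp

lemma primeFactors_subset_of_mem_divisors_prod {S : Finset ℕ} (hS : ∀ q ∈ S, q.Prime) {j e : ℕ}
    (he : e ∈ (∏ q ∈ S, q ^ j).divisors) : e.primeFactors ⊆ S := by
  intro p hp
  have hpp := Nat.prime_of_mem_primeFactors hp
  have h1 := (Nat.dvd_of_mem_primeFactors hp).trans (Nat.dvd_of_mem_divisors he)
  obtain ⟨q, hq, hpq⟩ := (hpp.prime.dvd_finsetProd_iff _).1 h1
  have := (Nat.prime_dvd_prime_iff_eq hpp (hS q hq)).1 (hpp.dvd_of_dvd_pow hpq)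
  exact this ▸ hq

set_option maxHeartbeats 1000000 in
/-- The upper bound sieve, with the primes of `S` treated exactly up to the exponent `j`. -/
lemma sum_primeWeight_div_card_divisors_le {Ψ : ℝ → ℝ} (hΨ : ∀ u, 0 ≤ Ψ u) (X : ℝ)
    {a j R : ℕ} (ha : 1 ≤ a) (hR : 1 ≤ R) {S B 𝓚 : Finset ℕ} (hS : ∀ q ∈ S, q.Prime) (hSB : S ⊆ B)
    (hK : ∀ e ∈ (∏ q ∈ S, q ^ j).divisors, ∀ T₁ ∈ roughSets R B, ∀ T₂ ∈ roughSets R B,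
      e * ∏ p ∈ T₁ ∪ T₂, p ∈ 𝓚) :
    ∑ n ∈ range (⌊Real.exp (X + 1)⌋₊ + 1), primeWeight Ψ X n * (1 / ((n + a).divisors.card : ℝ)) ≤
      (∏ q ∈ S, ∑ i ∈ range (j + 1), smallCoeff (q ^ i) / ((q ^ i).totient : ℝ)) *
        (∑ T ∈ roughSets R B, ∏ p ∈ T, sieveDensity p)⁻¹ *
        ∑ n ∈ range (⌊Real.exp (X + 1)⌋₊ + 1), primeWeight Ψ X n +
      ∑ k ∈ 𝓚, (3 : ℝ) ^ k.primeFactors.card * |progressionError Ψ X a k| := by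
  classical
  set N := range (⌊Real.exp (X + 1)⌋₊ + 1) with hN
  set 𝓡 := roughSets R B with h𝓡
  set 𝓔 := (∏ q ∈ S, q ^ j).divisors with h𝓔
  set c := selbergWeight 𝓡 sieveDensity with hc
  set W := ∑ n ∈ N, primeWeight Ψ X n with hW
  have hempty : ∅ ∈ 𝓡 := empty_mem_roughSets hR B
  have hdown : ∀ L ∈ 𝓡, ∀ T ⊆ L, T ∈ 𝓡 := fun L hL T hT => mem_roughSets_of_subset hL hT
  have hprime : ∀ T ∈ 𝓡, ∀ p ∈ T, p.Prime := fun T hT p hp => ((mem_roughSets.1 hT).1 p hp).1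
  have hnotB : ∀ T ∈ 𝓡, ∀ p ∈ T, p ∉ B := fun T hT p hp => ((mem_roughSets.1 hT).1 p hp).2
  have hdens : ∀ L ∈ 𝓡, ∀ q ∈ L, 0 < sieveDensity q := fun L hL q hq =>
    sieveDensity_pos (hprime L hL q hq).two_le
  have hUp : ∀ T₁ ∈ 𝓡, ∀ T₂ ∈ 𝓡, ∀ p ∈ T₁ ∪ T₂, p.Prime := fun T₁ h₁ T₂ h₂ p hp =>
    (mem_union.1 hp).elim (hprime T₁ h₁ p) (hprime T₂ h₂ p)
  have hUB : ∀ T₁ ∈ 𝓡, ∀ T₂ ∈ 𝓡, ∀ p ∈ T₁ ∪ T₂, p ∉ B := fun T₁ h₁ T₂ h₂ p hp =>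
    (mem_union.1 hp).elim (hnotB T₁ h₁ p) (hnotB T₂ h₂ p)
  have hco : ∀ e ∈ 𝓔, ∀ T₁ ∈ 𝓡, ∀ T₂ ∈ 𝓡, e.Coprime (∏ p ∈ T₁ ∪ T₂, p) := by
    intro e he T₁ h₁ T₂ h₂
    rw [← Nat.disjoint_primeFactors (Nat.pos_of_mem_divisors he).ne'
      (prod_id_ne_zero (hUp T₁ h₁ T₂ h₂)), primeFactors_prod_id (hUp T₁ h₁ T₂ h₂)]
    exact disjoint_left.2 fun p hp hp' => hUB T₁ h₁ T₂ h₂ p hp'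
      (hSB (primeFactors_subset_of_mem_divisors_prod hS he hp))
  have hpoint : ∀ n : ℕ, 1 / ((n + a).divisors.card : ℝ) ≤ ∑ e ∈ 𝓔, ∑ T₁ ∈ 𝓡, ∑ T₂ ∈ 𝓡,
      if e * ∏ p ∈ T₁ ∪ T₂, p ∣ n + a then
        smallCoeff e * (c T₁ * c T₂ * ((2 : ℝ) ^ (T₁ ∪ T₂).card)⁻¹) else 0 := by
    intro n
    have hm : n + a ≠ 0 := by omega
    set A := (n + a).primeFactors.filter (· ∉ B) with hA
    have hSA : Disjoint S A := disjoint_left.2 fun p hp hp' => (mem_filter.1 hp').2 (hSB hp)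
    refine (inv_card_divisors_le j S A hS hm (filter_subset _ _) hSA).trans ?_
    have h1 := inv_two_pow_card_le_sum (c := c) hempty (selbergWeight_empty hempty hdens) A
    have h0 : 0 ≤ ∑ e ∈ 𝓔, (if e ∣ n + a then smallCoeff e else 0) := by
      rw [h𝓔, sum_smallCoeff_dvd hS hm]
      exact prod_nonneg fun _ _ => by positivity
    refine (mul_le_mul_of_nonneg_left h1 h0).trans (le_of_eq ?_)
    rw [sum_mul]
    refine sum_congr rfl fun e he => ?_
    rw [mul_sum]
    refine sum_congr rfl fun T₁ h₁ => ?_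
    rw [mul_sum]
    refine sum_congr rfl fun T₂ h₂ => ?_
    have h2 : T₁ ∪ T₂ ⊆ A ↔ ∏ p ∈ T₁ ∪ T₂, p ∣ n + a := by
      rw [prod_id_dvd_iff (hUp T₁ h₁ T₂ h₂) hm, hA]
      refine ⟨fun h => h.trans (filter_subset _ _), fun h p hp => mem_filter.2 ⟨h hp, ?_⟩⟩
      exact hUB T₁ h₁ T₂ h₂ p hp
    have h3 : e * ∏ p ∈ T₁ ∪ T₂, p ∣ n + a ↔ e ∣ n + a ∧ ∏ p ∈ T₁ ∪ T₂, p ∣ n + a :=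
      ⟨fun h => ⟨(dvd_mul_right _ _).trans h, (dvd_mul_left _ _).trans h⟩,
        fun h => (hco e he T₁ h₁ T₂ h₂).mul_dvd_of_dvd_of_dvd h.1 h.2⟩
    simp only [h2, h3]
    by_cases h4 : e ∣ n + a <;> by_cases h5 : ∏ p ∈ T₁ ∪ T₂, p ∣ n + a <;> simp [h4, h5]
  have hsum : ∑ n ∈ N, primeWeight Ψ X n * (1 / ((n + a).divisors.card : ℝ)) ≤
      ∑ e ∈ 𝓔, ∑ T₁ ∈ 𝓡, ∑ T₂ ∈ 𝓡,
        smallCoeff e * (c T₁ * c T₂ * ((2 : ℝ) ^ (T₁ ∪ T₂).card)⁻¹) *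
        (1 / ((e * ∏ p ∈ T₁ ∪ T₂, p).totient : ℝ) * W +
          progressionError Ψ X a (e * ∏ p ∈ T₁ ∪ T₂, p)) := by
    refine (sum_le_sum fun n _ => mul_le_mul_of_nonneg_left (hpoint n)
      (primeWeight_nonneg hΨ X n)).trans (le_of_eq ?_)
    simp only [mul_sum]
    rw [sum_comm]
    refine sum_congr rfl fun e he => ?_
    rw [sum_comm]
    refine sum_congr rfl fun T₁ h₁ => ?_
    rw [sum_comm]
    refine sum_congr rfl fun T₂ h₂ => ?_
    rw [progressionError, ← hN, ← hW, add_sub_cancel, mul_sum, sum_filter]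
    refine sum_congr rfl fun n _ => ?_
    split_ifs
    · ring
    · ring
  refine hsum.trans ?_
  clear_value W
  simp only [mul_add, sum_add_distrib]
  refine add_le_add (le_of_eq ?_) ?_
  · rw [← sum_smallCoeff_div_totient hS, ← sum_selbergWeight_mul_selbergWeight hdown hempty hdens,
      sum_mul, sum_mul]
    refine sum_congr rfl fun e he => ?_
    rw [mul_sum, sum_mul]
    refine sum_congr rfl fun T₁ h₁ => ?_
    rw [mul_sum, sum_mul]
    refine sum_congr rfl fun T₂ h₂ => ?_
    have h1 : ∏ q ∈ T₁ ∪ T₂, (1 + (sieveDensity q)⁻¹) =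
        (2 : ℝ) ^ (T₁ ∪ T₂).card * ((∏ p ∈ T₁ ∪ T₂, p).totient : ℝ) := by
      rw [totient_prod_id (hUp T₁ h₁ T₂ h₂), ← prod_const, Nat.cast_prod, ← prod_mul_distrib]
      refine prod_congr rfl fun q hq => ?_
      have := (hUp T₁ h₁ T₂ h₂ q hq).one_le
      push_cast [this]
      rw [sieveDensity, one_div, inv_inv]
      ring
    rw [h1, Nat.totient_mul (hco e he T₁ h₁ T₂ h₂), mul_inv]
    push_cast
    rw [hc, one_div, mul_inv]
    ring
  · set H : ℕ → ℝ := fun k => |progressionError Ψ X a k| with hH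
    have hH0 : ∀ k, 0 ≤ H k := fun k => abs_nonneg _
    have h1 : ∑ e ∈ 𝓔, ∑ T₁ ∈ 𝓡, ∑ T₂ ∈ 𝓡,
        smallCoeff e * (c T₁ * c T₂ * ((2 : ℝ) ^ (T₁ ∪ T₂).card)⁻¹) *
          progressionError Ψ X a (e * ∏ p ∈ T₁ ∪ T₂, p) ≤
        ∑ x ∈ 𝓔 ×ˢ 𝓡 ×ˢ 𝓡, ((2 : ℝ) ^ (x.2.1 ∪ x.2.2).card)⁻¹ *
          H (x.1 * ∏ p ∈ x.2.1 ∪ x.2.2, p) := by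
      rw [sum_product]
      refine sum_le_sum fun e he => ?_
      rw [sum_product]
      refine sum_le_sum fun T₁ h₁ => sum_le_sum fun T₂ h₂ => ?_
      refine (le_abs_self _).trans ?_
      rw [abs_mul, abs_mul, abs_mul, abs_mul]
      have a1 := abs_smallCoeff_le_one e
      have a2 := abs_selbergWeight_le_one hdown hempty hdens h₁
      have a3 := abs_selbergWeight_le_one hdown hempty hdens h₂
      have a4 : |((2 : ℝ) ^ (T₁ ∪ T₂).card)⁻¹| = ((2 : ℝ) ^ (T₁ ∪ T₂).card)⁻¹ :=
        abs_of_nonneg (by positivity)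
      rw [a4]
      refine mul_le_mul_of_nonneg_right ?_ (hH0 _)
      have a5 : |c T₁| * |c T₂| ≤ 1 := mul_le_one₀ a2 (abs_nonneg _) a3
      have a6 : 0 ≤ ((2 : ℝ) ^ (T₁ ∪ T₂).card)⁻¹ := by positivity
      have a7 : |c T₁| * |c T₂| * ((2 : ℝ) ^ (T₁ ∪ T₂).card)⁻¹ ≤ ((2 : ℝ) ^ (T₁ ∪ T₂).card)⁻¹ :=
        mul_le_of_le_one_left a6 a5
      exact (mul_le_of_le_one_left (by positivity) a1).trans a7
    refine h1.trans ?_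
    have hmaps : ∀ x ∈ 𝓔 ×ˢ 𝓡 ×ˢ 𝓡, x.1 * ∏ p ∈ x.2.1 ∪ x.2.2, p ∈ 𝓚 := by
      rintro ⟨e, T₁, T₂⟩ hx
      simp only [mem_product] at hx
      exact hK e hx.1 T₁ hx.2.1 T₂ hx.2.2
    rw [← sum_fiberwise_of_maps_to hmaps]
    refine sum_le_sum fun k _ => ?_
    set U := k.primeFactors.filter (· ∉ B) with hU
    have hfib : ∀ x ∈ (𝓔 ×ˢ 𝓡 ×ˢ 𝓡).filter (fun x => x.1 * ∏ p ∈ x.2.1 ∪ x.2.2, p = k),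
        x.2.1 ∪ x.2.2 = U := by
      rintro ⟨e, T₁, T₂⟩ hx
      simp only [mem_filter, mem_product] at hx
      obtain ⟨⟨he, h₁, h₂⟩, hk⟩ := hx
      have hkp : k.primeFactors = e.primeFactors ∪ (T₁ ∪ T₂) := by
        rw [← hk, Nat.primeFactors_mul (Nat.pos_of_mem_divisors he).ne'
          (prod_id_ne_zero (hUp T₁ h₁ T₂ h₂)), primeFactors_prod_id (hUp T₁ h₁ T₂ h₂)]
      ext p
      have b1 := @primeFactors_subset_of_mem_divisors_prod S hS j e he p
      have b2 := @hSB p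
      have b3 := hUB T₁ h₁ T₂ h₂ p
      rw [hU, mem_filter, hkp, mem_union (s := e.primeFactors)]
      tauto
    have h2 : ∀ x ∈ (𝓔 ×ˢ 𝓡 ×ˢ 𝓡).filter (fun x => x.1 * ∏ p ∈ x.2.1 ∪ x.2.2, p = k),
        ((2 : ℝ) ^ (x.2.1 ∪ x.2.2).card)⁻¹ * H (x.1 * ∏ p ∈ x.2.1 ∪ x.2.2, p) =
          ((2 : ℝ) ^ U.card)⁻¹ * H k := by
      intro x hx
      rw [hfib x hx, ← hfib x hx, (mem_filter.1 hx).2]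
    rw [sum_congr rfl h2, sum_const, nsmul_eq_mul, ← mul_assoc]
    refine mul_le_mul_of_nonneg_right ?_ (hH0 k)
    have h3 : ((𝓔 ×ˢ 𝓡 ×ˢ 𝓡).filter (fun x => x.1 * ∏ p ∈ x.2.1 ∪ x.2.2, p = k)).card ≤
        (U.powerset ×ˢ U.powerset).card := by
      refine card_le_card_of_injOn (fun x => x.2) ?_ ?_
      · intro x hx
        have := hfib x hx
        simp only [coe_product, Set.mem_prod, mem_coe, mem_powerset, ← this]
        exact ⟨subset_union_left, subset_union_right⟩
      · rintro ⟨e, T⟩ hx ⟨e', T'⟩ hx' heq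
        have heq' : T = T' := heq
        subst heq'
        have hx1 := (mem_filter.1 (mem_coe.1 hx))
        have hx2 := (mem_filter.1 (mem_coe.1 hx')).2
        simp only [mem_product] at hx1
        have hne := prod_id_ne_zero (hUp T.1 hx1.1.2.1 T.2 hx1.1.2.2)
        have := hx1.2.trans hx2.symm
        rw [Nat.eq_of_mul_eq_mul_right (Nat.pos_of_ne_zero hne) this]
    rw [card_product, card_powerset] at h3
    have h4 : (((𝓔 ×ˢ 𝓡 ×ˢ 𝓡).filter (fun x => x.1 * ∏ p ∈ x.2.1 ∪ x.2.2, p = k)).card : ℝ) ≤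
        (2 : ℝ) ^ U.card * 2 ^ U.card := by exact_mod_cast h3
    refine (mul_le_mul_of_nonneg_right h4 (by positivity)).trans ?_
    rw [mul_inv_cancel_right₀ (by positivity)]
    calc (2 : ℝ) ^ U.card ≤ 3 ^ U.card := pow_le_pow_left₀ (by norm_num) (by norm_num) _
      _ ≤ 3 ^ k.primeFactors.card :=
        pow_le_pow_right₀ (by norm_num) (card_le_card (filter_subset _ _))

lemma tendsto_sum_primeWeight {Ψ : ℝ → ℝ} (hΨ : ContDiff ℝ (⊤ : ℕ∞) Ψ)
    (hsupp : ∀ u, 1 < |u| → Ψ u = 0) :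
    Filter.Tendsto (fun X => ∑ n ∈ range (⌊Real.exp (X + 1)⌋₊ + 1), primeWeight Ψ X n)
      Filter.atTop (nhds (∫ u, Ψ u)) := by
  have hg : ContDiff ℝ (⊤ : ℕ∞) (fun u => (Ψ u : ℂ)) := Complex.ofRealCLM.contDiff.comp hΨ
  have hgs : ∀ u, 1 < |u| → (fun u => (Ψ u : ℂ)) u = 0 := fun u hu => by simp [hsupp u hu]
  have hΨc : HasCompactSupport Ψ := HasCompactSupport.intro (isCompact_Icc (a := -1) (b := 1))
    fun u hu => hsupp u (by
      by_contra h
      exact hu (abs_le.1 (not_lt.1 h)))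
  have hgc : HasCompactSupport (fun u => (Ψ u : ℂ)) := by
    refine HasCompactSupport.intro (isCompact_Icc (a := -1) (b := 1)) fun u hu => hgs u (by
      by_contra h
      exact hu (abs_le.1 (not_lt.1 h)))
  obtain ⟨C₀, hC₀⟩ := hΨc.exists_bound_of_continuous hΨ.continuous
  have hC : ∀ u, |Ψ u| ≤ C₀ := hC₀
  have hlim : Filter.Tendsto (fun X : ℝ => 2 * C₀ * Real.exp (3 / 2) * (X + 1) *
      Real.exp (-(X / 2))) Filter.atTop (nhds 0) := by
    have h2 : Filter.Tendsto (fun X : ℝ => X / 2) Filter.atTop Filter.atTop :=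
      Filter.tendsto_id.atTop_div_const (by norm_num)
    have h3 := (((Real.tendsto_pow_mul_exp_neg_atTop_nhds_zero 1).comp h2).const_mul 2).add
      ((Real.tendsto_pow_mul_exp_neg_atTop_nhds_zero 0).comp h2)
    have h4 := h3.const_mul (2 * C₀ * Real.exp (3 / 2))
    simp only [Function.comp_def, mul_zero, add_zero] at h4
    refine h4.congr fun X => ?_
    ring
  rw [Metric.tendsto_nhds]
  intro ε hε
  filter_upwards [hlim.eventually (gt_mem_nhds (half_pos hε)), Filter.eventually_ge_atTop 0,
    eventually_norm_sum_vonMangoldt_sub_integral_le hg hgc (show 0 < ε / 3 by positivity)]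
    with X hX hX0 hmain
  have h1 := norm_vonMangoldtSum_sub_le hsupp hC hX0 (1 : DirichletCharacter ℂ 1)
  have h2 := hmain (⌊Real.exp (X + 1)⌋₊ + 1) fun n hn => by
    have hlt : Real.exp (X + 1) < n := Nat.lt_of_floor_lt (by omega)
    have := (Real.lt_log_iff_exp_lt ((Real.exp_pos _).trans hlt)).2 hlt
    exact hgs _ (by rw [abs_of_pos (by linarith)]; linarith)
  have h3 : ∀ n : ℕ, (1 : DirichletCharacter ℂ 1) n = 1 := fun n =>
    MulChar.one_apply (isUnit_of_subsingleton _)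
  rw [vonMangoldtSum_eq] at h1
  simp only [h3, mul_one, one_mul] at h1
  rw [show (∫ u, (Ψ u : ℂ)) = ((∫ u, Ψ u : ℝ) : ℂ) from integral_ofReal] at h2
  rw [dist_eq_norm]
  have h4 : ‖(((∑ n ∈ range (⌊Real.exp (X + 1)⌋₊ + 1), primeWeight Ψ X n) - ∫ u, Ψ u : ℝ) : ℂ)‖ <
      ε := by
    push_cast
    have h5 := norm_add_le_of_le h1 h2
    rw [sub_add_sub_cancel] at h5
    refine lt_of_le_of_lt h5 ?_
    linarith
  rwa [Complex.norm_real] at h4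

/-- The upper bound for the smooth sum of `1 / τ(p + a)` at a fixed sifting level `w`. -/
lemma eventually_sum_primeWeight_div_card_divisors_le {Ψ : ℝ → ℝ} (hΨ : ContDiff ℝ (⊤ : ℕ∞) Ψ)
    (hsupp : ∀ u, 1 < |u| → Ψ u = 0) (hΨ0 : ∀ u, 0 ≤ Ψ u) {a w : ℕ} (ha : 1 ≤ a) (haw : a ≤ w)
    (j : ℕ) (hj : 0 ≤ ∏ q ∈ (range (w + 1)).filter (fun q => q.Prime ∧ ¬ q ∣ a),
      ∑ i ∈ range (j + 1), smallCoeff (q ^ i) / ((q ^ i).totient : ℝ)) :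
    ∃ c : ℝ, ∀ᶠ X in Filter.atTop,
    ∑ n ∈ range (⌊Real.exp (X + 1)⌋₊ + 1), primeWeight Ψ X n * (1 / ((n + a).divisors.card : ℝ)) ≤
      (∏ q ∈ (range (w + 1)).filter (fun q => q.Prime ∧ ¬ q ∣ a),
        ∑ i ∈ range (j + 1), smallCoeff (q ^ i) / ((q ^ i).totient : ℝ)) *
      Real.sqrt ((∏ p ∈ (range (w + 1)).filter Nat.Prime, (1 - (p : ℝ)⁻¹)⁻¹) *
        (1 + 1 / w) * (1 + 2 / w) / (11 / 50 * X - c)) *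
      (∑ n ∈ range (⌊Real.exp (X + 1)⌋₊ + 1), primeWeight Ψ X n) + 1 / X := by
  have hw : 1 ≤ w := ha.trans haw
  have hw0 : (0 : ℝ) < w := by exact_mod_cast hw
  set S := (range (w + 1)).filter (fun q => q.Prime ∧ ¬ q ∣ a) with hSdef
  set P := (range (w + 1)).filter Nat.Prime with hPdef
  have hS : ∀ q ∈ S, q.Prime := fun q hq => (mem_filter.1 hq).2.1
  have hP : ∀ q ∈ P, q.Prime := fun q hq => (mem_filter.1 hq).2
  have hSP : S ⊆ P := fun q hq => mem_filter.2 ⟨(mem_filter.1 hq).1, hS q hq⟩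
  have hPw : ∀ p, p.Prime → p ≤ w → p ∈ P := fun p hp hpw =>
    mem_filter.2 ⟨mem_range.2 (by omega), hp⟩
  set M := ∏ q ∈ S, q ^ j with hM
  have hM0 : 0 < M := prod_pos fun q hq => pow_pos (hS q hq).pos _
  have hMr : (0 : ℝ) < M := by exact_mod_cast hM0
  refine ⟨Real.log (2 * M), ?_⟩
  have hbig : ∀ᶠ X : ℝ in Filter.atTop, Real.log (2 * M) + 1 ≤ 11 / 50 * X :=
    (Filter.tendsto_id.const_mul_atTop (show (0 : ℝ) < 11 / 50 by norm_num)).eventually_ge_atTop _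
  filter_upwards [hbig, eventually_sum_abs_progressionError_le hΨ hsupp a M] with X hX hBV
  obtain ⟨q₁, hq₁, hBV⟩ := hBV
  set Y := Real.exp (11 / 50 * X) / M with hY
  have hY1 : 1 ≤ Y / 2 := by
    rw [hY, div_div, one_le_div (by positivity), ← Real.log_le_iff_le_exp (by positivity), mul_comm]
    linarith
  set R := ⌊Y⌋₊ with hR
  have hRY : (R : ℝ) ≤ Y := Nat.floor_le (by linarith)
  have hRY' : Y / 2 ≤ R := by
    have := Nat.lt_floor_add_one Y
    rw [← hR] at this
    linarith
  have hR1 : 1 ≤ R := by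
    have : (1 : ℝ) ≤ R := hY1.trans hRY'
    exact_mod_cast this
  have hlogR : 11 / 50 * X - Real.log (2 * M) ≤ Real.log R := by
    refine le_trans (le_of_eq ?_) (Real.log_le_log (by linarith) hRY')
    rw [hY, div_div, Real.log_div (Real.exp_pos _).ne' (by positivity), Real.log_exp, mul_comm 2]
  have hlogpos : 0 < 11 / 50 * X - Real.log (2 * M) := by linarith
  set 𝓚 := (Icc 1 ⌊Real.exp (11 / 25 * X)⌋₊).filter (fun k => k.Coprime a ∧ ¬ q₁ ∣ k) with h𝓚
  -- the set of primes left out of the sieve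
  obtain ⟨B, hB, hPB, hBprod, hBS⟩ : ∃ B : Finset ℕ, (∀ p ∈ B, p.Prime) ∧ P ⊆ B ∧
      ∏ p ∈ B, (1 - (p : ℝ)⁻¹)⁻¹ ≤ (∏ p ∈ P, (1 - (p : ℝ)⁻¹)⁻¹) * (1 + 1 / w) ∧
      ∀ k m : ℕ, k ∣ M → (∀ p ∈ B, ¬ p ∣ m) → ¬ q₁ ∣ k * m := by
    have hP0 : 0 ≤ ∏ p ∈ P, (1 - (p : ℝ)⁻¹)⁻¹ := prod_nonneg fun p hp => by
      have : (p : ℝ)⁻¹ ≤ 1 := inv_le_one_of_one_le₀ (by exact_mod_cast (hP p hp).one_le)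
      exact inv_nonneg.2 (by linarith)
    by_cases h : ∃ p, p.Prime ∧ p ∣ q₁ ∧ w < p
    · obtain ⟨p₁, hp₁, hpq, hwp⟩ := h
      refine ⟨insert p₁ P, ?_, subset_insert _ _, ?_, ?_⟩
      · intro p hp
        rcases mem_insert.1 hp with rfl | hp
        · exact hp₁
        · exact hP p hp
      · have hnot : p₁ ∉ P := fun h => by
          have := mem_range.1 (mem_filter.1 h).1
          omega
        rw [prod_insert hnot, mul_comm]
        refine mul_le_mul_of_nonneg_left ?_ hP0
        have h1 : (w : ℝ) + 1 ≤ p₁ := by exact_mod_cast hwp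
        have h2 : (p₁ : ℝ)⁻¹ ≤ ((w : ℝ) + 1)⁻¹ := inv_anti₀ (by positivity) h1
        have h3 : (1 + 1 / (w : ℝ)) = (1 - ((w : ℝ) + 1)⁻¹)⁻¹ := by
          rw [eq_comm, inv_eq_iff_eq_inv, one_div]
          have : (w : ℝ) + 1 ≠ 0 := by positivity
          have h4 : (1 + (w : ℝ)⁻¹) = (w + 1) / w := by field_simp
          rw [h4]
          field_simp
          ring
        rw [h3]
        refine inv_anti₀ ?_ (by linarith)
        rw [sub_pos]
        exact inv_lt_one_of_one_lt₀ (by linarith)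
      · intro k m hk hm hdvd
        rcases (hp₁.dvd_mul).1 (hpq.trans hdvd) with h1 | h1
        · obtain ⟨q, hq, hpq⟩ := (hp₁.prime.dvd_finsetProd_iff _).1 (h1.trans hk)
          have h3 := (Nat.prime_dvd_prime_iff_eq hp₁ (hS q hq)).1 (hp₁.dvd_of_dvd_pow hpq)
          have := mem_range.1 (mem_filter.1 hq).1
          omega
        · exact hm p₁ (mem_insert_self _ _) h1
    · push Not at h
      refine ⟨P, hP, Subset.rfl, ?_, ?_⟩
      · exact le_mul_of_one_le_right hP0 (by simp)
      · intro k m hk hm hdvd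
        have hco : q₁.Coprime m := by
          refine Nat.coprime_of_dvd fun p hp hpq hpm => ?_
          exact hm p (hPw p hp (h p hp hpq)) hpm
        have := Nat.le_of_dvd hM0 ((hco.dvd_of_dvd_mul_right hdvd).trans hk)
        omega
  have hK : ∀ e ∈ M.divisors, ∀ T₁ ∈ roughSets R B, ∀ T₂ ∈ roughSets R B,
      e * ∏ p ∈ T₁ ∪ T₂, p ∈ 𝓚 := by
    intro e he T₁ h₁ T₂ h₂
    obtain ⟨h₁, h₁R⟩ := mem_roughSets.1 h₁
    obtain ⟨h₂, h₂R⟩ := mem_roughSets.1 h₂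
    have hU : ∀ p ∈ T₁ ∪ T₂, p.Prime ∧ p ∉ B := fun p hp => (mem_union.1 hp).elim (h₁ p) (h₂ p)
    have hU0 : 0 < ∏ p ∈ T₁ ∪ T₂, p := prod_pos fun p hp => (hU p hp).1.pos
    have hUdvd : ∀ p, p.Prime → p ∣ ∏ q ∈ T₁ ∪ T₂, q → p ∉ B := by
      intro p hp hpd
      obtain ⟨q, hq, hpq⟩ := (hp.prime.dvd_finsetProd_iff _).1 hpd
      rw [(Nat.prime_dvd_prime_iff_eq hp (hU q hq).1).1 hpq]
      exact (hU q hq).2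
    have he0 := Nat.pos_of_mem_divisors he
    rw [h𝓚, mem_filter, mem_Icc]
    refine ⟨⟨Nat.mul_pos he0 hU0, ?_⟩, ?_, ?_⟩
    · refine Nat.le_floor ?_
      have h3 : ∏ p ∈ T₁ ∪ T₂, p ≤ R * R := by
        refine le_trans ?_ (Nat.mul_le_mul h₁R h₂R)
        rw [← prod_union_inter]
        exact Nat.le_mul_of_pos_right _ (prod_pos fun p hp => (h₁ p (mem_inter.1 hp).1).1.pos)
      have h4 : e * ∏ p ∈ T₁ ∪ T₂, p ≤ M * (R * R) := Nat.mul_le_mul (Nat.divisor_le he) h3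
      have h5 : ((e * ∏ p ∈ T₁ ∪ T₂, p : ℕ) : ℝ) ≤ M * (R * R) := by exact_mod_cast h4
      refine h5.trans ?_
      have h6 : (R : ℝ) * R ≤ Y * Y := mul_le_mul hRY hRY (Nat.cast_nonneg _) (by linarith)
      have h7 : Real.exp (11 / 25 * X) = (Y * M) * (Y * M) := by
        rw [hY, div_mul_cancel₀ _ hMr.ne', ← Real.exp_add]
        congr 1
        ring
      have h8 : (1 : ℝ) ≤ M := by exact_mod_cast hM0
      calc (M : ℝ) * (R * R) ≤ M * (Y * Y) := mul_le_mul_of_nonneg_left h6 hMr.le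
        _ ≤ M * (M * (Y * Y)) := mul_le_mul_of_nonneg_left
            (le_mul_of_one_le_left (mul_self_nonneg _) h8) hMr.le
        _ = _ := by rw [h7]; ring
    · refine Nat.coprime_of_dvd fun p hp hpk hpa => ?_
      have hpw : p ∈ P := hPw p hp ((Nat.le_of_dvd ha hpa).trans haw)
      rcases (hp.dvd_mul).1 hpk with h3 | h3
      · have := primeFactors_subset_of_mem_divisors_prod hS he
          (Nat.mem_primeFactors.2 ⟨hp, h3, he0.ne'⟩)
        exact (mem_filter.1 this).2.2 hpa
      · exact hUdvd p hp h3 (hPB hpw)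
    · exact hBS e _ (Nat.dvd_of_mem_divisors he) fun p hp hpd => hUdvd p (hB p hp) hpd hp
  have hsieve := sum_primeWeight_div_card_divisors_le hΨ0 X ha hR1 hS (hSP.trans hPB) hK
  have hG := log_le_mul_sq_sum_sieveDensity hw hR1 hB fun p hp hpw => hPB (hPw p hp hpw)
  have hG0 : 0 < ∑ T ∈ roughSets R B, ∏ p ∈ T, sieveDensity p :=
    sum_prod_pos (empty_mem_roughSets hR1 B) fun L hL q hq =>
      sieveDensity_pos ((mem_roughSets.1 hL).1 q hq).1.two_le
  refine hsieve.trans (add_le_add ?_ hBV)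
  refine mul_le_mul_of_nonneg_right ?_ (sum_nonneg fun n _ => primeWeight_nonneg hΨ0 X n)
  refine mul_le_mul_of_nonneg_left ?_ hj
  refine Real.le_sqrt_of_sq_le ?_
  rw [inv_pow, le_div_iff₀ hlogpos, inv_mul_le_iff₀ (by positivity)]
  calc 11 / 50 * X - Real.log (2 * M) ≤ Real.log R := hlogR
    _ ≤ _ := hG
    _ ≤ (∏ p ∈ P, (1 - (p : ℝ)⁻¹)⁻¹) * (1 + 1 / w) * (1 + 2 / w) * _ ^ 2 := by
        gcongr
    _ = _ := by ring

/-! ### The constants -/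

lemma localFactor_eq {q : ℕ} (hq : 2 ≤ q) : localFactor q =
    (1 + 1 / (1 / ((q : ℝ) - 1))) * Real.log (1 + 1 / ((q : ℝ) - 1)) - 1 / ((q : ℝ) - 1) := by
  have h2 : (2 : ℝ) ≤ q := by exact_mod_cast hq
  have h1 : (q : ℝ) - 1 ≠ 0 := by linarith
  have h3 : 1 + 1 / ((q : ℝ) - 1) = q / (q - 1) := by field_simp; ring
  rw [localFactor, h3, one_div_one_div]
  ring

lemma le_localFactor {q : ℕ} (hq : 2 ≤ q) :
    (2 - (1 / ((q : ℝ) - 1)) ^ 2) / (2 + 1 / ((q : ℝ) - 1)) ≤ localFactor q := by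
  have h2 : (2 : ℝ) ≤ q := by exact_mod_cast hq
  have ht : 0 < 1 / ((q : ℝ) - 1) := one_div_pos.2 (by linarith)
  rw [localFactor_eq hq]
  generalize 1 / ((q : ℝ) - 1) = t at *
  have h := Real.le_log_one_add_of_nonneg ht.le
  have h3 : (2 - t ^ 2) / (2 + t) = (1 + 1 / t) * (2 * t / (t + 2)) - t := by
    field_simp
    ring
  rw [h3]
  gcongr

lemma localFactor_le {q : ℕ} (hq : 2 ≤ q) : localFactor q ≤ 1 - 1 / ((q : ℝ) - 1) / 2 := by
  have h2 : (2 : ℝ) ≤ q := by exact_mod_cast hq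
  have ht : 0 < 1 / ((q : ℝ) - 1) := one_div_pos.2 (by linarith)
  rw [localFactor_eq hq]
  generalize 1 / ((q : ℝ) - 1) = t at *
  have h : Real.log (1 + t) ≤ ((1 + t) - (1 + t)⁻¹) / 2 := by
    rw [← Real.sinh_log (by linarith)]
    exact Real.self_le_sinh_iff.2 (Real.log_nonneg (by linarith))
  have h3 : 1 - t / 2 = (1 + 1 / t) * (((1 + t) - (1 + t)⁻¹) / 2) - t := by
    field_simp
    ring
  rw [h3]
  gcongr

lemma localFactor_pos {q : ℕ} (hq : 2 ≤ q) : 0 < localFactor q := by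
  have h2 : (2 : ℝ) ≤ q := by exact_mod_cast hq
  have ht : 0 < 1 / ((q : ℝ) - 1) := one_div_pos.2 (by linarith)
  have ht1 : 1 / ((q : ℝ) - 1) ≤ 1 := (div_le_one (by linarith)).2 (by linarith)
  refine lt_of_lt_of_le ?_ (le_localFactor hq)
  refine div_pos ?_ (by positivity)
  nlinarith

/-- The factor at `q` of the product defining `Kconst`. -/
noncomputable def kFactor (q : ℕ) : ℝ := Real.sqrt ((q : ℝ) / ((q : ℝ) - 1)) * localFactor q

lemma kFactor_pos {q : ℕ} (hq : 2 ≤ q) : 0 < kFactor q := by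
  have h2 : (2 : ℝ) ≤ q := by exact_mod_cast hq
  exact mul_pos (Real.sqrt_pos.2 (div_pos (by linarith) (by linarith))) (localFactor_pos hq)

lemma abs_kFactor_sub_one_le {q : ℕ} (hq : 2 ≤ q) :
    |kFactor q - 1| ≤ 2 * (1 / ((q : ℝ) - 1)) ^ 2 := by
  have h2 : (2 : ℝ) ≤ q := by exact_mod_cast hq
  have ht : 0 < 1 / ((q : ℝ) - 1) := one_div_pos.2 (by linarith)
  have ht1 : 1 / ((q : ℝ) - 1) ≤ 1 := (div_le_one (by linarith)).2 (by linarith)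
  have h1 : (q : ℝ) - 1 ≠ 0 := by linarith
  have h3 : (q : ℝ) / (q - 1) = 1 + 1 / ((q : ℝ) - 1) := by field_simp; ring
  have hL := le_localFactor hq
  have hU := localFactor_le hq
  have hpos := localFactor_pos hq
  rw [kFactor, h3]
  generalize 1 / ((q : ℝ) - 1) = t at *
  generalize localFactor q = L at *
  have hs0 := Real.sqrt_nonneg (1 + t)
  have hs1 : Real.sqrt (1 + t) ≤ 1 + t / 2 := by
    rw [Real.sqrt_le_left (by linarith)]
    nlinarith
  have hs2 : 1 + t / 2 - t ^ 2 / 2 ≤ Real.sqrt (1 + t) := by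
    refine Real.le_sqrt_of_sq_le ?_
    nlinarith [mul_nonneg ht.le (sq_nonneg t), mul_nonneg (sub_nonneg.2 ht1) (pow_nonneg ht.le 3),
      pow_nonneg ht.le 3]
  rw [div_le_iff₀ (by linarith)] at hL
  have hc : 0 ≤ 1 + t / 2 - t ^ 2 / 2 := by nlinarith
  have hlow : (1 + t / 2 - t ^ 2 / 2) * L ≤ Real.sqrt (1 + t) * L :=
    mul_le_mul_of_nonneg_right hs2 hpos.le
  have hup : Real.sqrt (1 + t) * L ≤ (1 + t / 2) * L := mul_le_mul_of_nonneg_right hs1 hpos.le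
  have hlow2 : (1 - 2 * t ^ 2) * (2 + t) ≤ (1 + t / 2 - t ^ 2 / 2) * L * (2 + t) := by
    have := mul_le_mul_of_nonneg_left hL hc
    nlinarith [pow_nonneg ht.le 3, pow_nonneg ht.le 4, pow_nonneg ht.le 2]
  have hlow3 : 1 - 2 * t ^ 2 ≤ (1 + t / 2 - t ^ 2 / 2) * L :=
    le_of_mul_le_mul_right hlow2 (by linarith)
  have hup2 : (1 + t / 2) * L ≤ 1 := by
    have := mul_le_mul_of_nonneg_left hU (show 0 ≤ 1 + t / 2 by linarith)
    nlinarith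
  rw [abs_le]
  constructor
  · linarith
  · nlinarith

lemma summable_kFactor_sub_one : Summable fun p : Nat.Primes => kFactor p - 1 := by
  have h1 : Summable fun n : ℕ => 2 * (1 / ((n : ℝ) - 1)) ^ 2 := by
    refine Summable.mul_left 2 ?_
    rw [← summable_nat_add_iff 1]
    simp
  refine Summable.of_norm_bounded (h1.comp_injective (i := fun p : Nat.Primes => (p : ℕ))
    Nat.Primes.coe_nat_injective) fun p => ?_
  exact abs_kFactor_sub_one_le p.2.two_le

lemma summable_log_kFactor : Summable fun p : Nat.Primes => Real.log (kFactor p) := by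
  simpa using Real.summable_log_one_add_of_summable summable_kFactor_sub_one

/-- The infinite product in the definition of `Kconst`. -/
noncomputable def kProd : ℝ := ∏' p : Nat.Primes, kFactor p

lemma kProd_pos : 0 < kProd := by
  rw [kProd, ← Real.rexp_tsum_eq_tprod (fun p => kFactor_pos p.2.two_le) summable_log_kFactor]
  exact Real.exp_pos _

lemma Kconst_eq : Kconst = 1 / Real.sqrt Real.pi * kProd := rfl

lemma tendsto_prod_kFactor : Filter.Tendsto
    (fun w : ℕ => ∏ p ∈ (range (w + 1)).filter Nat.Prime, kFactor p) Filter.atTop (nhds kProd) := by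
  have h1 : HasProd (fun p : Nat.Primes => kFactor p) kProd :=
    (Real.multipliable_of_summable_log (fun p => kFactor_pos p.2.two_le)
      summable_log_kFactor).hasProd
  have h2 : HasProd (({p | p.Prime} : Set ℕ).mulIndicator kFactor) kProd :=
    hasProd_subtype_iff_mulIndicator.1 h1
  refine (h2.tendsto_prod_nat.comp (Filter.tendsto_add_atTop_nat 1)).congr fun w => ?_
  rw [Function.comp_apply, prod_filter]
  refine prod_congr rfl fun p _ => ?_
  simp [Set.mulIndicator_apply]

lemma prod_localFactor_mul_sqrt {a w : ℕ} (ha : 1 ≤ a) (haw : a ≤ w) :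
    (∏ q ∈ (range (w + 1)).filter (fun q => q.Prime ∧ ¬ q ∣ a), localFactor q) *
      Real.sqrt (∏ p ∈ (range (w + 1)).filter Nat.Prime, (1 - (p : ℝ)⁻¹)⁻¹) =
    (∏ p ∈ (range (w + 1)).filter Nat.Prime, kFactor p) *
      (∏ q ∈ a.primeFactors, localFactor q)⁻¹ := by
  have h0 : ∏ q ∈ a.primeFactors, localFactor q ≠ 0 := prod_ne_zero_iff.2 fun q hq =>
    (localFactor_pos (Nat.prime_of_mem_primeFactors hq).two_le).ne'
  have h1 : (range (w + 1)).filter Nat.Prime =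
      (range (w + 1)).filter (fun q => q.Prime ∧ ¬ q ∣ a) ∪ a.primeFactors := by
    ext q
    simp only [mem_filter, mem_range, mem_union, Nat.mem_primeFactors]
    constructor
    · rintro ⟨h1, h2⟩
      by_cases h : q ∣ a
      · exact Or.inr ⟨h2, h, by omega⟩
      · exact Or.inl ⟨h1, h2, h⟩
    · rintro (⟨h1, h2, -⟩ | ⟨h1, h2, -⟩)
      · exact ⟨h1, h2⟩
      · exact ⟨by have := Nat.le_of_dvd ha h2; omega, h1⟩
  have h2 : Disjoint ((range (w + 1)).filter (fun q => q.Prime ∧ ¬ q ∣ a)) a.primeFactors :=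
    disjoint_left.2 fun q hq hq' => (mem_filter.1 hq).2.2 (Nat.dvd_of_mem_primeFactors hq')
  have h3 : ∏ p ∈ (range (w + 1)).filter Nat.Prime, kFactor p =
      Real.sqrt (∏ p ∈ (range (w + 1)).filter Nat.Prime, (1 - (p : ℝ)⁻¹)⁻¹) *
        ∏ p ∈ (range (w + 1)).filter Nat.Prime, localFactor p := by
    have hpp : ∀ p ∈ (range (w + 1)).filter Nat.Prime,
        (1 - (p : ℝ)⁻¹)⁻¹ = (p : ℝ) / (p - 1) ∧ 0 ≤ (1 - (p : ℝ)⁻¹)⁻¹ := by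
      intro p hp
      have h2 : (2 : ℝ) ≤ p := by exact_mod_cast (mem_filter.1 hp).2.two_le
      have h4 : (p : ℝ) - 1 ≠ 0 := by linarith
      have h5 : (p : ℝ) ≠ 0 := by linarith
      have h6 : (1 - (p : ℝ)⁻¹)⁻¹ = (p : ℝ) / (p - 1) := by
        rw [inv_eq_iff_eq_inv, inv_div]
        field_simp
      exact ⟨h6, h6 ▸ div_nonneg (by linarith) (by linarith)⟩
    rw [Real.sqrt_prod _ fun p hp => (hpp p hp).2, ← prod_mul_distrib]
    exact prod_congr rfl fun p hp => by rw [(hpp p hp).1, kFactor]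
  have h4 : ∏ p ∈ (range (w + 1)).filter Nat.Prime, localFactor p =
      (∏ q ∈ (range (w + 1)).filter (fun q => q.Prime ∧ ¬ q ∣ a), localFactor q) *
        ∏ q ∈ a.primeFactors, localFactor q := by
    rw [h1, prod_union h2]
  rw [h3, h4, ← mul_assoc, mul_inv_cancel_right₀ h0, mul_comm]

lemma inv_prod_localFactor_le_betaConst (a : ℕ) :
    (∏ q ∈ a.primeFactors, localFactor q)⁻¹ ≤ betaConst a := by
  rw [betaConst, ← prod_inv_distrib]
  refine prod_le_prod (fun q hq => inv_nonneg.2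
    (localFactor_pos (Nat.prime_of_mem_primeFactors hq).two_le).le) fun q hq => ?_
  have hq2 := (Nat.prime_of_mem_primeFactors hq).two_le
  have h2 : (2 : ℝ) ≤ q := by exact_mod_cast hq2
  have h1 : (0 : ℝ) < q - 1 := by linarith
  have hpos := localFactor_pos hq2
  have hlow := le_localFactor hq2
  have ht : 0 < 1 / ((q : ℝ) - 1) := one_div_pos.2 h1
  have hge : 1 ≤ localFactor q + 1 / ((q : ℝ) - 1) := by
    generalize 1 / ((q : ℝ) - 1) = t at *
    generalize localFactor q = L at *
    rw [div_le_iff₀ (by linarith)] at hlow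
    nlinarith
  have heq : (q : ℝ) * (q - 1) * Real.log (q / (q - 1)) - 1 = (q - 1) * localFactor q := by
    rw [localFactor]
    field_simp
  have heq2 : 1 + 1 / ((q - 1) * localFactor q) =
      (localFactor q)⁻¹ * (localFactor q + 1 / ((q : ℝ) - 1)) := by
    field_simp
  rw [heq, heq2]
  exact le_mul_of_one_le_right (inv_nonneg.2 hpos.le) hge

lemma kProd_mul_inv_le (a : ℕ) : kProd * (∏ q ∈ a.primeFactors, localFactor q)⁻¹ ≤
    Real.sqrt Real.pi * (Kconst * betaConst a) := by
  have h : Real.sqrt Real.pi * (Kconst * betaConst a) = kProd * betaConst a := by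
    have := (Real.sqrt_pos.2 Real.pi_pos).ne'
    rw [Kconst_eq]
    field_simp
  rw [h]
  exact mul_le_mul_of_nonneg_left (inv_prod_localFactor_le_betaConst a) kProd_pos.le

/-- The smooth sum of `1 / τ(p + a)` is asymptotically at most a constant over `√X`. -/
theorem eventually_sum_primeWeight_div_card_divisors_lt {Ψ : ℝ → ℝ} (hΨ : ContDiff ℝ (⊤ : ℕ∞) Ψ)
    (hsupp : ∀ u, 1 < |u| → Ψ u = 0) (hΨ0 : ∀ u, 0 ≤ Ψ u) {a : ℕ} (ha : 1 ≤ a) {A : ℝ}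
    (hA : kProd * (∏ q ∈ a.primeFactors, localFactor q)⁻¹ * Real.sqrt (50 / 11) * ∫ u, Ψ u < A) :
    ∀ᶠ X : ℝ in Filter.atTop,
      ∑ n ∈ range (⌊Real.exp (X + 1)⌋₊ + 1), primeWeight Ψ X n *
        (1 / ((n + a).divisors.card : ℝ)) ≤ A / Real.sqrt X := by
  have hinv : ∀ c : ℝ, Filter.Tendsto (fun w : ℕ => 1 + c / (w : ℝ)) Filter.atTop (nhds 1) := by
    intro c
    simpa using (tendsto_const_div_atTop_nhds_zero_nat c).const_add 1
  -- choice of the sifting level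
  obtain ⟨w, haw, hw⟩ : ∃ w : ℕ, a ≤ w ∧
      (∏ q ∈ (range (w + 1)).filter (fun q => q.Prime ∧ ¬ q ∣ a), localFactor q) *
        Real.sqrt ((∏ p ∈ (range (w + 1)).filter Nat.Prime, (1 - (p : ℝ)⁻¹)⁻¹) *
          (1 + 1 / w) * (1 + 2 / w) / (11 / 50)) * ∫ u, Ψ u < A := by
    have h1 := (tendsto_prod_kFactor.mul_const (∏ q ∈ a.primeFactors, localFactor q)⁻¹).mul
      (((hinv 1).mul (hinv 2)).mul_const (50 / 11)).sqrt
    rw [mul_one, one_mul] at h1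
    obtain ⟨w, hw, haw⟩ := (((h1.mul_const (∫ u, Ψ u)).eventually (gt_mem_nhds hA)).and
      (Filter.eventually_ge_atTop a)).exists
    refine ⟨w, haw, lt_of_eq_of_lt ?_ hw⟩
    rw [← prod_localFactor_mul_sqrt ha haw]
    have h2 : (∏ p ∈ (range (w + 1)).filter Nat.Prime, (1 - (p : ℝ)⁻¹)⁻¹) *
          (1 + 1 / w) * (1 + 2 / w) / (11 / 50) =
        (∏ p ∈ (range (w + 1)).filter Nat.Prime, (1 - (p : ℝ)⁻¹)⁻¹) *
          ((1 + 1 / w) * (1 + 2 / w) * (50 / 11)) := by ring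
    rw [h2, Real.sqrt_mul' _ (by positivity), ← mul_assoc]
  -- choice of the exponent
  have hpos : ∀ q ∈ (range (w + 1)).filter (fun q => q.Prime ∧ ¬ q ∣ a), 0 < localFactor q :=
    fun q hq => localFactor_pos (mem_filter.1 hq).2.1.two_le
  have hj : Filter.Tendsto (fun j => ∏ q ∈ (range (w + 1)).filter (fun q => q.Prime ∧ ¬ q ∣ a),
      ∑ i ∈ range (j + 1), smallCoeff (q ^ i) / ((q ^ i).totient : ℝ)) Filter.atTop
      (nhds (∏ q ∈ (range (w + 1)).filter (fun q => q.Prime ∧ ¬ q ∣ a), localFactor q)) :=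
    tendsto_finsetProd _ fun q hq => tendsto_sum_smallCoeff_div_totient (mem_filter.1 hq).2.1
  obtain ⟨j, hj0, hjA⟩ := ((hj.eventually (lt_mem_nhds (prod_pos hpos))).and
    (((hj.mul_const _).mul_const _).eventually (gt_mem_nhds hw))).exists
  obtain ⟨c, hc⟩ := eventually_sum_primeWeight_div_card_divisors_le hΨ hsupp hΨ0 ha haw j hj0.le
  set Q := (∏ p ∈ (range (w + 1)).filter Nat.Prime, (1 - (p : ℝ)⁻¹)⁻¹) * (1 + 1 / w) * (1 + 2 / w)
    with hQ
  set Z := ∏ q ∈ (range (w + 1)).filter (fun q => q.Prime ∧ ¬ q ∣ a),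
      ∑ i ∈ range (j + 1), smallCoeff (q ^ i) / ((q ^ i).totient : ℝ) with hZ
  have hXinv : Filter.Tendsto (fun X : ℝ => (Real.sqrt X)⁻¹) Filter.atTop (nhds 0) :=
    Real.tendsto_sqrt_atTop.inv_tendsto_atTop
  have hQlim : Filter.Tendsto (fun X : ℝ => Real.sqrt (Q / (11 / 50 - c * X⁻¹))) Filter.atTop
      (nhds (Real.sqrt (Q / (11 / 50)))) := by
    have h1 := (tendsto_inv_atTop_zero (𝕜 := ℝ)).const_mul c
    rw [mul_zero] at h1
    have h2 := h1.const_sub (11 / 50)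
    rw [sub_zero] at h2
    exact (tendsto_const_nhds.div h2 (by norm_num)).sqrt
  have hlim := (((hQlim.const_mul Z).mul (tendsto_sum_primeWeight hΨ hsupp)).add hXinv)
  rw [add_zero] at hlim
  filter_upwards [hc, hlim.eventually (gt_mem_nhds hjA), Filter.eventually_gt_atTop 0]
    with X hX hXA hX0
  refine hX.trans ?_
  have hs : 0 < Real.sqrt X := Real.sqrt_pos.2 hX0
  rw [le_div_iff₀ hs]
  refine le_trans (le_of_eq ?_) hXA.le
  have h1 : Real.sqrt (Q / (11 / 50 * X - c)) * Real.sqrt X =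
      Real.sqrt (Q / (11 / 50 - c * X⁻¹)) := by
    rw [← Real.sqrt_mul' _ hX0.le]
    congr 1
    have : 11 / 50 * X - c = (11 / 50 - c * X⁻¹) * X := by field_simp
    rw [this, ← div_div, div_mul_cancel₀ _ hX0.ne']
  have h2 : 1 / X * Real.sqrt X = (Real.sqrt X)⁻¹ := by
    rw [one_div, inv_mul_eq_div, Real.sqrt_div_self]
  rw [add_mul, h2, ← h1]
  ring

/-! ### Conclusion -/

lemma eventually_le_of_contraction {φ : ℝ → ℝ} {X₀ η A ρ B c : ℝ} (hη : 0 < η) (hρ0 : 0 ≤ ρ)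
    (hρ : ρ < 1) (hB : 0 ≤ B) (hA : 0 ≤ A)
    (hbase : ∀ X, X₀ - η ≤ X → X < X₀ → φ X ≤ B)
    (hrec : ∀ X, X₀ ≤ X → φ X ≤ A + ρ * φ (X - η)) (hc : A / (1 - ρ) < c) :
    ∀ᶠ X in Filter.atTop, φ X ≤ c := by
  have hρ' : 0 < 1 - ρ := by linarith
  set d := A / (1 - ρ) with hd
  have hd0 : 0 ≤ d := div_nonneg hA hρ'.le
  have hAd : A + ρ * d = d := by rw [hd]; field_simp; ring
  have hstep : ∀ m : ℕ, ∀ X, X₀ - η ≤ X → X < X₀ + m * η → φ X ≤ d + B := by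
    intro m
    induction m with
    | zero =>
      intro X h1 h2
      have := hbase X h1 (by simpa using h2)
      linarith
    | succ m ih =>
      intro X h1 h2
      push_cast at h2
      by_cases h3 : X < X₀
      · have := hbase X h1 h3
        linarith
      · push Not at h3
        have h4 := ih (X - η) (by linarith) (by linarith)
        have h5 := mul_le_mul_of_nonneg_left h4 hρ0
        have h6 := hrec X h3
        have h7 : ρ * B ≤ B := mul_le_of_le_one_left hB hρ.le
        linarith
  have hall : ∀ X, X₀ - η ≤ X → φ X ≤ d + B := by
    intro X hX
    obtain ⟨m, hm⟩ := exists_nat_gt ((X - X₀) / η)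
    rw [div_lt_iff₀ hη] at hm
    exact hstep m X hX (by linarith)
  have hpow : ∀ n : ℕ, ∀ X, X₀ + n * η ≤ X → φ X ≤ d + ρ ^ n * B := by
    intro n
    induction n with
    | zero =>
      intro X hX
      simpa using hall X (by simp at hX; linarith)
    | succ n ih =>
      intro X hX
      push_cast at hX
      have h4 := ih (X - η) (by linarith)
      have h5 := mul_le_mul_of_nonneg_left h4 hρ0
      have h6 := hrec X (by nlinarith [mul_nonneg (Nat.cast_nonneg (α := ℝ) n) hη.le])
      rw [pow_succ]
      linarith
  have hlim : Filter.Tendsto (fun n : ℕ => d + ρ ^ n * B) Filter.atTop (nhds d) := by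
    simpa using ((tendsto_pow_atTop_nhds_zero_of_lt_one hρ0 hρ).mul_const B).const_add d
  obtain ⟨n, hn⟩ := (hlim.eventually (gt_mem_nhds hc)).exists
  filter_upwards [Filter.eventually_ge_atTop (X₀ + n * η)] with X hX
  exact (hpow n X hX).trans hn.le

/-- A smooth majorant of the indicator function of `[-1/50, 0]`. -/
lemma exists_smooth_majorant : ∃ Ψ : ℝ → ℝ, ContDiff ℝ (⊤ : ℕ∞) Ψ ∧ (∀ u, 1 < |u| → Ψ u = 0) ∧
    (∀ u, 0 ≤ Ψ u) ∧ (∀ u, -(1 / 50) ≤ u → u ≤ 0 → Ψ u = 1) ∧ ∫ u, Ψ u ≤ 202 / 10000 := by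
  let f : ContDiffBump (-(1 / 100) : ℝ) := ⟨1 / 100, 101 / 10000, by norm_num, by norm_num⟩
  refine ⟨f, f.contDiff, fun u hu => f.zero_of_le_dist ?_, fun u => f.nonneg, fun u h1 h2 =>
    f.one_of_mem_closedBall ?_, ?_⟩
  · change (101 / 10000 : ℝ) ≤ dist u (-(1 / 100))
    rw [Real.dist_eq]
    rcases lt_abs.1 hu with h | h
    · exact le_trans (by linarith) (le_abs_self _)
    · exact le_trans (by linarith) (neg_le_abs _)
  · rw [Metric.mem_closedBall, Real.dist_eq]
    change |u - -(1 / 100)| ≤ 1 / 100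
    rw [abs_le]
    constructor <;> linarith
  · refine (f.integral_le_measure_closedBall MeasureTheory.volume).trans (le_of_eq ?_)
    change MeasureTheory.volume.real (Metric.closedBall (-(1 / 100) : ℝ) (101 / 10000)) = _
    rw [Real.volume_real_closedBall (by norm_num)]
    norm_num

/-- The sum of `1 / τ(p + a)` over the primes up to `exp X`. -/
noncomputable def shiftedSum (a : ℕ) (X : ℝ) : ℝ :=
  ∑ p ∈ (Icc 1 ⌊Real.exp X⌋₊).filter Nat.Prime, (1 : ℝ) / ((p + a).divisors.card : ℝ)

lemma shiftedSum_nonneg (a : ℕ) (X : ℝ) : 0 ≤ shiftedSum a X :=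
  sum_nonneg fun _ _ => by positivity

lemma shiftedSum_le_exp (a : ℕ) (X : ℝ) : shiftedSum a X ≤ Real.exp X := by
  calc shiftedSum a X ≤ ∑ p ∈ (Icc 1 ⌊Real.exp X⌋₊).filter Nat.Prime, (1 : ℝ) := by
        refine sum_le_sum fun p hp => div_le_self zero_le_one ?_ |>.trans_eq rfl
        have hp1 := (mem_Icc.1 (mem_filter.1 hp).1).1
        exact_mod_cast (Nat.nonempty_divisors.2 (by omega : p + a ≠ 0)).card_pos
    _ ≤ ∑ p ∈ Icc 1 ⌊Real.exp X⌋₊, (1 : ℝ) :=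
        sum_le_sum_of_subset_of_nonneg (filter_subset _ _) fun _ _ _ => zero_le_one
    _ ≤ Real.exp X := by
        simp only [sum_const, Nat.card_Icc, Nat.add_sub_cancel, nsmul_eq_mul, mul_one]
        exact Nat.floor_le (Real.exp_pos _).le

lemma shiftedSum_sub_le {Ψ : ℝ → ℝ} (hΨ0 : ∀ u, 0 ≤ Ψ u) {η : ℝ} (hη : 0 ≤ η)
    (hΨ : ∀ u, -η ≤ u → u ≤ 0 → Ψ u = 1) (a : ℕ) {X : ℝ} (hX : η ≤ X) :
    (X - η) * Real.exp (-X) * (shiftedSum a X - shiftedSum a (X - η)) ≤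
      ∑ n ∈ range (⌊Real.exp (X + 1)⌋₊ + 1), primeWeight Ψ X n *
        (1 / ((n + a).divisors.card : ℝ)) := by
  have hmono : ⌊Real.exp (X - η)⌋₊ ≤ ⌊Real.exp X⌋₊ :=
    Nat.floor_le_floor (Real.exp_le_exp.2 (by linarith))
  have hmono' : ⌊Real.exp X⌋₊ ≤ ⌊Real.exp (X + 1)⌋₊ :=
    Nat.floor_le_floor (Real.exp_le_exp.2 (by linarith))
  have hsub : (Icc 1 ⌊Real.exp (X - η)⌋₊).filter Nat.Prime ⊆
      (Icc 1 ⌊Real.exp X⌋₊).filter Nat.Prime :=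
    filter_subset_filter _ (Icc_subset_Icc_right hmono)
  rw [shiftedSum, shiftedSum, ← sum_sdiff_eq_sub hsub, mul_sum]
  refine le_trans (sum_le_sum fun p hp => ?_) (sum_le_sum_of_subset_of_nonneg (s :=
    (Icc 1 ⌊Real.exp X⌋₊).filter Nat.Prime \ (Icc 1 ⌊Real.exp (X - η)⌋₊).filter Nat.Prime)
    (fun p hp => ?_) fun n _ _ => mul_nonneg (primeWeight_nonneg hΨ0 X n) (by positivity))
  · refine mul_le_mul_of_nonneg_right ?_ (by positivity)
    simp only [mem_sdiff, mem_filter, mem_Icc, not_and] at hp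
    obtain ⟨⟨⟨hp1, hpX⟩, hpp⟩, hpη⟩ := hp
    have hp0 : (0 : ℝ) < p := by exact_mod_cast hp1
    have h1 : (p : ℝ) ≤ Real.exp X := (Nat.le_floor_iff (Real.exp_pos _).le).1 hpX
    have h2 : Real.exp (X - η) < p := by
      refine Nat.lt_of_floor_lt ?_
      by_contra h
      exact hpη ⟨hp1, not_lt.1 h⟩ hpp
    have h3 : X - η < Real.log p := (Real.lt_log_iff_exp_lt hp0).2 h2
    have h4 : Real.log p ≤ X := (Real.log_le_iff_le_exp hp0).2 h1
    rw [primeWeight, if_pos hpp, hΨ _ (by linarith) (by linarith), Real.exp_neg, one_div]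
    exact mul_le_mul h3.le (inv_anti₀ hp0 h1) (by positivity) (by linarith)
  · have := mem_Icc.1 (mem_filter.1 (mem_sdiff.1 hp).1).1
    exact mem_range.2 (by omega)

lemma eventually_shiftedSum_le {a : ℕ} (ha : 1 ≤ a) : ∀ᶠ X in Filter.atTop,
    shiftedSum a X * Real.exp (-X) * (X * Real.sqrt X) ≤ 4 * (Kconst * betaConst a) := by
  obtain ⟨Ψ, hΨ, hsupp, hΨ0, hΨ1, h_integ⟩ := exists_smooth_majorant
  set E := Real.sqrt Real.pi * (Kconst * betaConst a) with hE
  set κ := kProd * (∏ q ∈ a.primeFactors, localFactor q)⁻¹ with hκ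
  have hκ0 : 0 < κ := mul_pos kProd_pos (inv_pos.2 (prod_pos fun q hq =>
    localFactor_pos (Nat.prime_of_mem_primeFactors hq).two_le))
  have hκE : κ ≤ E := kProd_mul_inv_le a
  have hE0 : 0 < E := hκ0.trans_le hκE
  have h_integ0 : 0 ≤ ∫ u, Ψ u := MeasureTheory.integral_nonneg hΨ0
  have hA : κ * Real.sqrt (50 / 11) * ∫ u, Ψ u < 431 / 10000 * E := by
    have h1 : Real.sqrt (50 / 11) ≤ 21321 / 10000 := by
      rw [Real.sqrt_le_left (by norm_num)]
      norm_num
    have h2 : κ * Real.sqrt (50 / 11) ≤ E * (21321 / 10000) :=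
      mul_le_mul hκE h1 (Real.sqrt_nonneg _) hE0.le
    have h3 := mul_le_mul h2 h_integ h_integ0 (by positivity)
    linarith
  obtain ⟨X₁, hX₁⟩ := Filter.eventually_atTop.1
    (eventually_sum_primeWeight_div_card_divisors_lt hΨ hsupp hΨ0 ha hA)
  set X₀ := max X₁ 401 with hX₀
  have hX₀1 : X₁ ≤ X₀ := le_max_left _ _
  have hX₀2 : 401 ≤ X₀ := le_max_right _ _
  have hfinal : 9 / 4 * E ≤ 4 * (Kconst * betaConst a) := by
    have h1 : Real.sqrt Real.pi ≤ 16 / 9 := by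
      rw [Real.sqrt_le_left (by norm_num)]
      linarith [Real.pi_lt_d2]
    have h2 : 0 ≤ Kconst * betaConst a :=
      (pos_of_mul_pos_right hE0 (Real.sqrt_nonneg _)).le
    have := mul_le_mul_of_nonneg_right h1 h2
    linarith
  refine (eventually_le_of_contraction (X₀ := X₀) (η := 1 / 50) (A := 4315 / 100000 * E)
    (ρ := 9803 / 10000) (B := X₀ * Real.sqrt X₀) (c := 9 / 4 * E) (by norm_num) (by norm_num)
    (by norm_num) (by positivity) (by positivity) ?_ ?_ ?_).mono fun X hX => hX.trans hfinal
  · intro X hX1 hX2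
    have h1 : shiftedSum a X * Real.exp (-X) ≤ 1 := by
      rw [Real.exp_neg, ← div_eq_mul_inv, div_le_one (Real.exp_pos _)]
      exact shiftedSum_le_exp a X
    have h0 : 0 ≤ X := by linarith
    have h2 : X * Real.sqrt X ≤ X₀ * Real.sqrt X₀ :=
      mul_le_mul hX2.le (Real.sqrt_le_sqrt hX2.le) (Real.sqrt_nonneg _) (by linarith)
    exact (mul_le_of_le_one_left (by positivity) h1).trans h2
  · intro X hX
    have h1 := (shiftedSum_sub_le hΨ0 (by norm_num) hΨ1 a (by linarith : 1 / 50 ≤ X)).trans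
      (hX₁ X (hX₀1.trans hX))
    have hT := shiftedSum_nonneg a (X - 1 / 50)
    set T' := shiftedSum a (X - 1 / 50) with hT'
    set T := shiftedSum a X with hTdef
    set Y := X - 1 / 50 with hY
    have hXY : X = Y + 1 / 50 := by rw [hY]; ring
    have hY0 : 400 ≤ Y := by linarith
    have hYpos : 0 < Y := by linarith
    have hs : 0 < Real.sqrt X := Real.sqrt_pos.2 (by linarith)
    have hsY : 0 < Real.sqrt Y := Real.sqrt_pos.2 hYpos
    have hr : X ≤ 100005 / 100000 * Y := by linarith
    have hsr : Real.sqrt X ≤ 100005 / 100000 * Real.sqrt Y := by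
      rw [Real.sqrt_le_left (by positivity), mul_pow, Real.sq_sqrt hYpos.le]
      linarith
    have hexp : Real.exp (-X) ≤ 9802 / 10000 * Real.exp (-Y) := by
      rw [hXY, neg_add, Real.exp_add, mul_comm]
      refine mul_le_mul_of_nonneg_right ?_ (Real.exp_pos _).le
      rw [Real.exp_neg]
      refine inv_le_of_inv_le₀ (by norm_num) ?_
      have := Real.quadratic_le_exp_of_nonneg (show (0 : ℝ) ≤ 1 / 50 by norm_num)
      refine le_trans ?_ this
      norm_num
    rw [le_div_iff₀ hs] at h1
    have h2 : (T - T') * Real.exp (-X) * (X * Real.sqrt X) ≤ 4315 / 100000 * E := by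
      have h3 : (T - T') * Real.exp (-X) * Real.sqrt X * Y ≤ 431 / 10000 * E :=
        le_trans (le_of_eq (by ring)) h1
      have h4 : (T - T') * Real.exp (-X) * (X * Real.sqrt X) =
          ((T - T') * Real.exp (-X) * Real.sqrt X * Y) * (X / Y) := by
        field_simp
      have h5 : X / Y ≤ 100005 / 100000 := (div_le_iff₀ hYpos).2 hr
      have h6 : 0 ≤ X / Y := div_nonneg (by linarith) hYpos.le
      rw [h4]
      calc _ ≤ 431 / 10000 * E * (X / Y) := mul_le_mul_of_nonneg_right h3 h6
        _ ≤ 431 / 10000 * E * (100005 / 100000) := mul_le_mul_of_nonneg_left h5 (by positivity)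
        _ ≤ _ := by linarith
    have h7 : T' * Real.exp (-X) * (X * Real.sqrt X) ≤
        9803 / 10000 * (T' * Real.exp (-Y) * (Y * Real.sqrt Y)) := by
      have h8 : X * Real.sqrt X ≤ (100005 / 100000 * Y) * (100005 / 100000 * Real.sqrt Y) :=
        mul_le_mul hr hsr hs.le (by positivity)
      have h9 : T' * Real.exp (-X) ≤ T' * (9802 / 10000 * Real.exp (-Y)) :=
        mul_le_mul_of_nonneg_left hexp hT
      have h10 := mul_le_mul h9 h8 (mul_nonneg (by linarith) hs.le) (by positivity)
      have h11 : 0 ≤ T' * Real.exp (-Y) * (Y * Real.sqrt Y) := by positivity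
      refine h10.trans (le_trans (le_of_eq (by ring)) (mul_le_mul_of_nonneg_right
        (show (9802 / 10000 * (100005 / 100000) ^ 2 : ℝ) ≤ 9803 / 10000 by norm_num) h11))
    have h12 : T * Real.exp (-X) * (X * Real.sqrt X) =
        (T - T') * Real.exp (-X) * (X * Real.sqrt X) + T' * Real.exp (-X) * (X * Real.sqrt X) := by
      ring
    rw [h12]
    exact add_le_add h2 h7
  · rw [div_lt_iff₀ (by norm_num)]
    linarith

/-- **The Karatsuba divisor problem upper bound.**
For fixed `a ≥ 1` there are `C > 0` and `x₀ ≥ 2` such that for all `x ≥ x₀`,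
`∑_{p ≤ x, p prime} 1/τ(p+a) ≤ 4 K(a) x/(ln x)^{3/2} + C x ln ln x/(ln x)^{5/2}`. -/
theorem karatsuba_divisor_problem (a : ℕ) (ha : 1 ≤ a) :
    ∃ C : ℝ, 0 < C ∧ ∃ x₀ : ℝ, 2 ≤ x₀ ∧ ∀ x : ℝ, x₀ ≤ x →
      ∑ p ∈ (Finset.Icc 1 ⌊x⌋₊).filter Nat.Prime,
          (1 : ℝ) / ((p + a).divisors.card : ℝ) ≤
        4 * (Kconst * betaConst a) * x / Real.log x ^ ((3 : ℝ) / 2) +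
          C * x * Real.log (Real.log x) / Real.log x ^ ((5 : ℝ) / 2) := by
  obtain ⟨X₀, hX₀⟩ := Filter.eventually_atTop.1 (eventually_shiftedSum_le ha)
  refine ⟨1, one_pos, Real.exp (max X₀ 1), ?_, fun x hx => ?_⟩
  · have h1 : Real.exp 1 ≤ Real.exp (max X₀ 1) := Real.exp_le_exp.2 (le_max_right _ _)
    linarith [Real.add_one_le_exp 1]
  have hx0 : 0 < x := (Real.exp_pos _).trans_le hx
  have hlog : max X₀ 1 ≤ Real.log x := (Real.le_log_iff_exp_le hx0).2 hx
  have h1 := hX₀ (Real.log x) ((le_max_left _ _).trans hlog)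
  have hlog1 : 1 ≤ Real.log x := (le_max_right _ _).trans hlog
  have hlog0 : 0 < Real.log x := by linarith
  rw [shiftedSum, Real.exp_neg, Real.exp_log hx0] at h1
  have h2 : Real.log x ^ ((3 : ℝ) / 2) = Real.log x * Real.sqrt (Real.log x) := by
    rw [Real.sqrt_eq_rpow, show (3 : ℝ) / 2 = 1 + 1 / 2 by norm_num, Real.rpow_add hlog0,
      Real.rpow_one]
  have h3 : 0 < Real.log x * Real.sqrt (Real.log x) := mul_pos hlog0 (Real.sqrt_pos.2 hlog0)
  have h4 : 0 ≤ 1 * x * Real.log (Real.log x) / Real.log x ^ ((5 : ℝ) / 2) := by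
    have := Real.log_nonneg hlog1
    positivity
  refine le_trans ?_ (le_add_of_nonneg_right h4)
  rw [h2, le_div_iff₀ h3]
  calc _ = (_ * x⁻¹ * (Real.log x * Real.sqrt (Real.log x))) * x := by field_simp
    _ ≤ _ := mul_le_mul_of_nonneg_right h1 hx0.le
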